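/- (Klain–Schneider) Let V be an n-dimensional real vector space and let φ : 𝒦(V) → ℝ be a continuous, translation invariant, simple valuation (φ(K) = 0 whenever dim K < n). Then φ(K) = c·vol(K) + V(K,…,K,f) for all K ∈ 𝒦(V), where c ∈ ℝ is a constant and f : V* → ℝ is an odd, positively 1-homogeneous, continuous function, unique up to the addition of a linear function. -/

import Mathlib

open scoped Pointwise
open MeasureTheory Module

noncomputable section

section CommonDefs

variable {V V' A : Type*}
variable [NormedAddCommGroup V] [NormedSpace ℝ V]
variable [NormedAddCommGroup V'] [NormedSpace ℝ V']
variable [NormedAddCommGroup A] [NormedSpace ℝ A]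

/-- The supremum of a (pairing) functional over a convex body; used to express the
support function `h(K, ξ) = sup_{x ∈ K} ⟨ξ, x⟩` for the various pairings `p = ⟨ξ, ·⟩`. -/
def hSupp (K : ConvexBody V) (p : V → ℝ) : ℝ := sSup (p '' (K : Set V))

/-- The translate `x + K` of a convex body. -/
def ConvexBody.translate (K : ConvexBody V) (x : V) : ConvexBody V :=
  ⟨(fun y => x + y) '' (K : Set V), K.convex.translate x,
    K.isCompact.image (continuous_const.add continuous_id),
    K.nonempty.image _⟩

/-- The image of a convex body under a continuous linear map. -/
def ConvexBody.mapCLM (f : V →L[ℝ] V') (K : ConvexBody V) : ConvexBody V' :=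
  ⟨f '' (K : Set V), K.convex.linear_image (f : V →ₗ[ℝ] V'),
    K.isCompact.image f.continuous, K.nonempty.image _⟩

/-- The reflection `-K` of a convex body about the origin. -/
def ConvexBody.neg (K : ConvexBody V) : ConvexBody V :=
  K.mapCLM (-(ContinuousLinearMap.id ℝ V))

/-- The union of two convex bodies (a convex body provided it is convex). -/
def ConvexBody.union (K L : ConvexBody V) (h : Convex ℝ ((K : Set V) ∪ (L : Set V))) :
    ConvexBody V :=
  ⟨(K : Set V) ∪ (L : Set V), h, K.isCompact.union L.isCompact,
    K.nonempty.mono Set.subset_union_left⟩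

/-- The intersection of two convex bodies (a convex body provided it is nonempty). -/
def ConvexBody.inter (K L : ConvexBody V) (h : ((K : Set V) ∩ (L : Set V)).Nonempty) :
    ConvexBody V :=
  ⟨(K : Set V) ∩ (L : Set V), K.convex.inter L.convex,
    K.isCompact.inter_right L.isClosed, h⟩

/-- A Minkowski valuation: `Z(K ∪ L) + Z(K ∩ L) = Z(K) + Z(L)` (Minkowski addition)
whenever `K, L, K ∪ L` are convex bodies. -/
def IsMinkowskiValuation (Z : ConvexBody V → ConvexBody A) : Prop :=
  ∀ (K L : ConvexBody V) (hU : Convex ℝ ((K : Set V) ∪ (L : Set V)))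
    (hI : ((K : Set V) ∩ (L : Set V)).Nonempty),
    Z (K.union L hU) + Z (K.inter L hI) = Z K + Z L

/-- A real-valued valuation: `φ(K ∪ L) + φ(K ∩ L) = φ(K) + φ(L)`
whenever `K, L, K ∪ L` are convex bodies. -/
def IsValuation (φ : ConvexBody V → ℝ) : Prop :=
  ∀ (K L : ConvexBody V) (hU : Convex ℝ ((K : Set V) ∪ (L : Set V)))
    (hI : ((K : Set V) ∩ (L : Set V)).Nonempty),
    φ (K.union L hU) + φ (K.inter L hI) = φ K + φ L

/-- Translation invariance of a map defined on convex bodies. -/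
def IsTranslationInvariant {α : Type*} (Z : ConvexBody V → α) : Prop :=
  ∀ (K : ConvexBody V) (x : V), Z (K.translate x) = Z K

/-- The mixed volume (w.r.t. the Lebesgue (Haar) measure `μ`) of an `n`-tuple of convex
bodies, given by the polarization formula
`V(K₁, …, Kₙ) = (1/n!) ∑_{S ⊆ {1,…,n}} (-1)^{n - |S|} vol(∑_{i ∈ S} K_i)`. -/
def mixedVol [MeasurableSpace V] (μ : Measure V) {n : ℕ} (K : Fin n → ConvexBody V) : ℝ :=
  (n.factorial : ℝ)⁻¹ *
    ∑ S : Finset (Fin n), (-1 : ℝ) ^ (n - S.card) * (μ (∑ i ∈ S, (K i : Set V))).toReal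

/-- The extension `V(K, …, K, f)` (with `n - 1` copies of `K`) of the mixed volume to
continuous positively `1`-homogeneous functions `f` on the dual space, defined via
Aleksandrov's variational formula: `V(K,…,K,f)` is `1/n` times the right derivative at
`t = 0` of the volume of the Wulff shape (aka Aleksandrov body) of `h_K + t f`.
For `f = h_L` the Wulff shape is `K + t L`, so this indeed extends `L ↦ V(K, …, K, L)`. -/
def mixedVolFn [MeasurableSpace V] (μ : Measure V) (K : ConvexBody V)
    (f : (V →L[ℝ] ℝ) → ℝ) : ℝ :=
  (Module.finrank ℝ V : ℝ)⁻¹ *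
    derivWithin (fun t : ℝ =>
        (μ {x : V | ∀ ξ : V →L[ℝ] ℝ, ξ x ≤ hSupp K ξ + t * f ξ}).toReal)
      (Set.Ici 0) 0

/-- The dimension of a convex body: the dimension of (the direction of) its affine hull. -/
def bodyDim (K : ConvexBody V) : ℕ := Module.finrank ℝ (vectorSpan ℝ (K : Set V))

/-- A convex body contained in a subspace `E`, viewed as a convex body of `E`. -/
def bodyIn (E : Submodule ℝ V) (K : ConvexBody V) (h : (K : Set V) ⊆ (E : Set V)) :
    ConvexBody ↥E :=
  ⟨Subtype.val ⁻¹' (K : Set V),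
    K.convex.linear_preimage (E.subtype),
    by
      rw [Topology.IsEmbedding.subtypeVal.isCompact_iff,
        Set.image_preimage_eq_of_subset (by rw [Subtype.range_coe]; exact h)]
      exact K.isCompact,
    by obtain ⟨x, hx⟩ := K.nonempty; exact ⟨⟨x, h hx⟩, hx⟩⟩

/-- The properties of the components of McMullen's decomposition of (the support function
of) a Minkowski valuation: each `fᵢ(·, u)` is a continuous, translation invariant
valuation, homogeneous of degree `i`, and each `fᵢ(K, ·)` is continuous and positively
`1`-homogeneous. -/
def McMullenProps (f : ℕ → ConvexBody V → V → ℝ) : Prop :=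
  (∀ (i : ℕ) (u : V), Continuous fun K : ConvexBody V => f i K u) ∧
  (∀ (i : ℕ) (u : V), IsValuation fun K : ConvexBody V => f i K u) ∧
  (∀ (i : ℕ) (u : V), IsTranslationInvariant fun K : ConvexBody V => f i K u) ∧
  (∀ (i : ℕ) (K : ConvexBody V) (u : V) (t : ℝ), 0 < t → f i (t • K) u = t ^ i * f i K u) ∧
  (∀ (i : ℕ) (K : ConvexBody V), Continuous fun u : V => f i K u) ∧
  (∀ (i : ℕ) (K : ConvexBody V) (u : V) (t : ℝ), 0 < t → f i K (t • u) = t * f i K u)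

end CommonDefs

/-- The surface area measure `S(M, ·)` on `S¹ ⊆ ℂ` of a planar convex body `M`,
characterized (uniquely) by the property that it is a finite measure concentrated on the
unit circle with `∫_{S¹} h(L, α) dσ(α) = 2 V(M, L)` for every planar convex body `L`. -/
def IsSurfaceAreaMeasure (M : ConvexBody ℂ) (σ : Measure ℂ) : Prop :=
  IsFiniteMeasure σ ∧ σ (Metric.sphere (0 : ℂ) 1)ᶜ = 0 ∧
    ∀ L : ConvexBody ℂ,
      (∫ α, hSupp L (fun c => (c * (starRingEnd ℂ) α).re) ∂σ) = 2 * mixedVol volume ![M, L]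

namespace KlainSchneider

section Basic

variable {V : Type*} [NormedAddCommGroup V] [NormedSpace ℝ V]

/-- A simple, translation invariant valuation which is continuous at bodies with interior points,
as a function on sets (only its values on compact convex sets matter). -/
structure SimpleVal (Φ : Set V → ℝ) : Prop where
  null : ∀ S : Set V, Convex ℝ S → IsCompact S → interior S = ∅ → Φ S = 0
  trans : ∀ (S : Set V) (x : V), Convex ℝ S → IsCompact S → Φ ((fun y => x + y) '' S) = Φ S
  cut : ∀ (S : Set V) (u : V →L[ℝ] ℝ) (c : ℝ), Convex ℝ S → IsCompact S → u ≠ 0 →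
    Φ S = Φ (S ∩ {x | u x ≤ c}) + Φ (S ∩ {x | c ≤ u x})
  val : ∀ K L : Set V, Convex ℝ K → IsCompact K → Convex ℝ L → IsCompact L →
    Convex ℝ (K ∪ L) → (interior (K ∩ L)).Nonempty → Φ (K ∪ L) + Φ (K ∩ L) = Φ K + Φ L
  cont : ∀ K : Set V, Convex ℝ K → IsCompact K → (interior K).Nonempty → ∀ ε > 0, ∃ δ > 0,
    ∀ L : Set V, Convex ℝ L → IsCompact L → L ⊆ Metric.cthickening δ K →
      K ⊆ Metric.cthickening δ L → |Φ L - Φ K| < ε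

lemma convex_le (u : V →L[ℝ] ℝ) (c : ℝ) : Convex ℝ {x | u x ≤ c} :=
  convex_halfSpace_le u.toLinearMap.isLinear c

lemma convex_ge (u : V →L[ℝ] ℝ) (c : ℝ) : Convex ℝ {x | c ≤ u x} :=
  convex_halfSpace_ge u.toLinearMap.isLinear c

lemma isClosed_le' (u : V →L[ℝ] ℝ) (c : ℝ) : IsClosed {x | u x ≤ c} :=
  isClosed_le u.continuous continuous_const

lemma isClosed_ge' (u : V →L[ℝ] ℝ) (c : ℝ) : IsClosed {x | c ≤ u x} :=
  isClosed_le continuous_const u.continuous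

/-- A set on which a nonzero functional is constant has empty interior. -/
lemma interior_eq_empty_of_const {S : Set V} {u : V →L[ℝ] ℝ} (hu : u ≠ 0) {c : ℝ}
    (h : ∀ x ∈ S, u x = c) : interior S = ∅ := by
  by_contra hne
  obtain ⟨x, hx⟩ := Set.nonempty_iff_ne_empty.mpr hne
  apply hu
  have hS : ∀ᶠ y in nhds x, u y = c := by
    filter_upwards [mem_interior_iff_mem_nhds.mp hx] with y hy using h y hy
  ext v
  have h1 : Filter.Tendsto (fun t : ℝ => x + t • v) (nhdsWithin 0 {0}ᶜ) (nhds x) := by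
    have : Continuous (fun t : ℝ => x + t • v) := by fun_prop
    have h2 := this.tendsto 0
    simp only [zero_smul, add_zero] at h2
    exact h2.mono_left nhdsWithin_le_nhds
  have h3 := (h1.eventually hS).and self_mem_nhdsWithin
  obtain ⟨t, ht, ht0⟩ := h3.exists
  have hc : u x = c := h x (interior_subset hx)
  simp only [map_add, map_smul, hc, smul_eq_mul] at ht
  have ht0' : t ≠ 0 := ht0
  have : t * u v = 0 := by linarith
  simpa [ht0'] using this

/-- The set swept by `K` along the segment from `0` to `v`. -/
def sweep (K : Set V) (v : V) : Set V := (fun p : V × ℝ => p.1 + p.2 • v) '' (K ×ˢ Set.Icc 0 1)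

lemma mem_sweep {K : Set V} {v x : V} :
    x ∈ sweep K v ↔ ∃ y ∈ K, ∃ s : ℝ, 0 ≤ s ∧ s ≤ 1 ∧ x = y + s • v := by
  constructor
  · rintro ⟨⟨y, s⟩, ⟨hy, hs⟩, rfl⟩
    exact ⟨y, hy, s, hs.1, hs.2, rfl⟩
  · rintro ⟨y, hy, s, h0, h1, rfl⟩
    exact ⟨(y, s), ⟨hy, h0, h1⟩, rfl⟩

lemma mem_sweep_smul {K : Set V} {v x : V} {t : ℝ} (ht : 0 ≤ t) :
    x ∈ sweep K (t • v) ↔ ∃ y ∈ K, ∃ s : ℝ, 0 ≤ s ∧ s ≤ t ∧ x = y + s • v := by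
  rw [mem_sweep]
  constructor
  · rintro ⟨y, hy, s, h0, h1, rfl⟩
    exact ⟨y, hy, s * t, by positivity, by nlinarith, by rw [smul_smul]⟩
  · rintro ⟨y, hy, s, h0, h1, rfl⟩
    rcases ht.eq_or_lt with rfl | ht
    · obtain rfl : s = 0 := le_antisymm h1 h0
      exact ⟨y, hy, 0, le_rfl, zero_le_one, by simp⟩
    · refine ⟨y, hy, s / t, by positivity, (div_le_one ht).mpr h1, ?_⟩
      rw [smul_smul, div_mul_cancel₀ _ ht.ne']

lemma sweep_eq_add (K : Set V) (v : V) : sweep K v = K + segment ℝ 0 v := by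
  ext x
  rw [mem_sweep, Set.mem_add]
  constructor
  · rintro ⟨y, hy, s, h0, h1, rfl⟩
    refine ⟨y, hy, s • v, ?_, rfl⟩
    rw [segment_eq_image]
    exact ⟨s, ⟨h0, h1⟩, by simp⟩
  · rintro ⟨y, hy, z, hz, rfl⟩
    rw [segment_eq_image] at hz
    obtain ⟨s, ⟨h0, h1⟩, rfl⟩ := hz
    exact ⟨y, hy, s, h0, h1, by simp⟩

lemma convex_sweep {K : Set V} (hK : Convex ℝ K) (v : V) : Convex ℝ (sweep K v) := by
  rw [sweep_eq_add]
  exact hK.add (convex_segment _ _)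

lemma isCompact_sweep {K : Set V} (hK : IsCompact K) (v : V) : IsCompact (sweep K v) :=
  (hK.prod isCompact_Icc).image (by fun_prop)

lemma subset_sweep (K : Set V) (v : V) : K ⊆ sweep K v := fun x hx =>
  mem_sweep.mpr ⟨x, hx, 0, le_rfl, zero_le_one, by simp⟩

lemma sweep_sweep {K : Set V} {v : V} {s t : ℝ} (hs : 0 ≤ s) (ht : 0 ≤ t) :
    sweep (sweep K (s • v)) (t • v) = sweep K ((s + t) • v) := by
  ext x
  rw [mem_sweep_smul ht, mem_sweep_smul (add_nonneg hs ht)]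
  constructor
  · rintro ⟨y, hy, b, hb, hb', rfl⟩
    obtain ⟨z, hz, a, ha, ha', rfl⟩ := (mem_sweep_smul hs).mp hy
    exact ⟨z, hz, a + b, by positivity, by linarith, by module⟩
  · rintro ⟨y, hy, b, hb, hb', rfl⟩
    refine ⟨y + min b s • v, (mem_sweep_smul hs).mpr ⟨y, hy, _, le_min hb hs,
      min_le_right _ _, rfl⟩,
      b - min b s, by simp, ?_, by module⟩
    rcases le_total b s with h | h
    · simp [h, ht]
    · simp only [h, inf_of_le_right]; linarith

/-- Points between two points of a convex set on a line. -/
lemma convex_line {K : Set V} (hK : Convex ℝ K) {x v : V} {a b : ℝ} (ha : x + a • v ∈ K)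
    (hb : x - b • v ∈ K) (ha0 : 0 ≤ a) (hb0 : 0 ≤ b) : x ∈ K := by
  rcases ha0.eq_or_lt with rfl | ha0
  · simpa using ha
  have h := hK ha hb (div_nonneg hb0 (by positivity : 0 ≤ a + b))
    (div_nonneg ha0.le (by positivity : 0 ≤ a + b)) (by field_simp; ring)
  convert h using 1
  have hab : a + b ≠ 0 := by positivity
  match_scalars <;> field_simp <;> ring

variable {Φ : Set V → ℝ}

lemma SimpleVal.null_of_const (h : SimpleVal Φ) {S : Set V} (hS : Convex ℝ S) (hS' : IsCompact S)
    {u : V →L[ℝ] ℝ} (hu : u ≠ 0) {c : ℝ} (hc : ∀ x ∈ S, u x = c) : Φ S = 0 :=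
  h.null S hS hS' (interior_eq_empty_of_const hu hc)

lemma SimpleVal.empty (h : SimpleVal Φ) : Φ ∅ = 0 :=
  h.null ∅ convex_empty isCompact_empty interior_empty

lemma SimpleVal.lincomb (h : SimpleVal Φ) {Φ' : Set V → ℝ} (h' : SimpleVal Φ') (a b : ℝ) :
    SimpleVal fun S => a * Φ S + b * Φ' S where
  null S h1 h2 h3 := by simp [h.null S h1 h2 h3, h'.null S h1 h2 h3]
  trans S x h1 h2 := by simp only [h.trans S x h1 h2, h'.trans S x h1 h2]
  cut S u c h1 h2 h3 := by
    rw [h.cut S u c h1 h2 h3, h'.cut S u c h1 h2 h3]; ring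
  val K L h1 h2 h3 h4 h5 h6 := by
    have e1 := h.val K L h1 h2 h3 h4 h5 h6
    have e2 := h'.val K L h1 h2 h3 h4 h5 h6
    linear_combination a * e1 + b * e2
  cont K h1 h2 h3 ε hε := by
    obtain ⟨d1, hd1, H1⟩ := h.cont K h1 h2 h3 (ε / (2 * (|a| + 1))) (by positivity)
    obtain ⟨d2, hd2, H2⟩ := h'.cont K h1 h2 h3 (ε / (2 * (|b| + 1))) (by positivity)
    refine ⟨min d1 d2, by positivity, fun L hL hL' i1 i2 => ?_⟩
    have e1 := H1 L hL hL' (i1.trans (Metric.cthickening_mono (min_le_left _ _) _))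
      (i2.trans (Metric.cthickening_mono (min_le_left _ _) _))
    have e2 := H2 L hL hL' (i1.trans (Metric.cthickening_mono (min_le_right _ _) _))
      (i2.trans (Metric.cthickening_mono (min_le_right _ _) _))
    rw [lt_div_iff₀ (by positivity)] at e1 e2
    have : a * Φ L + b * Φ' L - (a * Φ K + b * Φ' K) = a * (Φ L - Φ K) + b * (Φ' L - Φ' K) := by
      ring
    rw [this]
    refine (abs_add_le _ _).trans_lt ?_
    rw [abs_mul, abs_mul]
    nlinarith [abs_nonneg (Φ L - Φ K), abs_nonneg (Φ' L - Φ' K), abs_nonneg a, abs_nonneg b]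

lemma SimpleVal.trans' (h : SimpleVal Φ) {S T : Set V} (x : V) (hS : Convex ℝ S)
    (hS' : IsCompact S) (hT : ∀ y, x + y ∈ T ↔ y ∈ S) : Φ T = Φ S := by
  rw [← h.trans S x hS hS']
  congr 1
  ext z
  constructor
  · intro hz
    exact ⟨z - x, (hT _).mp (by simpa using hz), by simp⟩
  · rintro ⟨y, hy, rfl⟩
    exact (hT y).mpr hy

lemma SimpleVal.sweep_two (h : SimpleVal Φ) {K : Set V} (hK : Convex ℝ K) (hK' : IsCompact K)
    (hi : (interior K).Nonempty) (v : V) :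
    Φ (sweep K ((2 : ℝ) • v)) + Φ K = 2 * Φ (sweep K v) := by
  set L := (fun y => v + y) '' sweep K v
  have hm : ∀ {x : V}, x ∈ sweep K ((2:ℝ) • v) ↔ _ := fun {x} =>
    mem_sweep_smul (K := K) (v := v) (x := x) (zero_le_two)
  have hU : sweep K v ∪ L = sweep K ((2 : ℝ) • v) := by
    ext x
    rw [hm]
    constructor
    · rintro (hx | ⟨z, hz, rfl⟩)
      · obtain ⟨y, hy, s, h0, h1, rfl⟩ := mem_sweep.mp hx
        exact ⟨y, hy, s, h0, by linarith, rfl⟩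
      · obtain ⟨y, hy, s, h0, h1, rfl⟩ := mem_sweep.mp hz
        exact ⟨y, hy, 1 + s, by linarith, by linarith, by module⟩
    · rintro ⟨y, hy, s, h0, h1, rfl⟩
      rcases le_total s 1 with hs | hs
      · exact Or.inl (mem_sweep.mpr ⟨y, hy, s, h0, hs, rfl⟩)
      · refine Or.inr ⟨y + (s - 1) • v, mem_sweep.mpr ⟨y, hy, s - 1, by linarith,
          by linarith, rfl⟩, ?_⟩
        simp only [sub_smul, one_smul]; abel
  have hI : sweep K v ∩ L = (fun y => v + y) '' K := by
    ext x
    constructor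
    · rintro ⟨hx, z, hz, rfl⟩
      refine ⟨z, ?_, rfl⟩
      obtain ⟨y, hy, s, h0, h1, e⟩ := mem_sweep.mp hx
      obtain ⟨y', hy', s', h0', h1', rfl⟩ := mem_sweep.mp hz
      refine convex_line hK (v := v) (a := 1 - s) (b := s') ?_ (by simpa using hy')
        (by linarith) h0'
      convert hy using 1
      simp only at e
      linear_combination (norm := module) e
    · rintro ⟨z, hz, rfl⟩
      exact ⟨mem_sweep.mpr ⟨z, hz, 1, zero_le_one, le_rfl, by simp [add_comm]⟩, z,
        subset_sweep _ _ hz, rfl⟩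
  have hL : Convex ℝ L := (convex_sweep hK v).translate v
  have hLc : IsCompact L := (isCompact_sweep hK' v).image (by fun_prop)
  have key := h.val (sweep K v) L (convex_sweep hK v) (isCompact_sweep hK' v) hL hLc
    (by rw [hU]; exact convex_sweep hK _) (by
      rw [hI]
      obtain ⟨x, hx⟩ := hi
      refine ⟨v + x, ?_⟩
      have := (Homeomorph.addLeft v).image_interior K
      rw [show (fun y => v + y) = Homeomorph.addLeft v from rfl, ← this]
      exact ⟨x, hx, rfl⟩)
  rw [hU, hI, h.trans K v hK hK', h.trans _ v (convex_sweep hK v) (isCompact_sweep hK' v)] at key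
  linarith

/-- Vanishing on prisms. -/
def VanishPrism (Φ : Set V → ℝ) : Prop :=
  ∀ (u : V →L[ℝ] ℝ) (v : V) (L : Set V), u v = 1 → Convex ℝ L → IsCompact L →
    (∀ x ∈ L, u x = 0) → ∀ t : ℝ, 0 < t → Φ (sweep L (t • v)) = 0

lemma SimpleVal.sweep_const (h : SimpleVal Φ) (hp : VanishPrism Φ) {K : Set V} (hK : Convex ℝ K)
    (hK' : IsCompact K) {u : V →L[ℝ] ℝ} {v : V} (huv : u v = 1) {m M t : ℝ}
    (hm : ∀ x ∈ K, m ≤ u x) (hM : ∀ x ∈ K, u x ≤ M) (hmM : m < M) (ht : M - m < t) :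
    Φ (sweep K (t • v)) = Φ (sweep K ((M - m) • v)) := by
  have hu : u ≠ 0 := by rintro rfl; simp at huv
  have t0 : 0 ≤ t := by linarith
  have t0' : 0 ≤ M - m := by linarith
  have c1 := convex_sweep hK (t • v)
  have k1 := isCompact_sweep hK' (t • v)
  have c2 := convex_sweep hK ((M - m) • v)
  have k2 := isCompact_sweep hK' ((M - m) • v)
  have c3 := c1.inter (convex_ge u M)
  have k3 := k1.inter_right (isClosed_ge' u M)
  rw [h.cut _ u M c1 k1 hu, h.cut _ u M c2 k2 hu, h.cut _ u (m + t) c3 k3 hu]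
  have e1 : sweep K (t • v) ∩ {x | u x ≤ M} = sweep K ((M - m) • v) ∩ {x | u x ≤ M} := by
    ext x
    simp only [Set.mem_inter_iff, mem_sweep_smul t0, mem_sweep_smul t0', Set.mem_ofPred_eq]
    constructor
    · rintro ⟨⟨y, hy, s, h0, h1, rfl⟩, hx⟩
      simp only [map_add, map_smul, huv, smul_eq_mul, mul_one] at hx
      have := hm y hy
      exact ⟨⟨y, hy, s, h0, by linarith, rfl⟩, by simp [huv, hx]⟩
    · rintro ⟨⟨y, hy, s, h0, h1, rfl⟩, hx⟩
      exact ⟨⟨y, hy, s, h0, by linarith, rfl⟩, hx⟩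
  have e2 : Φ (sweep K (t • v) ∩ {x | M ≤ u x} ∩ {x | m + t ≤ u x}) =
      Φ (sweep K ((M - m) • v) ∩ {x | M ≤ u x}) := by
    refine h.trans' ((t - (M - m)) • v) (c2.inter (convex_ge u M))
      (k2.inter_right (isClosed_ge' u M)) ?_
    intro x
    simp only [Set.mem_inter_iff, mem_sweep_smul t0, mem_sweep_smul t0', Set.mem_ofPred_eq, map_add,
      map_smul, huv, smul_eq_mul, mul_one]
    constructor
    · rintro ⟨⟨⟨y, hy, s, h0, h1, e⟩, hx⟩, hx'⟩
      have hux := congrArg u e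
      simp only [map_add, map_smul, huv, smul_eq_mul, mul_one] at hux
      refine ⟨⟨y, hy, s - (t - (M - m)), ?_, by linarith, ?_⟩, by linarith⟩
      · have := hM y hy; linarith
      · rw [sub_smul, ← add_sub_assoc, ← e]; abel
    · rintro ⟨⟨y, hy, s, h0, h1, rfl⟩, hx⟩
      simp only [map_add, map_smul, huv, smul_eq_mul, mul_one] at hx ⊢
      exact ⟨⟨⟨y, hy, s + (t - (M - m)), by linarith, by linarith, by module⟩,
        by linarith⟩, by linarith⟩
  have e3 : Φ (sweep K (t • v) ∩ {x | M ≤ u x} ∩ {x | u x ≤ m + t}) = 0 := by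
    have hcont : Continuous fun x : V => x - u x • v := by fun_prop
    have hL : Convex ℝ ((fun x : V => x - u x • v) '' K) :=
      hK.is_linear_image (f := fun x : V => x - u x • v)
        ⟨fun x y => by rw [map_add]; module, fun c x => by simp [smul_sub, smul_smul]⟩
    rw [← hp u v ((fun x : V => x - u x • v) '' K) huv hL (hK'.image hcont)
      (by rintro _ ⟨x, hx, rfl⟩; simp [huv]) (m + t - M) (by linarith)]
    refine h.trans' (M • v) (convex_sweep hL _) (isCompact_sweep (hK'.image hcont) _) ?_
    intro x
    have hp0 : 0 ≤ m + t - M := by linarith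
    simp only [Set.mem_inter_iff, mem_sweep_smul t0, mem_sweep_smul hp0, Set.mem_ofPred_eq, map_add,
      map_smul, huv, smul_eq_mul, mul_one]
    constructor
    · rintro ⟨⟨⟨y, hy, s, h0, h1, e⟩, hx⟩, hx'⟩
      have hux := congrArg u e
      simp only [map_add, map_smul, huv, smul_eq_mul, mul_one] at hux
      refine ⟨y - u y • v, ⟨y, hy, rfl⟩, u x, by linarith, by linarith, ?_⟩
      have : u x = u y + s - M := by linarith
      rw [this]
      linear_combination (norm := module) e
    · rintro ⟨_, ⟨y, hy, rfl⟩, s, h0, h1, rfl⟩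
      have := hm y hy
      have := hM y hy
      simp only [map_add, map_sub, map_smul, huv, smul_eq_mul, mul_one]
      refine ⟨⟨⟨y, hy, s + M - u y, by linarith, by linarith, ?_⟩, by linarith⟩, by linarith⟩
      rw [sub_smul, add_smul]; abel
  rw [e1, e2, e3]; ring

/-- A simple valuation vanishing on prisms is invariant under adding segments. -/
theorem SimpleVal.sweep_eq (h : SimpleVal Φ) (hp : VanishPrism Φ) {K : Set V} (hK : Convex ℝ K)
    (hK' : IsCompact K) (hi : (interior K).Nonempty) (v : V) : Φ (sweep K v) = Φ K := by
  by_cases hv : v = 0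
  · subst hv
    congr 1
    ext x
    rw [mem_sweep]
    constructor
    · rintro ⟨y, hy, s, -, -, rfl⟩; simpa
    · intro hx; exact ⟨x, hx, 0, le_rfl, zero_le_one, by simp⟩
  obtain ⟨u, huv⟩ := SeparatingDual.exists_eq_one (R := ℝ) hv
  obtain ⟨C, hC⟩ := (hK'.image u.continuous).isBounded.exists_norm_le
  have hC' : ∀ x ∈ K, |u x| ≤ C := fun x hx => hC _ ⟨x, hx, rfl⟩
  have key : ∀ K : Set V, Convex ℝ K → IsCompact K → (interior K).Nonempty → ∀ C : ℝ, 0 < C →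
      (∀ x ∈ K, |u x| ≤ C) → ∀ t, 2 * C < t → Φ (sweep K (t • v)) = Φ K := by
    intro K hK hK' hi C hC0 hC t ht
    have a : ∀ t, 2 * C < t → Φ (sweep K (t • v)) = Φ (sweep K ((C - -C) • v)) := fun t ht =>
      h.sweep_const hp hK hK' huv (fun x hx => (abs_le.mp (hC x hx)).1)
        (fun x hx => (abs_le.mp (hC x hx)).2) (by linarith) (by linarith)
    have e := h.sweep_two hK hK' hi (t • v)
    rw [smul_smul, a (2 * t) (by linarith)] at e
    rw [a t ht] at e ⊢
    linarith
  obtain ⟨y, hy⟩ := hi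
  have hC0 : 0 ≤ C := (abs_nonneg _).trans (hC' y (interior_subset hy))
  have b1 := key (sweep K v) (convex_sweep hK v) (isCompact_sweep hK' v)
    ⟨y, interior_mono (subset_sweep _ _) hy⟩ (C + 1) (by linarith) (by
      intro x hx
      obtain ⟨z, hz, s, h0, h1, rfl⟩ := mem_sweep.mp hx
      simp only [map_add, map_smul, huv, smul_eq_mul, mul_one]
      refine (abs_add_le _ _).trans ?_
      rw [abs_of_nonneg h0]
      linarith [hC' z hz]) (2 * C + 3) (by linarith)
  have b2 := key K hK hK' ⟨y, hy⟩ (C + 1) (by linarith) (fun x hx => by linarith [hC' x hx])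
    (1 + (2 * C + 3)) (by linarith)
  rw [← sweep_sweep zero_le_one (by linarith), one_smul] at b2
  rw [← b1, b2]

end Basic

section Wulff

variable {X : Type*} [NormedAddCommGroup X] [InnerProductSpace ℝ X]

/-- Subadditive positively homogeneous functions. -/
structure Sublin (h : X → ℝ) : Prop where
  add_le : ∀ x y, h (x + y) ≤ h x + h y
  smul : ∀ t : ℝ, 0 ≤ t → ∀ x, h (t • x) = t * h x

/-- The Wulff shape of a function. -/
def wulff (h : X → ℝ) : Set X := {x | ∀ y, inner ℝ y x ≤ h y}

lemma mem_wulff {h : X → ℝ} {x : X} : x ∈ wulff h ↔ ∀ y, inner ℝ y x ≤ h y := Iff.rfl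

lemma convex_wulff (h : X → ℝ) : Convex ℝ (wulff h) := by
  intro x hx y hy a b ha hb hab z
  rw [inner_add_right, inner_smul_right, inner_smul_right]
  have h1 := mul_le_mul_of_nonneg_left (hx z) ha
  have h2 := mul_le_mul_of_nonneg_left (hy z) hb
  calc _ ≤ a * h z + b * h z := add_le_add h1 h2
    _ = h z := by rw [← add_mul, hab, one_mul]

lemma isClosed_wulff (h : X → ℝ) : IsClosed (wulff h) := by
  have : wulff h = ⋂ y, {x | inner ℝ y x ≤ h y} := by ext; simp [mem_wulff]
  rw [this]
  exact isClosed_iInter fun y => isClosed_le (by fun_prop) continuous_const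

lemma wulff_mono {h k : X → ℝ} (hk : ∀ x, h x ≤ k x) : wulff h ⊆ wulff k :=
  fun _ hx y => (hx y).trans (hk y)

lemma wulff_min (h k : X → ℝ) : wulff (fun x => min (h x) (k x)) = wulff h ∩ wulff k := by
  ext x; simp [mem_wulff, forall_and]

namespace Sublin

variable {h k : X → ℝ}

lemma zero_eq (hh : Sublin h) : h 0 = 0 := by simpa using hh.smul 0 le_rfl 0

lemma add (hh : Sublin h) (hk : Sublin k) : Sublin fun x => h x + k x where
  add_le x y := by linarith [hh.add_le x y, hk.add_le x y]
  smul t ht x := by rw [hh.smul t ht, hk.smul t ht]; ring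

lemma max (hh : Sublin h) (hk : Sublin k) : Sublin fun x => max (h x) (k x) where
  add_le x y := max_le ((hh.add_le x y).trans (add_le_add (le_max_left _ _) (le_max_left _ _)))
    ((hk.add_le x y).trans (add_le_add (le_max_right _ _) (le_max_right _ _)))
  smul t ht x := by rw [hh.smul t ht, hk.smul t ht, mul_max_of_nonneg _ _ ht]

lemma const_mul (hh : Sublin h) {a : ℝ} (ha : 0 ≤ a) : Sublin fun x => a * h x where
  add_le x y := by nlinarith [hh.add_le x y]
  smul t ht x := by rw [hh.smul t ht]; ring

lemma inner (v : X) : Sublin fun x => inner ℝ x v where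
  add_le x y := by rw [inner_add_left]
  smul t _ x := by rw [inner_smul_left]; rfl

lemma norm : Sublin fun x : X => ‖x‖ where
  add_le x y := norm_add_le x y
  smul t ht x := by rw [norm_smul, Real.norm_of_nonneg ht]

lemma zero : Sublin fun _ : X => (0 : ℝ) where
  add_le _ _ := by simp
  smul _ _ _ := by simp

lemma neg_arg (hh : Sublin h) : Sublin fun x => h (-x) where
  add_le x y := by rw [neg_add]; exact hh.add_le _ _
  smul t ht x := by rw [← smul_neg, hh.smul t ht]

lemma abs_inner (v : X) : Sublin fun x => |Inner.inner ℝ x v| where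
  add_le x y := by rw [inner_add_left]; exact abs_add_le _ _
  smul t ht x := by rw [inner_smul_left, abs_mul]; simp [abs_of_nonneg ht]

lemma convexOn (hh : Sublin h) : ConvexOn ℝ Set.univ h :=
  ⟨convex_univ, fun x _ y _ a b ha hb _ => by
    have := hh.add_le (a • x) (b • y)
    rwa [hh.smul a ha, hh.smul b hb] at this⟩

lemma sum {ι : Type*} (s : Finset ι) {f : ι → X → ℝ} (hf : ∀ i ∈ s, Sublin (f i)) :
    Sublin fun x => ∑ i ∈ s, f i x where
  add_le x y := by
    rw [← Finset.sum_add_distrib]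
    exact Finset.sum_le_sum fun i hi => (hf i hi).add_le x y
  smul t ht x := by
    rw [Finset.mul_sum]
    exact Finset.sum_congr rfl fun i hi => (hf i hi).smul t ht x

variable [FiniteDimensional ℝ X]

lemma continuous (hh : Sublin h) : Continuous h := hh.convexOn.locallyLipschitz.continuous

lemma exists_bound (hh : Sublin h) : ∃ C, 0 < C ∧ ∀ x, |h x| ≤ C * ‖x‖ := by
  obtain ⟨C, hC⟩ := ((isCompact_sphere (0 : X) 1).image hh.continuous).isBounded.exists_norm_le
  refine ⟨C ⊔ 1, by positivity, fun x => ?_⟩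
  rcases eq_or_ne x 0 with rfl | hx
  · simp [hh.zero_eq]
  have hx' : 0 < ‖x‖ := norm_pos_iff.mpr hx
  have h1 : |h (‖x‖⁻¹ • x)| ≤ C := hC _ ⟨‖x‖⁻¹ • x, by simp [norm_smul, hx'.ne'], rfl⟩
  rw [hh.smul _ (by positivity), abs_mul, abs_inv, abs_norm, inv_mul_le_iff₀ hx'] at h1
  rw [mul_comm]
  exact h1.trans (mul_le_mul_of_nonneg_left (le_max_left _ _) hx'.le)

lemma isCompact_wulff (hh : Sublin h) : IsCompact (wulff h) := by
  obtain ⟨C, hC0, hC⟩ := hh.exists_bound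
  refine Metric.isCompact_of_isClosed_isBounded (isClosed_wulff h)
    ((Metric.isBounded_closedBall (x := (0 : X)) (r := C)).subset fun x hx => ?_)
  rw [mem_closedBall_zero_iff]
  have h1 := (hx x).trans ((le_abs_self _).trans (hC x))
  rw [real_inner_self_eq_norm_sq] at h1
  by_contra hlt
  push Not at hlt
  nlinarith

lemma exists_linear (hh : Sublin h) (f : X →ₗ.[ℝ] ℝ) (hf : ∀ x : f.domain, f x ≤ h x) :
    ∃ x ∈ wulff h, ∀ y : f.domain, Inner.inner ℝ (y : X) x = f y := by
  obtain ⟨g, hg, hg'⟩ := exists_extension_of_le_sublinear f h (fun c hc x => hh.smul c hc.le x)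
    hh.add_le hf
  refine ⟨(InnerProductSpace.toDual ℝ X).symm (LinearMap.toContinuousLinearMap g), ?_, ?_⟩
  · intro y
    rw [real_inner_comm, InnerProductSpace.toDual_symm_apply]
    exact hg' y
  · intro y
    rw [real_inner_comm, InnerProductSpace.toDual_symm_apply]
    exact hg y

lemma wulff_nonempty (hh : Sublin h) : (wulff h).Nonempty := by
  obtain ⟨x, hx, -⟩ := hh.exists_linear ⊥ (by
    rintro ⟨x, hx⟩
    obtain rfl : x = 0 := hx
    exact (LinearPMap.map_zero _).trans_le hh.zero_eq.ge)
  exact ⟨x, hx⟩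

/-- A sublinear function is the support function of its Wulff shape. -/
lemma exists_eq (hh : Sublin h) (y : X) : ∃ x ∈ wulff h, Inner.inner ℝ y x = h y := by
  rcases eq_or_ne y 0 with rfl | hy
  · obtain ⟨x, hx⟩ := hh.wulff_nonempty
    exact ⟨x, hx, by simp [hh.zero_eq]⟩
  obtain ⟨x, hx, H⟩ := hh.exists_linear (LinearPMap.mkSpanSingleton y (h y) hy) (by
    rintro ⟨x, hx⟩
    obtain ⟨t, rfl⟩ := Submodule.mem_span_singleton.mp hx
    rw [LinearPMap.mkSpanSingleton'_apply]
    simp only [RingHom.id_apply, smul_eq_mul]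
    rcases le_total 0 t with ht | ht
    · rw [hh.smul t ht]
    · have h1 := hh.smul (-t) (by linarith) y
      have h2 := hh.add_le (t • y) ((-t) • y)
      rw [← add_smul, add_neg_cancel, zero_smul, hh.zero_eq, h1] at h2
      linarith)
  refine ⟨x, hx, ?_⟩
  have := H ⟨y, Submodule.mem_span_singleton_self y⟩
  exact this.trans (LinearPMap.mkSpanSingleton'_apply_self y (h y) _ _)

lemma wulff_add (hh : Sublin h) (hk : Sublin k) :
    wulff (fun x => h x + k x) = wulff h + wulff k := by
  apply Set.Subset.antisymm
  · intro x hx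
    by_contra hx'
    obtain ⟨f, u, hf, hu⟩ := geometric_hahn_banach_closed_point
      ((convex_wulff h).add (convex_wulff k))
      (hh.isCompact_wulff.add hk.isCompact_wulff).isClosed hx'
    set y := (InnerProductSpace.toDual ℝ X).symm f
    have hy : ∀ z, Inner.inner ℝ y z = f z := fun z => InnerProductSpace.toDual_symm_apply
    obtain ⟨a, ha, ha'⟩ := hh.exists_eq y
    obtain ⟨b, hb, hb'⟩ := hk.exists_eq y
    have h1 := hf (a + b) (Set.add_mem_add ha hb)
    rw [map_add, ← hy, ← hy, ha', hb'] at h1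
    have h2 := hx y
    rw [hy] at h2
    linarith
  · rintro _ ⟨a, ha, b, hb, rfl⟩ y
    simp only [inner_add_right]
    exact add_le_add (ha y) (hb y)

omit [FiniteDimensional ℝ X] in
lemma wulff_norm {r : ℝ} (hr : 0 ≤ r) : wulff (fun x : X => r * ‖x‖) = Metric.closedBall 0 r := by
  ext x
  rw [mem_closedBall_zero_iff]
  constructor
  · intro hx
    have h1 := hx x
    rw [real_inner_self_eq_norm_sq] at h1
    rcases (norm_nonneg x).eq_or_lt with h0 | h0
    · rwa [← h0]
    · nlinarith
  · intro hx y
    have := real_inner_le_norm y x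
    nlinarith [norm_nonneg y]

lemma wulff_subset_thickening (hh : Sublin h) {δ : ℝ} (hδ : 0 ≤ δ)
    (hd : ∀ x, k x ≤ h x + δ * ‖x‖) : wulff k ⊆ Metric.cthickening δ (wulff h) := by
  refine (wulff_mono hd).trans ?_
  rw [hh.wulff_add (Sublin.norm.const_mul hδ), wulff_norm hδ]
  rintro _ ⟨x, hx, y, hy, rfl⟩
  refine Metric.mem_cthickening_of_dist_le _ x δ _ hx ?_
  simpa using hy

lemma wulff_max (hh : Sublin h) (hk : Sublin k) (hm : Sublin fun x => Min.min (h x) (k x)) :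
    wulff (fun x => Max.max (h x) (k x)) = wulff h ∪ wulff k := by
  apply Set.Subset.antisymm
  · intro x hx
    by_contra hx'
    simp only [Set.mem_union, not_or, mem_wulff, not_forall, not_le] at hx'
    obtain ⟨⟨y1, h1⟩, ⟨y2, h2⟩⟩ := hx'
    let z : ℝ → X := fun s => (1 - s) • y1 + s • y2
    have hz : Continuous z := by fun_prop
    have key := isPreconnected_Icc (a := (0:ℝ)) (b := 1) {s | h (z s) < Inner.inner ℝ (z s) x}
      {s | k (z s) < Inner.inner ℝ (z s) x}
      (isOpen_lt (hh.continuous.comp hz) (by fun_prop))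
      (isOpen_lt (hk.continuous.comp hz) (by fun_prop)) (by
        rintro s ⟨hs0, hs1⟩
        have h3 := hm.add_le ((1 - s) • y1) (s • y2)
        rw [hm.smul _ (by linarith), hm.smul _ hs0] at h3
        have h4 : Min.min (h y1) (k y1) < Inner.inner ℝ y1 x := (min_le_left _ _).trans_lt h1
        have h5 : Min.min (h y2) (k y2) < Inner.inner ℝ y2 x := (min_le_right _ _).trans_lt h2
        have h6 : Min.min (h (z s)) (k (z s)) < Inner.inner ℝ (z s) x := by
          simp only [z, inner_add_left, inner_smul_left, conj_trivial]
          refine h3.trans_lt ?_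
          rcases hs0.eq_or_lt with rfl | hs0
          · simpa using h4
          · nlinarith
        rcases min_lt_iff.mp h6 with h | h
        · exact Or.inl h
        · exact Or.inr h)
      ⟨0, ⟨le_rfl, zero_le_one⟩, by simpa [z] using h1⟩
      ⟨1, ⟨zero_le_one, le_rfl⟩, by simpa [z] using h2⟩
    obtain ⟨s, -, hs1, hs2⟩ := key
    exact absurd (hx (z s)) (not_le.mpr (max_lt hs1 hs2))
  · exact Set.union_subset (wulff_mono fun _ => le_max_left _ _)
      (wulff_mono fun _ => le_max_right _ _)

end Sublin

/-- The support function of a set. -/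
def supp (K : Set X) (y : X) : ℝ := sSup ((fun x => inner ℝ y x) '' K)

lemma inner_le_supp {K : Set X} (hK : IsCompact K) {x : X} (hx : x ∈ K) (y : X) :
    inner ℝ y x ≤ supp K y :=
  le_csSup (hK.image (by fun_prop)).bddAbove ⟨x, hx, rfl⟩

lemma supp_le {K : Set X} (hK : K.Nonempty) {y : X} {c : ℝ} (h : ∀ x ∈ K, inner ℝ y x ≤ c) :
    supp K y ≤ c :=
  csSup_le (hK.image _) (by rintro _ ⟨x, hx, rfl⟩; exact h x hx)

lemma sublin_supp {K : Set X} (hK : IsCompact K) (hne : K.Nonempty) : Sublin (supp K) where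
  add_le x y := supp_le hne fun z hz => by
    rw [inner_add_left]
    exact add_le_add (inner_le_supp hK hz _) (inner_le_supp hK hz _)
  smul t ht x := by
    rcases ht.eq_or_lt with rfl | ht'
    · rw [zero_smul, zero_mul]
      exact le_antisymm (supp_le hne fun z _ => by simp)
        (by obtain ⟨z, hz⟩ := hne; simpa using inner_le_supp hK hz 0)
    · apply le_antisymm
      · refine supp_le hne fun z hz => ?_
        rw [inner_smul_left]
        exact mul_le_mul_of_nonneg_left (inner_le_supp hK hz _) ht
      · rw [← le_div_iff₀' ht']
        refine supp_le hne fun z hz => ?_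
        rw [le_div_iff₀' ht']
        have := inner_le_supp hK hz (t • x)
        rwa [inner_smul_left] at this

variable [FiniteDimensional ℝ X]

lemma wulff_supp {K : Set X} (hK : IsCompact K) (hc : Convex ℝ K) (hne : K.Nonempty) :
    wulff (supp K) = K := by
  apply Set.Subset.antisymm
  · intro x hx
    by_contra hx'
    obtain ⟨f, u, hf, hu⟩ := geometric_hahn_banach_closed_point hc hK.isClosed hx'
    have hy : ∀ z, inner ℝ ((InnerProductSpace.toDual ℝ X).symm f) z = f z :=
      fun z => InnerProductSpace.toDual_symm_apply
    have h1 := hx ((InnerProductSpace.toDual ℝ X).symm f)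
    have h2 := supp_le hne (y := (InnerProductSpace.toDual ℝ X).symm f) (c := u)
      fun z hz => by rw [hy]; exact (hf z hz).le
    rw [hy] at h1
    linarith
  · intro x hx y
    exact inner_le_supp hK hx y

/-- Sublinear functions whose Wulff shape has interior points. -/
structure Good (h : X → ℝ) : Prop where
  sub : Sublin h
  int : (interior (wulff h)).Nonempty

lemma Good.add {h k : X → ℝ} (hh : Good h) (hk : Sublin k) : Good fun x => h x + k x where
  sub := hh.sub.add hk
  int := by
    obtain ⟨x, hx⟩ := hh.int
    obtain ⟨y, hy⟩ := hk.wulff_nonempty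
    rw [hh.sub.wulff_add hk]
    exact ⟨x + y, subset_interior_add_left (Set.add_mem_add hx hy)⟩

lemma Good.add' {h k : X → ℝ} (hh : Sublin h) (hk : Good k) : Good fun x => h x + k x := by
  simpa only [add_comm] using hk.add hh

omit [FiniteDimensional ℝ X] in
lemma good_norm {r : ℝ} (hr : 0 < r) : Good fun x : X => r * ‖x‖ where
  sub := Sublin.norm.const_mul hr.le
  int := by
    rw [Sublin.wulff_norm hr.le]
    exact ⟨0, Metric.ball_subset_interior_closedBall (by simpa using hr)⟩

variable {Φ : Set X → ℝ}

lemma SimpleVal.wulff_val (hΦ : SimpleVal Φ) {h k : X → ℝ} (hh : Sublin h) (hk : Sublin k)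
    (hm : Good fun x => min (h x) (k x)) :
    Φ (wulff fun x => max (h x) (k x)) + Φ (wulff fun x => min (h x) (k x)) =
      Φ (wulff h) + Φ (wulff k) := by
  have := hΦ.val (wulff h) (wulff k) (convex_wulff _) hh.isCompact_wulff (convex_wulff _)
    hk.isCompact_wulff (by rw [← hh.wulff_max hk hm.sub]; exact convex_wulff _)
    (by rw [← wulff_min]; exact hm.int)
  rwa [← hh.wulff_max hk hm.sub, ← wulff_min] at this

lemma SimpleVal.wulff_cont (hΦ : SimpleVal Φ) {h : X → ℝ} (hh : Good h) {ε : ℝ} (hε : 0 < ε) :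
    ∃ δ > 0, ∀ k, Sublin k → (∀ x, |k x - h x| ≤ δ * ‖x‖) →
      |Φ (wulff k) - Φ (wulff h)| < ε := by
  obtain ⟨δ, hδ, H⟩ := hΦ.cont (wulff h) (convex_wulff _) hh.sub.isCompact_wulff hh.int ε hε
  refine ⟨δ, hδ, fun k hk hd => H _ (convex_wulff _) hk.isCompact_wulff ?_ ?_⟩
  · exact hh.sub.wulff_subset_thickening hδ.le fun x => by
      have := (abs_le.mp (hd x)).2; linarith
  · exact hk.wulff_subset_thickening hδ.le fun x => by
      have := (abs_le.mp (hd x)).1; linarith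

end Wulff

section Cone

variable {X : Type*} [NormedAddCommGroup X] [InnerProductSpace ℝ X] [FiniteDimensional ℝ X]

/-- A convex cone of sublinear functions, closed under uniform limits on the unit ball. -/
structure ClosedCone (C : (X → ℝ) → Prop) : Prop where
  sub : ∀ m, C m → Sublin m
  zero : C fun _ => 0
  add : ∀ m m', C m → C m' → C fun x => m x + m' x
  smul : ∀ m (a : ℝ), C m → 0 ≤ a → C fun x => a * m x
  lim : ∀ m, (∀ ε > 0, ∃ m', C m' ∧ ∀ x, |m' x - m x| ≤ ε * ‖x‖) → C m

omit [FiniteDimensional ℝ X] in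
lemma Sublin.of_lim {m : X → ℝ} (h : ∀ ε > 0, ∃ m', Sublin m' ∧ ∀ x, |m' x - m x| ≤ ε * ‖x‖) :
    Sublin m where
  add_le x y := by
    refine le_of_forall_pos_le_add fun ε hε => ?_
    obtain ⟨m', hm', hd⟩ := h (ε / (‖x + y‖ + ‖x‖ + ‖y‖ + 1)) (by positivity)
    have h1 := (abs_le.mp (hd x)).2
    have h2 := (abs_le.mp (hd y)).2
    have h3 := (abs_le.mp (hd (x + y))).1
    have h4 := hm'.add_le x y
    have h5 : ε / (‖x + y‖ + ‖x‖ + ‖y‖ + 1) * (‖x + y‖ + ‖x‖ + ‖y‖) ≤ ε := by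
      rw [div_mul_eq_mul_div, div_le_iff₀ (by positivity)]
      nlinarith
    nlinarith
  smul t ht x := by
    have : ∀ ε > 0, |m (t • x) - t * m x| ≤ ε := by
      intro ε hε
      obtain ⟨m', hm', hd⟩ := h (ε / (2 * t * ‖x‖ + 1)) (by positivity)
      have h1 := hd (t • x)
      have h2 := mul_le_mul_of_nonneg_left (hd x) ht
      rw [hm'.smul t ht, norm_smul, Real.norm_of_nonneg ht] at h1
      have h5 : ε / (2 * t * ‖x‖ + 1) * (2 * t * ‖x‖) ≤ ε := by
        rw [div_mul_eq_mul_div, div_le_iff₀ (by positivity)]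
        nlinarith
      have h6 : m (t • x) - t * m x = -(t * m' x - m (t • x)) + t * (m' x - m x) := by ring
      rw [h6]
      refine (abs_add_le _ _).trans ?_
      rw [abs_neg, abs_mul, abs_of_nonneg ht]
      nlinarith
    have h0 : |m (t • x) - t * m x| ≤ 0 := le_of_forall_pos_le_add fun ε hε => by
      simpa using this ε hε
    exact sub_eq_zero.mp (abs_nonpos_iff.mp h0)

omit [FiniteDimensional ℝ X] in
lemma Sublin.eq_norm_mul {m : X → ℝ} (hm : Sublin m) (x : X) : m x = ‖x‖ * m (‖x‖⁻¹ • x) := by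
  rcases eq_or_ne x 0 with rfl | hx
  · simp [hm.zero_eq]
  rw [← hm.smul _ (norm_nonneg x), smul_smul, mul_inv_cancel₀ (norm_ne_zero_iff.mpr hx), one_smul]

/-- Integrals of elements of a closed cone belong to the cone. -/
theorem ClosedCone.integral_mem {C : (X → ℝ) → Prop} (hC : ClosedCone C) {Y : Type*}
    [TopologicalSpace Y] [SecondCountableTopology Y] [MeasurableSpace Y] [BorelSpace Y]
    (ν : Measure Y) [IsFiniteMeasure ν] (τ : Y → X → ℝ) (hτ : ∀ y, C (τ y))
    (hcont : Continuous (Function.uncurry τ)) (b : Y → ℝ) (hb : Integrable b ν)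
    (hbd : ∀ y x, |τ y x| ≤ b y * ‖x‖) : C fun x => ∫ y, τ y x ∂ν := by
  let B := Metric.closedBall (0 : X) 1
  have : CompactSpace B := isCompact_iff_compactSpace.mp (isCompact_closedBall _ _)
  let T : Y → C(B, ℝ) := fun y => ⟨fun x => τ y x,
    hcont.comp (by fun_prop : Continuous fun x : B => (y, (x : X)))⟩
  have hT : Continuous T := ContinuousMap.continuous_of_continuous_uncurry _ (by
    exact hcont.comp (by fun_prop : Continuous fun p : Y × B => (p.1, (p.2 : X))))
  have hTi : Integrable T ν := by
    refine hb.mono hT.aestronglyMeasurable (Filter.Eventually.of_forall fun y => ?_)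
    have hb0 : 0 ≤ |b y| := abs_nonneg _
    rw [Real.norm_eq_abs, ContinuousMap.norm_le _ hb0]
    rintro ⟨x, hx⟩
    have hx' : ‖x‖ ≤ 1 := by simpa [B] using hx
    refine (hbd y x).trans ?_
    have := le_abs_self (b y)
    nlinarith [norm_nonneg x]
  let K : Set C(B, ℝ) := {f | ∃ m, C m ∧ ∀ x : B, f x = m x}
  have hKc : Convex ℝ K := by
    rintro f ⟨m, hm, hf⟩ g ⟨m', hm', hg⟩ a a' ha ha' -
    exact ⟨_, hC.add _ _ (hC.smul m a hm ha) (hC.smul m' a' hm' ha'), fun x => by simp [hf, hg]⟩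
  have hn : ∀ x : X, ‖x‖⁻¹ • x ∈ B := fun x => by
    rw [mem_closedBall_zero_iff, norm_smul, norm_inv, norm_norm]
    exact inv_mul_le_one
  have hlim : ∀ f ∈ closure K, C fun x => ‖x‖ * f ⟨‖x‖⁻¹ • x, hn x⟩ := by
    intro f hf
    refine hC.lim _ fun ε hε => ?_
    obtain ⟨g, ⟨m, hm, hg⟩, hd⟩ := Metric.mem_closure_iff.mp hf ε hε
    refine ⟨m, hm, fun x => ?_⟩
    rw [(hC.sub m hm).eq_norm_mul x, ← mul_sub, abs_mul, abs_norm, mul_comm]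
    refine mul_le_mul_of_nonneg_right ?_ (norm_nonneg x)
    have := ContinuousMap.dist_apply_le_dist (f := f) (g := g) ⟨‖x‖⁻¹ • x, hn x⟩
    rw [hg, dist_comm, Real.dist_eq] at this
    exact this.trans hd.le
  have hKcl : IsClosed K := by
    rw [← closure_subset_iff_isClosed]
    intro f hf
    have hm := hlim f hf
    refine ⟨_, hm, fun x => ?_⟩
    have hsub : ∀ ε > 0, ∃ m' : X → ℝ, Sublin m' ∧ ∀ x : B, |m' x - f x| ≤ ε := by
      intro ε hε
      obtain ⟨g, ⟨m, hm, hg⟩, hd⟩ := Metric.mem_closure_iff.mp hf ε hε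
      refine ⟨m, hC.sub m hm, fun x => ?_⟩
      have := ContinuousMap.dist_apply_le_dist (f := f) (g := g) x
      rw [hg, dist_comm, Real.dist_eq] at this
      exact this.trans hd.le
    refine eq_of_forall_dist_le fun ε hε => ?_
    obtain ⟨m', hm', hd⟩ := hsub (ε / 2) (by positivity)
    have h1 := hd x
    have h2 := hd ⟨‖(x : X)‖⁻¹ • (x : X), hn x⟩
    rw [hm'.eq_norm_mul (x : X)] at h1
    have hx' : ‖(x : X)‖ ≤ 1 := mem_closedBall_zero_iff.mp x.2
    rw [Real.dist_eq]
    have h3 := mul_le_mul_of_nonneg_left h2 (norm_nonneg (x : X))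
    have h4 : f x - ‖(x : X)‖ * f ⟨‖(x : X)‖⁻¹ • (x : X), hn x⟩ =
      -(‖(x : X)‖ * m' (‖(x : X)‖⁻¹ • (x : X)) - f x) +
        ‖(x : X)‖ * (m' (‖(x : X)‖⁻¹ • (x : X)) - f ⟨‖(x : X)‖⁻¹ • (x : X), hn x⟩) := by ring
    rw [h4]
    refine (abs_add_le _ _).trans ?_
    rw [abs_neg, abs_mul, abs_norm]
    nlinarith [norm_nonneg (x : X)]
  have hmem : ∃ m, C m ∧ ∀ x : B, (∫ y, T y ∂ν) x = m x := by
    rcases eq_zero_or_neZero ν with rfl | hν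
    · exact ⟨_, hC.zero, fun x => by simp⟩
    · obtain ⟨m, hm, hmx⟩ := hKc.average_mem (μ := ν) hKcl
        (Filter.Eventually.of_forall fun y => ⟨τ y, hτ y, fun x => rfl⟩) hTi
      refine ⟨_, hC.smul m (ν.real Set.univ) hm measureReal_nonneg, fun x => ?_⟩
      rw [← hmx, average_eq, ContinuousMap.smul_apply, smul_eq_mul, ← mul_assoc, mul_inv_cancel₀,
        one_mul]
      simpa [measureReal_def, ENNReal.toReal_eq_zero_iff] using hν.out
  obtain ⟨m, hm, hmx⟩ := hmem
  have heval : ∀ x : B, ∫ y, τ y x ∂ν = m x := fun x => by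
    rw [← hmx x]
    exact (ContinuousMap.evalCLM ℝ x).integral_comp_comm hTi
  convert hm using 1
  ext x
  rw [(hC.sub m hm).eq_norm_mul x, ← heval ⟨_, hn x⟩, ← integral_const_mul]
  exact integral_congr_ae (Filter.Eventually.of_forall fun y => (hC.sub _ (hτ y)).eq_norm_mul x)

variable {Φ : Set X → ℝ}

/-- Sublinear functions all of whose multiples can be added without changing the valuation. -/
def Inv (Φ : Set X → ℝ) (m : X → ℝ) : Prop :=
  Sublin m ∧ ∀ a : ℝ, 0 ≤ a → ∀ h, Good h → Φ (wulff fun x => h x + a * m x) = Φ (wulff h)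

omit [FiniteDimensional ℝ X] in
lemma Inv.eq {m : X → ℝ} (hm : Inv Φ m) {h : X → ℝ} (hh : Good h) :
    Φ (wulff fun x => h x + m x) = Φ (wulff h) := by simpa using hm.2 1 zero_le_one h hh

lemma SimpleVal.closedCone_inv (hΦ : SimpleVal Φ) : ClosedCone (Inv Φ) where
  sub m hm := hm.1
  zero := ⟨Sublin.zero, fun a _ h _ => by simp⟩
  add m m' hm hm' := ⟨hm.1.add hm'.1, fun a ha h hh => by
    have := hm'.2 a ha _ (hh.add (hm.1.const_mul ha))
    rw [hm.2 a ha h hh] at this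
    rw [← this]
    congr! 3; ring⟩
  smul m a hm ha := ⟨hm.1.const_mul ha, fun b hb h hh => by
    have := hm.2 (b * a) (by positivity) h hh
    rw [← this]
    congr! 3; ring⟩
  lim m hm := by
    have hs : Sublin m := Sublin.of_lim fun ε hε => by
      obtain ⟨m', h1, h2⟩ := hm ε hε
      exact ⟨m', h1.1, h2⟩
    refine ⟨hs, fun a ha h hh => ?_⟩
    have : ∀ ε > 0, |Φ (wulff h) - Φ (wulff fun x => h x + a * m x)| ≤ ε := by
      intro ε hε
      obtain ⟨δ, hδ, H⟩ := hΦ.wulff_cont (hh.add (hs.const_mul ha)) hε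
      obtain ⟨m', h1, h2⟩ := hm (δ / (a + 1)) (by positivity)
      rw [← h1.2 a ha h hh]
      refine (H _ (hh.sub.add (h1.1.const_mul ha)) fun x => ?_).le
      have e : h x + a * m' x - (h x + a * m x) = a * (m' x - m x) := by ring
      rw [e, abs_mul, abs_of_nonneg ha]
      have h3 := mul_le_mul_of_nonneg_left (h2 x) ha
      refine h3.trans ?_
      have h4 : a * (δ / (a + 1)) ≤ δ := by
        rw [mul_div_assoc', div_le_iff₀ (by positivity)]
        nlinarith
      nlinarith [norm_nonneg x]
    have h0 : |Φ (wulff h) - Φ (wulff fun x => h x + a * m x)| ≤ 0 :=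
      le_of_forall_pos_le_add fun ε hε => by simpa using this ε hε
    exact (sub_eq_zero.mp (abs_nonpos_iff.mp h0)).symm

omit [FiniteDimensional ℝ X] in
lemma wulff_add_inner {h : X → ℝ} (v : X) :
    wulff (fun x => h x + inner ℝ x v) = (fun y => v + y) '' wulff h := by
  ext z
  constructor
  · intro hz
    refine ⟨z - v, fun y => ?_, by simp⟩
    have := hz y
    rw [inner_sub_right]; linarith
  · rintro ⟨z, hz, rfl⟩ y
    have := hz y
    rw [inner_add_right]; linarith

lemma SimpleVal.inv_inner (hΦ : SimpleVal Φ) (v : X) : Inv Φ fun x => inner ℝ x v := by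
  refine ⟨Sublin.inner v, fun a _ h hh => ?_⟩
  rw [← hΦ.trans (wulff h) (a • v) (convex_wulff h) hh.sub.isCompact_wulff, ← wulff_add_inner]
  simp [inner_smul_right]

omit [FiniteDimensional ℝ X] in
lemma isCompact_segment_zero (v : X) : IsCompact (segment ℝ 0 v) := by
  rw [segment_eq_image]
  exact isCompact_Icc.image (by fun_prop)

lemma wulff_max_zero_inner (v : X) : wulff (fun x => max 0 (inner ℝ x v)) = segment ℝ 0 v := by
  rw [← wulff_supp (isCompact_segment_zero v) (convex_segment 0 v)
    ⟨0, left_mem_segment ℝ 0 v⟩]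
  congr 1
  ext y
  apply le_antisymm
  · apply max_le
    · simpa using inner_le_supp (isCompact_segment_zero v) (left_mem_segment ℝ 0 v) y
    · exact inner_le_supp (isCompact_segment_zero v) (right_mem_segment ℝ 0 v) y
  · refine supp_le ⟨0, left_mem_segment ℝ 0 v⟩ ?_
    rintro x hx
    rw [segment_eq_image] at hx
    obtain ⟨s, ⟨h0, h1⟩, rfl⟩ := hx
    simp only [smul_zero, zero_add, inner_smul_right]
    rcases le_total 0 (inner ℝ y v) with h | h
    · rw [max_eq_right h]; nlinarith
    · exact le_max_of_le_left (by nlinarith)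

lemma SimpleVal.inv_abs_inner (hΦ : SimpleVal Φ) (hp : VanishPrism Φ) (v : X) :
    Inv Φ fun x => |inner ℝ x v| := by
  refine ⟨Sublin.abs_inner v, fun a ha h hh => ?_⟩
  have hs : Sublin fun x => max 0 (inner ℝ x ((2 * a) • v)) := Sublin.zero.max (Sublin.inner _)
  have e : (fun x => h x + a * |inner ℝ x v|) =
      fun x => (h x + inner ℝ x (-(a • v))) + max 0 (inner ℝ x ((2 * a) • v)) := by
    ext x
    simp only [inner_neg_right, inner_smul_right]
    rcases le_total 0 (inner ℝ x v) with h | h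
    · rw [abs_of_nonneg h, max_eq_right (by positivity)]; ring
    · rw [abs_of_nonpos h, max_eq_left (by nlinarith)]; ring
  have g1 := hh.add (Sublin.inner (-(a • v)))
  rw [e, g1.sub.wulff_add hs, wulff_max_zero_inner, ← sweep_eq_add,
    hΦ.sweep_eq hp (convex_wulff _) g1.sub.isCompact_wulff g1.int]
  exact (hΦ.inv_inner _).eq hh

end Cone

section CosInt

/-- The constant `∫₀^∞ (1 - cos r) / r² dr`. -/
def cosC : ℝ := ∫ r in Set.Ioi (0 : ℝ), (1 - Real.cos r) / r ^ 2

lemma integral_one_sub_cos (s : ℝ) :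
    ∫ r in Set.Ioi (0 : ℝ), (1 - Real.cos (r * s)) / r ^ 2 = cosC * |s| := by
  rcases eq_or_ne s 0 with rfl | hs
  · simp
  have hs' : 0 < |s| := abs_pos.mpr hs
  have := integral_comp_mul_left_Ioi (fun r : ℝ => (1 - Real.cos r) / r ^ 2) 0 hs'
  rw [mul_zero, smul_eq_mul] at this
  have h2 := mul_inv_cancel_left₀ hs'.ne' (∫ r in Set.Ioi (0 : ℝ), (1 - Real.cos r) / r ^ 2)
  rw [← this] at h2
  rw [cosC, ← h2, ← integral_const_mul, ← integral_mul_const]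
  refine setIntegral_congr_fun measurableSet_Ioi fun r hr => ?_
  have hr' : r ≠ 0 := (Set.mem_Ioi.mp hr).ne'
  have hc : Real.cos (r * s) = Real.cos (|s| * r) := by
    rcases abs_choice s with h | h <;> rw [h]
    · rw [mul_comm]
    · rw [← Real.cos_neg]; ring_nf
  simp only [hc]
  field_simp

lemma one_sub_cos_div_le (r s : ℝ) :
    |(1 - Real.cos (r * s)) / r ^ 2| ≤ (4 + s ^ 2) * (1 + r ^ 2)⁻¹ := by
  rcases eq_or_ne r 0 with rfl | hr
  · simp; positivity
  have h0 : 0 ≤ 1 - Real.cos (r * s) := by linarith [Real.cos_le_one (r * s)]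
  have h1 : 1 - Real.cos (r * s) ≤ 2 := by linarith [Real.neg_one_le_cos (r * s)]
  have h2 : 1 - Real.cos (r * s) ≤ (r * s) ^ 2 / 2 := by
    linarith [Real.one_sub_sq_div_two_le_cos (x := r * s)]
  rw [abs_of_nonneg (by positivity), ← div_eq_mul_inv, div_le_div_iff₀ (by positivity)
    (by positivity)]
  have := sq_nonneg r
  have := sq_nonneg s
  nlinarith [mul_nonneg (sq_nonneg r) h0]

theorem integral_one_sub_cos_weight {Y : Type*} [MeasurableSpace Y] (ν : Measure Y) [SigmaFinite ν]
    (W s : Y → ℝ) (hW : Integrable W ν) (hs : Measurable s)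
    (hWs : Integrable (fun y => W y * s y ^ 2) ν) :
    IntegrableOn (fun r => (∫ y, W y * (1 - Real.cos (r * s y)) ∂ν) / r ^ 2) (Set.Ioi 0) ∧
    ∫ r in Set.Ioi (0 : ℝ), (∫ y, W y * (1 - Real.cos (r * s y)) ∂ν) / r ^ 2 =
      cosC * ∫ y, W y * |s y| ∂ν := by
  have hF : Integrable (Function.uncurry fun (r : ℝ) (y : Y) =>
      W y * ((1 - Real.cos (r * s y)) / r ^ 2)) ((volume.restrict (Set.Ioi 0)).prod ν) := by
    have hb : Integrable (fun p : ℝ × Y => (1 + p.1 ^ 2)⁻¹ * (4 * W p.2 + W p.2 * s p.2 ^ 2))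
        ((volume.restrict (Set.Ioi 0)).prod ν) :=
      (integrable_inv_one_add_sq.integrableOn (s := Set.Ioi 0)).mul_prod ((hW.const_mul 4).add hWs)
    refine hb.mono ?_ (Filter.Eventually.of_forall fun p => ?_)
    · refine (hW.aestronglyMeasurable.comp_snd).mul (Measurable.aestronglyMeasurable ?_)
      have := hs.comp (measurable_snd : Measurable (Prod.snd : ℝ × Y → Y))
      fun_prop
    · have h1 := one_sub_cos_div_le p.1 (s p.2)
      have e : (1 + p.1 ^ 2)⁻¹ * (4 * W p.2 + W p.2 * s p.2 ^ 2) =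
        W p.2 * ((4 + s p.2 ^ 2) * (1 + p.1 ^ 2)⁻¹) := by ring
      rw [e, Function.uncurry_def, norm_mul, norm_mul]
      refine mul_le_mul_of_nonneg_left ?_ (norm_nonneg _)
      exact h1.trans (le_abs_self _)
  have e : ∀ r : ℝ, (∫ y, W y * (1 - Real.cos (r * s y)) ∂ν) / r ^ 2 =
      ∫ y, W y * ((1 - Real.cos (r * s y)) / r ^ 2) ∂ν := fun r => by
    rw [← integral_div]
    exact integral_congr_ae (Filter.Eventually.of_forall fun y => by ring)
  simp only [e]
  refine ⟨hF.integral_prod_left, ?_⟩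
  rw [integral_integral_swap hF, ← integral_const_mul]
  refine integral_congr_ae (Filter.Eventually.of_forall fun y => ?_)
  simp only [integral_const_mul, integral_one_sub_cos]
  ring

end CosInt

section Fourier

open FourierTransform

variable {X : Type*} [NormedAddCommGroup X] [InnerProductSpace ℝ X] [FiniteDimensional ℝ X]
  [MeasurableSpace X] [BorelSpace X]

/-- Rapidly decaying weights, as far as needed: continuous with integrable second moments. -/
structure Weight (w : X → ℝ) : Prop where
  cont : Continuous w
  int : ∀ k : ℕ, Integrable fun y => ‖y‖ ^ k * w y

lemma Weight.integrable {w : X → ℝ} (hw : Weight w) : Integrable w := by simpa using hw.int 0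

lemma exists_fourier {H : X → ℝ} (hH : ContDiff ℝ (⊤ : ℕ∞) H) (hc : HasCompactSupport H) :
    ∃ w1 w2 : X → ℝ, Weight w1 ∧ Weight w2 ∧ ∀ x, H x =
      ∫ y, (w1 y * Real.cos (2 * Real.pi * inner ℝ y x) +
        w2 y * Real.sin (2 * Real.pi * inner ℝ y x)) := by
  have hc' : HasCompactSupport fun x => (H x : ℂ) := hc.comp_left (g := fun t : ℝ => (t : ℂ)) rfl
  let f : SchwartzMap X ℂ := hc'.toSchwartzMap (Complex.ofRealCLM.contDiff.comp hH)
  have hfx : ∀ x, f x = (H x : ℂ) := fun x => rfl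
  have hint : ∀ k : ℕ, Integrable fun y => (‖y‖ ^ k : ℝ) • (𝓕 f) y := fun k => by
    refine ((𝓕 f).integrable_pow_mul volume k).mono (by fun_prop)
      (Filter.Eventually.of_forall fun y => ?_)
    simp
  refine ⟨fun y => ((𝓕 f) y).re, fun y => -((𝓕 f) y).im, ⟨by fun_prop, fun k => ?_⟩,
    ⟨by fun_prop, fun k => ?_⟩, fun x => ?_⟩
  · refine (hint k).re.congr (Filter.Eventually.of_forall fun y => ?_)
    simp only [RCLike.re_to_complex, Complex.smul_re, smul_eq_mul]
  · refine (hint k).im.neg.congr (Filter.Eventually.of_forall fun y => ?_)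
    simp only [RCLike.im_to_complex, Pi.neg_apply, Complex.smul_im, smul_eq_mul, mul_neg]
  · have h1 : 𝓕⁻ (𝓕 f) = f := by simp
    have h2 := SchwartzMap.fourierInv_coe (𝓕 f)
    rw [h1] at h2
    have h3 := congrFun h2 x
    rw [Real.fourierInv_eq', hfx] at h3
    have h4 := congrArg Complex.re h3
    rw [Complex.ofReal_re] at h4
    rw [h4]
    have hi : Integrable fun v =>
        Complex.exp (↑(2 * Real.pi * inner ℝ v x) * Complex.I) • (𝓕 f) v := by
      refine ((𝓕 f).integrable).mono (by fun_prop) (Filter.Eventually.of_forall fun y => ?_)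
      rw [norm_smul, Complex.norm_exp_ofReal_mul_I, one_mul]
    have h5 := integral_re (𝕜 := ℂ) hi
    simp only [RCLike.re_to_complex] at h5
    rw [← h5]
    refine integral_congr_ae (Filter.Eventually.of_forall fun y => ?_)
    simp only [smul_eq_mul, Complex.mul_re, Complex.exp_ofReal_mul_I_re,
      Complex.exp_ofReal_mul_I_im]
    ring

lemma Weight.integrable_cos {w : X → ℝ} (hw : Weight w) (x : X) :
    Integrable fun y => w y * Real.cos (2 * Real.pi * inner ℝ y x) := by
  have := hw.cont
  refine hw.integrable.mono (by fun_prop) (Filter.Eventually.of_forall fun y => ?_)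
  rw [norm_mul]
  exact mul_le_of_le_one_right (norm_nonneg _) (Real.abs_cos_le_one _)

lemma Weight.integrable_sin {w : X → ℝ} (hw : Weight w) (x : X) :
    Integrable fun y => w y * Real.sin (2 * Real.pi * inner ℝ y x) := by
  have := hw.cont
  refine hw.integrable.mono (by fun_prop) (Filter.Eventually.of_forall fun y => ?_)
  rw [norm_mul]
  exact mul_le_of_le_one_right (norm_nonneg _) (Real.abs_sin_le_one _)

lemma exists_cos {H : X → ℝ} (hH : ContDiff ℝ (⊤ : ℕ∞) H) (hc : HasCompactSupport H)
    (he : ∀ x, H (-x) = H x) :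
    ∃ w : X → ℝ, Weight w ∧ ∀ x, H x = ∫ y, w y * Real.cos (2 * Real.pi * inner ℝ y x) := by
  obtain ⟨w1, w2, h1, h2, h⟩ := exists_fourier hH hc
  refine ⟨w1, h1, fun x => ?_⟩
  have ha := h x
  have hb := h (-x)
  rw [integral_add (h1.integrable_cos _) (h2.integrable_sin _)] at ha hb
  simp only [inner_neg_right, mul_neg, Real.cos_neg, Real.sin_neg, integral_neg, he] at hb
  linarith

lemma exists_sin {H : X → ℝ} (hH : ContDiff ℝ (⊤ : ℕ∞) H) (hc : HasCompactSupport H)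
    (ho : ∀ x, H (-x) = -H x) :
    ∃ w : X → ℝ, Weight w ∧ ∀ x, H x = ∫ y, w y * Real.sin (2 * Real.pi * inner ℝ y x) := by
  obtain ⟨w1, w2, h1, h2, h⟩ := exists_fourier hH hc
  refine ⟨w2, h2, fun x => ?_⟩
  have ha := h x
  have hb := h (-x)
  rw [integral_add (h1.integrable_cos _) (h2.integrable_sin _)] at ha hb
  simp only [inner_neg_right, mul_neg, Real.cos_neg, Real.sin_neg, integral_neg, ho] at hb
  linarith

end Fourier

section Bump

/-- A bump function supported in `(1/4, 1/2)`. -/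
def bump : ContDiffBump (3 / 8 : ℝ) := ⟨1 / 16, 1 / 8, by norm_num, by norm_num⟩

lemma bump_eq_zero {r : ℝ} (hr : r ≤ 1 / 4 ∨ 1 / 2 ≤ r) : bump r = 0 := by
  refine bump.zero_of_le_dist ?_
  rw [Real.dist_eq, show bump.rOut = 1 / 8 from rfl]
  rcases hr with h | h
  · rw [abs_of_nonpos (by linarith)]; linarith
  · rw [abs_of_nonneg (by linarith)]; linarith

lemma integral_bump_comp (g : ℝ → ℝ) {a : ℝ} (ha : 0 < a) :
    ∫ r in Set.Ioi (0 : ℝ), g (a * r) / r = ∫ r in Set.Ioi (0 : ℝ), g r / r := by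
  have := integral_comp_mul_left_Ioi (fun r : ℝ => g r / r) 0 ha
  rw [mul_zero, smul_eq_mul, eq_inv_mul_iff_mul_eq₀ ha.ne', ← integral_const_mul] at this
  rw [← this]
  refine setIntegral_congr_fun measurableSet_Ioi fun r hr => ?_
  field_simp

lemma integral_bump_pos {g : ℝ → ℝ} (hg : Continuous g) (h0 : ∀ r, 1 / 4 ≤ r → r ≤ 1 / 2 → 0 ≤ g r)
    (hp : 0 < g (3 / 8)) : 0 < ∫ r in Set.Ioi (0 : ℝ), bump r * g r / r := by
  have e : ∀ r, bump r * g r / r = bump r * g r * (max r (1 / 4))⁻¹ := by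
    intro r
    rcases le_total r (1 / 4) with h | h
    · rw [bump_eq_zero (.inl h)]; simp
    · rw [max_eq_left h, div_eq_mul_inv]
  rw [setIntegral_eq_integral_of_forall_compl_eq_zero (fun r hr => by
    rw [bump_eq_zero (.inl (by simp at hr; linarith))]; simp)]
  simp only [e]
  have hpos : ∀ r : ℝ, 0 < max r (1 / 4) := fun r => lt_max_of_lt_right (by norm_num)
  refine Continuous.integral_pos_of_hasCompactSupport_nonneg_nonzero (x := 3 / 8) ?_ ?_ ?_ ?_
  · exact (bump.continuous.mul hg).mul
      (Continuous.inv₀ (by fun_prop) fun r => (hpos r).ne')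
  · exact (bump.hasCompactSupport.mul_right).mul_right
  · intro r
    rcases le_total r (1 / 4) with h | h
    · simp [bump_eq_zero (.inl h)]
    rcases le_total r (1 / 2) with h' | h'
    · have := h0 r h h'
      have := bump.nonneg (x := r)
      have := hpos r
      simp only [Pi.zero_apply]
      positivity
    · simp [bump_eq_zero (.inr h')]
  · have h1 : bump (3 / 8) = 1 := bump.one_of_mem_closedBall (Metric.mem_closedBall_self (by
      exact bump.rIn_pos.le))
    rw [h1, one_mul]
    exact (mul_pos hp (inv_pos.mpr (hpos _))).ne'

variable {X : Type*} [NormedAddCommGroup X] [InnerProductSpace ℝ X]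

lemma contDiff_bump_mul {h : X → ℝ} (hs : ∀ x ≠ 0, ContDiffAt ℝ (⊤ : ℕ∞) h x) :
    ContDiff ℝ (⊤ : ℕ∞) fun x => bump ‖x‖ * h x := by
  rw [contDiff_iff_contDiffAt]
  intro x
  rcases eq_or_ne x 0 with rfl | hx
  · refine (contDiffAt_const (c := (0 : ℝ))).congr_of_eventuallyEq ?_
    filter_upwards [Metric.ball_mem_nhds (0 : X) (show (0 : ℝ) < 1 / 4 by norm_num)] with y hy
    rw [mem_ball_zero_iff] at hy
    rw [bump_eq_zero (.inl hy.le), zero_mul]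
  · exact (bump.contDiff.contDiffAt.comp x (contDiffAt_norm ℝ hx)).mul (hs x hx)

lemma hasCompactSupport_bump_mul [FiniteDimensional ℝ X] (h : X → ℝ) :
    HasCompactSupport fun x => bump ‖x‖ * h x := by
  refine HasCompactSupport.intro (isCompact_closedBall (0 : X) (1 / 2)) fun x hx => ?_
  rw [mem_closedBall_zero_iff, not_le] at hx
  rw [bump_eq_zero (.inr hx.le), zero_mul]

end Bump

section Rep

variable {X : Type*} [NormedAddCommGroup X] [InnerProductSpace ℝ X] [FiniteDimensional ℝ X]
  [MeasurableSpace X] [BorelSpace X]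

omit [FiniteDimensional ℝ X] [MeasurableSpace X] [BorelSpace X] in
lemma bump_mul_smul {h : X → ℝ} (hh : ∀ x (t : ℝ), 0 < t → h (t • x) = t * h x) (x : X) {r : ℝ}
    (hr : 0 < r) : bump ‖r • x‖ * h (r • x) / r ^ 2 = h x * (bump (‖x‖ * r) / r) := by
  rw [hh x r hr, norm_smul, Real.norm_of_nonneg hr.le, mul_comm r ‖x‖]
  field_simp

/-- An even smooth function is a difference of support functions of zonoids. -/
theorem even_rep {h : X → ℝ} (hh : ∀ x (t : ℝ), 0 < t → h (t • x) = t * h x)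
    (he : ∀ x, h (-x) = h x) (hs : ∀ x ≠ 0, ContDiffAt ℝ (⊤ : ℕ∞) h x) :
    ∃ w : X → ℝ, Weight w ∧ ∀ x, h x = ∫ y, w y * |inner ℝ x y| := by
  obtain ⟨w, hw, hH⟩ := exists_cos (contDiff_bump_mul hs) (hasCompactSupport_bump_mul h)
    (fun x => by rw [norm_neg, he])
  have h0 : h 0 = 0 := by
    have := hh 0 2 two_pos
    rw [smul_zero] at this; linarith
  have hw0 : ∫ y, w y = 0 := by
    have := hH 0
    rw [h0] at this
    simpa using this.symm
  have hc := integral_bump_pos (g := fun _ => 1) continuous_const (fun _ _ _ => zero_le_one) one_pos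
  simp only [mul_one] at hc
  set c := ∫ r in Set.Ioi (0 : ℝ), bump r / r with hcdef
  have key : ∀ x, x ≠ 0 → h x * c = -(cosC * ∫ y, w y * |2 * Real.pi * inner ℝ y x|) := by
    intro x hx
    have hm : Integrable fun y => w y * (2 * Real.pi * inner ℝ y x) ^ 2 := by
      have := hw.cont
      refine ((hw.int 2).const_mul ((2 * Real.pi) ^ 2 * ‖x‖ ^ 2)).mono (by fun_prop)
        (Filter.Eventually.of_forall fun y => ?_)
      have h1 := abs_real_inner_le_norm y x
      have h2 : (inner ℝ y x) ^ 2 ≤ (‖y‖ * ‖x‖) ^ 2 := by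
        rw [← sq_abs]; gcongr
      have e1 : ‖w y * (2 * Real.pi * inner ℝ y x) ^ 2‖ =
          |w y| * (2 * Real.pi) ^ 2 * (inner ℝ y x) ^ 2 := by
        rw [norm_mul, Real.norm_eq_abs, Real.norm_of_nonneg (sq_nonneg _)]; ring
      have e2 : ‖(2 * Real.pi) ^ 2 * ‖x‖ ^ 2 * (‖y‖ ^ 2 * w y)‖ =
          |w y| * (2 * Real.pi) ^ 2 * (‖y‖ * ‖x‖) ^ 2 := by
        rw [norm_mul, Real.norm_of_nonneg (by positivity), norm_mul,
          Real.norm_of_nonneg (sq_nonneg _), Real.norm_eq_abs]; ring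
      rw [e1, e2]
      gcongr
    have := (integral_one_sub_cos_weight volume w (fun y => 2 * Real.pi * inner ℝ y x) hw.integrable
      (by fun_prop) hm).2
    rw [← this, hcdef, ← integral_bump_comp bump (norm_pos_iff.mpr hx), ← integral_const_mul,
      ← integral_neg]
    refine setIntegral_congr_fun measurableSet_Ioi fun r hr => ?_
    rw [← bump_mul_smul hh x hr, hH, ← neg_div]
    congr 1
    have e : ∀ y, w y * (1 - Real.cos (r * (2 * Real.pi * inner ℝ y x))) =
      w y - w y * Real.cos (2 * Real.pi * inner ℝ y (r • x)) := fun y => by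
        rw [inner_smul_right]; ring_nf
    simp only [e]
    rw [integral_sub hw.integrable (hw.integrable_cos _), hw0, zero_sub, neg_neg]
  refine ⟨fun y => -(cosC * (2 * Real.pi) / c) * w y, ⟨continuous_const.mul hw.cont, fun k => ?_⟩,
    fun x => ?_⟩
  · refine ((hw.int k).const_mul (-(cosC * (2 * Real.pi) / c))).congr
      (Filter.Eventually.of_forall fun y => by ring)
  · rcases eq_or_ne x 0 with rfl | hx
    · simp [h0]
    · have := key x hx
      have e : ∀ y, w y * |2 * Real.pi * inner ℝ y x| = 2 * Real.pi * (w y * |inner ℝ x y|) :=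
        fun y => by rw [abs_mul, abs_of_pos Real.two_pi_pos, real_inner_comm]; ring
      simp only [e, integral_const_mul] at this
      have e2 : ∀ y, -(cosC * (2 * Real.pi) / c) * w y * |inner ℝ x y| =
        -(cosC * (2 * Real.pi) / c) * (w y * |inner ℝ x y|) := fun y => by ring
      simp only [e2, integral_const_mul]
      field_simp
      linarith

/-- The average of `sin (2π|⟨x, ·⟩|)` over the unit ball. -/
def sinAvg (x : X) : ℝ := ∫ z in Metric.closedBall (0 : X) 1, Real.sin (2 * Real.pi * |inner ℝ x z|)

lemma sinAvg_eq {x y : X} (hxy : ‖x‖ = ‖y‖) : sinAvg x = sinAvg y := by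
  let R : X ≃ₗᵢ[ℝ] X := (ℝ ∙ (x - y))ᗮ.reflection
  have hR : R x = y := Submodule.reflection_sub hxy
  have hpre : R ⁻¹' Metric.closedBall (0 : X) 1 = Metric.closedBall (0 : X) 1 := by
    ext z; simp
  have := R.measurePreserving.setIntegral_preimage_emb R.toMeasurableEquiv.measurableEmbedding
    (fun z => Real.sin (2 * Real.pi * |inner ℝ y z|)) (Metric.closedBall (0 : X) 1)
  rw [sinAvg, sinAvg, ← this, hpre]
  refine integral_congr_ae (Filter.Eventually.of_forall fun z => ?_)
  simp only [← hR, LinearIsometryEquiv.inner_map_map]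

lemma continuous_sinAvg : Continuous (sinAvg : X → ℝ) := by
  refine continuous_of_dominated (bound := fun _ => 1) (fun x => ?_) (fun x => ?_) ?_ ?_
  · exact Continuous.aestronglyMeasurable (by fun_prop)
  · exact Filter.Eventually.of_forall fun z => Real.abs_sin_le_one _
  · have : IsFiniteMeasure (volume.restrict (Metric.closedBall (0 : X) 1)) :=
      isFiniteMeasure_restrict.mpr (measure_closedBall_lt_top).ne
    exact integrable_const _
  · exact Filter.Eventually.of_forall fun z => by fun_prop

omit [FiniteDimensional ℝ X] [MeasurableSpace X] [BorelSpace X] in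
lemma sin_arg_nonneg {x z : X} (hx : ‖x‖ ≤ 1 / 2) (hz : z ∈ Metric.closedBall (0 : X) 1) :
    0 ≤ Real.sin (2 * Real.pi * |inner ℝ x z|) := by
  have hz' : ‖z‖ ≤ 1 := mem_closedBall_zero_iff.mp hz
  refine Real.sin_nonneg_of_nonneg_of_le_pi (by positivity) ?_
  have h1 : |inner ℝ x z| ≤ 1 / 2 := (abs_real_inner_le_norm x z).trans (by
    nlinarith [norm_nonneg x, norm_nonneg z])
  nlinarith [Real.pi_pos]

lemma sinAvg_nonneg {x : X} (hx : ‖x‖ ≤ 1 / 2) : 0 ≤ sinAvg x :=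
  setIntegral_nonneg measurableSet_closedBall fun _ hz => sin_arg_nonneg hx hz

lemma sinAvg_pos {x : X} (hx : ‖x‖ = 3 / 8) : 0 < sinAvg x := by
  have hf : IsFiniteMeasure (volume.restrict (Metric.closedBall (0 : X) 1)) :=
    isFiniteMeasure_restrict.mpr (measure_closedBall_lt_top).ne
  have hc : Continuous fun z : X => Real.sin (2 * Real.pi * |inner ℝ x z|) := by fun_prop
  rw [sinAvg, setIntegral_pos_iff_support_of_nonneg_ae]
  · let U := {z : X | 0 < Real.sin (2 * Real.pi * |inner ℝ x z|)} ∩ Metric.ball 0 1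
    have hU : IsOpen U := (isOpen_lt continuous_const hc).inter Metric.isOpen_ball
    have hne : U.Nonempty := by
      refine ⟨x, ?_, by rw [mem_ball_zero_iff, hx]; norm_num⟩
      rw [Set.mem_ofPred_eq, real_inner_self_eq_norm_sq, hx]
      refine Real.sin_pos_of_pos_of_lt_pi (by positivity) ?_
      rw [abs_of_pos (by norm_num)]
      nlinarith [Real.pi_pos]
    refine (hU.measure_pos volume hne).trans_le (measure_mono ?_)
    rintro z ⟨h1, h2⟩
    exact ⟨ne_of_gt h1, Metric.ball_subset_closedBall h2⟩
  · exact (ae_restrict_iff' measurableSet_closedBall).mpr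
      (Filter.Eventually.of_forall fun z hz => sin_arg_nonneg (by rw [hx]; norm_num) hz)
  · exact Integrable.of_bound hc.aestronglyMeasurable 1
      (Filter.Eventually.of_forall fun z => Real.abs_sin_le_one _)

end Rep

section OddRep

variable {X : Type*} [NormedAddCommGroup X] [InnerProductSpace ℝ X] [FiniteDimensional ℝ X]
  [MeasurableSpace X] [BorelSpace X]

/-- Lebesgue measure on `X × X`, with the second variable restricted to the unit ball. -/
def nuBall (X : Type*) [NormedAddCommGroup X] [InnerProductSpace ℝ X] [FiniteDimensional ℝ X]
    [MeasurableSpace X] [BorelSpace X] : Measure (X × X) :=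
  (volume : Measure X).prod (volume.restrict (Metric.closedBall (0 : X) 1))

instance : IsFiniteMeasure ((volume : Measure X).restrict (Metric.closedBall (0 : X) 1)) :=
  isFiniteMeasure_restrict.mpr (measure_closedBall_lt_top).ne

instance : SigmaFinite (nuBall X) := by unfold nuBall; infer_instance

lemma ae_nuBall : ∀ᵐ p ∂(nuBall X), ‖p.2‖ ≤ 1 := by
  have h : ∀ᵐ z ∂((volume : Measure X).restrict (Metric.closedBall (0 : X) 1)), ‖z‖ ≤ 1 :=
    (ae_restrict_iff' measurableSet_closedBall).mpr
      (Filter.Eventually.of_forall fun z hz => mem_closedBall_zero_iff.mp hz)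
  exact Measure.quasiMeasurePreserving_snd.ae h

lemma Weight.integrable_prod {w : X → ℝ} (hw : Weight w) (k : ℕ) :
    Integrable (fun p : X × X => ‖p.1‖ ^ k * w p.1) (nuBall X) := by
  unfold nuBall
  simpa using (hw.int k).mul_prod (integrable_const (1 : ℝ)
    (μ := (volume : Measure X).restrict (Metric.closedBall (0 : X) 1)))

lemma Weight.integrable_sq {w : X → ℝ} (hw : Weight w) (x : X) (s : X × X → ℝ) (hs : Measurable s)
    (hb : ∀ p, |s p| ≤ 2 * Real.pi * ((‖p.1‖ + ‖p.2‖) * ‖x‖)) :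
    Integrable (fun p : X × X => w p.1 * s p ^ 2) (nuBall X) := by
  have hi : Integrable (fun p : X × X => (2 * Real.pi * ‖x‖) ^ 2 * (2 * (‖p.1‖ ^ 2 * w p.1) +
      2 * (‖p.1‖ ^ 0 * w p.1))) (nuBall X) :=
    (((hw.integrable_prod 2).const_mul 2).add ((hw.integrable_prod 0).const_mul 2)).const_mul _
  have := hw.cont.measurable
  refine hi.mono (Measurable.aestronglyMeasurable (by fun_prop)) ?_
  filter_upwards [ae_nuBall] with p hp
  have e1 : ‖w p.1 * s p ^ 2‖ = |w p.1| * |s p| ^ 2 := by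
    rw [norm_mul, Real.norm_eq_abs, Real.norm_of_nonneg (sq_nonneg _), sq_abs]
  have e2 : ‖(2 * Real.pi * ‖x‖) ^ 2 * (2 * (‖p.1‖ ^ 2 * w p.1) + 2 * (‖p.1‖ ^ 0 * w p.1))‖ =
      |w p.1| * ((2 * Real.pi * ‖x‖) ^ 2 * (2 * (‖p.1‖ ^ 2 + 1))) := by
    rw [pow_zero, one_mul, ← mul_add, ← add_one_mul, norm_mul, norm_mul, norm_mul,
      Real.norm_of_nonneg (by positivity), Real.norm_of_nonneg (by positivity),
      Real.norm_of_nonneg (by positivity), Real.norm_eq_abs]; ring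
  rw [e1, e2]
  refine mul_le_mul_of_nonneg_left ?_ (abs_nonneg _)
  have h1 : |s p| ≤ 2 * Real.pi * ‖x‖ * (‖p.1‖ + 1) := (hb p).trans (by
    have : 0 ≤ 2 * Real.pi * ‖x‖ := by positivity
    nlinarith)
  calc |s p| ^ 2 ≤ (2 * Real.pi * ‖x‖ * (‖p.1‖ + 1)) ^ 2 := by gcongr
    _ = (2 * Real.pi * ‖x‖) ^ 2 * (‖p.1‖ + 1) ^ 2 := by ring
    _ ≤ _ := by
      gcongr
      nlinarith [sq_nonneg (‖p.1‖ - 1)]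

/-- An odd smooth function is a combination of the functions
`| ⟨x,y⟩ + |⟨x,z⟩| | - | ⟨x,y⟩ - |⟨x,z⟩| |`, which are differences of triangle functions. -/
theorem odd_rep {h : X → ℝ} (hh : ∀ x (t : ℝ), 0 < t → h (t • x) = t * h x)
    (ho : ∀ x, h (-x) = -h x) (hs : ∀ x ≠ 0, ContDiffAt ℝ (⊤ : ℕ∞) h x) :
    ∃ w : X → ℝ, Weight w ∧ ∀ x, h x = ∫ p : X × X, w p.1 *
      (|inner ℝ x p.1 + abs (inner ℝ x p.2)| - |inner ℝ x p.1 - abs (inner ℝ x p.2)|)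
        ∂(nuBall X) := by
  obtain ⟨w, hw, hH⟩ := exists_sin (contDiff_bump_mul hs) (hasCompactSupport_bump_mul h)
    (fun x => by rw [norm_neg, ho]; ring)
  have h0 : h 0 = 0 := by
    have := ho 0
    rw [neg_zero] at this; linarith
  by_cases hX : ∀ x : X, x = 0
  · exact ⟨w, hw, fun x => by rw [hX x, h0]; simp⟩
  push Not at hX
  obtain ⟨e₀, he₀⟩ := hX
  obtain ⟨e, he⟩ : ∃ e : X, ‖e‖ = 1 := ⟨‖e₀‖⁻¹ • e₀, by
    rw [norm_smul, norm_inv, norm_norm, inv_mul_cancel₀ (norm_ne_zero_iff.mpr he₀)]⟩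
  have hc := integral_bump_pos (g := fun r => sinAvg (r • e))
    (continuous_sinAvg.comp (by fun_prop)) (fun r h1 h2 => sinAvg_nonneg (by
      rw [norm_smul, he, mul_one, Real.norm_of_nonneg (by linarith)]; exact h2))
    (sinAvg_pos (by rw [norm_smul, he, mul_one]; norm_num))
  set c := ∫ r in Set.Ioi (0 : ℝ), bump r * sinAvg (r • e) / r with hcdef
  have hWi : Integrable (fun p : X × X => w p.1) (nuBall X) := by
    simpa using hw.integrable_prod 0
  have key : ∀ x, x ≠ 0 → h x * c = 2⁻¹ *
      (cosC * ∫ p : X × X, w p.1 * |2 * Real.pi * (inner ℝ x p.1 + |inner ℝ x p.2|)| ∂(nuBall X)) -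
      2⁻¹ * (cosC * ∫ p : X × X, w p.1 *
        |2 * Real.pi * (inner ℝ x p.1 - |inner ℝ x p.2|)| ∂(nuBall X)) := by
    intro x hx
    have hb1 : ∀ p : X × X, |2 * Real.pi * (inner ℝ x p.1 + |inner ℝ x p.2|)| ≤
        2 * Real.pi * ((‖p.1‖ + ‖p.2‖) * ‖x‖) := fun p => by
      rw [abs_mul, abs_of_pos Real.two_pi_pos]
      have h1 := abs_real_inner_le_norm x p.1
      have h2 := abs_real_inner_le_norm x p.2
      refine mul_le_mul_of_nonneg_left ?_ Real.two_pi_pos.le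
      refine (abs_add_le _ _).trans ?_
      rw [abs_abs]; linarith
    have hb2 : ∀ p : X × X, |2 * Real.pi * (inner ℝ x p.1 - |inner ℝ x p.2|)| ≤
        2 * Real.pi * ((‖p.1‖ + ‖p.2‖) * ‖x‖) := fun p => by
      rw [abs_mul, abs_of_pos Real.two_pi_pos]
      have h1 := abs_real_inner_le_norm x p.1
      have h2 := abs_real_inner_le_norm x p.2
      refine mul_le_mul_of_nonneg_left ?_ Real.two_pi_pos.le
      refine (abs_sub _ _).trans ?_
      rw [abs_abs]; linarith
    have hm1 : Measurable fun p : X × X => 2 * Real.pi * (inner ℝ x p.1 + |inner ℝ x p.2|) :=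
      Continuous.measurable (by fun_prop)
    have hm2 : Measurable fun p : X × X => 2 * Real.pi * (inner ℝ x p.1 - |inner ℝ x p.2|) :=
      Continuous.measurable (by fun_prop)
    obtain ⟨i1, t1⟩ := integral_one_sub_cos_weight (nuBall X) (fun p => w p.1) _ hWi hm1
      (hw.integrable_sq x _ hm1 hb1)
    obtain ⟨i2, t2⟩ := integral_one_sub_cos_weight (nuBall X) (fun p => w p.1) _ hWi hm2
      (hw.integrable_sq x _ hm2 hb2)
    rw [← t1, ← t2, hcdef, ← integral_bump_comp (fun r => bump r * sinAvg (r • e))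
      (norm_pos_iff.mpr hx), ← integral_const_mul, ← integral_const_mul, ← integral_const_mul,
      ← integral_sub (i1.const_mul _) (i2.const_mul _)]
    refine setIntegral_congr_fun measurableSet_Ioi fun r (hr : 0 < r) => ?_
    have hS : sinAvg ((‖x‖ * r) • e) = sinAvg (r • x) := sinAvg_eq (by
      rw [norm_smul, norm_smul, he, mul_one, Real.norm_of_nonneg (by positivity),
        Real.norm_of_nonneg hr.le, mul_comm])
    have e1 : h x * (bump (‖x‖ * r) * sinAvg ((‖x‖ * r) • e) / r) =
        (bump ‖r • x‖ * h (r • x)) * sinAvg (r • x) / r ^ 2 := by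
      rw [hS, mul_div_right_comm _ (sinAvg _) (r ^ 2), bump_mul_smul hh x hr]; ring
    have e2 : (bump ‖r • x‖ * h (r • x)) * sinAvg (r • x) = ∫ p : X × X,
        (2⁻¹ * (w p.1 * (1 - Real.cos (r * (2 * Real.pi * (inner ℝ x p.1 + |inner ℝ x p.2|))))) -
        2⁻¹ * (w p.1 * (1 - Real.cos (r * (2 * Real.pi * (inner ℝ x p.1 - |inner ℝ x p.2|))))))
        ∂(nuBall X) := by
      rw [hH, sinAvg, nuBall, ← integral_prod_mul]
      refine integral_congr_ae (Filter.Eventually.of_forall fun p => ?_)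
      have e3 : |inner ℝ (r • x) p.2| = r * |inner ℝ x p.2| := by
        rw [inner_smul_left, abs_mul]; simp [abs_of_pos hr]
      have e4 : inner ℝ p.1 (r • x) = r * inner ℝ x p.1 := by
        rw [inner_smul_right, real_inner_comm]
      simp only [e3, e4, mul_add, mul_sub, Real.cos_add, Real.cos_sub]
      ring_nf
    have hcos : ∀ s : X × X → ℝ, Measurable s →
        Integrable (fun p => w p.1 * (1 - Real.cos (r * s p))) (nuBall X) := fun s hs => by
      have := hw.cont.measurable
      refine (hWi.const_mul 2).mono (Measurable.aestronglyMeasurable (by fun_prop))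
        (Filter.Eventually.of_forall fun p => ?_)
      rw [norm_mul, norm_mul, mul_comm, Real.norm_of_nonneg zero_le_two]
      refine mul_le_mul_of_nonneg_right ?_ (norm_nonneg _)
      rw [Real.norm_of_nonneg (by linarith [Real.cos_le_one (r * s p)])]
      linarith [Real.neg_one_le_cos (r * s p)]
    rw [e1, e2, integral_sub ((hcos _ hm1).const_mul _) ((hcos _ hm2).const_mul _),
      integral_const_mul, integral_const_mul]
    ring
  refine ⟨fun y => cosC * Real.pi / c * w y, ⟨continuous_const.mul hw.cont, fun k => ?_⟩,
    fun x => ?_⟩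
  · refine ((hw.int k).const_mul (cosC * Real.pi / c)).congr
      (Filter.Eventually.of_forall fun y => by ring)
  · rcases eq_or_ne x 0 with rfl | hx
    · simp [h0]
    · have hk := key x hx
      have hint : ∀ s : X × X → ℝ, Measurable s →
          (∀ p, |s p| ≤ (‖p.1‖ + ‖p.2‖) * ‖x‖) →
          Integrable (fun p => w p.1 * |s p|) (nuBall X) := fun s hs hb => by
        have := hw.cont.measurable
        have hi : Integrable (fun p : X × X => ‖x‖ * (‖p.1‖ ^ 1 * w p.1 + ‖p.1‖ ^ 0 * w p.1))
          (nuBall X) := ((hw.integrable_prod 1).add (hw.integrable_prod 0)).const_mul _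
        refine hi.mono (Measurable.aestronglyMeasurable (by fun_prop)) ?_
        filter_upwards [ae_nuBall] with p hp
        have e1 : ‖‖x‖ * (‖p.1‖ ^ 1 * w p.1 + ‖p.1‖ ^ 0 * w p.1)‖ =
            |w p.1| * ((‖p.1‖ + 1) * ‖x‖) := by
          rw [pow_zero, pow_one, ← add_mul, norm_mul, norm_mul,
            Real.norm_of_nonneg (by positivity), Real.norm_of_nonneg (by positivity),
            Real.norm_eq_abs]; ring
        rw [norm_mul, e1, Real.norm_eq_abs, Real.norm_eq_abs, abs_abs]
        refine mul_le_mul_of_nonneg_left ((hb p).trans ?_) (abs_nonneg _)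
        gcongr
      have j1 := hint (fun p => inner ℝ x p.1 + |inner ℝ x p.2|)
        (Continuous.measurable (by fun_prop)) (fun p => by
          have h1 := abs_real_inner_le_norm x p.1
          have h2 := abs_real_inner_le_norm x p.2
          refine (abs_add_le _ _).trans ?_
          rw [abs_abs]; linarith)
      have j2 := hint (fun p => inner ℝ x p.1 - |inner ℝ x p.2|)
        (Continuous.measurable (by fun_prop)) (fun p => by
          have h1 := abs_real_inner_le_norm x p.1
          have h2 := abs_real_inner_le_norm x p.2
          refine (abs_sub _ _).trans ?_
          rw [abs_abs]; linarith)
      have e2 : ∀ p : X × X, cosC * Real.pi / c * w p.1 *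
          (|inner ℝ x p.1 + abs (inner ℝ x p.2)| - |inner ℝ x p.1 - abs (inner ℝ x p.2)|) =
          cosC * Real.pi / c * (w p.1 * |inner ℝ x p.1 + abs (inner ℝ x p.2)| -
            w p.1 * |inner ℝ x p.1 - abs (inner ℝ x p.2)|) := fun p => by ring
      have e3 : ∀ (y : X × X) (a : ℝ), w y.1 * |2 * Real.pi * a| = 2 * Real.pi * (w y.1 * |a|) :=
        fun y a => by rw [abs_mul, abs_of_pos Real.two_pi_pos]; ring
      simp only [e3, integral_const_mul] at hk
      simp only [e2, integral_const_mul]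
      rw [integral_sub j1 j2]
      field_simp
      linarith

end OddRep

section Smoothing

variable {X : Type*} [NormedAddCommGroup X] [InnerProductSpace ℝ X] [FiniteDimensional ℝ X]

omit [FiniteDimensional ℝ X] in
/-- The `ℓ^p` combination of finitely many sublinear functions. -/
lemma sublin_lp {ι : Type*} (s : Finset ι) {f : ι → X → ℝ} (hf : ∀ i ∈ s, Sublin (f i))
    (h0 : ∀ i ∈ s, ∀ x, 0 ≤ f i x) {p : ℝ} (hp : 1 ≤ p) :
    Sublin fun x => (∑ i ∈ s, f i x ^ p) ^ (1 / p) where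
  add_le x y := by
    have hp0 : 0 < p := by linarith
    refine le_trans ?_ (Real.Lp_add_le_of_nonneg (f := fun i => f i x) (g := fun i => f i y) s hp
      (fun i hi => h0 i hi x) (fun i hi => h0 i hi y))
    refine Real.rpow_le_rpow (Finset.sum_nonneg fun i hi => Real.rpow_nonneg (h0 i hi _) _) ?_
      (by positivity)
    exact Finset.sum_le_sum fun i hi => Real.rpow_le_rpow (h0 i hi _) ((hf i hi).add_le x y) hp0.le
  smul t ht x := by
    have hp0 : 0 < p := by linarith
    have e : ∑ i ∈ s, f i (t • x) ^ p = t ^ p * ∑ i ∈ s, f i x ^ p := by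
      rw [Finset.mul_sum]
      refine Finset.sum_congr rfl fun i hi => ?_
      rw [(hf i hi).smul t ht, Real.mul_rpow ht (h0 i hi x)]
    rw [e, Real.mul_rpow (Real.rpow_nonneg ht _)
      (Finset.sum_nonneg fun i hi => Real.rpow_nonneg (h0 i hi _) _), ← Real.rpow_mul ht,
      mul_one_div_cancel hp0.ne', Real.rpow_one]

/-- Up to adding a large ball, convex bodies can be approximated by smooth ones. -/
theorem exists_smooth {m : X → ℝ} (hm : Sublin m) : ∃ R₀ : ℝ, ∀ R, R₀ ≤ R → ∀ ε > 0,
    ∃ q : X → ℝ, Sublin q ∧ (∀ x ≠ 0, ContDiffAt ℝ (⊤ : ℕ∞) q x) ∧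
      ∀ x, |q x - (m x + R * ‖x‖)| ≤ ε * ‖x‖ := by
  obtain ⟨D, hD, hbd⟩ := hm.exists_bound
  refine ⟨D + 1, fun R hR ε hε => ?_⟩
  obtain ⟨t, hts, htf, hcov⟩ := hm.isCompact_wulff.finite_cover_balls (show 0 < ε by exact hε)
  lift t to Finset X using htf
  have hne : t.Nonempty := by
    by_contra h
    rw [Finset.not_nonempty_iff_eq_empty] at h
    subst h
    obtain ⟨z, hz⟩ := hm.wulff_nonempty
    simpa using hcov hz
  have hv : ∀ v ∈ t, ∀ x, inner ℝ x v ≤ m x := fun v hv x => hts hv x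
  have hv' : ∀ v ∈ t, ∀ x, -(D * ‖x‖) ≤ inner ℝ x v := fun v hv x => by
    have h1 := hts hv (-x)
    have h2 := (abs_le.mp (hbd (-x))).2
    rw [norm_neg] at h2
    rw [inner_neg_left] at h1; linarith
  have hpos : ∀ v ∈ t, ∀ x ≠ 0, 0 < inner ℝ x v + R * ‖x‖ := fun v hvt x hx => by
    have := hv' v hvt x
    have := norm_pos_iff.mpr hx
    nlinarith
  have hnn : ∀ v ∈ t, ∀ x, 0 ≤ inner ℝ x v + R * ‖x‖ := fun v hvt x => by
    have := hv' v hvt x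
    have := norm_nonneg x
    nlinarith
  have hR0 : 0 < D + R := by linarith
  set δ := ε / (D + R) with hδ
  have hδ0 : 0 < δ := by positivity
  obtain ⟨n, hn⟩ := pow_unbounded_of_one_lt (t.card : ℝ) (show 1 < 1 + δ by linarith)
  have hp1 : (1 : ℝ) ≤ ((n + 1 : ℕ) : ℝ) := by simp
  set p : ℝ := ((n + 1 : ℕ) : ℝ) with hpdef
  have hp0 : 0 < p := by linarith
  have hN : (t.card : ℝ) ≤ (1 + δ) ^ p := by
    rw [hpdef, Real.rpow_natCast]
    exact hn.le.trans (pow_le_pow_right₀ (by linarith) (Nat.le_succ n))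
  refine ⟨fun x => (∑ v ∈ t, (inner ℝ x v + R * ‖x‖) ^ p) ^ (1 / p), sublin_lp t (fun v _ =>
    (Sublin.inner v).add (Sublin.norm.const_mul (by linarith))) hnn hp1, fun x hx => ?_,
    fun x => ?_⟩
  · have hs : ContDiffAt ℝ (⊤ : ℕ∞) (fun x : X => ∑ v ∈ t, (inner ℝ x v + R * ‖x‖) ^ p) x := by
      refine ContDiffAt.sum fun v hvt => ContDiffAt.rpow_const_of_ne ?_ (hpos v hvt x hx).ne'
      exact (contDiffAt_id.inner ℝ contDiffAt_const).add
        (contDiffAt_const.mul (contDiffAt_norm ℝ hx))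
    refine hs.rpow_const_of_ne (ne_of_gt ?_)
    exact Finset.sum_pos (fun v hvt => Real.rpow_pos_of_pos (hpos v hvt x hx) _) hne
  · have hsum0 : 0 ≤ ∑ v ∈ t, (inner ℝ x v + R * ‖x‖) ^ p :=
      Finset.sum_nonneg fun v hvt => Real.rpow_nonneg (hnn v hvt x) _
    have hm0 : 0 ≤ m x + R * ‖x‖ := by
      obtain ⟨v, hvt⟩ := hne
      linarith [hnn v hvt x, hv v hvt x]
    have hup : (∑ v ∈ t, (inner ℝ x v + R * ‖x‖) ^ p) ^ (1 / p) ≤ (1 + δ) * (m x + R * ‖x‖) := by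
      rw [one_div, Real.rpow_inv_le_iff_of_pos hsum0 (by positivity) hp0,
        Real.mul_rpow (by positivity) hm0]
      calc _ ≤ ∑ v ∈ t, (m x + R * ‖x‖) ^ p := Finset.sum_le_sum fun v hvt =>
            Real.rpow_le_rpow (hnn v hvt x) (by linarith [hv v hvt x]) hp0.le
        _ = t.card * (m x + R * ‖x‖) ^ p := by rw [Finset.sum_const, nsmul_eq_mul]
        _ ≤ _ := by gcongr
    have hlow : ∀ v ∈ t, inner ℝ x v + R * ‖x‖ ≤
        (∑ v ∈ t, (inner ℝ x v + R * ‖x‖) ^ p) ^ (1 / p) := fun v hvt => by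
      rw [one_div, Real.le_rpow_inv_iff_of_pos (hnn v hvt x) hsum0 hp0]
      exact Finset.single_le_sum (f := fun v => (inner ℝ x v + R * ‖x‖) ^ p)
        (fun v hvt => Real.rpow_nonneg (hnn v hvt x) _) hvt
    obtain ⟨z, hz, hzx⟩ := hm.exists_eq x
    obtain ⟨v, hvt, hzv⟩ := Set.mem_iUnion₂.mp (hcov hz)
    have h1 := hlow v hvt
    have h2 : inner ℝ x z - inner ℝ x v ≤ ε * ‖x‖ := by
      rw [← inner_sub_right]
      have := real_inner_le_norm x (z - v)
      rw [Metric.mem_ball, dist_eq_norm] at hzv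
      nlinarith [norm_nonneg x]
    rw [abs_le]
    constructor
    · linarith
    · have h3 : δ * (m x + R * ‖x‖) ≤ ε * ‖x‖ := by
        have h4 : m x + R * ‖x‖ ≤ (D + R) * ‖x‖ := by linarith [(abs_le.mp (hbd x)).2]
        calc _ ≤ δ * ((D + R) * ‖x‖) := by gcongr
          _ = _ := by rw [hδ]; field_simp
      linarith

end Smoothing

section EvenInv

variable {X : Type*} [NormedAddCommGroup X] [InnerProductSpace ℝ X] [FiniteDimensional ℝ X]

lemma ClosedCone.weight_mem {C : (X → ℝ) → Prop} (hC : ClosedCone C) {Y : Type*}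
    [TopologicalSpace Y] [SecondCountableTopology Y] [MeasurableSpace Y] [BorelSpace Y]
    (ν : Measure Y) (τ : Y → X → ℝ) (hτ : ∀ y, C (τ y))
    (hcont : Continuous (Function.uncurry τ)) (b : Y → ℝ)
    (hbd : ∀ y x, |τ y x| ≤ b y * ‖x‖) (W : Y → ℝ) (hW : Measurable W) (hW0 : ∀ y, 0 ≤ W y)
    (hWi : Integrable W ν) (hWb : Integrable (fun y => W y * b y) ν) :
    C fun x => ∫ y, W y * τ y x ∂ν := by
  have hm : Measurable fun y => ENNReal.ofReal (W y) := hW.ennreal_ofReal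
  have hlt : ∀ᵐ y ∂ν, ENNReal.ofReal (W y) < ⊤ :=
    Filter.Eventually.of_forall fun y => ENNReal.ofReal_lt_top
  have : IsFiniteMeasure (ν.withDensity fun y => ENNReal.ofReal (W y)) :=
    isFiniteMeasure_withDensity_ofReal hWi.2
  have hb : Integrable b (ν.withDensity fun y => ENNReal.ofReal (W y)) := by
    rw [integrable_withDensity_iff_integrable_smul' hm hlt]
    simpa [ENNReal.toReal_ofReal (hW0 _)] using hWb
  have := hC.integral_mem _ τ hτ hcont b hb hbd
  simpa [integral_withDensity_eq_integral_toReal_smul hm hlt, ENNReal.toReal_ofReal (hW0 _)]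
    using this

/-- A signed integral of cone elements is a difference of cone elements. -/
lemma ClosedCone.signed_mem {C : (X → ℝ) → Prop} (hC : ClosedCone C) {Y : Type*}
    [TopologicalSpace Y] [SecondCountableTopology Y] [MeasurableSpace Y] [BorelSpace Y]
    (ν : Measure Y) (τ : Y → X → ℝ) (hτ : ∀ y, C (τ y))
    (hcont : Continuous (Function.uncurry τ)) (b : Y → ℝ)
    (hbd : ∀ y x, |τ y x| ≤ b y * ‖x‖) (W : Y → ℝ) (hW : Measurable W)
    (hWi : Integrable W ν) (hWb : Integrable (fun y => W y * b y) ν) (hb : Measurable b)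
    (hb0 : ∀ y, 0 ≤ b y) :
    ∃ A B, C A ∧ C B ∧ ∀ x, Integrable (fun y => W y * τ y x) ν ∧
      (∫ y, W y * τ y x ∂ν) + A x = B x := by
  have hbm : ∀ W' : Y → ℝ, Measurable W' → (∀ y, |W' y| ≤ |W y|) →
      Integrable (fun y => W' y * b y) ν := fun W' hW' hle => hWb.mono
        (hW'.mul hb).aestronglyMeasurable (Filter.Eventually.of_forall fun y => by
          rw [norm_mul, norm_mul]; exact mul_le_mul_of_nonneg_right (hle y) (norm_nonneg _))
  have hWm : ∀ W' : Y → ℝ, Measurable W' → (∀ y, |W' y| ≤ |W y|) → ∀ x,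
      Integrable (fun y => W' y * τ y x) ν := fun W' hW' hle x => by
    have hτm : Measurable fun y => τ y x := by
      have : Continuous fun y => τ y x := hcont.comp (by fun_prop : Continuous fun y : Y => (y, x))
      exact this.measurable
    refine (hWb.mul_const ‖x‖).mono (hW'.mul hτm).aestronglyMeasurable
      (Filter.Eventually.of_forall fun y => ?_)
    rw [norm_mul, mul_assoc, norm_mul (W y),
      Real.norm_of_nonneg (mul_nonneg (hb0 y) (norm_nonneg x))]
    exact mul_le_mul (hle y) (hbd y x) (norm_nonneg _) (abs_nonneg _)
  have hp : ∀ y, |max (W y) 0| ≤ |W y| := fun y => by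
    rw [abs_of_nonneg (le_max_right _ _)]; exact max_le (le_abs_self _) (abs_nonneg _)
  have hn : ∀ y, |max (-W y) 0| ≤ |W y| := fun y => by
    rw [abs_of_nonneg (le_max_right _ _)]; exact max_le (neg_le_abs _) (abs_nonneg _)
  have hpm : Measurable fun y => max (W y) 0 := hW.max measurable_const
  have hnm : Measurable fun y => max (-W y) 0 := hW.neg.max measurable_const
  refine ⟨_, _, hC.weight_mem ν τ hτ hcont b hbd _ hnm (fun y => le_max_right _ _)
    hWi.neg_part (hbm _ hnm hn),
    hC.weight_mem ν τ hτ hcont b hbd _ hpm (fun y => le_max_right _ _) hWi.pos_part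
      (hbm _ hpm hp), fun x => ⟨hWm W hW (fun _ => le_rfl) x, ?_⟩⟩
  rw [← integral_add (hWm W hW (fun _ => le_rfl) x) (hWm _ hnm hn x)]
  refine integral_congr_ae (Filter.Eventually.of_forall fun y => ?_)
  simp only
  rw [← add_mul]
  congr 1
  rcases le_total 0 (W y) with h | h
  · rw [max_eq_right (by linarith), max_eq_left h, add_zero]
  · rw [max_eq_left (by linarith), max_eq_right h]; ring

variable {Φ : Set X → ℝ}

/-- Cancellation: if `q + A = B` with `A`, `B` invariant then `q` is invariant. -/
lemma Inv.cancel {q A B : X → ℝ} (hq : Sublin q) (hA : Inv Φ A) (hB : Inv Φ B)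
    (e : ∀ x, q x + A x = B x) : Inv Φ q := by
  refine ⟨hq, fun a ha h hh => ?_⟩
  rw [← hA.2 a ha _ (hh.add (hq.const_mul ha)), ← hB.2 a ha h hh]
  congr 2
  ext x
  rw [← e x]; ring

variable [MeasurableSpace X] [BorelSpace X]

lemma SimpleVal.inv_even_smooth (hΦ : SimpleVal Φ) (hp : VanishPrism Φ) {q : X → ℝ}
    (hq : Sublin q) (he : ∀ x, q (-x) = q x) (hs : ∀ x ≠ 0, ContDiffAt ℝ (⊤ : ℕ∞) q x) :
    Inv Φ q := by
  obtain ⟨w, hw, hr⟩ := even_rep (fun x t ht => hq.smul t ht.le x) he hs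
  obtain ⟨A, B, hA, hB, hAB⟩ := hΦ.closedCone_inv.signed_mem volume
    (fun y x => |inner ℝ x y|) (hΦ.inv_abs_inner hp) (by
      unfold Function.uncurry; fun_prop) (fun y => ‖y‖)
    (fun y x => by rw [abs_abs, mul_comm]; exact abs_real_inner_le_norm x y) w hw.cont.measurable
    hw.integrable ((hw.int 1).congr (Filter.Eventually.of_forall fun y => by simp [mul_comm]))
    measurable_norm (fun y => norm_nonneg y)
  exact Inv.cancel hq hA hB fun x => by rw [hr x]; exact (hAB x).2

/-- Adding an origin-symmetric convex body does not change the valuation. -/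
theorem SimpleVal.inv_even (hΦ : SimpleVal Φ) (hp : VanishPrism Φ) {m : X → ℝ} (hm : Sublin m)
    (he : ∀ x, m (-x) = m x) : Inv Φ m := by
  have key : ∀ m : X → ℝ, Sublin m → (∀ x, m (-x) = m x) → ∃ R₀ : ℝ, ∀ R, R₀ ≤ R →
      Inv Φ fun x => m x + R * ‖x‖ := by
    intro m hm he
    obtain ⟨R₀, hR₀⟩ := exists_smooth hm
    refine ⟨R₀, fun R hR => hΦ.closedCone_inv.lim _ fun ε hε => ?_⟩
    obtain ⟨q, hq, hqs, hqa⟩ := hR₀ R hR ε hε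
    refine ⟨fun x => 2⁻¹ * (q x + q (-x)), hΦ.inv_even_smooth hp
      ((hq.add hq.neg_arg).const_mul (by norm_num)) (fun x => by rw [neg_neg, add_comm])
      (fun x hx => contDiffAt_const.mul ((hqs x hx).add
        ((hqs (-x) (neg_ne_zero.mpr hx)).comp x contDiffAt_id.neg))), fun x => ?_⟩
    have h1 := abs_le.mp (hqa x)
    have h2 := abs_le.mp (hqa (-x))
    rw [norm_neg, he] at h2
    rw [abs_le]
    constructor <;> linarith [h1.1, h1.2, h2.1, h2.2]
  obtain ⟨R₁, h1⟩ := key m hm he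
  obtain ⟨R₂, h2⟩ := key (fun _ => 0) Sublin.zero fun _ => rfl
  have i1 := h1 (max R₁ R₂) (le_max_left _ _)
  have i2 := h2 (max R₁ R₂) (le_max_right _ _)
  exact Inv.cancel hm i2 i1 fun x => by ring

end EvenInv

section DS

variable {X : Type*} [NormedAddCommGroup X] [InnerProductSpace ℝ X]

/-- Differences of sublinear functions. -/
def DS (f : X → ℝ) : Prop := ∃ A B : X → ℝ, Sublin A ∧ Sublin B ∧ ∀ x, f x = A x - B x

namespace DS

variable {f g : X → ℝ}

lemma of_sublin (h : Sublin f) : DS f := ⟨f, _, h, Sublin.zero, fun x => by simp⟩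

lemma zero : DS fun _ : X => (0 : ℝ) := of_sublin Sublin.zero

lemma add (hf : DS f) (hg : DS g) : DS fun x => f x + g x := by
  obtain ⟨A, B, hA, hB, h⟩ := hf
  obtain ⟨A', B', hA', hB', h'⟩ := hg
  exact ⟨_, _, hA.add hA', hB.add hB', fun x => by simp only [h, h']; ring⟩

lemma neg (hf : DS f) : DS fun x => -f x := by
  obtain ⟨A, B, hA, hB, h⟩ := hf
  exact ⟨_, _, hB, hA, fun x => by simp only [h]; ring⟩

lemma sub (hf : DS f) (hg : DS g) : DS fun x => f x - g x := by
  simpa [sub_eq_add_neg] using hf.add hg.neg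

lemma max (hf : DS f) (hg : DS g) : DS fun x => max (f x) (g x) := by
  obtain ⟨A, B, hA, hB, h⟩ := hf
  obtain ⟨A', B', hA', hB', h'⟩ := hg
  refine ⟨_, _, (hA.add hB').max (hA'.add hB), hB.add hB', fun x => ?_⟩
  simp only [h, h']
  rw [← max_sub_sub_right]
  congr 1 <;> ring

lemma min (hf : DS f) (hg : DS g) : DS fun x => min (f x) (g x) := by
  have := (hf.neg.max hg.neg).neg
  simpa [max_neg_neg] using this

lemma neg_arg (hf : DS f) : DS fun x => f (-x) := by
  obtain ⟨A, B, hA, hB, h⟩ := hf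
  exact ⟨_, _, hA.neg_arg, hB.neg_arg, fun x => h _⟩

lemma const_mul (hf : DS f) {a : ℝ} (ha : 0 ≤ a) : DS fun x => a * f x := by
  obtain ⟨A, B, hA, hB, h⟩ := hf
  exact ⟨_, _, hA.const_mul ha, hB.const_mul ha, fun x => by simp only [h]; ring⟩

lemma sum {ι : Type*} (s : Finset ι) {f : ι → X → ℝ} (hf : ∀ i ∈ s, DS (f i)) :
    DS fun x => ∑ i ∈ s, f i x := by
  classical
  induction s using Finset.induction_on with
  | empty => simpa using zero
  | insert i s hi ih =>
    simp only [Finset.sum_insert hi]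
    exact (hf i (Finset.mem_insert_self i s)).add
      (ih fun j hj => hf j (Finset.mem_insert_of_mem hj))

lemma zero_eq (hf : DS f) : f 0 = 0 := by
  obtain ⟨A, B, hA, hB, h⟩ := hf
  rw [h, hA.zero_eq, hB.zero_eq, sub_zero]

lemma exists_bound [FiniteDimensional ℝ X] (hf : DS f) : ∃ C, 0 < C ∧ ∀ x, f x ≤ C * ‖x‖ := by
  obtain ⟨A, B, hA, hB, h⟩ := hf
  obtain ⟨C, hC, h1⟩ := hA.exists_bound
  obtain ⟨C', hC', h2⟩ := hB.exists_bound
  refine ⟨C + C', by positivity, fun x => ?_⟩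
  rw [h]
  linarith [(abs_le.mp (h1 x)).2, (abs_le.mp (h2 x)).1]

end DS

/-- `M` is an even sublinear function making `f + M` the support function of a body. -/
structure Cov (f M : X → ℝ) : Prop where
  sub : Sublin M
  even : ∀ x, M (-x) = M x
  good : Good fun x => f x + M x

variable [FiniteDimensional ℝ X]

lemma Cov.add {f M M' : X → ℝ} (h : Cov f M) (hM' : Sublin M') (he : ∀ x, M' (-x) = M' x) :
    Cov f fun x => M x + M' x where
  sub := h.sub.add hM'
  even x := by rw [h.even, he]
  good := by simpa [add_assoc] using h.good.add hM'

lemma Cov.add' {f M M' : X → ℝ} (h : Cov f M) (hM' : Sublin M') (he : ∀ x, M' (-x) = M' x) :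
    Cov f fun x => M' x + M x := by simpa [add_comm] using h.add hM' he

lemma DS.exists_cov {f : X → ℝ} (hf : DS f) : ∃ M, Cov f M := by
  obtain ⟨A, B, hA, hB, h⟩ := hf
  refine ⟨fun x => B x + B (-x) + 1 * ‖x‖, (hB.add hB.neg_arg).add
    (Sublin.norm.const_mul zero_le_one), fun x => by rw [neg_neg, norm_neg]; ring, ?_⟩
  have := Good.add' (hA.add hB.neg_arg) (good_norm (X := X) one_pos)
  convert this using 2
  rw [h]; ring

open Classical in
/-- The valuation as a functional on differences of sublinear functions, modulo even functions. -/
def Psi (Φ : Set X → ℝ) (f : X → ℝ) : ℝ :=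
  if h : ∃ M, Cov f M then Φ (wulff fun x => f x + h.choose x) else 0

variable {Φ : Set X → ℝ} [MeasurableSpace X] [BorelSpace X]

section

variable (hΦ : SimpleVal Φ) (hp : VanishPrism Φ)
include hΦ hp

lemma psi_eq {f M : X → ℝ} (h : Cov f M) : Psi Φ f = Φ (wulff fun x => f x + M x) := by
  have hex : ∃ M, Cov f M := ⟨M, h⟩
  rw [Psi, dif_pos hex]
  have h' := hex.choose_spec
  set M' := hex.choose
  rw [← (hΦ.inv_even hp h.sub h.even).eq h'.good, ← (hΦ.inv_even hp h'.sub h'.even).eq h.good]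
  congr 2
  ext x; ring

lemma psi_of_good {f : X → ℝ} (h : Good f) : Psi Φ f = Φ (wulff f) := by
  rw [psi_eq hΦ hp (M := fun _ => 0) ⟨Sublin.zero, fun _ => rfl, by simpa using h⟩]
  simp

lemma psi_add_even_sublin {f E : X → ℝ} (hf : DS f) (hE : Sublin E) (he : ∀ x, E (-x) = E x) :
    Psi Φ (fun x => f x + E x) = Psi Φ f := by
  obtain ⟨M, hM⟩ := hf.exists_cov
  have h2 := hM.add' hE he
  rw [psi_eq hΦ hp h2, psi_eq hΦ hp (M := M) ⟨hM.sub, hM.even, by simpa [add_assoc] using h2.good⟩]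
  simp [add_assoc]

lemma psi_add_even {f E : X → ℝ} (hf : DS f) (hE : DS E) (he : ∀ x, E (-x) = E x) :
    Psi Φ (fun x => f x + E x) = Psi Φ f := by
  obtain ⟨A, B, hA, hB, h⟩ := hE
  have hB' : Sublin fun x => 2⁻¹ * (B x + B (-x)) := (hB.add hB.neg_arg).const_mul (by norm_num)
  have hA' : Sublin fun x => 2⁻¹ * (A x + A (-x)) := (hA.add hA.neg_arg).const_mul (by norm_num)
  rw [← psi_add_even_sublin hΦ hp (hf.add ⟨A, B, hA, hB, h⟩) hB'
      (fun x => by rw [neg_neg, add_comm]),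
    ← psi_add_even_sublin hΦ hp hf hA' (fun x => by rw [neg_neg, add_comm])]
  congr 1
  ext x
  have h1 := h x
  have h2 := h (-x)
  rw [he] at h2
  linarith

lemma psi_add_inner {f : X → ℝ} (hf : DS f) (v : X) :
    Psi Φ (fun x => f x + inner ℝ x v) = Psi Φ f := by
  obtain ⟨M, hM⟩ := hf.exists_cov
  rw [psi_eq hΦ hp hM, ← (hΦ.inv_inner v).eq hM.good, psi_eq hΦ hp (M := M)
    ⟨hM.sub, hM.even, by simpa [add_right_comm] using hM.good.add (Sublin.inner v)⟩]
  simp [add_right_comm]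

lemma psi_min_add_max {f g : X → ℝ} (hf : DS f) (hg : DS g) :
    Psi Φ (fun x => min (f x) (g x)) + Psi Φ (fun x => max (f x) (g x)) = Psi Φ f + Psi Φ g := by
  obtain ⟨M₁, h1⟩ := hf.exists_cov
  obtain ⟨M₂, h2⟩ := hg.exists_cov
  obtain ⟨M₃, h3⟩ := (hf.min hg).exists_cov
  obtain ⟨M₄, h4⟩ := (hf.max hg).exists_cov
  have c1 := ((h1.add h2.sub h2.even).add h3.sub h3.even).add h4.sub h4.even
  have c2 := ((h2.add' h1.sub h1.even).add h3.sub h3.even).add h4.sub h4.even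
  have c3 := (h3.add' (h1.sub.add h2.sub) (fun x => by rw [h1.even, h2.even])).add h4.sub h4.even
  have c4 := h4.add' ((h1.sub.add h2.sub).add h3.sub)
    (fun x => by rw [h1.even, h2.even, h3.even])
  rw [psi_eq hΦ hp c1, psi_eq hΦ hp c2, psi_eq hΦ hp c3, psi_eq hΦ hp c4]
  have := hΦ.wulff_val c1.good.sub c2.good.sub (by simpa [min_add_add_right] using c3.good)
  simp only [min_add_add_right, max_add_add_right] at this
  linarith

end

end DS

section Additive

variable {X : Type*} [NormedAddCommGroup X] [InnerProductSpace ℝ X] [FiniteDimensional ℝ X]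
  [MeasurableSpace X] [BorelSpace X] {Φ : Set X → ℝ}

lemma psi_zero [Nontrivial X] (hΦ : SimpleVal Φ) (hp : VanishPrism Φ) :
    Psi Φ (fun _ => 0) = 0 := by
  obtain ⟨v, hv⟩ := exists_norm_eq X zero_le_one
  have hvv : inner ℝ v v = (1 : ℝ) := by rw [real_inner_self_eq_norm_sq, hv]; norm_num
  set L : Set X := Metric.closedBall 0 1 ∩ {x | inner ℝ v x = 0} with hL
  have hLc : IsCompact L := (isCompact_closedBall 0 1).inter_right
    (isClosed_eq (by fun_prop) continuous_const)
  have hLconv : Convex ℝ L := (convex_closedBall 0 1).inter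
    (convex_hyperplane ((innerSL ℝ v).toLinearMap.isLinear) 0)
  have h0L : (0 : X) ∈ L := ⟨Metric.mem_closedBall_self zero_le_one, inner_zero_right v⟩
  have hs := sublin_supp hLc ⟨0, h0L⟩
  have hseven : ∀ x, supp L (-x) = supp L x := by
    have key : ∀ x, supp L (-x) ≤ supp L x := fun x => supp_le ⟨0, h0L⟩ fun y hy => by
      rw [inner_neg_left, ← inner_neg_right]
      refine inner_le_supp hLc ⟨?_, ?_⟩ x
      · simpa using hy.1
      · have : inner ℝ v y = (0 : ℝ) := hy.2
        simp [this]
    intro x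
    refine le_antisymm (key x) ?_
    simpa using key (-x)
  have hm : Sublin fun x : X => max 0 (inner ℝ x v) := Sublin.zero.max (Sublin.inner v)
  have hw : wulff (fun x => supp L x + max 0 (inner ℝ x v)) = sweep L v := by
    rw [hs.wulff_add hm, wulff_supp hLc hLconv ⟨0, h0L⟩, wulff_max_zero_inner, sweep_eq_add]
  have hgood : Good fun x => supp L x + max 0 (inner ℝ x v) := by
    refine ⟨hs.add hm, ?_⟩
    rw [hw]
    refine ⟨(1 / 2 : ℝ) • v, interior_mono ?_ (by
      rw [Metric.isOpen_ball.interior_eq]; exact Metric.mem_ball_self (ε := 1 / 2) (by norm_num))⟩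
    intro x hx
    rw [mem_ball_iff_norm] at hx
    have e : inner ℝ v x = inner ℝ v (x - (1 / 2 : ℝ) • v) + 1 / 2 := by
      rw [inner_sub_right, inner_smul_right, hvv]; ring
    have hi := abs_real_inner_le_norm v (x - (1 / 2 : ℝ) • v)
    rw [hv, one_mul] at hi
    have hi' := abs_le.mp hi
    refine mem_sweep.mpr ⟨x - (inner ℝ v x : ℝ) • v, ⟨?_, ?_⟩, inner ℝ v x, by linarith,
      by linarith, by simp⟩
    · rw [mem_closedBall_zero_iff]
      have : x - (inner ℝ v x : ℝ) • v
          = (x - (1 / 2 : ℝ) • v) - (inner ℝ v (x - (1 / 2 : ℝ) • v) : ℝ) • v := by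
        rw [e]; module
      rw [this]
      refine (norm_sub_le _ _).trans ?_
      rw [norm_smul, hv, mul_one, Real.norm_eq_abs]
      linarith
    · change inner ℝ v _ = (0 : ℝ)
      rw [inner_sub_right, inner_smul_right, hvv, mul_one, sub_self]
  have h1 := psi_of_good hΦ hp hgood
  rw [hw] at h1
  have h2 : Φ (sweep L v) = 0 := by
    have := hp (innerSL ℝ v) v L hvv hLconv hLc (fun x hx => hx.2) 1 one_pos
    rwa [one_smul] at this
  have h3 := psi_add_even hΦ hp (f := fun x : X => 0 + inner ℝ x ((1 / 2 : ℝ) • v))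
    (E := fun x => supp L x + (1 / 2) * |inner ℝ x v|)
    (DS.zero.add (.of_sublin (Sublin.inner _)))
    ((DS.of_sublin hs).add (.of_sublin ((Sublin.abs_inner v).const_mul (by norm_num))))
    (fun x => by rw [hseven, inner_neg_left, abs_neg])
  rw [psi_add_inner hΦ hp DS.zero] at h3
  refine h3.symm.trans (Eq.trans ?_ (h1.trans h2))
  congr 1
  ext x
  rw [inner_smul_right]
  rcases le_total 0 (inner ℝ x v : ℝ) with h | h
  · rw [max_eq_right h, abs_of_nonneg h]; ring
  · rw [max_eq_left h, abs_of_nonpos h]; ring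

/-- Nonnegative functions living on an open half space. -/
def Loc (b : X → ℝ) : Prop :=
  DS b ∧ (∀ x, 0 ≤ b x) ∧ ∃ u : X, ∃ δ > 0, ∀ x, inner ℝ u x < δ * ‖x‖ → b x = 0

omit [FiniteDimensional ℝ X] [MeasurableSpace X] [BorelSpace X] in
lemma Loc.mono {b c : X → ℝ} (hc : Loc c) (hb : DS b) (h0 : ∀ x, 0 ≤ b x) (h : ∀ x, b x ≤ c x) :
    Loc b := by
  obtain ⟨_, _, u, δ, hδ, hu⟩ := hc
  exact ⟨hb, h0, u, δ, hδ, fun x hx => le_antisymm (hu x hx ▸ h x) (h0 x)⟩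

omit [FiniteDimensional ℝ X] [MeasurableSpace X] [BorelSpace X] in
lemma loc_cap (u : X) {N : ℝ} (hN : 0 ≤ N) :
    Loc fun x => N * max 0 (inner ℝ x u - (1 / 2) * ‖x‖) := by
  refine ⟨(DS.zero.max ((DS.of_sublin (Sublin.inner u)).sub
    (.of_sublin (Sublin.norm.const_mul (by norm_num))))).const_mul hN,
    fun x => mul_nonneg hN (le_max_left _ _), u, 1 / 2, by norm_num, fun x hx => ?_⟩
  simp only
  rw [max_eq_left, mul_zero]
  rw [real_inner_comm]; linarith

/-- Functions on which `Psi` is additive. -/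
def Addi (Φ : Set X → ℝ) (f : X → ℝ) : Prop :=
  DS f ∧ ∀ k, DS k → Psi Φ (fun x => k x + f x) = Psi Φ k + Psi Φ f

section

variable (hΦ : SimpleVal Φ) (hp : VanishPrism Φ)
include hΦ hp

lemma psi_disjoint {k b d : X → ℝ} (hk : DS k) (hb : DS b) (hd : DS d)
    (h : ∀ x, min (b x) (d x) = 0) :
    Psi Φ (fun x => k x + d x + b x) + Psi Φ k =
      Psi Φ (fun x => k x + b x) + Psi Φ (fun x => k x + d x) := by
  rw [← psi_min_add_max hΦ hp (hk.add hb) (hk.add hd), add_comm]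
  simp only [min_add_add_left, max_add_add_left, h, add_zero]
  congr 2
  ext x
  have := min_add_max (b x) (d x)
  rw [h] at this
  linarith

lemma psi_local_neg {k b : X → ℝ} (hk : DS k) (hb : Loc b) :
    2 * Psi Φ k = Psi Φ (fun x => k x + b x) + Psi Φ (fun x => k x + b (-x)) := by
  obtain ⟨hd, h0, u, δ, hδ, hu⟩ := hb
  rw [← psi_disjoint hΦ hp hk hd hd.neg_arg]
  · have := psi_add_even hΦ hp hk (E := fun x => b (-x) + b x) (hd.neg_arg.add hd)
      (fun x => by rw [neg_neg, add_comm])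
    simp only [add_assoc]
    rw [this]; ring
  · intro x
    rcases eq_or_ne x 0 with rfl | hx
    · simp [hd.zero_eq]
    by_cases h1 : inner ℝ u x < δ * ‖x‖
    · rw [hu x h1, min_eq_left (h0 _)]
    · rw [hu (-x), min_eq_right (h0 _)]
      rw [inner_neg_right, norm_neg]
      linarith [mul_pos hδ (norm_pos_iff.mpr hx)]

lemma psi_add_local_nonneg {k b d : X → ℝ} (hk : DS k) (hb : Loc b) (hd : DS d)
    (h0 : ∀ x, 0 ≤ d x) :
    Psi Φ (fun x => k x + d x + b x) - Psi Φ (fun x => k x + d x) =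
      Psi Φ (fun x => k x + b x) - Psi Φ k := by
  obtain ⟨C, hC, hCd⟩ := hd.exists_bound
  have hb' := hb
  obtain ⟨hbD, hb0, u, δ, hδ, hu⟩ := hb
  set d2 : X → ℝ := fun x => min (d x) (C / δ * max 0 (inner ℝ x u)) with hd2
  have hd2D : DS d2 :=
      hd.min ((DS.zero.max (.of_sublin (Sublin.inner u))).const_mul (by positivity))
  have hd1D : DS fun x => d x - d2 x := hd.sub hd2D
  have e1 := psi_disjoint hΦ hp (hk.add hd2D) hbD hd1D fun x => by
    by_cases h1 : inner ℝ u x < δ * ‖x‖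
    · rw [hu x h1, min_eq_left]
      linarith [min_le_left (d x) (C / δ * max 0 (inner ℝ x u))]
    · have : d2 x = d x := by
        apply min_eq_left
        rw [real_inner_comm] at h1
        calc d x ≤ C * ‖x‖ := hCd x
          _ = C / δ * (δ * ‖x‖) := by field_simp
          _ ≤ _ := by gcongr; exact (not_lt.mp h1).trans (le_max_right _ _)
      rw [this, sub_self, min_eq_right (hb0 x)]
  have e2 := psi_disjoint hΦ hp hk hbD.neg_arg hd2D fun x => by
    rcases eq_or_ne x 0 with rfl | hx
    · simp [hbD.zero_eq, hd2D.zero_eq]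
    by_cases h1 : inner ℝ u (-x) < δ * ‖x‖
    · rw [hu (-x) (by rwa [norm_neg]), min_eq_left]
      exact le_min (h0 x) (by positivity)
    · have : d2 x = 0 := by
        have : inner ℝ x u ≤ (0 : ℝ) := by
          rw [inner_neg_right] at h1
          rw [real_inner_comm]
          linarith [mul_pos hδ (norm_pos_iff.mpr hx)]
        simp only [hd2]
        rw [max_eq_left this, mul_zero, min_eq_right (h0 x)]
      rw [this, min_eq_right (hb0 _)]
  have e3 := psi_local_neg hΦ hp hk hb'
  have e4 := psi_local_neg hΦ hp (hk.add hd2D) hb'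
  have e5 : ∀ x, k x + d2 x + (d x - d2 x) = k x + d x := fun x => by ring
  simp only [e5] at e1
  linarith

lemma Loc.addi [Nontrivial X] {b : X → ℝ} (hb : Loc b) : Addi Φ b := by
  refine ⟨hb.1, fun k hk => ?_⟩
  have hm : DS fun x => max 0 (-k x) := DS.zero.max hk.neg
  have hM : DS fun x => max 0 (k x) := DS.zero.max hk
  have e1 := psi_add_local_nonneg hΦ hp hk hb hm fun x => le_max_left _ _
  have e2 := psi_add_local_nonneg hΦ hp DS.zero hb hM fun x => le_max_left _ _
  have e : ∀ x, k x + max 0 (-k x) = 0 + max 0 (k x) := fun x => by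
    rcases le_total 0 (k x) with h | h
    · rw [max_eq_left (by linarith), max_eq_right h]; ring
    · rw [max_eq_right (by linarith), max_eq_left h]; ring
  simp only [e] at e1
  simp only [zero_add, psi_zero hΦ hp] at e1 e2
  linarith

lemma addi_zero [Nontrivial X] : Addi Φ fun _ => 0 :=
  ⟨DS.zero, fun k _ => by simp [psi_zero hΦ hp]⟩

omit [FiniteDimensional ℝ X] [MeasurableSpace X] [BorelSpace X] hΦ hp in
lemma Addi.add {f g : X → ℝ} (hf : Addi Φ f) (hg : Addi Φ g) : Addi Φ fun x => f x + g x := by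
  refine ⟨hf.1.add hg.1, fun k hk => ?_⟩
  simp only [← add_assoc]
  rw [hg.2 _ (hk.add hf.1), hf.2 k hk, hg.2 f hf.1, add_assoc]

lemma Addi.neg [Nontrivial X] {f : X → ℝ} (hf : Addi Φ f) : Addi Φ fun x => -f x := by
  refine ⟨hf.1.neg, fun k hk => ?_⟩
  have h1 := hf.2 _ (hk.add hf.1.neg)
  have h2 := hf.2 _ hf.1.neg
  simp only [neg_add_cancel_right, neg_add_cancel, psi_zero hΦ hp] at h1 h2
  linarith

lemma addi_min_sum [Nontrivial X] {ι : Type*} (s : Finset ι) {c : ι → X → ℝ}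
    (hc : ∀ i ∈ s, Loc (c i)) {f : X → ℝ} (hf : DS f) (h0 : ∀ x, 0 ≤ f x) :
    Addi Φ fun x => min (f x) (∑ i ∈ s, c i x) := by
  classical
  induction s using Finset.induction_on with
  | empty => simpa [h0] using addi_zero hΦ hp
  | insert i s hi ih =>
    have hs : ∀ j ∈ s, Loc (c j) := fun j hj => hc j (Finset.mem_insert_of_mem hj)
    have hci := hc i (Finset.mem_insert_self i s)
    have hl : Loc fun x => min (max 0 (f x - ∑ j ∈ s, c j x)) (c i x) :=
      hci.mono ((DS.zero.max (hf.sub (DS.sum s fun j hj => (hs j hj).1))).min hci.1)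
        (fun x => le_min (le_max_left _ _) (hci.2.1 x)) fun x => min_le_right _ _
    have := (ih hs).add (hl.addi hΦ hp)
    convert this using 2 with x
    rw [Finset.sum_insert hi]
    have h1 := hci.2.1 x
    generalize ∑ j ∈ s, c j x = S
    generalize c i x = t at *
    generalize f x = r
    rcases le_total r S with h | h
    · rw [min_eq_left h, max_eq_left (by linarith), min_eq_left h1, min_eq_left (by linarith)]
      ring
    · rw [min_eq_right h, max_eq_right (by linarith), ← min_add_add_left]
      congr 1 <;> ring

lemma addi_nonneg [Nontrivial X] {f : X → ℝ} (hf : DS f) (h0 : ∀ x, 0 ≤ f x) : Addi Φ f := by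
  obtain ⟨C, hC, hCf⟩ := hf.exists_bound
  obtain ⟨s, -, hfin, hs⟩ := (isCompact_sphere (0 : X) 1).finite_cover_balls
    (e := 1 / 4) (by norm_num)
  have := addi_min_sum hΦ hp hfin.toFinset
    (c := fun u x => 4 * C * max 0 (inner ℝ x u - (1 / 2) * ‖x‖))
    (fun u _ => loc_cap u (by positivity)) hf h0
  convert this using 2 with x
  refine (min_eq_left ?_).symm
  have hnn : ∀ u ∈ hfin.toFinset, 0 ≤ 4 * C * max 0 (inner ℝ x u - (1 / 2) * ‖x‖) :=
    fun u _ => by positivity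
  rcases eq_or_ne x 0 with rfl | hx
  · rw [hf.zero_eq]; exact Finset.sum_nonneg hnn
  have hx' := norm_pos_iff.mpr hx
  have hmem : ‖x‖⁻¹ • x ∈ Metric.sphere (0 : X) 1 := by
    rw [mem_sphere_zero_iff_norm, norm_smul, norm_inv, norm_norm, inv_mul_cancel₀ hx'.ne']
  obtain ⟨u, hu, hux⟩ := Set.mem_iUnion₂.mp (hs hmem)
  refine le_trans ?_ (Finset.single_le_sum hnn (hfin.mem_toFinset.mpr hu))
  refine (hCf x).trans ?_
  rw [mem_ball_iff_norm] at hux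
  have e : inner ℝ x u = ‖x‖ * (1 : ℝ) - ‖x‖ * inner ℝ (‖x‖⁻¹ • x) (‖x‖⁻¹ • x - u) := by
    rw [inner_sub_right, inner_smul_left, inner_smul_left, inner_smul_right,
      real_inner_self_eq_norm_sq]
    simp only [RCLike.conj_to_real]
    field_simp
    ring
  have h2 := real_inner_le_norm (‖x‖⁻¹ • x) (‖x‖⁻¹ • x - u)
  rw [mem_sphere_zero_iff_norm.mp hmem, one_mul] at h2
  have h3 : ‖x‖ * inner ℝ (‖x‖⁻¹ • x) (‖x‖⁻¹ • x - u) ≤ ‖x‖ * (1 / 4) :=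
    mul_le_mul_of_nonneg_left (h2.trans hux.le) hx'.le
  calc C * ‖x‖ = 4 * C * (1 / 4 * ‖x‖) := by ring
    _ ≤ _ := by
      refine mul_le_mul_of_nonneg_left (le_trans ?_ (le_max_right _ _)) (by positivity)
      rw [e]; linarith

theorem addi [Nontrivial X] {f : X → ℝ} (hf : DS f) : Addi Φ f := by
  have h1 := addi_nonneg hΦ hp (DS.zero.max hf) fun x => le_max_left _ _
  have h2 := addi_nonneg hΦ hp (DS.zero.max hf.neg) fun x => le_max_left _ _
  convert h1.add (h2.neg hΦ hp) using 2 with x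
  rcases le_total 0 (f x) with h | h
  · rw [max_eq_left (by linarith : -f x ≤ 0), max_eq_right h]; ring
  · rw [max_eq_right (by linarith : 0 ≤ -f x), max_eq_left h]; ring

end

end Additive

section Triangles

variable {X : Type*} [NormedAddCommGroup X] [InnerProductSpace ℝ X]

/-- The support function of the triangle with vertices `0`, `a`, `b`. -/
def triSupp (a b x : X) : ℝ := max 0 (max (inner ℝ x a) (inner ℝ x b))

lemma sublin_triSupp (a b : X) : Sublin (triSupp a b) :=
  Sublin.zero.max ((Sublin.inner a).max (Sublin.inner b))

lemma abs_triSupp_le (a b x : X) : |triSupp a b x| ≤ (‖a‖ + ‖b‖) * ‖x‖ := by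
  have h1 := abs_le.mp (abs_real_inner_le_norm x a)
  have h2 := abs_le.mp (abs_real_inner_le_norm x b)
  have := norm_nonneg x
  have := norm_nonneg a
  have := norm_nonneg b
  rw [abs_of_nonneg (le_max_left _ _), triSupp]
  refine max_le (by positivity) (max_le ?_ ?_) <;> nlinarith

lemma abs_sub_abs_eq_max (s t : ℝ) :
    |s + abs (t)| - |s - abs (t)| = 2 * (2 * s + (max 0 (max (-s) (-t)) + max 0 (max (-s) t))) -
      2 * (max 0 (max s t) + max 0 (max s (-t))) := by
  wlog ht : 0 ≤ t generalizing t
  · have := this (-t) (by linarith)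
    rw [abs_neg, neg_neg] at this
    rw [this]; ring
  have e1 : max 0 (max (-s) (-t)) = max 0 (-s) := by
    rw [max_comm (-s), ← max_assoc, max_eq_left (by linarith : -t ≤ 0)]
  have e2 : max 0 (max s (-t)) = max 0 s := by
    rw [max_comm s, ← max_assoc, max_eq_left (by linarith : -t ≤ 0)]
  have e3 : max 0 (max (-s) t) = max (-s) t := max_eq_right (ht.trans (le_max_right _ _))
  have e4 : max 0 (max s t) = max s t := max_eq_right (ht.trans (le_max_right _ _))
  rw [abs_of_nonneg ht, e1, e2, e3, e4]
  rcases le_total 0 s with h | h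
  · rw [abs_of_nonneg (by linarith : 0 ≤ s + t), max_eq_left (by linarith : -s ≤ 0),
      max_eq_right (by linarith : -s ≤ t), max_eq_right h]
    rcases le_total s t with h' | h'
    · rw [abs_of_nonpos (by linarith), max_eq_right h']; ring
    · rw [abs_of_nonneg (by linarith), max_eq_left h']; ring
  · rw [abs_of_nonpos (by linarith : s - t ≤ 0), max_eq_right (by linarith : 0 ≤ -s),
      max_eq_right (by linarith : s ≤ t), max_eq_left h]
    rcases le_total (-s) t with h' | h'
    · rw [abs_of_nonneg (by linarith), max_eq_right h']; ring
    · rw [abs_of_nonpos (by linarith), max_eq_left h']; ring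

variable [FiniteDimensional ℝ X] [MeasurableSpace X] [BorelSpace X] {Φ : Set X → ℝ}

/-- Sublinear functions all of whose multiples are annihilated by `Psi`. -/
def PsiNull (Φ : Set X → ℝ) (l : X → ℝ) : Prop :=
  Sublin l ∧ ∀ a : ℝ, 0 ≤ a → Psi Φ (fun x => a * l x) = 0

variable [Nontrivial X] (hΦ : SimpleVal Φ) (hp : VanishPrism Φ)
include hΦ hp

lemma closedCone_psiNull : ClosedCone (PsiNull Φ) where
  sub _ h := h.1
  zero := ⟨Sublin.zero, fun a _ => by simpa using psi_zero hΦ hp⟩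
  add m m' h h' := ⟨h.1.add h'.1, fun a ha => by
    simp only [mul_add]
    rw [(addi hΦ hp (DS.of_sublin (h'.1.const_mul ha))).2 _ (.of_sublin (h.1.const_mul ha)),
      h.2 a ha, h'.2 a ha, add_zero]⟩
  smul m a h ha := ⟨h.1.const_mul ha, fun b hb => by
    simp only [← mul_assoc]
    exact h.2 _ (mul_nonneg hb ha)⟩
  lim m h := by
    have hm : Sublin m := Sublin.of_lim fun ε hε => by
      obtain ⟨m', h1, h2⟩ := h ε hε
      exact ⟨m', h1.1, h2⟩
    refine ⟨hm, fun a ha => ?_⟩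
    have hg : ∀ m : X → ℝ, Sublin m → Good fun x => a * m x + 1 * ‖x‖ := fun m hm =>
      Good.add' (hm.const_mul ha) (good_norm one_pos)
    have hcov : ∀ m : X → ℝ, Sublin m → Cov (fun x => a * m x) fun x => 1 * ‖x‖ := fun m hm =>
      ⟨Sublin.norm.const_mul zero_le_one, fun x => by rw [norm_neg], hg m hm⟩
    rw [psi_eq hΦ hp (hcov m hm), ← abs_nonpos_iff]
    refine le_of_forall_pos_le_add fun ε hε => ?_
    obtain ⟨δ, hδ, hδ'⟩ := hΦ.wulff_cont (hg m hm) hε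
    obtain ⟨m', h1, h2⟩ := h (δ / (a + 1)) (by positivity)
    have := hδ' _ (hg m' h1.1).sub fun x => by
      have e : a * m' x + 1 * ‖x‖ - (a * m x + 1 * ‖x‖) = a * (m' x - m x) := by ring
      rw [e, abs_mul, abs_of_nonneg ha]
      calc a * |m' x - m x| ≤ (a + 1) * (δ / (a + 1) * ‖x‖) := by
            have := h2 x
            gcongr
            linarith
        _ = δ * ‖x‖ := by field_simp
    rw [← psi_eq hΦ hp (hcov m' h1.1), h1.2 a ha, zero_sub, abs_neg] at this
    linarith

lemma psiNull_inner (v : X) : PsiNull Φ fun x => inner ℝ x v :=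
  ⟨Sublin.inner v, fun a ha => by
    have := psi_add_inner hΦ hp DS.zero (a • v)
    simpa [inner_smul_right, psi_zero hΦ hp] using this⟩

lemma psi_neg_arg {f : X → ℝ} (hf : DS f) : Psi Φ f + Psi Φ (fun x => f (-x)) = 0 := by
  rw [← (addi hΦ hp hf.neg_arg).2 f hf]
  have := psi_add_even hΦ hp DS.zero (hf.add hf.neg_arg) fun x => by rw [neg_neg, add_comm]
  rw [psi_zero hΦ hp] at this
  simpa using this

variable (hT : ∀ a b : X, Psi Φ (triSupp a b) = 0)
include hT

omit [FiniteDimensional ℝ X] [MeasurableSpace X] [BorelSpace X] [Nontrivial X] hΦ hp in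
lemma psiNull_triSupp (a b : X) : PsiNull Φ (triSupp a b) :=
  ⟨sublin_triSupp a b, fun c hc => by
    rw [← hT (c • a) (c • b)]
    congr 1
    ext x
    simp only [triSupp, inner_smul_right, mul_max_of_nonneg _ _ hc, mul_zero]⟩

lemma psi_smooth {q : X → ℝ} (hq : Sublin q) (hs : ∀ x ≠ 0, ContDiffAt ℝ (⊤ : ℕ∞) q x) :
    Psi Φ q = 0 := by
  have hZ := closedCone_psiNull hΦ hp
  obtain ⟨w, hw, hr⟩ := odd_rep (h := fun x => q x - q (-x))
    (fun x t ht => by rw [← smul_neg, hq.smul t ht.le, hq.smul t ht.le]; ring)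
    (fun x => by rw [neg_neg]; ring)
    (fun x hx => (hs x hx).sub ((hs (-x) (neg_ne_zero.mpr hx)).comp x contDiffAt_id.neg))
  have hwm := hw.cont.measurable
  have hWi : Integrable (fun p : X × X => w p.1) (nuBall X) := by
    simpa using hw.integrable_prod 0
  have hWb : Integrable (fun p : X × X => w p.1 * (8 * (‖p.1‖ + ‖p.2‖))) (nuBall X) := by
    have hi : Integrable (fun p : X × X => 8 * (‖p.1‖ ^ 1 * w p.1 + ‖p.1‖ ^ 0 * w p.1))
      (nuBall X) := ((hw.integrable_prod 1).add (hw.integrable_prod 0)).const_mul _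
    refine hi.mono (Measurable.aestronglyMeasurable (by fun_prop)) ?_
    filter_upwards [ae_nuBall] with p hp
    have e1 : ‖8 * (‖p.1‖ ^ 1 * w p.1 + ‖p.1‖ ^ 0 * w p.1)‖ = |w p.1| * (8 * (‖p.1‖ + 1)) := by
      rw [pow_zero, pow_one, ← add_mul, norm_mul, norm_mul,
        Real.norm_of_nonneg (by positivity), Real.norm_of_nonneg (by positivity),
        Real.norm_eq_abs]; ring
    rw [norm_mul, e1, Real.norm_eq_abs, Real.norm_of_nonneg (by positivity)]
    gcongr
  obtain ⟨A₁, B₁, hA₁, hB₁, h1⟩ := hZ.signed_mem (nuBall X)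
    (fun p x => 2 * (2 * inner ℝ x p.1 + (triSupp (-p.1) (-p.2) x + triSupp (-p.1) p.2 x)))
    (fun p => hZ.smul _ 2 (hZ.add _ _ (hZ.smul _ 2 (psiNull_inner hΦ hp _) (by norm_num))
      (hZ.add _ _ (psiNull_triSupp hT _ _) (psiNull_triSupp hT _ _))) (by norm_num))
    (by unfold Function.uncurry triSupp; fun_prop) (fun p => 8 * (‖p.1‖ + ‖p.2‖))
    (fun p x => by
      have i1 := abs_le.mp (abs_triSupp_le (-p.1) (-p.2) x)
      have i2 := abs_le.mp (abs_triSupp_le (-p.1) p.2 x)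
      have i3 := abs_le.mp (abs_real_inner_le_norm x p.1)
      simp only [norm_neg] at i1 i2
      have : 0 ≤ ‖p.2‖ * ‖x‖ := by positivity
      rw [abs_le]; constructor <;> linarith [i1.1, i1.2, i2.1, i2.2, i3.1, i3.2])
    (fun p => w p.1) (by fun_prop) hWi hWb (by fun_prop) (fun p => by positivity)
  obtain ⟨A₂, B₂, hA₂, hB₂, h2⟩ := hZ.signed_mem (nuBall X)
    (fun p x => 2 * (triSupp p.1 p.2 x + triSupp p.1 (-p.2) x))
    (fun p => hZ.smul _ 2
      (hZ.add _ _ (psiNull_triSupp hT _ _) (psiNull_triSupp hT _ _)) (by norm_num))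
    (by unfold Function.uncurry triSupp; fun_prop) (fun p => 8 * (‖p.1‖ + ‖p.2‖))
    (fun p x => by
      have i1 := abs_le.mp (abs_triSupp_le p.1 p.2 x)
      have i2 := abs_le.mp (abs_triSupp_le p.1 (-p.2) x)
      simp only [norm_neg] at i1 i2
      have : 0 ≤ ‖p.2‖ * ‖x‖ := by positivity
      have : 0 ≤ ‖p.1‖ * ‖x‖ := by positivity
      rw [abs_le]; constructor <;> linarith [i1.1, i1.2, i2.1, i2.2])
    (fun p => w p.1) (by fun_prop) hWi hWb (by fun_prop) (fun p => by positivity)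
  have e : ∀ x, q x + (A₁ x + B₂ x) = q (-x) + (B₁ x + A₂ x) := fun x => by
    have h3 := hr x
    have h4 : ∀ p : X × X, w p.1 *
        (|inner ℝ x p.1 + abs (inner ℝ x p.2)| - |inner ℝ x p.1 - abs (inner ℝ x p.2)|) =
        w p.1 * (2 * (2 * inner ℝ x p.1 + (triSupp (-p.1) (-p.2) x + triSupp (-p.1) p.2 x))) -
        w p.1 * (2 * (triSupp p.1 p.2 x + triSupp p.1 (-p.2) x)) := fun p => by
      rw [abs_sub_abs_eq_max]
      simp only [triSupp, inner_neg_right]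
      ring
    simp only [h4] at h3
    rw [integral_sub (h1 x).1 (h2 x).1] at h3
    linarith [(h1 x).2, (h2 x).2]
  have key : ∀ (f A : X → ℝ), DS f → PsiNull Φ A → Psi Φ (fun x => f x + A x) = Psi Φ f :=
    fun f A hf hA => by
      have := hA.2 1 zero_le_one
      simp only [one_mul] at this
      rw [(addi hΦ hp (DS.of_sublin hA.1)).2 f hf, this, add_zero]
  have h5 := key _ _ (DS.of_sublin hq) (hZ.add _ _ hA₁ hB₂)
  have h6 := key _ _ (DS.of_sublin hq).neg_arg (hZ.add _ _ hB₁ hA₂)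
  simp only [e] at h5
  have h7 := psi_neg_arg hΦ hp (DS.of_sublin hq)
  linarith

/-- A simple valuation vanishing on prisms and annihilating all triangles vanishes. -/
theorem SimpleVal.eq_zero_of_triangles {K : Set X} (hK : Convex ℝ K) (hK' : IsCompact K) :
    Φ K = 0 := by
  rcases Set.eq_empty_or_nonempty (interior K) with hi | hi
  · exact hΦ.null K hK hK' hi
  have hne : K.Nonempty := hi.mono interior_subset
  have hm := sublin_supp hK' hne
  have hw := wulff_supp hK' hK hne
  rw [← hw, ← psi_of_good hΦ hp ⟨hm, by rwa [hw]⟩]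
  obtain ⟨R₀, hR₀⟩ := exists_smooth hm
  set R := max R₀ 0
  have h2 : PsiNull Φ fun x => supp K x + R * ‖x‖ :=
    (closedCone_psiNull hΦ hp).lim _ fun ε hε => by
      obtain ⟨q, hq, hqs, hqa⟩ := hR₀ R (le_max_left _ _) ε hε
      exact ⟨q, ⟨hq, fun a ha => psi_smooth hΦ hp hT (hq.const_mul ha) fun x hx =>
        contDiffAt_const.mul (hqs x hx)⟩, hqa⟩
  have h3 := h2.2 1 zero_le_one
  simp only [one_mul] at h3
  rw [← h3]
  exact (psi_add_even_sublin hΦ hp (DS.of_sublin hm) (Sublin.norm.const_mul (le_max_right _ _))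
    fun x => by rw [norm_neg]).symm

end Triangles

section Frames

variable {V : Type*} [NormedAddCommGroup V] [NormedSpace ℝ V]

/-- Triangular prisms. -/
def Tri {k : ℕ} (p q : V →L[ℝ] ℝ) (r : Fin k → V →L[ℝ] ℝ) : Set V :=
  {x | 0 ≤ p x ∧ 0 ≤ q x ∧ p x + q x ≤ 1 ∧ ∀ i, 0 ≤ r i x ∧ r i x ≤ 1}

/-- The functionals `p`, `q`, `r i` separate points. -/
def Frame {k : ℕ} (p q : V →L[ℝ] ℝ) (r : Fin k → V →L[ℝ] ℝ) : Prop :=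
  ∀ x, p x = 0 → q x = 0 → (∀ i, r i x = 0) → x = 0

end Frames

section Hyperplane

variable {X : Type*} [NormedAddCommGroup X] [InnerProductSpace ℝ X]

/-- The projection to the kernel of `u` along `v`. -/
def kerProj (u : X →L[ℝ] ℝ) (v : X) (h : u v = 1) : X →L[ℝ] u.ker :=
  (ContinuousLinearMap.id ℝ X - u.smulRight v).codRestrict _ fun x => by simp [h]

variable {u : X →L[ℝ] ℝ} {v : X} (h : u v = 1)

lemma kerProj_val (x : X) : (kerProj u v h x : X) = x - u x • v := rfl

lemma kerProj_add (y : u.ker) (s : ℝ) : kerProj u v h (y + s • v) = y := by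
  ext
  have : u y = 0 := y.2
  simp [kerProj_val, h, this]

lemma mem_sweep_val {L : Set u.ker} {t : ℝ} (ht : 0 ≤ t) {x : X} :
    x ∈ sweep (Subtype.val '' L) (t • v) ↔ kerProj u v h x ∈ L ∧ 0 ≤ u x ∧ u x ≤ t := by
  rw [mem_sweep_smul ht]
  constructor
  · rintro ⟨_, ⟨y, hy, rfl⟩, s, hs, hs', rfl⟩
    have : u y = 0 := y.2
    rw [kerProj_add]
    simp [h, this, hy, hs, hs']
  · rintro ⟨h1, h2, h3⟩
    exact ⟨_, ⟨_, h1, rfl⟩, u x, h2, h3, by rw [kerProj_val]; simp⟩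

lemma interior_sweep_val (h : u v = 1) {L : Set u.ker} {t : ℝ} (ht : 0 < t) :
    (interior (sweep (Subtype.val '' L) (t • v))).Nonempty ↔ (interior L).Nonempty := by
  constructor
  · rintro ⟨x, hx⟩
    have hc : Continuous fun y : u.ker => (y : X) + u x • v := by fun_prop
    refine ⟨kerProj u v h x, mem_interior.mpr
      ⟨_ ⁻¹' interior (sweep (Subtype.val '' L) (t • v)), ?_, isOpen_interior.preimage hc, ?_⟩⟩
    · intro y hy
      have := (mem_sweep_val h ht.le).mp (interior_subset hy)
      rw [kerProj_add] at this
      exact this.1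
    · simpa [kerProj_val] using hx
  · rintro ⟨y, hy⟩
    refine ⟨y + (t / 2) • v, mem_interior.mpr ⟨kerProj u v h ⁻¹' (interior L) ∩ u ⁻¹' (Set.Ioo 0 t),
      ?_, ?_, ?_⟩⟩
    · rintro x ⟨h1, h2⟩
      exact (mem_sweep_val h ht.le).mpr ⟨interior_subset h1, h2.1.le, h2.2.le⟩
    · exact (isOpen_interior.preimage (kerProj u v h).continuous).inter
        (isOpen_Ioo.preimage u.continuous)
    · have : u y = 0 := y.2
      refine ⟨by rwa [Set.mem_preimage, kerProj_add], ?_⟩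
      simp only [Set.mem_preimage, map_add, this, map_smul, h, smul_eq_mul, Set.mem_Ioo]
      constructor <;> linarith

variable {Φ : Set X → ℝ}

include h in
lemma SimpleVal.hyperplane (hΦ : SimpleVal Φ) {t : ℝ} (ht : 0 < t) :
    SimpleVal fun L : Set u.ker => Φ (sweep (Subtype.val '' L) (t • v)) := by
  have conv : ∀ {L : Set u.ker}, Convex ℝ L → Convex ℝ (sweep (Subtype.val '' L) (t • v)) :=
    fun hL => convex_sweep (hL.linear_image u.ker.subtype) _
  have comp : ∀ {L : Set u.ker}, IsCompact L → IsCompact (sweep (Subtype.val '' L) (t • v)) :=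
    fun hL => isCompact_sweep (hL.image continuous_subtype_val) _
  have thick : ∀ {K L : Set u.ker} {δ : ℝ}, IsCompact K → 0 ≤ δ → L ⊆ Metric.cthickening δ K →
      sweep (Subtype.val '' L) (t • v) ⊆
        Metric.cthickening δ (sweep (Subtype.val '' K) (t • v)) := by
    intro K L δ hK hδ hKL x hx
    obtain ⟨_, ⟨y, hy, rfl⟩, s, hs, hs', rfl⟩ := (mem_sweep_smul ht.le).mp hx
    have h1 := hKL hy
    rw [hK.cthickening_eq_biUnion_closedBall hδ] at h1
    obtain ⟨z, hz, hyz⟩ := Set.mem_iUnion₂.mp h1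
    refine Metric.mem_cthickening_of_dist_le _ (z + s • v) δ _
      ((mem_sweep_smul ht.le).mpr ⟨_, ⟨z, hz, rfl⟩, s, hs, hs', rfl⟩) ?_
    rw [dist_add_right]
    exact hyz
  refine ⟨fun L hL hL' hi => ?_, fun L x hL hL' => ?_, fun L w c hL hL' hw => ?_,
    fun K L hK hK' hL hL' hKL hi => ?_, fun K hK hK' hi ε hε => ?_⟩
  · refine hΦ.null _ (conv hL) (comp hL') ?_
    rw [← Set.not_nonempty_iff_eq_empty, interior_sweep_val h ht, hi]
    exact Set.not_nonempty_empty
  · refine hΦ.trans' (x : X) (conv hL) (comp hL') fun y => ?_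
    have : u x = 0 := x.2
    rw [mem_sweep_val h ht.le, mem_sweep_val h ht.le]
    have e : kerProj u v h (x + y) = x + kerProj u v h y := by
      ext; simp [kerProj_val, this]
    rw [e, map_add, this, zero_add]
    simp
  · have hw' : w.comp (kerProj u v h) ≠ 0 := fun h0 => hw <| by
      ext y
      have := DFunLike.congr_fun h0 (y : X)
      have e := kerProj_add h y 0
      rw [zero_smul, add_zero] at e
      simpa [e] using this
    rw [hΦ.cut _ _ c (conv hL) (comp hL') hw']
    congr 2 <;>
    · ext x
      simp only [Set.mem_inter_iff, mem_sweep_val h ht.le, Set.mem_ofPred_eq,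
        ContinuousLinearMap.comp_apply]
      tauto
  · have e1 : sweep (Subtype.val '' (K ∪ L)) (t • v) =
        sweep (Subtype.val '' K) (t • v) ∪ sweep (Subtype.val '' L) (t • v) := by
      ext x; simp only [Set.mem_union, mem_sweep_val h ht.le]; tauto
    have e2 : sweep (Subtype.val '' (K ∩ L)) (t • v) =
        sweep (Subtype.val '' K) (t • v) ∩ sweep (Subtype.val '' L) (t • v) := by
      ext x; simp only [Set.mem_inter_iff, mem_sweep_val h ht.le]; tauto
    simp only [e1, e2]
    refine hΦ.val _ _ (conv hK) (comp hK') (conv hL) (comp hL') ?_ ?_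
    · rw [← e1]; exact conv hKL
    · rw [← e2]; exact (interior_sweep_val h ht).mpr hi
  · obtain ⟨δ, hδ, hd⟩ := hΦ.cont _ (conv hK) (comp hK') ((interior_sweep_val h ht).mpr hi) ε hε
    exact ⟨δ, hδ, fun L hL hL' h1 h2 => hd _ (conv hL) (comp hL') (thick hK' hδ.le h1)
      (thick hL' hδ.le h2)⟩

end Hyperplane

section FrameBasics

variable {V : Type*} [NormedAddCommGroup V] [NormedSpace ℝ V] {k : ℕ}

lemma convex_Tri (p q : V →L[ℝ] ℝ) (r : Fin k → V →L[ℝ] ℝ) : Convex ℝ (Tri p q r) := by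
  simp only [Tri, Set.ofPred_and, Set.ofPred_forall]
  exact (convex_ge p 0).inter ((convex_ge q 0).inter ((convex_le (p + q) 1).inter
    (convex_iInter fun i => (convex_ge _ _).inter (convex_le _ _))))

lemma isClosed_Tri (p q : V →L[ℝ] ℝ) (r : Fin k → V →L[ℝ] ℝ) : IsClosed (Tri p q r) := by
  simp only [Tri, Set.ofPred_and, Set.ofPred_forall]
  exact (isClosed_ge' p 0).inter ((isClosed_ge' q 0).inter ((isClosed_le' (p + q) 1).inter
    (isClosed_iInter fun i => (isClosed_ge' _ _).inter (isClosed_le' _ _))))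

/-- Boxes. -/
def Box {k : ℕ} (p q : V →L[ℝ] ℝ) (r : Fin k → V →L[ℝ] ℝ) : Set V :=
  {x | 0 ≤ p x ∧ p x ≤ 1 ∧ 0 ≤ q x ∧ q x ≤ 1 ∧ ∀ i, 0 ≤ r i x ∧ r i x ≤ 1}

/-- The map with components `p`, `q`, `r i`. -/
def frameMap (p q : V →L[ℝ] ℝ) (r : Fin k → V →L[ℝ] ℝ) : V →L[ℝ] ℝ × ℝ × (Fin k → ℝ) :=
  p.prod (q.prod (ContinuousLinearMap.pi r))

variable [FiniteDimensional ℝ V]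

omit [FiniteDimensional ℝ V] in
lemma Frame.frameMap_injective {p q : V →L[ℝ] ℝ} {r : Fin k → V →L[ℝ] ℝ} (h : Frame p q r) :
    Function.Injective (frameMap p q r) := by
  rw [injective_iff_map_eq_zero]
  intro x hx
  simp only [frameMap, ContinuousLinearMap.prod_apply, Prod.mk_eq_zero] at hx
  exact h x hx.1 hx.2.1 fun i => congrFun hx.2.2 i

lemma Frame.isCompact_bounded {p q : V →L[ℝ] ℝ} {r : Fin k → V →L[ℝ] ℝ} (h : Frame p q r)
    {S : Set V} (hS : IsClosed S) (C : ℝ)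
    (hb : ∀ x ∈ S, |p x| ≤ C ∧ |q x| ≤ C ∧ ∀ i, |r i x| ≤ C) : IsCompact S := by
  have he := LinearMap.isClosedEmbedding_of_injective
    (f := (frameMap p q r).toLinearMap) (LinearMap.ker_eq_bot.mpr h.frameMap_injective)
  refine (he.isCompact_preimage (isCompact_closedBall 0 (|C|))).of_isClosed_subset hS
    fun x hx => ?_
  obtain ⟨h1, h2, h3⟩ := hb x hx
  have hC := le_abs_self C
  rw [Set.mem_preimage, mem_closedBall_zero_iff]
  refine max_le (h1.trans hC) (max_le (h2.trans hC) ?_)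
  exact (pi_norm_le_iff_of_nonneg (abs_nonneg _)).mpr fun i => (h3 i).trans hC

lemma Frame.isCompact_Tri {p q : V →L[ℝ] ℝ} {r : Fin k → V →L[ℝ] ℝ} (h : Frame p q r) :
    IsCompact (Tri p q r) := by
  refine h.isCompact_bounded (isClosed_Tri p q r) 1 fun x ⟨h1, h2, h3, h4⟩ => ?_
  refine ⟨?_, ?_, fun i => ?_⟩ <;> rw [abs_le]
  · constructor <;> linarith
  · constructor <;> linarith
  · constructor <;> linarith [(h4 i).1, (h4 i).2]

lemma Frame.isCompact_Box {p q : V →L[ℝ] ℝ} {r : Fin k → V →L[ℝ] ℝ} (h : Frame p q r) :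
    IsCompact (Box p q r) := by
  refine h.isCompact_bounded ?_ 1 fun x ⟨h1, h1', h2, h2', h4⟩ => ?_
  · simp only [Box, Set.ofPred_and, Set.ofPred_forall]
    exact (isClosed_ge' p 0).inter ((isClosed_le' p 1).inter ((isClosed_ge' q 0).inter
      ((isClosed_le' q 1).inter (isClosed_iInter fun i => (isClosed_ge' _ _).inter
        (isClosed_le' _ _)))))
  refine ⟨?_, ?_, fun i => ?_⟩ <;> rw [abs_le]
  · constructor <;> linarith
  · constructor <;> linarith
  · constructor <;> linarith [(h4 i).1, (h4 i).2]

omit [FiniteDimensional ℝ V] in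
lemma convex_Box (p q : V →L[ℝ] ℝ) (r : Fin k → V →L[ℝ] ℝ) : Convex ℝ (Box p q r) := by
  simp only [Box, Set.ofPred_and, Set.ofPred_forall]
  exact (convex_ge p 0).inter ((convex_le p 1).inter ((convex_ge q 0).inter
      ((convex_le q 1).inter (convex_iInter fun i => (convex_ge _ _).inter
        (convex_le _ _)))))

lemma Frame.exists_eq {p q : V →L[ℝ] ℝ} {r : Fin k → V →L[ℝ] ℝ} (h : Frame p q r)
    (hk : finrank ℝ V = k + 2) (a b : ℝ) (c : Fin k → ℝ) :
    ∃ x, p x = a ∧ q x = b ∧ ∀ i, r i x = c i := by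
  have hs : Function.Surjective (frameMap p q r).toLinearMap :=
    (LinearMap.injective_iff_surjective_of_finrank_eq_finrank (by simp [hk]; ring)).mp
      h.frameMap_injective
  obtain ⟨x, hx⟩ := hs (a, b, c)
  have hx' : (p x, q x, fun i => r i x) = (a, b, c) := hx
  simp only [Prod.mk.injEq] at hx'
  exact ⟨x, hx'.1, hx'.2.1, fun i => congrFun hx'.2.2 i⟩

lemma Frame.ne_zero {p q : V →L[ℝ] ℝ} {r : Fin k → V →L[ℝ] ℝ} (h : Frame p q r)
    (hk : finrank ℝ V = k + 2) (a b : ℝ) (hab : a ≠ 0 ∨ b ≠ 0) : a • p + b • q ≠ 0 := by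
  obtain ⟨x, h1, h2, -⟩ := h.exists_eq hk a b 0
  intro h0
  have := DFunLike.congr_fun h0 x
  simp only [_root_.add_apply, _root_.smul_apply, h1, h2, smul_eq_mul, _root_.zero_apply] at this
  rcases hab with hab | hab
  · nlinarith [mul_self_pos.mpr hab, mul_self_nonneg b]
  · nlinarith [mul_self_pos.mpr hab, mul_self_nonneg a]

variable {Φ : Set V → ℝ}

lemma SimpleVal.box_eq (hΦ : SimpleVal Φ) {p q : V →L[ℝ] ℝ} {r : Fin k → V →L[ℝ] ℝ}
    (h : Frame p q r) (hk : finrank ℝ V = k + 2) :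
    Φ (Box p q r) = Φ (Tri p q r) + Φ (Tri (-p) (-q) r) := by
  have h1 := h.ne_zero hk 1 1 (Or.inl one_ne_zero)
  rw [one_smul, one_smul] at h1
  obtain ⟨x, hx1, hx2, hx3⟩ := h.exists_eq hk 1 1 0
  have h' : Frame (-p) (-q) r := fun x h1 h2 h3 => h x (by simpa using h1) (by simpa using h2) h3
  rw [hΦ.cut _ (p + q) 1 (convex_Box p q r) h.isCompact_Box h1,
    ← hΦ.trans' (T := Box p q r ∩ {x | 1 ≤ (p + q) x}) x (convex_Tri (-p) (-q) r) h'.isCompact_Tri]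
  · congr 2
    ext y
    simp only [Box, Tri, Set.mem_inter_iff, Set.mem_ofPred_eq, _root_.add_apply]
    constructor
    · rintro ⟨⟨h1, -, h2, -, h3⟩, h4⟩
      exact ⟨h1, h2, h4, h3⟩
    · rintro ⟨h1, h2, h3, h4⟩
      exact ⟨⟨h1, by linarith, h2, by linarith, h4⟩, h3⟩
  · intro y
    simp only [Box, Tri, Set.mem_inter_iff, Set.mem_ofPred_eq, _root_.add_apply,
      _root_.neg_apply, map_add, hx1, hx2, hx3, Pi.zero_apply, zero_add]
    constructor
    · rintro ⟨⟨h1, h2, h3, h4, h5⟩, h6⟩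
      exact ⟨by linarith, by linarith, by linarith, h5⟩
    · rintro ⟨h1, h2, h3, h4⟩
      exact ⟨⟨by linarith, by linarith, by linarith, by linarith, h4⟩, by linarith⟩

end FrameBasics

section Vanish

variable {X : Type*} [NormedAddCommGroup X] [InnerProductSpace ℝ X] [FiniteDimensional ℝ X]
  {Φ : Set X → ℝ}

lemma vanishPrism_two (hΦ : SimpleVal Φ) (h2 : finrank ℝ X = 2)
    (hT : ∀ (p q : X →L[ℝ] ℝ) (r : Fin 0 → X →L[ℝ] ℝ), Frame p q r → Φ (Tri p q r) = 0) :
    VanishPrism Φ := by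
  intro u v L huv hL hL' hu t ht
  have hu0 : u ≠ 0 := fun h => by simp [h] at huv
  have hker : finrank ℝ u.ker = 1 := by
    have := LinearMap.finrank_range_add_finrank_ker u.toLinearMap
    rw [LinearMap.range_eq_top.mpr (LinearMap.surjective
      (fun h => hu0 (by ext x; exact DFunLike.congr_fun h x))), finrank_top,
      finrank_self, h2] at this
    omega
  obtain ⟨⟨w, hwu⟩, hw0, hw⟩ := finrank_eq_one_iff'.mp hker
  have hw0' : w ≠ 0 := fun h => hw0 (by ext; exact h)
  have hwu' : u w = 0 := hwu
  set f : X →L[ℝ] ℝ := ((‖w‖ ^ 2)⁻¹ • innerSL ℝ w).comp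
    (ContinuousLinearMap.id ℝ X - u.smulRight v) with hf
  have hfw : f w = 1 := by
    simp [hf, hwu', norm_ne_zero_iff.mpr hw0']
  have hfv : f v = 0 := by simp [hf, huv]
  have hdec : ∀ x, x = u x • v + f x • w := by
    intro x
    have hmem : x - u x • v ∈ u.ker := by simp [huv]
    obtain ⟨c, hc⟩ := hw ⟨_, hmem⟩
    have hc' : c • w = x - u x • v := congrArg Subtype.val hc
    have : f x = c := by
      have : x = c • w + u x • v := by rw [hc']; abel
      conv_lhs => rw [this]
      simp [hfw, hfv]
    rw [this, hc']; abel
  rcases L.eq_empty_or_nonempty with rfl | hne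
  · simpa [sweep] using hΦ.empty
  have hS := convex_sweep hL (t • v)
  have hS' := isCompact_sweep hL' (t • v)
  have hf0 : f ≠ 0 := fun h => by simp [h] at hfw
  obtain ⟨y₁, hy₁, hm⟩ := hL'.exists_isMinOn hne f.continuous.continuousOn
  obtain ⟨y₂, hy₂, hM⟩ := hL'.exists_isMaxOn hne f.continuous.continuousOn
  have hm' : ∀ y ∈ L, f y₁ ≤ f y := fun y hy => hm hy
  have hM' : ∀ y ∈ L, f y ≤ f y₂ := fun y hy => hM hy
  rcases (hm' _ hy₂).eq_or_lt with heq | hlt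
  · refine hΦ.null_of_const hS hS' hf0 (c := f y₁) fun x hx => ?_
    obtain ⟨y, hy, s, -, -, rfl⟩ := mem_sweep.mp hx
    simp only [map_add, map_smul, hfv, smul_zero, add_zero]
    exact le_antisymm ((hM' y hy).trans heq.ge) (hm' y hy)
  set l := f y₂ - f y₁ with hl
  have hl0 : 0 < l := sub_pos.mpr hlt
  have hfr : Frame (l⁻¹ • f) (t⁻¹ • u) (Fin.elim0 : Fin 0 → X →L[ℝ] ℝ) := by
    intro x h1 h2 _
    simp only [_root_.smul_apply, smul_eq_mul, mul_eq_zero, inv_eq_zero, hl0.ne', ht.ne',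
      false_or] at h1 h2
    rw [hdec x, h1, h2]; simp
  have hfr' : Frame (-(l⁻¹ • f)) (-(t⁻¹ • u)) (Fin.elim0 : Fin 0 → X →L[ℝ] ℝ) :=
    fun x h1 h2 h3 => hfr x (by simpa using h1) (by simpa using h2) h3
  have hbox : Φ (Box (l⁻¹ • f) (t⁻¹ • u) (Fin.elim0 : Fin 0 → X →L[ℝ] ℝ)) = 0 := by
    rw [hΦ.box_eq hfr (by rw [h2]), hT _ _ _ hfr, hT _ _ _ hfr', add_zero]
  rw [← hbox]
  refine hΦ.trans' (f y₁ • w) (convex_Box _ _ _) hfr.isCompact_Box fun x => ?_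
  rw [mem_sweep_smul ht.le]
  have e1 : ∀ a : ℝ, 0 ≤ l⁻¹ * a ↔ 0 ≤ a := fun a => by
    rw [mul_nonneg_iff_of_pos_left (inv_pos.mpr hl0)]
  have e2 : ∀ a : ℝ, l⁻¹ * a ≤ 1 ↔ a ≤ l := fun a => inv_mul_le_one₀ hl0
  have e3 : ∀ a : ℝ, 0 ≤ t⁻¹ * a ↔ 0 ≤ a := fun a => by
    rw [mul_nonneg_iff_of_pos_left (inv_pos.mpr ht)]
  have e4 : ∀ a : ℝ, t⁻¹ * a ≤ 1 ↔ a ≤ t := fun a => inv_mul_le_one₀ ht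
  simp only [Box, Set.mem_ofPred_eq, _root_.smul_apply, smul_eq_mul, e1, e2, e3, e4,
    IsEmpty.forall_iff, and_true]
  constructor
  · rintro ⟨y, hy, s, hs, hs', he⟩
    have hx : x = y + s • v - f y₁ • w := by rw [← he]; abel
    have h1 := hm' y hy
    have h2 := hM' y hy
    simp only [hx, map_sub, map_add, map_smul, hfw, hfv, huv, hwu', hu y hy, smul_eq_mul]
    refine ⟨?_, ?_, ?_, ?_⟩ <;> linarith
  · rintro ⟨h1, h2, h3, h4⟩
    obtain ⟨y, hy, hfy⟩ : ∃ y ∈ L, f y = f x + f y₁ := by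
      have := (hL.isPreconnected.image f f.continuous.continuousOn).ordConnected.out
        ⟨y₁, hy₁, rfl⟩ ⟨y₂, hy₂, rfl⟩
      exact this ⟨by linarith, by linarith⟩
    refine ⟨y, hy, u x, h3, h4, ?_⟩
    have e5 := hdec y
    rw [hu y hy, hfy] at e5
    have e6 := hdec x
    linear_combination (norm := module) e6 - e5

end Vanish

section Bridge

variable {V : Type*} [NormedAddCommGroup V] [NormedSpace ℝ V] [FiniteDimensional ℝ V] {k : ℕ}

lemma Frame.interior_Tri {p q : V →L[ℝ] ℝ} {r : Fin k → V →L[ℝ] ℝ} (h : Frame p q r)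
    (hk : finrank ℝ V = k + 2) : (interior (Tri p q r)).Nonempty := by
  obtain ⟨x, hx, hx', hx''⟩ := h.exists_eq hk (1 / 3) (1 / 3) fun _ => 1 / 2
  refine ⟨x, mem_interior.mpr ⟨{x | 0 < p x} ∩ {x | 0 < q x} ∩ {x | p x + q x < 1} ∩
    ⋂ i, ({x | 0 < r i x} ∩ {x | r i x < 1}), ?_, ?_, ?_⟩⟩
  · rintro y ⟨⟨⟨h1, h2⟩, h3⟩, h4⟩
    rw [Set.mem_iInter] at h4
    exact ⟨le_of_lt h1, le_of_lt h2, le_of_lt h3, fun i => ⟨le_of_lt (h4 i).1, le_of_lt (h4 i).2⟩⟩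
  · refine IsOpen.inter (IsOpen.inter (IsOpen.inter ?_ ?_) ?_)
      (isOpen_iInter_of_finite fun i => IsOpen.inter ?_ ?_)
    all_goals first
      | exact isOpen_lt continuous_const (by fun_prop)
      | exact isOpen_lt (by fun_prop) continuous_const
  · simp only [Set.mem_inter_iff, Set.mem_ofPred_eq, Set.mem_iInter, hx, hx', hx'']
    norm_num

variable {X : Type*} [NormedAddCommGroup X] [InnerProductSpace ℝ X] [FiniteDimensional ℝ X]
  [MeasurableSpace X] [BorelSpace X] {Φ : Set X → ℝ}

lemma max_zero_max_mul (c s : ℝ) : max 0 (max s (c * s)) =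
    (max 1 c - max 0 (-c)) / 2 * s + (max 1 c + max 0 (-c)) / 2 * |s| := by
  rcases le_total 0 s with h | h
  · have : max s (c * s) = s * max 1 c := by rw [mul_max_of_nonneg _ _ h]; congr 1 <;> ring
    rw [this, abs_of_nonneg h, max_eq_right (mul_nonneg h (le_max_of_le_left zero_le_one))]
    ring
  · have : max 0 (max s (c * s)) = -s * max 0 (-c) := by
      rw [mul_max_of_nonneg _ _ (neg_nonneg.mpr h), ← max_assoc, max_eq_left h]
      congr 1 <;> ring
    rw [this, abs_of_nonpos h]
    ring

omit [FiniteDimensional ℝ X] [MeasurableSpace X] [BorelSpace X] in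
lemma triSupp_comm (a b : X) : triSupp a b = triSupp b a := by
  funext x; simp only [triSupp]; rw [max_comm (inner ℝ x a)]

lemma psi_triSupp_smul [Nontrivial X] (hΦ : SimpleVal Φ) (hp : VanishPrism Φ) (a : X) (c : ℝ) :
    Psi Φ (triSupp a (c • a)) = 0 := by
  set A := (max 1 c - max 0 (-c)) / 2
  set B := (max 1 c + max 0 (-c)) / 2
  have hB : 0 ≤ B := by positivity
  have e : triSupp a (c • a) = fun x => (0 + inner ℝ x (A • a)) + B * |inner ℝ x a| := by
    funext x
    simp only [triSupp, inner_smul_right, max_zero_max_mul c (inner ℝ x a), zero_add]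
    rfl
  rw [e, psi_add_even hΦ hp (DS.zero.add (DS.of_sublin (Sublin.inner _)))
    (DS.of_sublin ((Sublin.abs_inner a).const_mul hB)) (by simp), psi_add_inner hΦ hp DS.zero,
    psi_zero hΦ hp]

omit [MeasurableSpace X] [BorelSpace X] in
lemma exists_basis {a b : X} (h : LinearIndependent ℝ ![a, b]) (hk : finrank ℝ X = k + 2) :
    ∃ B : Basis (Fin 2 ⊕ Fin k) ℝ X, B (Sum.inl 0) = a ∧ B (Sum.inl 1) = b := by
  classical
  have : Fintype (Basis.sumExtendIndex h) := by
    have := FiniteDimensional.fintypeBasisIndex (Basis.sumExtend h)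
    exact Fintype.ofInjective (Sum.inr : _ → Fin 2 ⊕ _) Sum.inr_injective
  have hc : Fintype.card (Basis.sumExtendIndex h) = k := by
    have := finrank_eq_card_basis (Basis.sumExtend h)
    rw [hk, Fintype.card_sum, Fintype.card_fin] at this
    omega
  refine ⟨(Basis.sumExtend h).reindex
    (Equiv.sumCongr (Equiv.refl _) (Fintype.equivFinOfCardEq hc)), ?_, ?_⟩
  · simp [Basis.sumExtend]; rfl
  · simp [Basis.sumExtend]; rfl

lemma psi_triSupp [Nontrivial X] (hΦ : SimpleVal Φ) (hp : VanishPrism Φ) (hk : finrank ℝ X = k + 2)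
    (hT : ∀ (p q : X →L[ℝ] ℝ) (r : Fin k → X →L[ℝ] ℝ), Frame p q r → Φ (Tri p q r) = 0)
    (a b : X) : Psi Φ (triSupp a b) = 0 := by
  by_cases hli : LinearIndependent ℝ ![a, b]
  swap
  · rw [LinearIndependent.pair_iff] at hli
    push Not at hli
    obtain ⟨s, t, hst, hne⟩ := hli
    by_cases hs : s = 0
    · have ht := hne hs
      have : b = (0 : ℝ) • a := by
        rw [hs, zero_smul, zero_add] at hst
        rw [zero_smul]; exact (smul_eq_zero.mp hst).resolve_left ht
      rw [this]; exact psi_triSupp_smul hΦ hp a 0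
    · have : a = (-(t / s)) • b := by
        have h1 : s • a = -(t • b) := by rw [eq_neg_iff_add_eq_zero]; exact hst
        rw [← inv_smul_smul₀ hs a, h1, smul_neg, smul_smul, neg_smul]; congr 2; ring
      rw [this, triSupp_comm]; exact psi_triSupp_smul hΦ hp b _
  obtain ⟨B, ha, hb⟩ := exists_basis hli hk
  set C : Fin 2 ⊕ Fin k → X →L[ℝ] ℝ := fun i => LinearMap.toContinuousLinearMap (B.coord i) with hC
  have hCB : ∀ i j, C i (B j) = if j = i then 1 else 0 := fun i j => by
    simp [hC, Finsupp.single_apply]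
  set p := C (Sum.inl 0)
  set q := C (Sum.inl 1)
  set r := fun i => C (Sum.inr i)
  have hdec : ∀ y, y = p y • a + q y • b + ∑ i, r i y • B (Sum.inr i) := fun y => by
    conv_lhs => rw [← B.sum_repr y]
    rw [Fintype.sum_sum_type, Fin.sum_univ_two, ha, hb]
    rfl
  have hfr : Frame p q r := fun x h1 h2 h3 => by
    rw [hdec x, h1, h2]; simp [h3]
  set E : X → ℝ := fun x => ∑ i, |inner ℝ x (B (Sum.inr i))| with hE
  set w := ∑ i, B (Sum.inr i) with hw
  have hEs : Sublin E := Sublin.sum _ fun i _ => Sublin.abs_inner _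
  set h : X → ℝ := fun x => (triSupp a b x + inner ℝ x ((1 / 2 : ℝ) • w)) + (1 / 2) * E x with hh
  have hsum : ∀ x, h x = triSupp a b x + ∑ i, max 0 (inner ℝ x (B (Sum.inr i))) := fun x => by
    rw [hh]
    simp only [hE, hw, inner_smul_right, inner_sum]
    rw [add_assoc, ← mul_add, ← Finset.sum_add_distrib, Finset.mul_sum]
    congr 1
    refine Finset.sum_congr rfl fun i _ => ?_
    rcases le_total 0 (inner ℝ x (B (Sum.inr i))) with h | h
    · rw [abs_of_nonneg h, max_eq_right h]; ring
    · rw [abs_of_nonpos h, max_eq_left h]; ring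
  have hD : DS (triSupp a b) := DS.of_sublin (sublin_triSupp a b)
  have hhs : Sublin h := ((sublin_triSupp a b).add (Sublin.inner _)).add
    (hEs.const_mul (by norm_num))
  have hpsi : Psi Φ h = Psi Φ (triSupp a b) := by
    rw [hh, psi_add_even hΦ hp (hD.add (DS.of_sublin (Sublin.inner _)))
      (DS.of_sublin (hEs.const_mul (by norm_num))) (by simp [hE]), psi_add_inner hΦ hp hD]
  have hwul : wulff h = Tri p q r := by
    apply Set.Subset.antisymm
    · intro y hy
      have key : ∀ f : X →L[ℝ] ℝ, f y ≤ max 0 (max (f a) (f b)) +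
          ∑ i, max 0 (f (B (Sum.inr i))) := fun f => by
        have := hy ((InnerProductSpace.toDual ℝ X).symm f)
        rw [hsum] at this
        simpa only [triSupp, InnerProductSpace.toDual_symm_apply] using this
      have hp' := key (-p)
      have hq' := key (-q)
      have hpq := key (p + q)
      have hr₁ := fun i => key (-(r i))
      have hr₂ := fun i => key (r i)
      simp only [_root_.neg_apply, _root_.add_apply, ← ha, ← hb, p, q, r, hCB]
          at hp' hq' hpq hr₁ hr₂
      simp at hp' hq' hpq hr₁ hr₂
      refine ⟨hp', hq', hpq, fun i => ⟨?_, ?_⟩⟩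
      · have := hr₁ i
        rw [Finset.sum_eq_zero] at this
        · simpa using this
        · intro j _; split_ifs <;> simp
      · have := hr₂ i
        rw [Finset.sum_eq_single i] at this
        · simpa using this
        · intro j _ hj; simp [hj]
        · simp
    · intro y hy x
      rw [hsum]
      conv_lhs => rw [hdec y]
      rw [inner_add_right, inner_add_right, inner_sum, inner_smul_right, inner_smul_right]
      refine add_le_add ?_ (Finset.sum_le_sum fun i _ => ?_)
      · set M := triSupp a b x with hM
        have h0 : 0 ≤ M := le_max_left _ _
        have h1 : inner ℝ x a ≤ M := le_max_of_le_right (le_max_left _ _)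
        have h2 : inner ℝ x b ≤ M := le_max_of_le_right (le_max_right _ _)
        nlinarith [mul_le_mul_of_nonneg_left h1 hy.1, mul_le_mul_of_nonneg_left h2 hy.2.1,
          mul_le_mul_of_nonneg_right hy.2.2.1 h0]
      · rw [inner_smul_right]
        obtain ⟨h1, h2⟩ := hy.2.2.2 i
        nlinarith [mul_le_mul_of_nonneg_left (le_max_right 0 (inner ℝ x (B (Sum.inr i)))) h1,
          mul_le_mul_of_nonneg_right h2 (le_max_left 0 (inner ℝ x (B (Sum.inr i))))]
  rw [← hpsi, psi_of_good hΦ hp ⟨hhs, hwul ▸ hfr.interior_Tri hk⟩, hwul, hT p q r hfr]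

end Bridge

section Vanishing

universe u

lemma vanishPrism_succ {X : Type u} [NormedAddCommGroup X] [InnerProductSpace ℝ X]
    [FiniteDimensional ℝ X] {Φ : Set X → ℝ} {k : ℕ} (hk : finrank ℝ X = k + 3)
    (hT : ∀ (p q : X →L[ℝ] ℝ) (r : Fin (k + 1) → X →L[ℝ] ℝ), Frame p q r → Φ (Tri p q r) = 0)
    (ih : ∀ (u : X →L[ℝ] ℝ) (v : X), u v = 1 → ∀ t : ℝ, 0 < t → finrank ℝ u.ker = k + 2 →
      (∀ (p q : u.ker →L[ℝ] ℝ) (r : Fin k → u.ker →L[ℝ] ℝ), Frame p q r →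
        Φ (sweep (Subtype.val '' Tri p q r) (t • v)) = 0) →
      ∀ L : Set u.ker, Convex ℝ L → IsCompact L → Φ (sweep (Subtype.val '' L) (t • v)) = 0) :
    VanishPrism Φ := by
  intro u v L huv hL hL' hu t ht
  have hu0 : u ≠ 0 := fun h => by simp [h] at huv
  have hker : finrank ℝ u.ker = k + 2 := by
    have := LinearMap.finrank_range_add_finrank_ker u.toLinearMap
    rw [LinearMap.range_eq_top.mpr (LinearMap.surjective
      (fun h => hu0 (by ext x; exact DFunLike.congr_fun h x))), finrank_top,
      finrank_self, hk] at this
    omega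
  have hLu : L ⊆ (u.ker : Set X) := fun x hx => hu x hx
  have himg : (Subtype.val '' (Subtype.val ⁻¹' L : Set u.ker)) = L :=
    Set.image_preimage_eq_of_subset (by rw [Subtype.range_coe]; exact hLu)
  have := ih u v huv t ht hker (fun p q r hfr => ?_) (Subtype.val ⁻¹' L)
    (hL.linear_preimage u.ker.subtype) (by
      rw [Topology.IsEmbedding.subtypeVal.isCompact_iff, himg]; exact hL')
  · rwa [himg] at this
  · set π := kerProj u v huv
    have hπ : ∀ x, (π x : X) = x - u x • v := kerProj_val huv
    rw [show sweep (Subtype.val '' Tri p q r) (t • v) = Tri (p.comp π) (q.comp π)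
      (Fin.cons (t⁻¹ • u) fun i => (r i).comp π : Fin (k + 1) → X →L[ℝ] ℝ) from ?_]
    · refine hT _ _ _ fun x h1 h2 h3 => ?_
      rw [Fin.forall_fin_succ] at h3
      have hu' : u x = 0 := by simpa [ht.ne'] using h3.1
      have : π x = 0 := hfr _ h1 h2 fun i => by simpa using h3.2 i
      have h5 := hπ x
      rw [this, hu'] at h5
      simpa using h5.symm
    · ext x
      rw [mem_sweep_val huv ht.le]
      simp only [Tri, Set.mem_ofPred_eq, Fin.forall_fin_succ, Fin.cons_zero, Fin.cons_succ,
        ContinuousLinearMap.comp_apply, _root_.smul_apply, smul_eq_mul,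
        mul_nonneg_iff_of_pos_left (inv_pos.mpr ht), inv_mul_le_one₀ ht]
      tauto

theorem SimpleVal.eq_zero_of_tri_inner (k : ℕ) : ∀ {X : Type u} [NormedAddCommGroup X]
    [InnerProductSpace ℝ X] [FiniteDimensional ℝ X] [MeasurableSpace X] [BorelSpace X]
    {Φ : Set X → ℝ}, finrank ℝ X = k + 2 → SimpleVal Φ →
    (∀ (p q : X →L[ℝ] ℝ) (r : Fin k → X →L[ℝ] ℝ), Frame p q r → Φ (Tri p q r) = 0) →
    ∀ K : Set X, Convex ℝ K → IsCompact K → Φ K = 0 := by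
  induction k with
  | zero =>
    intro X _ _ _ _ _ Φ hk hΦ hT K hK hK'
    have : Nontrivial X := Module.nontrivial_of_finrank_pos (R := ℝ) (by omega)
    have hp := vanishPrism_two hΦ hk hT
    exact hΦ.eq_zero_of_triangles hp (psi_triSupp hΦ hp hk hT) hK hK'
  | succ k ih =>
    intro X _ _ _ _ _ Φ hk hΦ hT K hK hK'
    have : Nontrivial X := Module.nontrivial_of_finrank_pos (R := ℝ) (by omega)
    have hp : VanishPrism Φ := vanishPrism_succ hk hT fun u v huv t ht hker hT' L hL hL' =>
      ih hker (hΦ.hyperplane huv ht) hT' L hL hL'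
    exact hΦ.eq_zero_of_triangles hp (psi_triSupp hΦ hp hk hT) hK hK'

end Vanishing

section Transfer

variable {V X : Type*} [NormedAddCommGroup V] [NormedSpace ℝ V] [NormedAddCommGroup X]
  [NormedSpace ℝ X] {Φ : Set V → ℝ} {k : ℕ}

lemma SimpleVal.comap (hΦ : SimpleVal Φ) (e : V ≃L[ℝ] X) : SimpleVal fun S => Φ (e ⁻¹' S) := by
  have conv : ∀ {S : Set X}, Convex ℝ S → Convex ℝ (e ⁻¹' S) := fun hS =>
    hS.linear_preimage e.toLinearEquiv.toLinearMap
  have comp : ∀ {S : Set X}, IsCompact S → IsCompact (e ⁻¹' S) := fun hS =>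
    e.toHomeomorph.isCompact_preimage.mpr hS
  have int : ∀ S : Set X, interior (e ⁻¹' S) = e ⁻¹' interior S := fun S =>
    (e.toHomeomorph.preimage_interior S).symm
  have thick : ∀ {K L : Set X} {δ : ℝ}, IsCompact K → 0 ≤ δ → L ⊆ Metric.cthickening δ K →
      e ⁻¹' L ⊆ Metric.cthickening (‖(e.symm : X →L[ℝ] V)‖ * δ) (e ⁻¹' K) := by
    intro K L δ hK hδ hL x hx
    have h1 := hL hx
    rw [hK.cthickening_eq_biUnion_closedBall hδ] at h1
    obtain ⟨y, hy, hxy⟩ := Set.mem_iUnion₂.mp h1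
    refine Metric.mem_cthickening_of_dist_le x (e.symm y) _ _ (by simpa using hy) ?_
    have h2 : x - e.symm y = (e.symm : X →L[ℝ] V) (e x - y) := by simp
    rw [dist_eq_norm, h2]
    refine (ContinuousLinearMap.le_opNorm _ _).trans ?_
    gcongr
    rwa [← dist_eq_norm]
  refine ⟨fun S hS hS' h => hΦ.null _ (conv hS) (comp hS') (by rw [int, h, Set.preimage_empty]),
    fun S x hS hS' => ?_, fun S u c hS hS' hu => ?_, fun K L hK hK' hL hL' hU hI => ?_,
    fun K hK hK' hi ε hε => ?_⟩
  · refine hΦ.trans' (e.symm x) (conv hS) (comp hS') fun y => ?_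
    simp
  · have := hΦ.cut (e ⁻¹' S) (u.comp (e : V →L[ℝ] X)) c (conv hS) (comp hS') fun h => hu (by
      ext x; simpa using DFunLike.congr_fun h (e.symm x))
    simpa using this
  · have h1 : (interior (e ⁻¹' K ∩ e ⁻¹' L)).Nonempty := by
      rw [← Set.preimage_inter, int]; exact hI.preimage e.surjective
    have h2 := conv hU
    rw [Set.preimage_union] at h2
    exact hΦ.val _ _ (conv hK) (comp hK') (conv hL) (comp hL') h2 h1
  · obtain ⟨δ, hδ, h⟩ := hΦ.cont _ (conv hK) (comp hK')
      (by rw [int]; exact hi.preimage e.surjective)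
      ε hε
    set N := ‖(e.symm : X →L[ℝ] V)‖
    have hN : 0 ≤ N := norm_nonneg _
    have hle : N * (δ / (N + 1)) ≤ δ := by
      rw [← mul_div_assoc, div_le_iff₀ (by positivity)]; nlinarith
    exact ⟨δ / (N + 1), by positivity, fun L hL hL' h1 h2 => h _ (conv hL) (comp hL')
      ((thick hK' (by positivity) h1).trans (Metric.cthickening_mono hle _))
      ((thick hL' (by positivity) h2).trans (Metric.cthickening_mono hle _))⟩

/-- A simple valuation vanishing on all triangular prisms vanishes. -/
theorem SimpleVal.eq_zero_of_tri [FiniteDimensional ℝ V] (hk : finrank ℝ V = k + 2)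
    (hΦ : SimpleVal Φ)
    (hT : ∀ (p q : V →L[ℝ] ℝ) (r : Fin k → V →L[ℝ] ℝ), Frame p q r → Φ (Tri p q r) = 0)
    {K : Set V} (hK : Convex ℝ K) (hK' : IsCompact K) : Φ K = 0 := by
  set e := toEuclidean (E := V)
  have := SimpleVal.eq_zero_of_tri_inner k (finrank_euclideanSpace_fin.trans hk) (hΦ.comap e)
    (fun p q r h => ?_) (e.symm ⁻¹' K) (hK.linear_preimage e.symm.toLinearEquiv.toLinearMap)
    (e.symm.toHomeomorph.isCompact_preimage.mpr hK')
  · rwa [← Set.preimage_comp, e.symm_comp_self, Set.preimage_id] at this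
  · exact hT (p.comp (e : V →L[ℝ] _)) (q.comp (e : V →L[ℝ] _))
      (fun i => (r i).comp (e : V →L[ℝ] _)) fun x h1 h2 h3 => by
        have := h (e x) h1 h2 h3
        simpa using this

end Transfer

section Sandwich

variable {V : Type*} [NormedAddCommGroup V] [NormedSpace ℝ V]

lemma subset_smul_of_thickening {K L : Set V} (hK : Convex ℝ K) (hK' : IsCompact K) {r δ : ℝ}
    (hr : 0 < r) (hδ : 0 ≤ δ) (hb : Metric.closedBall 0 r ⊆ K)
    (hL : L ⊆ Metric.cthickening δ K) : L ⊆ (1 + δ / r) • K := by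
  intro x hx
  have h1 := hL hx
  rw [hK'.cthickening_eq_biUnion_closedBall hδ] at h1
  obtain ⟨y, hy, hxy⟩ := Set.mem_iUnion₂.mp h1
  rw [hK.add_smul zero_le_one (by positivity), one_smul]
  refine ⟨y, hy, x - y, ?_, by simp⟩
  rw [Metric.mem_closedBall, dist_eq_norm] at hxy
  rcases hδ.eq_or_lt with rfl | hδ
  · have : x - y = 0 := norm_le_zero_iff.mp hxy
    rw [this]
    exact ⟨0, hb (by simp [hr.le]), by simp⟩
  refine ⟨(r / δ) • (x - y), hb ?_, ?_⟩
  · rw [mem_closedBall_zero_iff, norm_smul, Real.norm_of_nonneg (by positivity)]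
    calc r / δ * ‖x - y‖ ≤ r / δ * δ := by gcongr
      _ = r := by field_simp
  · simp only [smul_smul]
    rw [show δ / r * (r / δ) = 1 by field_simp, one_smul]

lemma smul_subset_of_thickening {K L : Set V} (hK : Convex ℝ K) (hL : Convex ℝ L)
    (hL' : IsCompact L) {r δ : ℝ} (hr : 0 < r) (hδ : 0 ≤ δ) (hδr : δ ≤ r)
    (hb : Metric.closedBall 0 r ⊆ K) (hKL : K ⊆ Metric.cthickening δ L) :
    (1 - δ / r) • K ⊆ L := by
  rintro _ ⟨y, hy, rfl⟩
  by_contra hx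
  obtain ⟨f, c, hfc, hfx⟩ := geometric_hahn_banach_closed_point hL hL'.isClosed hx
  simp only [map_smul, smul_eq_mul] at hfx
  have hle : ∀ z ∈ K, f z ≤ c + δ * ‖f‖ := by
    intro z hz
    have h1 := hKL hz
    rw [hL'.cthickening_eq_biUnion_closedBall hδ] at h1
    obtain ⟨w, hw, hzw⟩ := Set.mem_iUnion₂.mp h1
    rw [Metric.mem_closedBall, dist_eq_norm] at hzw
    have h2 : f (z - w) ≤ ‖f‖ * δ := (le_abs_self _).trans ((f.le_opNorm _).trans (by gcongr))
    rw [map_sub] at h2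
    linarith [hfc w hw]
  set D := c + δ * ‖f‖ - (1 - δ / r) * f y with hD
  have hρ : δ / r ≤ 1 := (div_le_one hr).mpr hδr
  have hu : ∀ u : V, ‖u‖ = 1 → δ * f u ≤ D := by
    intro u hu
    have := hle _ (hK hy (hb (show r • u ∈ _ by
      rw [mem_closedBall_zero_iff, norm_smul, hu, Real.norm_of_nonneg hr.le, mul_one]))
      (sub_nonneg.mpr hρ) (div_nonneg hδ hr.le) (by ring))
    simp only [map_add, map_smul, smul_eq_mul] at this
    rw [← mul_assoc, div_mul_cancel₀ _ hr.ne'] at this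
    rw [hD]; linarith
  have hD0 : 0 ≤ D := by
    have := hle _ (hK hy (hb (Metric.mem_closedBall_self hr.le)) (sub_nonneg.mpr hρ)
      (div_nonneg hδ hr.le) (by ring))
    simp only [map_add, map_smul, smul_eq_mul, map_zero, mul_zero, add_zero] at this
    rw [hD]; linarith
  have : ‖δ • f‖ ≤ D := by
    refine ContinuousLinearMap.opNorm_le_of_unit_norm hD0 fun u hu' => ?_
    rw [_root_.smul_apply, smul_eq_mul, Real.norm_eq_abs, abs_le]
    have h2 := hu (-u) (by rwa [norm_neg])
    rw [map_neg] at h2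
    exact ⟨by linarith, hu u hu'⟩
  rw [norm_smul, Real.norm_of_nonneg hδ] at this
  linarith

lemma cont_of_sandwich {Φ : Set V → ℝ}
    (ht : ∀ (S : Set V) (x : V), Convex ℝ S → IsCompact S → Φ ((fun y => x + y) '' S) = Φ S)
    (h : ∀ K : Set V, Convex ℝ K → IsCompact K → (0 : V) ∈ interior K → ∀ ε > 0,
      ∃ ρ : ℝ, 0 < ρ ∧ ρ < 1 ∧
      ∀ L : Set V, Convex ℝ L → IsCompact L → (1 - ρ) • K ⊆ L → L ⊆ (1 + ρ) • K →
        |Φ L - Φ K| < ε) :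
    ∀ K : Set V, Convex ℝ K → IsCompact K → (interior K).Nonempty → ∀ ε > 0, ∃ δ > 0,
      ∀ L : Set V, Convex ℝ L → IsCompact L → L ⊆ Metric.cthickening δ K →
        K ⊆ Metric.cthickening δ L → |Φ L - Φ K| < ε := by
  intro K hK hK' ⟨x, hx⟩ ε hε
  have tr : ∀ {A B : Set V} {δ : ℝ}, A ⊆ Metric.cthickening δ B →
      (fun y => -x + y) '' A ⊆ Metric.cthickening δ ((fun y => -x + y) '' B) := by
    rintro A B δ hAB _ ⟨a, ha, rfl⟩
    have := hAB ha
    rw [Metric.mem_cthickening_iff] at this ⊢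
    rwa [Metric.infEDist_image (isometry_add_left (-x))]
  set K₀ := (fun y => -x + y) '' K
  have hK₀ : Convex ℝ K₀ := hK.translate _
  have hK₀' : IsCompact K₀ := hK'.image (by fun_prop)
  have h0 : (0 : V) ∈ interior K₀ := by
    have : interior K₀ = (fun y => -x + y) '' interior K :=
      ((Homeomorph.addLeft (-x)).image_interior K).symm
    rw [this]; exact ⟨x, hx, by simp⟩
  obtain ⟨ρ, hρ, hρ1, hρ'⟩ := h K₀ hK₀ hK₀' h0 ε hε
  obtain ⟨r, hr, hb⟩ := Metric.nhds_basis_closedBall.mem_iff.mp (mem_interior_iff_mem_nhds.mp h0)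
  refine ⟨ρ * r, by positivity, fun L hL hL' h1 h2 => ?_⟩
  have e : ρ * r / r = ρ := by field_simp
  rw [← ht L (-x) hL hL', ← ht K (-x) hK hK']
  refine hρ' _ (hL.translate _) (hL'.image (by fun_prop)) ?_ ?_
  · have := smul_subset_of_thickening hK₀ (hL.translate (-x)) (hL'.image (by fun_prop)) hr
      (by positivity) (by nlinarith) hb (tr h2)
    rwa [e] at this
  · have := subset_smul_of_thickening hK₀ hK₀' hr (by positivity) hb (tr h1)
    rwa [e] at this

variable [FiniteDimensional ℝ V] [MeasurableSpace V] [BorelSpace V] (μ : Measure V)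
  [μ.IsAddHaarMeasure]

lemma measure_hyperplane {u : V →L[ℝ] ℝ} (hu : u ≠ 0) (c : ℝ) : μ {x | u x = c} = 0 := by
  obtain ⟨v, hv⟩ : ∃ v, u v ≠ 0 := by
    by_contra! h; exact hu (by ext x; simpa using h x)
  have h0 : μ (u.ker : Set V) = 0 := μ.addHaar_submodule _ fun h => hv (by
    have : v ∈ u.ker := h ▸ Submodule.mem_top
    exact this)
  have : {x | u x = c} = (fun y => (c / u v) • v + y) '' (u.ker : Set V) := by
    ext x
    constructor
    · intro hx
      rw [Set.mem_ofPred_eq] at hx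
      refine ⟨x - (c / u v) • v, ?_, by simp⟩
      have : u (x - (c / u v) • v) = 0 := by simp [hx, hv]
      exact this
    · rintro ⟨y, hy, rfl⟩
      have : u y = 0 := hy
      simp [this, hv]
  rw [this, Set.image_add_left, measure_preimage_add, h0]

lemma measure_eq_zero_of_interior {S : Set V} (hS : Convex ℝ S) (hS' : IsCompact S)
    (h : interior S = ∅) : μ S = 0 := by
  rw [← hS.addHaar_frontier μ, hS'.isClosed.frontier_eq, h, Set.sdiff_empty]

/-- The volume is a simple valuation. -/
lemma simpleVal_measure : SimpleVal fun S => (μ S).toReal := by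
  have htr : ∀ (S : Set V) (x : V), Convex ℝ S → IsCompact S →
      (μ ((fun y => x + y) '' S)).toReal = (μ S).toReal := fun S x _ _ => by
    rw [Set.image_add_left, measure_preimage_add]
  refine ⟨fun S hS hS' h => ?_, htr, fun S u c hS hS' hu => ?_,
    fun K L hK hK' hL hL' hU hI => ?_, cont_of_sandwich htr fun K hK hK' h0 ε hε => ?_⟩
  · simp [measure_eq_zero_of_interior μ hS hS' h]
  · have h1 := hS'.isClosed.measurableSet
    have hf : ∀ T : Set V, μ (S ∩ T) ≠ ⊤ := fun T =>
      measure_ne_top_of_subset Set.inter_subset_left hS'.measure_lt_top.ne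
    rw [← measure_inter_add_sdiff S (isClosed_le' u c).measurableSet]
    rw [ENNReal.toReal_add (hf _) (measure_ne_top_of_subset Set.sdiff_subset hS'.measure_lt_top.ne)]
    congr 2
    refine measure_congr ?_
    have h2 : ∀ᵐ x ∂μ, ¬ u x = c := by
      rw [ae_iff]; simpa using measure_hyperplane μ hu c
    filter_upwards [h2] with x hx
    apply propext
    change (x ∈ S ∧ ¬ u x ≤ c) ↔ (x ∈ S ∧ c ≤ u x)
    rw [not_le]
    exact and_congr_right fun _ => ⟨le_of_lt, fun h => lt_of_le_of_ne h (Ne.symm hx)⟩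
  · rw [← ENNReal.toReal_add, measure_union_add_inter _ hL'.isClosed.measurableSet,
      ENNReal.toReal_add hK'.measure_lt_top.ne hL'.measure_lt_top.ne]
    · exact (hK'.union hL').measure_lt_top.ne
    · exact (hK'.inter hL').measure_lt_top.ne
  · set n := finrank ℝ V
    set m := (μ K).toReal with hm
    have hc : Filter.Tendsto (fun ρ : ℝ => (1 + ρ) ^ n * m - (1 - ρ) ^ n * m)
        (nhds 0) (nhds 0) := by
      have : Continuous fun ρ : ℝ => (1 + ρ) ^ n * m - (1 - ρ) ^ n * m := by fun_prop
      simpa using this.tendsto 0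
    obtain ⟨η, hη, hη'⟩ := Metric.eventually_nhds_iff.mp (hc.eventually (gt_mem_nhds hε))
    refine ⟨min (η / 2) (1 / 2), by positivity, by
      linarith [min_le_right (η / 2) ((1 : ℝ) / 2)], fun L hL hL' h1 h2 => ?_⟩
    set ρ := min (η / 2) (1 / 2 : ℝ)
    have hρ0 : 0 < ρ := by positivity
    have hρ1 : ρ ≤ 1 / 2 := min_le_right _ _
    have hρη : ρ ≤ η / 2 := min_le_left _ _
    have key := @hη' ρ (by rw [dist_zero_right, Real.norm_of_nonneg hρ0.le]; linarith)
    have sc : ∀ a : ℝ, 0 ≤ a → (μ (a • K)).toReal = a ^ n * m := fun a ha => by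
      rw [Measure.addHaar_smul, ENNReal.toReal_mul, abs_of_nonneg (by positivity),
        ENNReal.toReal_ofReal (by positivity)]
    have g1 : (1 - ρ) ^ n * m ≤ (μ L).toReal := by
      rw [← sc _ (by linarith)]
      exact ENNReal.toReal_mono hL'.measure_lt_top.ne (measure_mono h1)
    have g2 : (μ L).toReal ≤ (1 + ρ) ^ n * m := by
      rw [← sc _ (by linarith)]
      exact ENNReal.toReal_mono (hK'.smul _).measure_lt_top.ne (measure_mono h2)
    have hm0 : 0 ≤ m := ENNReal.toReal_nonneg
    have g3 : (1 - ρ) ^ n * m ≤ m :=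
      mul_le_of_le_one_left hm0 (pow_le_one₀ (by linarith) (by linarith))
    have g4 : m ≤ (1 + ρ) ^ n * m := le_mul_of_one_le_left hm0 (one_le_pow₀ (by linarith))
    rw [abs_lt]
    constructor <;> linarith

end Sandwich

lemma linear_of_additive_nonneg {f : ℝ → ℝ} (hadd : ∀ s t, 0 ≤ s → 0 ≤ t → f (s + t) = f s + f t)
    (hc : ∀ ε > 0, ∃ δ > 0, ∀ t, |t - 1| < δ → |f t - f 1| < ε) {t : ℝ} (ht : 0 ≤ t) :
    f t = t * f 1 := by
  have h0 : f 0 = 0 := by simpa using hadd 0 0 le_rfl le_rfl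
  have hg : ∀ a b : ℝ, 0 ≤ a → 0 ≤ b → f ((a - b)⁺) - f ((a - b)⁻) = f a - f b := by
    intro a b ha hb
    have h1 := hadd ((a - b)⁺) b (posPart_nonneg _) hb
    have h2 := hadd ((a - b)⁻) a (negPart_nonneg _) ha
    have h3 : (a - b)⁺ - (a - b)⁻ = a - b := posPart_sub_negPart _
    rw [show (a - b)⁺ + b = (a - b)⁻ + a by linarith] at h1
    linarith
  let g : ℝ →+ ℝ := AddMonoidHom.mk' (fun x => f x⁺ - f x⁻) fun x y => by
    have h3 := posPart_sub_negPart x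
    have h4 := posPart_sub_negPart y
    have := hg (x⁺ + y⁺) (x⁻ + y⁻) (add_nonneg (posPart_nonneg _) (posPart_nonneg _))
      (add_nonneg (negPart_nonneg _) (negPart_nonneg _))
    rw [hadd _ _ (posPart_nonneg _) (posPart_nonneg _),
      hadd _ _ (negPart_nonneg _) (negPart_nonneg _),
      show x⁺ + y⁺ - (x⁻ + y⁻) = x + y by linarith] at this
    linarith
  have hgt : ∀ t, 0 ≤ t → g t = f t := fun t ht => by
    change f t⁺ - f t⁻ = f t
    rw [posPart_of_nonneg ht, negPart_of_nonneg ht, h0, sub_zero]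
  have hgc : Continuous g := by
    refine continuous_of_continuousAt_zero g ?_
    rw [Metric.continuousAt_iff]
    intro ε hε
    obtain ⟨δ, hδ, h⟩ := hc ε hε
    refine ⟨min δ 1, by positivity, fun x hx => ?_⟩
    rw [dist_zero_right, Real.norm_eq_abs, lt_min_iff] at hx
    have h1 := h (1 + x) (by simpa using hx.1)
    rw [← hgt _ (by linarith [(abs_lt.mp hx.2).1]), ← hgt 1 zero_le_one, map_add] at h1
    simpa [Real.dist_eq] using h1
  have := (g.toRealLinearMap hgc).map_smul t 1
  simp only [smul_eq_mul, mul_one] at this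
  rw [← hgt t ht, ← hgt 1 zero_le_one]
  exact this

section Slab

variable {V : Type*} [NormedAddCommGroup V] [NormedSpace ℝ V] {Φ : Set V → ℝ} {S : Set V}

lemma convex_slab (hS : Convex ℝ S) (z : V →L[ℝ] ℝ) (a b : ℝ) :
    Convex ℝ (S ∩ {x | a ≤ z x ∧ z x ≤ b}) :=
  hS.inter ((convex_ge z a).inter (convex_le z b))

variable (hΦ : SimpleVal Φ) (hS : Convex ℝ S) {z : V →L[ℝ] ℝ} {v : V} (hzv : z v = 1)
  (hinv : ∀ x ∈ S, ∀ t : ℝ, x + t • v ∈ S)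
  (hcomp : ∀ a b, IsCompact (S ∩ {x | a ≤ z x ∧ z x ≤ b}))
include hΦ hS hzv hinv hcomp

lemma SimpleVal.slab_shear (hcl : IsClosed S) {l : V →L[ℝ] ℝ} (hlv : l v = 0) :
    Φ (S ∩ {x | 0 ≤ (z + l) x ∧ (z + l) x ≤ 1}) = Φ (S ∩ {x | 0 ≤ z x ∧ z x ≤ 1}) := by
  have hinv' : ∀ x t, x + t • v ∈ S ↔ x ∈ S := fun x t =>
    ⟨fun h => by simpa using hinv _ h (-t), fun h => hinv x h t⟩
  obtain ⟨C, hC⟩ : ∃ C, ∀ x ∈ S, |l x| ≤ C := by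
    obtain ⟨C, hC⟩ := (hcomp 0 0).exists_bound_of_continuousOn l.continuous.continuousOn
    refine ⟨C, fun x hx => ?_⟩
    have := hC (x + (-z x) • v) ⟨hinv x hx _, by simp [hzv]⟩
    simpa [hlv] using this
  have hC' : ∀ x ∈ S, -C ≤ l x ∧ l x ≤ C := fun x hx => abs_le.mp (hC x hx)
  set U := S ∩ {x | 0 ≤ z x ∧ (z + l) x ≤ C + 1} with hU
  set W := S ∩ {x | 0 ≤ z x ∧ (z + l) x ≤ C} with hW
  have cvx : ∀ c, Convex ℝ (S ∩ {x | 0 ≤ z x ∧ (z + l) x ≤ c}) := fun c =>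
    hS.inter ((convex_ge z 0).inter (convex_le (z + l) c))
  have cpt : ∀ c, IsCompact (S ∩ {x | 0 ≤ z x ∧ (z + l) x ≤ c}) := fun c => by
    refine (hcomp 0 (c + C)).of_isClosed_subset
      (hcl.inter ((isClosed_ge' z 0).inter (isClosed_le' (z + l) c))) fun x hx => ?_
    have h1 := hx.2.2
    rw [_root_.add_apply] at h1
    exact ⟨hx.1, hx.2.1, by linarith [(hC' x hx.1).1]⟩
  have hz0 : z ≠ 0 := fun h => by simp [h] at hzv
  have hzl0 : z + l ≠ 0 := fun h => by
    have := DFunLike.congr_fun h v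
    simp [hzv, hlv] at this
  have c1 := hΦ.cut U z 1 (cvx _) (cpt _) hz0
  have c2 := hΦ.cut U (z + l) C (cvx _) (cpt _) hzl0
  have e1 : U ∩ {x | z x ≤ 1} = S ∩ {x | 0 ≤ z x ∧ z x ≤ 1} := by
    ext x
    simp only [hU, Set.mem_inter_iff, Set.mem_ofPred_eq, _root_.add_apply]
    constructor
    · rintro ⟨⟨h1, h2, h3⟩, h4⟩; exact ⟨h1, h2, h4⟩
    · rintro ⟨h1, h2, h3⟩; exact ⟨⟨h1, h2, by linarith [(hC' x h1).2]⟩, h3⟩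
  have e2 : Φ (U ∩ {x | 1 ≤ z x}) = Φ W := by
    refine hΦ.trans' v (cvx _) (cpt _) fun y => ?_
    have := hinv' y 1
    rw [one_smul] at this
    simp only [hU, hW, Set.mem_inter_iff, Set.mem_ofPred_eq, add_comm v, this, map_add,
      _root_.add_apply, hzv, hlv]
    constructor
    · rintro ⟨⟨h1, h2, h3⟩, h4⟩; exact ⟨h1, by linarith, by linarith⟩
    · rintro ⟨h1, h2, h3⟩; exact ⟨⟨h1, by linarith, by linarith⟩, by linarith⟩
  have e3 : U ∩ {x | (z + l) x ≤ C} = W := by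
    ext x
    simp only [hU, hW, Set.mem_inter_iff, Set.mem_ofPred_eq]
    constructor
    · rintro ⟨⟨h1, h2, h3⟩, h4⟩; exact ⟨h1, h2, h4⟩
    · rintro ⟨h1, h2, h3⟩; exact ⟨⟨h1, h2, by linarith⟩, h3⟩
  have e4 : Φ (S ∩ {x | 0 ≤ (z + l) x ∧ (z + l) x ≤ 1}) = Φ (U ∩ {x | C ≤ (z + l) x}) := by
    refine hΦ.trans' (-C • v) ((cvx _).inter (convex_ge _ _))
      ((cpt _).inter_right (isClosed_ge' _ _)) fun y => ?_
    simp only [hU, Set.mem_inter_iff, Set.mem_ofPred_eq, add_comm (-C • v), hinv', map_add,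
      _root_.add_apply, map_smul, hzv, hlv, smul_eq_mul]
    constructor
    · rintro ⟨h1, h2, h3⟩
      exact ⟨⟨h1, by linarith [(hC' y h1).2], by linarith⟩, by linarith⟩
    · rintro ⟨⟨h1, h2, h3⟩, h4⟩; exact ⟨h1, by linarith, by linarith⟩
  rw [e1, e2] at c1
  rw [e3, ← e4] at c2
  linarith

lemma SimpleVal.slab_scale (hint : (interior (S ∩ {x | 0 ≤ z x ∧ z x ≤ 1})).Nonempty) {t : ℝ}
    (ht : 0 ≤ t) :
    Φ (S ∩ {x | 0 ≤ z x ∧ z x ≤ t}) = t * Φ (S ∩ {x | 0 ≤ z x ∧ z x ≤ 1}) := by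
  have hinv' : ∀ x t, x + t • v ∈ S ↔ x ∈ S := fun x t =>
    ⟨fun h => by simpa using hinv _ h (-t), fun h => hinv x h t⟩
  have hz0 : z ≠ 0 := fun h => by simp [h] at hzv
  refine linear_of_additive_nonneg (f := fun t => Φ (S ∩ {x | 0 ≤ z x ∧ z x ≤ t}))
    (fun s t hs ht => ?_) (fun ε hε => ?_) ht
  · rw [hΦ.cut _ z s (convex_slab hS z _ _) (hcomp _ _) hz0]
    congr 1
    · congr 1; ext x
      simp only [Set.mem_inter_iff, Set.mem_ofPred_eq]
      constructor
      · rintro ⟨⟨h1, h2, h3⟩, h4⟩; exact ⟨h1, h2, h4⟩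
      · rintro ⟨h1, h2, h3⟩; exact ⟨⟨h1, h2, by linarith⟩, h3⟩
    · refine hΦ.trans' (s • v) (convex_slab hS z _ _) (hcomp _ _) fun y => ?_
      simp only [Set.mem_inter_iff, Set.mem_ofPred_eq, add_comm (s • v), hinv', map_add, map_smul,
        hzv, smul_eq_mul]
      constructor
      · rintro ⟨⟨h1, h2, h3⟩, h4⟩; exact ⟨h1, by linarith, by linarith⟩
      · rintro ⟨h1, h2, h3⟩; exact ⟨⟨h1, by linarith, by linarith⟩, by linarith⟩
  · obtain ⟨δ, hδ, h⟩ := hΦ.cont _ (convex_slab hS z _ _) (hcomp _ _) hint ε hε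
    have close : ∀ a b : ℝ, 0 ≤ b → |a - b| * ‖v‖ ≤ δ → (S ∩ {x | 0 ≤ z x ∧ z x ≤ a}) ⊆
        Metric.cthickening δ (S ∩ {x | 0 ≤ z x ∧ z x ≤ b}) := by
      rintro a b hb hab x ⟨hxS, hx0, hxa⟩
      refine Metric.mem_cthickening_of_dist_le x (x + (min b (z x) - z x) • v) _ _
        ⟨hinv _ hxS _, ?_⟩ ?_
      · simp only [Set.mem_ofPred_eq, map_add, map_smul, hzv, smul_eq_mul, mul_one,
          add_sub_cancel]
        exact ⟨le_min hb hx0, min_le_left _ _⟩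
      · rw [dist_eq_norm, sub_add_cancel_left, norm_neg, norm_smul, Real.norm_eq_abs]
        refine le_trans ?_ hab
        refine mul_le_mul_of_nonneg_right ?_ (norm_nonneg v)
        rcases le_total (z x) b with h | h
        · rw [min_eq_right h]; simp
        · rw [min_eq_left h, abs_of_nonpos (by linarith), abs_of_nonneg (by linarith)]; linarith
    refine ⟨min 1 (δ / (‖v‖ + 1)), by positivity, fun t ht => ?_⟩
    rw [lt_min_iff, lt_div_iff₀ (by positivity)] at ht
    have hv := norm_nonneg v
    have h0 := abs_nonneg (t - 1)
    refine h _ (convex_slab hS z _ _) (hcomp _ _) (close _ _ zero_le_one (by nlinarith))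
      (close _ _ (by linarith [(abs_lt.mp ht.1).1]) (by rw [abs_sub_comm]; nlinarith))

end Slab

section Cyl

variable {V : Type*} [NormedAddCommGroup V] [NormedSpace ℝ V] {ι κ : Type*}

/-- The part of `S` lying in the parallelepiped-like region `0 ≤ r i ≤ 1`. -/
def Cyl (S : Set V) (r : κ → V →L[ℝ] ℝ) : Set V := S ∩ {x | ∀ i, 0 ≤ r i x ∧ r i x ≤ 1}

/-- The two families of functionals jointly separate points. -/
def Sep (w : ι → V →L[ℝ] ℝ) (r : κ → V →L[ℝ] ℝ) : Prop :=
  ∀ x, (∀ i, w i x = 0) → (∀ i, r i x = 0) → x = 0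

/-- Uniform proportionality of the values of all simple valuations on two cylinders. -/
def CylRel (S : Set V) (r r' : κ → V →L[ℝ] ℝ) : Prop :=
  ∃ t : ℝ, 0 < t ∧ ∀ Φ : Set V → ℝ, SimpleVal Φ → Φ (Cyl S r') = t * Φ (Cyl S r)

lemma CylRel.of_eq {S : Set V} {r r' : κ → V →L[ℝ] ℝ}
    (h : ∀ Φ : Set V → ℝ, SimpleVal Φ → Φ (Cyl S r') = Φ (Cyl S r)) : CylRel S r r' :=
  ⟨1, one_pos, fun Φ hΦ => (h Φ hΦ).trans (one_mul _).symm⟩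

lemma CylRel.refl (S : Set V) (r : κ → V →L[ℝ] ℝ) : CylRel S r r :=
  CylRel.of_eq fun _ _ => rfl

lemma CylRel.trans {S : Set V} {r r' r'' : κ → V →L[ℝ] ℝ} (h : CylRel S r r')
    (h' : CylRel S r' r'') : CylRel S r r'' := by
  obtain ⟨t, ht, h⟩ := h
  obtain ⟨s, hs, h'⟩ := h'
  exact ⟨s * t, mul_pos hs ht, fun Φ hΦ => by rw [h' Φ hΦ, h Φ hΦ, mul_assoc]⟩

variable [Fintype ι] [Fintype κ] [FiniteDimensional ℝ V]

lemma isCompact_of_sep {w : ι → V →L[ℝ] ℝ} {r : κ → V →L[ℝ] ℝ} (h : Sep w r) {S : Set V}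
    (hS : IsClosed S) (C : ℝ) (hw : ∀ x ∈ S, ∀ i, |w i x| ≤ C) (hr : ∀ x ∈ S, ∀ i, |r i x| ≤ C) :
    IsCompact S := by
  let f : V →L[ℝ] (ι → ℝ) × (κ → ℝ) :=
    (ContinuousLinearMap.pi w).prod (ContinuousLinearMap.pi r)
  have hinj : Function.Injective f := by
    rw [injective_iff_map_eq_zero]
    intro x hx
    exact h x (fun i => congrFun (congrArg Prod.fst hx) i)
      (fun i => congrFun (congrArg Prod.snd hx) i)
  have hce : Topology.IsClosedEmbedding f :=
    LinearMap.isClosedEmbedding_of_injective (f := f.toLinearMap) (LinearMap.ker_eq_bot.mpr hinj)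
  refine (hce.isCompact_preimage (isCompact_closedBall (0 : (ι → ℝ) × (κ → ℝ))
    (max C 0))).of_isClosed_subset hS fun x hx => ?_
  rw [Set.mem_preimage, mem_closedBall_zero_iff, Prod.norm_def]
  refine max_le ?_ ?_
  · rw [pi_norm_le_iff_of_nonneg (le_max_right _ _)]
    exact fun i => (hw x hx i).trans (le_max_left _ _)
  · rw [pi_norm_le_iff_of_nonneg (le_max_right _ _)]
    exact fun i => (hr x hx i).trans (le_max_left _ _)

lemma Sep.exists_eq {w : ι → V →L[ℝ] ℝ} {r : κ → V →L[ℝ] ℝ} (h : Sep w r)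
    (hd : finrank ℝ V = Fintype.card ι + Fintype.card κ) (a : ι → ℝ) (b : κ → ℝ) :
    ∃ x, (∀ i, w i x = a i) ∧ ∀ i, r i x = b i := by
  let f : V →ₗ[ℝ] (ι → ℝ) × (κ → ℝ) :=
    ((ContinuousLinearMap.pi w).prod (ContinuousLinearMap.pi r)).toLinearMap
  have hinj : Function.Injective f := by
    rw [injective_iff_map_eq_zero]
    intro x hx
    exact h x (fun i => congrFun (congrArg Prod.fst hx) i)
      (fun i => congrFun (congrArg Prod.snd hx) i)
  have hs := (LinearMap.injective_iff_surjective_of_finrank_eq_finrank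
    (by simp [hd])).mp hinj
  obtain ⟨x, hx⟩ := hs (a, b)
  exact ⟨x, fun i => congrFun (congrArg Prod.fst hx) i,
    fun i => congrFun (congrArg Prod.snd hx) i⟩

omit [Fintype ι] [Fintype κ] [FiniteDimensional ℝ V] in
lemma isClosed_Cyl {S : Set V} (hS : IsClosed S) (r : κ → V →L[ℝ] ℝ) : IsClosed (Cyl S r) := by
  refine hS.inter ?_
  rw [Set.ofPred_forall]
  exact isClosed_iInter fun i => (isClosed_ge' (r i) 0).inter (isClosed_le' (r i) 1)

omit [Fintype ι] [Fintype κ] [FiniteDimensional ℝ V] in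
lemma convex_Cyl {S : Set V} (hS : Convex ℝ S) (r : κ → V →L[ℝ] ℝ) : Convex ℝ (Cyl S r) := by
  refine hS.inter ?_
  rw [Set.ofPred_forall]
  exact convex_iInter fun i => (convex_ge (r i) 0).inter (convex_le (r i) 1)

variable {S : Set V} (hS : Convex ℝ S) (hcl : IsClosed S) {w : ι → V →L[ℝ] ℝ} {C : ℝ}
  (hw : ∀ x ∈ S, ∀ i, |w i x| ≤ C) (hinv : ∀ x ∈ S, ∀ v, (∀ i, w i v = 0) → x + v ∈ S)
  (hint : (interior S).Nonempty) (hd : finrank ℝ V = Fintype.card ι + Fintype.card κ)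

include hint hd hinv in
lemma interior_Cyl {r : κ → V →L[ℝ] ℝ} (h : Sep w r) : (interior (Cyl S r)).Nonempty := by
  obtain ⟨x, hx⟩ := hint
  obtain ⟨v, hv, hv'⟩ := h.exists_eq hd 0 (fun i => 1 / 2 - r i x)
  have hxv : x + v ∈ interior S := by
    refine interior_maximal (s := S) (t := (fun y => y - v) ⁻¹' interior S) (fun y hy => ?_)
      (isOpen_interior.preimage (by fun_prop)) (by simpa using hx)
    simpa using hinv _ (interior_subset hy) v hv
  refine ⟨x + v, interior_maximal (s := Cyl S r)
    (t := interior S ∩ ⋂ i, {y | 0 < r i y ∧ r i y < 1}) ?_ ?_ ⟨hxv, ?_⟩⟩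
  · rintro y ⟨h1, h2⟩
    rw [Set.mem_iInter] at h2
    exact ⟨interior_subset h1, fun i => ⟨(h2 i).1.le, (h2 i).2.le⟩⟩
  · exact isOpen_interior.inter (isOpen_iInter_of_finite fun i =>
      (isOpen_lt continuous_const (r i).continuous).inter
        (isOpen_lt (r i).continuous continuous_const))
  · rw [Set.mem_iInter]
    intro i
    simp only [Set.mem_ofPred_eq, map_add, hv']
    norm_num

variable [DecidableEq κ]

omit [Fintype κ] [FiniteDimensional ℝ V] in
lemma Cyl_update (S : Set V) (r : κ → V →L[ℝ] ℝ) (j : κ) (z : V →L[ℝ] ℝ) :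
    Cyl S (Function.update r j z) = Cyl S (fun i : {i // i ≠ j} => r i) ∩
      {x | 0 ≤ z x ∧ z x ≤ 1} := by
  ext x
  simp only [Cyl, Set.mem_inter_iff, Set.mem_ofPred_eq, Subtype.forall]
  constructor
  · rintro ⟨h1, h2⟩
    exact ⟨⟨h1, fun i hi => by simpa [hi] using h2 i⟩, by simpa using h2 j⟩
  · rintro ⟨⟨h1, h2⟩, h3⟩
    refine ⟨h1, fun i => ?_⟩
    by_cases hi : i = j
    · subst hi; simpa using h3
    · simpa [hi] using h2 i hi

include hcl hw in
omit [DecidableEq κ] in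
lemma isCompact_slab {r : κ → V →L[ℝ] ℝ} (h : Sep w r) (j : κ) (a b : ℝ) :
    IsCompact (Cyl S (fun i : {i // i ≠ j} => r i) ∩ {x | a ≤ r j x ∧ r j x ≤ b}) := by
  classical
  refine isCompact_of_sep h ((isClosed_Cyl hcl _).inter
    ((isClosed_ge' _ _).inter (isClosed_le' _ _))) (max (max C 1) (max |a| |b|)) ?_ ?_
  · exact fun x hx i => (hw x hx.1.1 i).trans ((le_max_left _ _).trans (le_max_left _ _))
  · rintro x ⟨⟨-, hx⟩, hx'⟩ i
    by_cases hi : i = j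
    · subst hi
      refine (abs_le_max_abs_abs hx'.1 hx'.2).trans (le_max_right _ _)
    · have := hx ⟨i, hi⟩
      refine (?_ : _ ≤ (1 : ℝ)).trans ((le_max_right C 1).trans (le_max_left _ _))
      exact abs_le.mpr ⟨by linarith [this.1], this.2⟩

omit [Fintype ι] [Fintype κ] [FiniteDimensional ℝ V] [DecidableEq κ] in
include hinv in
lemma slab_inv {r : κ → V →L[ℝ] ℝ} {j : κ} {v : V} (hv : ∀ i, w i v = 0)
    (hv' : ∀ i, i ≠ j → r i v = 0) :
    ∀ x ∈ Cyl S (fun i : {i // i ≠ j} => r i), ∀ t : ℝ,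
      x + t • v ∈ Cyl S (fun i : {i // i ≠ j} => r i) := by
  rintro x ⟨hx, hx'⟩ t
  refine ⟨hinv x hx _ fun i => by simp [hv], fun i => ?_⟩
  simpa [hv' i i.2] using hx' i

include hS hcl hw hinv hd

lemma Sep.update_add {r : κ → V →L[ℝ] ℝ} (h : Sep w r) (j : κ) {l : V →L[ℝ] ℝ}
    (hl : ∀ v, (∀ i, w i v = 0) → (∀ i, i ≠ j → r i v = 0) → l v = 0) :
    Sep w (Function.update r j (r j + l)) ∧ ∀ Φ : Set V → ℝ, SimpleVal Φ →
      Φ (Cyl S (Function.update r j (r j + l))) = Φ (Cyl S r) := by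
  constructor
  · intro x h1 h2
    have h3 : ∀ i, i ≠ j → r i x = 0 := fun i hi => by simpa [hi] using h2 i
    refine h x h1 fun i => ?_
    by_cases hi : i = j
    · subst hi; simpa [hl x h1 h3] using h2 i
    · exact h3 i hi
  · obtain ⟨v, hv, hv'⟩ := h.exists_eq hd 0 (Pi.single j 1)
    have hvj : ∀ i, i ≠ j → r i v = 0 := fun i hi => by rw [hv', Pi.single_eq_of_ne hi]
    intro Φ hΦ
    rw [Cyl_update, hΦ.slab_shear (convex_Cyl hS _) (by rw [hv', Pi.single_eq_same])
      (slab_inv hinv hv hvj) (isCompact_slab hcl hw h j) (isClosed_Cyl hcl _) (hl v hv hvj),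
      ← Cyl_update, Function.update_eq_self]

include hint

lemma Sep.update_smul {r : κ → V →L[ℝ] ℝ} (h : Sep w r) (j : κ) {t : ℝ} (ht : t ≠ 0) :
    Sep w (Function.update r j (t • r j)) ∧ ∀ Φ : Set V → ℝ, SimpleVal Φ →
      Φ (Cyl S (Function.update r j (t • r j))) = |t|⁻¹ * Φ (Cyl S r) := by
  constructor
  · intro x h1 h2
    refine h x h1 fun i => ?_
    by_cases hi : i = j
    · subst hi; simpa [ht] using h2 i
    · simpa [hi] using h2 i
  · obtain ⟨v, hv, hv'⟩ := h.exists_eq hd 0 (Pi.single j 1)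
    have hvj : ∀ i, i ≠ j → r i v = 0 := fun i hi => by rw [hv', Pi.single_eq_of_ne hi]
    have hzv : r j v = 1 := by rw [hv', Pi.single_eq_same]
    intro Φ hΦ
    have e := Cyl_update S r j (r j)
    rw [Function.update_eq_self] at e
    have key := hΦ.slab_scale (convex_Cyl hS _) hzv (slab_inv hinv hv hvj)
      (isCompact_slab hcl hw h j) (e ▸ interior_Cyl hinv hint hd h)
      (t := |t|⁻¹) (by positivity)
    rw [← e] at key
    rw [← key, Cyl_update]
    rcases lt_or_gt_of_ne ht with ht' | ht'
    · refine hΦ.trans' (t⁻¹ • v) (convex_slab (convex_Cyl hS _) _ _ _)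
        (isCompact_slab hcl hw h j _ _) fun y => ?_
      have h1 : t⁻¹ • v + y ∈ Cyl S (fun i : {i // i ≠ j} => r i) ↔
          y ∈ Cyl S (fun i : {i // i ≠ j} => r i) := by
        constructor
        · intro hy
          have := slab_inv hinv hv hvj _ hy (-t⁻¹)
          rwa [neg_smul, add_comm, neg_add_cancel_left] at this
        · intro hy
          rw [add_comm]; exact slab_inv hinv hv hvj _ hy _
      simp only [Set.mem_inter_iff, h1, Set.mem_ofPred_eq, _root_.smul_apply, map_add, map_smul,
        hzv, smul_eq_mul, mul_one, mul_add, mul_inv_cancel₀ ht, abs_of_neg ht', inv_neg]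
      refine and_congr_right fun _ => ?_
      have : r j y = t⁻¹ * (t * r j y) := by field_simp
      have ht2 : t⁻¹ < 0 := inv_neg''.mpr ht'
      constructor
      · rintro ⟨h3, h4⟩; constructor <;> nlinarith
      · rintro ⟨h3, h4⟩
        have : t * r j y = -1 + t * (r j y + t⁻¹) := by field_simp; ring
        constructor
        · have : t * (r j y + t⁻¹) ≥ 0 := mul_nonneg_of_nonpos_of_nonpos ht'.le (by linarith)
          linarith
        · have := mul_nonpos_of_nonpos_of_nonneg ht'.le h3
          linarith
    · congr 1; ext x
      simp only [Set.mem_inter_iff, Set.mem_ofPred_eq, _root_.smul_apply, smul_eq_mul,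
        abs_of_pos ht', mul_nonneg_iff_of_pos_left ht']
      rw [← one_div, le_div_iff₀ ht', mul_comm]

lemma cylRel_matrix {M : Matrix κ κ ℝ} (hM : M.det ≠ 0) :
    ∀ r : κ → V →L[ℝ] ℝ, Sep w r → Sep w (fun j => ∑ i, M j i • r i) ∧
      CylRel S r (fun j => ∑ i, M j i • r i) := by
  refine Matrix.diagonal_transvection_induction_of_det_ne_zero
    (fun M => ∀ r : κ → V →L[ℝ] ℝ, Sep w r → Sep w (fun j => ∑ i, M j i • r i) ∧
      CylRel S r (fun j => ∑ i, M j i • r i)) M hM ?_ ?_ ?_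
  · intro D hD r h
    rw [Matrix.det_diagonal, Finset.prod_ne_zero_iff] at hD
    have key : ∀ s : Finset κ, Sep w (fun j => if j ∈ s then D j • r j else r j) ∧
        CylRel S r (fun j => if j ∈ s then D j • r j else r j) := by
      intro s
      induction s using Finset.induction_on with
      | empty => simpa using ⟨h, CylRel.refl S r⟩
      | insert a s ha ih =>
        have hDa := hD a (Finset.mem_univ _)
        have := Sep.update_smul hS hcl hw hinv hint hd ih.1 a hDa
        have e : Function.update (fun j => if j ∈ s then D j • r j else r j) a
            (D a • (fun j => if j ∈ s then D j • r j else r j) a) =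
            fun j => if j ∈ insert a s then D j • r j else r j := by
          funext j
          by_cases hj : j = a
          · subst hj; simp [ha]
          · simp [hj]
        rw [e] at this
        exact ⟨this.1, ih.2.trans ⟨_, by positivity, this.2⟩⟩
    have := key Finset.univ
    simpa [Matrix.diagonal_apply] using this
  · rintro ⟨i, j, hij, c⟩ r h
    have := Sep.update_add hS hcl hw hinv hd h i (l := c • r j) fun v _ hv => by
      simp [hv j hij.symm]
    have e : Function.update r i (r i + c • r j) =
        fun a => ∑ b, (Matrix.transvection i j c) a b • r b := by
      funext a
      by_cases ha : a = i
      · subst ha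
        simp [Matrix.transvection, Matrix.single_apply, add_smul, Finset.sum_add_distrib,
          Matrix.one_apply]
      · simp [Matrix.transvection, Matrix.one_apply, ha, Ne.symm ha]
    rw [e] at this
    exact ⟨this.1, CylRel.of_eq this.2⟩
  · intro A B _ _ hA hB r h
    have h1 := hB r h
    have h2 := hA _ h1.1
    have e : (fun j => ∑ i, A j i • ∑ i', B i i' • r i') = fun j => ∑ i, (A * B) j i • r i := by
      funext j
      simp only [Matrix.mul_apply, Finset.sum_smul, Finset.smul_sum, mul_smul]
      exact Finset.sum_comm
    rw [e] at h2
    exact ⟨h2.1, h1.2.trans h2.2⟩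

theorem cylRel {r r' : κ → V →L[ℝ] ℝ} (h : Sep w r) (h' : Sep w r') : CylRel S r r' := by
  have hex := fun j => h.exists_eq hd 0 (Pi.single j 1)
  choose e he he' using hex
  have span : ∀ x, (∀ i, w i x = 0) → x = ∑ i, r i x • e i := fun x hx => by
    rw [← sub_eq_zero]
    refine h _ (fun i => by simp [hx, he]) fun i => ?_
    simp [he', Pi.single_apply]
  let M : Matrix κ κ ℝ := fun j i => r' j (e i)
  have hM : M.det ≠ 0 := by
    intro h0
    obtain ⟨c, hc, hMc⟩ := Matrix.exists_mulVec_eq_zero_iff.mpr h0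
    refine hc ?_
    have hx : ∑ i, c i • e i = 0 := h' _ (fun i => by simp [he]) fun j => by
      have := congrFun hMc j
      simpa [Matrix.mulVec, dotProduct, M, mul_comm] using this
    funext i
    have := congrArg (r i) hx
    simpa [he', Pi.single_apply] using this
  obtain ⟨h1, h2⟩ := cylRel_matrix hS hcl hw hinv hint hd hM r h
  set r₁ : κ → V →L[ℝ] ℝ := fun j => ∑ i, M j i • r i with hr₁
  have hl : ∀ j v, (∀ i, w i v = 0) → (r' j - r₁ j) v = 0 := fun j v hv => by
    have : r' j v = ∑ i, r i v * r' j (e i) := by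
      conv_lhs => rw [span v hv]
      simp
    simp [hr₁, M, this, mul_comm]
  have key : ∀ s : Finset κ, Sep w (fun j => if j ∈ s then r' j else r₁ j) ∧
      CylRel S r₁ (fun j => if j ∈ s then r' j else r₁ j) := by
    intro s
    induction s using Finset.induction_on with
    | empty => simpa using ⟨h1, CylRel.refl S r₁⟩
    | insert a s ha ih =>
      have := Sep.update_add hS hcl hw hinv hd ih.1 a (l := r' a - r₁ a) fun v hv _ => hl a v hv
      have e : Function.update (fun j => if j ∈ s then r' j else r₁ j) a
          ((fun j => if j ∈ s then r' j else r₁ j) a + (r' a - r₁ a)) =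
          fun j => if j ∈ insert a s then r' j else r₁ j := by
        funext j
        by_cases hj : j = a
        · subst hj; simp [ha]
        · simp [hj]
      rw [e] at this
      exact ⟨this.1, ih.2.trans (CylRel.of_eq this.2)⟩
  refine h2.trans ?_
  simpa using (key Finset.univ).2

end Cyl

section BoxTri

variable {V : Type*} [NormedAddCommGroup V] [NormedSpace ℝ V] {k : ℕ}

lemma Frame.symm {p q : V →L[ℝ] ℝ} {r : Fin k → V →L[ℝ] ℝ} (h : Frame p q r) : Frame q p r :=
  fun x h1 h2 h3 => h x h2 h1 h3

lemma Frame.neg {p q : V →L[ℝ] ℝ} {r : Fin k → V →L[ℝ] ℝ} (h : Frame p q r) :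
    Frame (-p) (-q) r :=
  fun x h1 h2 h3 => h x (by simpa using h1) (by simpa using h2) h3

lemma Frame.shear {p q : V →L[ℝ] ℝ} {r : Fin k → V →L[ℝ] ℝ} (h : Frame p q r) (s : ℝ) :
    Frame p (q + s • p) r :=
  fun x h1 h2 h3 => h x h1 (by simpa [h1] using h2) h3

lemma Frame.smul {p q : V →L[ℝ] ℝ} {r : Fin k → V →L[ℝ] ℝ} (h : Frame p q r) {t : ℝ}
    (ht : t ≠ 0) : Frame p (t • q) r :=
  fun x h1 h2 h3 => h x h1 (by simpa [ht] using h2) h3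

lemma Box_symm (p q : V →L[ℝ] ℝ) (r : Fin k → V →L[ℝ] ℝ) : Box p q r = Box q p r := by
  ext x; simp only [Box, Set.mem_ofPred_eq]; tauto

lemma Tri_symm (p q : V →L[ℝ] ℝ) (r : Fin k → V →L[ℝ] ℝ) : Tri p q r = Tri q p r := by
  ext x; simp only [Tri, Set.mem_ofPred_eq, add_comm (p x)]; tauto

lemma Box_eq_Cyl (p q : V →L[ℝ] ℝ) (r : Fin k → V →L[ℝ] ℝ) :
    Box p q r = Cyl Set.univ (Fin.cons p (Fin.cons q r) : Fin (k + 2) → V →L[ℝ] ℝ) := by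
  ext x
  simp only [Box, Cyl, Set.mem_ofPred_eq, Set.univ_inter, Fin.forall_fin_succ, Fin.cons_zero,
    Fin.cons_succ]
  tauto

lemma Frame.sep {p q : V →L[ℝ] ℝ} {r : Fin k → V →L[ℝ] ℝ} (h : Frame p q r) :
    Sep (Fin.elim0 : Fin 0 → V →L[ℝ] ℝ) (Fin.cons p (Fin.cons q r) : Fin (k + 2) → V →L[ℝ] ℝ) :=
  fun x _ h2 => h x (h2 0) (h2 1) fun i => h2 i.succ.succ

variable [FiniteDimensional ℝ V] {Φ : Set V → ℝ}

lemma Frame.cylRel_box (hk : finrank ℝ V = k + 2) {p q p' q' : V →L[ℝ] ℝ}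
    {r r' : Fin k → V →L[ℝ] ℝ} (h : Frame p q r) (h' : Frame p' q' r') : ∃ t : ℝ, 0 < t ∧
      ∀ Φ : Set V → ℝ, SimpleVal Φ → Φ (Box p' q' r') = t * Φ (Box p q r) := by
  simp only [Box_eq_Cyl]
  exact cylRel (C := 0) convex_univ isClosed_univ (fun _ _ i => i.elim0) (fun _ _ _ _ => trivial)
    (by simp) (by simp [hk]) h.sep h'.sep

lemma Frame.interior_Box (hk : finrank ℝ V = k + 2) {p q : V →L[ℝ] ℝ} {r : Fin k → V →L[ℝ] ℝ}
    (h : Frame p q r) : (interior (Box p q r)).Nonempty := by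
  rw [Box_eq_Cyl]
  exact interior_Cyl (fun _ _ _ _ => Set.mem_univ _) (by simp) (by simp [hk]) h.sep

lemma SimpleVal.box_shear (hΦ : SimpleVal Φ) (hk : finrank ℝ V = k + 2) {p q : V →L[ℝ] ℝ}
    {r : Fin k → V →L[ℝ] ℝ} (h : Frame p q r) (s : ℝ) :
    Φ (Box p (q + s • p) r) = Φ (Box p q r) := by
  have := (Sep.update_add (C := 0) convex_univ isClosed_univ (fun _ _ i => i.elim0)
    (fun _ _ _ _ => trivial) (by simp [hk]) h.sep 1 (l := s • p) fun v _ hv => by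
      simpa using Or.inr (hv 0 (by simp))).2 Φ hΦ
  rw [Box_eq_Cyl, Box_eq_Cyl, ← this]
  congr 2
  funext i
  refine Fin.cases (by simp) (fun i => Fin.cases (by simp) (fun i => ?_) i) i
  rw [Function.update_of_ne (by simp [Fin.ext_iff])]
  rfl

lemma SimpleVal.box_smul (hΦ : SimpleVal Φ) (hk : finrank ℝ V = k + 2) {p q : V →L[ℝ] ℝ}
    {r : Fin k → V →L[ℝ] ℝ} (h : Frame p q r) {t : ℝ} (ht : t ≠ 0) :
    Φ (Box p (t • q) r) = |t|⁻¹ * Φ (Box p q r) := by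
  have := (Sep.update_smul (C := 0) convex_univ isClosed_univ (fun _ _ i => i.elim0)
    (fun _ _ _ _ => trivial) (by simp) (by simp [hk]) h.sep 1 ht).2 Φ hΦ
  rw [Box_eq_Cyl, Box_eq_Cyl, ← this]
  congr 2
  funext i
  refine Fin.cases (by simp) (fun i => Fin.cases ?_ (fun i => ?_) i) i
  · rfl
  rw [Function.update_of_ne (by simp [Fin.ext_iff])]
  rfl

lemma Frame.cylRel_tri (hk : finrank ℝ V = k + 2) {p q : V →L[ℝ] ℝ}
    {r r' : Fin k → V →L[ℝ] ℝ} (h : Frame p q r) (h' : Frame p q r') : ∃ t : ℝ, 0 < t ∧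
      ∀ Φ : Set V → ℝ, SimpleVal Φ → Φ (Tri p q r') = t * Φ (Tri p q r) := by
  have e : ∀ r : Fin k → V →L[ℝ] ℝ, Tri p q r = Cyl {x | 0 ≤ p x ∧ 0 ≤ q x ∧ (p + q) x ≤ 1} r :=
    fun r => by ext x; simp only [Tri, Cyl, Set.mem_inter_iff, Set.mem_ofPred_eq,
      _root_.add_apply, and_assoc]
  have hs : ∀ {r : Fin k → V →L[ℝ] ℝ}, Frame p q r → Sep ![p, q] r :=
    fun h x h1 h2 => h x (h1 0) (h1 1) h2
  have hint : (interior {x | 0 ≤ p x ∧ 0 ≤ q x ∧ (p + q) x ≤ 1}).Nonempty :=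
    (h.interior_Tri hk).mono (interior_mono (by rw [e]; exact Set.inter_subset_left))
  simp only [e]
  refine cylRel (C := 1) ((convex_ge p 0).inter ((convex_ge q 0).inter (convex_le (p + q) 1)))
    ((isClosed_ge' p 0).inter ((isClosed_ge' q 0).inter (isClosed_le' (p + q) 1))) ?_ ?_ hint
    (by simp [hk, add_comm]) (hs h) (hs h')
  · rintro x ⟨h1, h2, h3⟩
    rw [Set.mem_ofPred_eq] at h1 h2 h3
    rw [_root_.add_apply] at h3
    rw [Fin.forall_fin_two]
    constructor
    · simpa [abs_of_nonneg h1] using by linarith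
    · simpa [abs_of_nonneg h2] using by linarith
  · intro x hx v hv
    have h1 : p v = 0 := hv 0
    have h2 : q v = 0 := hv 1
    simpa [h1, h2] using hx

/-- Triangular prisms whose triangle is scaled by `s`. -/
def TriS (p q : V →L[ℝ] ℝ) (r : Fin k → V →L[ℝ] ℝ) (s : ℝ) : Set V :=
  {x | 0 ≤ p x ∧ 0 ≤ q x ∧ p x + q x ≤ s ∧ ∀ i, 0 ≤ r i x ∧ r i x ≤ 1}

omit [FiniteDimensional ℝ V] in
lemma isClosed_cube (r : Fin k → V →L[ℝ] ℝ) : IsClosed {x | ∀ i, 0 ≤ r i x ∧ r i x ≤ 1} := by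
  simpa [Cyl] using isClosed_Cyl isClosed_univ r

omit [FiniteDimensional ℝ V] in
lemma convex_cube (r : Fin k → V →L[ℝ] ℝ) : Convex ℝ {x | ∀ i, 0 ≤ r i x ∧ r i x ≤ 1} := by
  simpa [Cyl] using convex_Cyl convex_univ r

omit [FiniteDimensional ℝ V] in
lemma convex_TriS (p q : V →L[ℝ] ℝ) (r : Fin k → V →L[ℝ] ℝ) (s : ℝ) : Convex ℝ (TriS p q r s) :=
  (convex_ge p 0).inter ((convex_ge q 0).inter ((convex_le (p + q) s).inter (convex_cube r)))

lemma Frame.isCompact_TriS {p q : V →L[ℝ] ℝ} {r : Fin k → V →L[ℝ] ℝ} (h : Frame p q r) (s : ℝ) :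
    IsCompact (TriS p q r s) := by
  refine h.isCompact_bounded ((isClosed_ge' p 0).inter ((isClosed_ge' q 0).inter
    ((isClosed_le' (p + q) s).inter (isClosed_cube r)))) (max s 1) ?_
  rintro x ⟨h1, h2, h3, h4⟩
  refine ⟨?_, ?_, fun i => ?_⟩
  · rw [abs_of_nonneg h1]; exact le_max_of_le_left (by linarith)
  · rw [abs_of_nonneg h2]; exact le_max_of_le_left (by linarith)
  · rw [abs_of_nonneg (h4 i).1]; exact le_max_of_le_right (h4 i).2

variable (hΦ : SimpleVal Φ) (hk : finrank ℝ V = k + 2)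
  (hB : ∀ (p q : V →L[ℝ] ℝ) (r : Fin k → V →L[ℝ] ℝ), Frame p q r → Φ (Box p q r) = 0)
include hΦ hk hB

lemma SimpleVal.triS_add {p q : V →L[ℝ] ℝ} {r : Fin k → V →L[ℝ] ℝ} (h : Frame p q r)
    {s t : ℝ} (hs : 0 < s) (ht : 0 < t) :
    Φ (TriS p q r (s + t)) = Φ (TriS p q r s) + Φ (TriS p q r t) := by
  have hp : p ≠ 0 := by simpa using h.ne_zero hk 1 0 (by simp)
  have hq : q ≠ 0 := by simpa using h.ne_zero hk 0 1 (by simp)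
  obtain ⟨v, hv1, hv2, hv3⟩ := h.exists_eq hk s 0 0
  obtain ⟨v', hv1', hv2', hv3'⟩ := h.exists_eq hk 0 t 0
  have hc := (convex_TriS p q r (s + t)).inter (convex_le p s)
  have hc' := (h.isCompact_TriS (s + t)).inter_right (isClosed_le' p s)
  rw [hΦ.cut _ p s (convex_TriS p q r _) (h.isCompact_TriS _) hp, hΦ.cut _ q t hc hc' hq]
  have e1 : TriS p q r (s + t) ∩ {x | p x ≤ s} ∩ {x | q x ≤ t} = Box (s⁻¹ • p) (t⁻¹ • q) r := by
    ext x
    simp only [TriS, Box, Set.mem_inter_iff, Set.mem_ofPred_eq, _root_.smul_apply, smul_eq_mul,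
      inv_mul_le_iff₀ hs, inv_mul_le_iff₀ ht, mul_one,
      mul_nonneg_iff_of_pos_left (inv_pos.mpr hs), mul_nonneg_iff_of_pos_left (inv_pos.mpr ht)]
    constructor
    · rintro ⟨⟨⟨h1, h2, h3, h4⟩, h5⟩, h6⟩; exact ⟨h1, h5, h2, h6, h4⟩
    · rintro ⟨h1, h5, h2, h6, h4⟩; exact ⟨⟨⟨h1, h2, by linarith, h4⟩, h5⟩, h6⟩
  have e2 : Φ (TriS p q r (s + t) ∩ {x | p x ≤ s} ∩ {x | t ≤ q x}) = Φ (TriS p q r s) := by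
    refine hΦ.trans' v' (convex_TriS p q r s) (h.isCompact_TriS s) fun y => ?_
    simp only [TriS, Set.mem_inter_iff, Set.mem_ofPred_eq, map_add, hv1', hv2', hv3',
      Pi.zero_apply, zero_add]
    constructor
    · rintro ⟨⟨⟨h1, h2, h3, h4⟩, h5⟩, h6⟩; exact ⟨h1, by linarith, by linarith, h4⟩
    · rintro ⟨h1, h2, h3, h4⟩
      exact ⟨⟨⟨h1, by linarith, by linarith, h4⟩, by linarith⟩, by linarith⟩
  have e3 : Φ (TriS p q r (s + t) ∩ {x | s ≤ p x}) = Φ (TriS p q r t) := by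
    refine hΦ.trans' v (convex_TriS p q r t) (h.isCompact_TriS t) fun y => ?_
    simp only [TriS, Set.mem_inter_iff, Set.mem_ofPred_eq, map_add, hv1, hv2, hv3,
      Pi.zero_apply, zero_add]
    constructor
    · rintro ⟨⟨h1, h2, h3, h4⟩, h5⟩; exact ⟨by linarith, h2, by linarith, h4⟩
    · rintro ⟨h1, h2, h3, h4⟩; exact ⟨⟨by linarith, h2, by linarith, h4⟩, by linarith⟩
  rw [e1, e2, e3, hB _ _ _ ((h.smul (inv_ne_zero ht.ne')).symm.smul (inv_ne_zero hs.ne')).symm,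
    zero_add]

lemma SimpleVal.triS_eq {p q : V →L[ℝ] ℝ} {r : Fin k → V →L[ℝ] ℝ} (h : Frame p q r)
    {s : ℝ} (hs : 0 ≤ s) : Φ (TriS p q r s) = s * Φ (Tri p q r) := by
  have hq : q ≠ 0 := by simpa using h.ne_zero hk 0 1 (by simp)
  have h0 : Φ (TriS p q r 0) = 0 :=
    hΦ.null_of_const (convex_TriS p q r 0) (h.isCompact_TriS 0) hq (c := 0)
      fun x ⟨h1, h2, h3, _⟩ => by linarith
  refine linear_of_additive_nonneg (f := fun s => Φ (TriS p q r s)) (fun s t hs ht => ?_)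
    (fun ε hε => ?_) hs
  · rcases hs.eq_or_lt with rfl | hs
    · simp [h0]
    rcases ht.eq_or_lt with rfl | ht
    · simp [h0]
    exact hΦ.triS_add hk hB h hs ht
  · obtain ⟨δ, hδ, H⟩ := hΦ.cont _ (convex_TriS p q r 1) (h.isCompact_TriS 1)
      (h.interior_Tri hk) ε hε
    obtain ⟨v, hv1, hv2, hv3⟩ := h.exists_eq hk 1 0 0
    obtain ⟨v', hv1', hv2', hv3'⟩ := h.exists_eq hk 0 1 0
    have close : ∀ a b : ℝ, 0 ≤ b → |a - b| * (‖v‖ + ‖v'‖) ≤ δ →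
        TriS p q r a ⊆ Metric.cthickening δ (TriS p q r b) := by
      rintro a b hb hab x ⟨h1, h2, h3, h4⟩
      set c := min b (p x) with hc
      set d := min (b - c) (q x) with hd
      have hcb : c ≤ b := min_le_left _ _
      have hcp : c ≤ p x := min_le_right _ _
      have hdb : d ≤ b - c := min_le_left _ _
      have hdq : d ≤ q x := min_le_right _ _
      have hc0 : 0 ≤ c := le_min hb h1
      have hd0 : 0 ≤ d := le_min (by linarith) h2
      have hab1 := le_abs_self (a - b)
      have hab2 := abs_nonneg (a - b)
      have k1 : |p x - c| ≤ |a - b| := by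
        rw [abs_of_nonneg (by linarith)]
        rcases min_choice b (p x) with h | h <;> rw [← hc] at h <;> linarith
      have k2 : |q x - d| ≤ |a - b| := by
        rw [abs_of_nonneg (by linarith)]
        rcases min_choice (b - c) (q x) with h | h <;> rw [← hd] at h <;> linarith
      refine Metric.mem_cthickening_of_dist_le x (x - ((p x - c) • v + (q x - d) • v')) _ _
        ?_ ?_
      · simp only [TriS, Set.mem_ofPred_eq, map_sub, map_add, map_smul, hv1, hv2, hv3, hv1', hv2',
          hv3', smul_eq_mul, Pi.zero_apply, mul_one, mul_zero, zero_add, add_zero, sub_zero,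
          sub_sub_cancel]
        exact ⟨hc0, hd0, by linarith, h4⟩
      · rw [dist_eq_norm, sub_sub_cancel]
        refine (norm_add_le _ _).trans (le_trans ?_ hab)
        rw [norm_smul, norm_smul, Real.norm_eq_abs, Real.norm_eq_abs, mul_add]
        exact add_le_add (mul_le_mul_of_nonneg_right k1 (norm_nonneg _))
          (mul_le_mul_of_nonneg_right k2 (norm_nonneg _))
    have hv := norm_nonneg v
    have hv' := norm_nonneg v'
    refine ⟨min 1 (δ / (‖v‖ + ‖v'‖ + 1)), by positivity, fun t ht => ?_⟩
    rw [lt_min_iff, lt_div_iff₀ (by positivity)] at ht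
    have h0 := abs_nonneg (t - 1)
    refine H _ (convex_TriS p q r t) (h.isCompact_TriS t) (close _ _ zero_le_one (by nlinarith))
      (close _ _ (by linarith [(abs_lt.mp ht.1).1]) (by rw [abs_sub_comm]; nlinarith))

end BoxTri

section Cobound

variable {E : Type*} [AddCommGroup E] [Module ℝ E] {F : E → E → ℝ}

/-- Algebraic properties of a normalized triangle functional. -/
structure TriFun (F : E → E → ℝ) : Prop where
  self : ∀ x (t : ℝ), F x (t • x) = 0
  symm : ∀ x y, F x y = F y x
  smul : ∀ (t : ℝ) x y, F (t • x) (t • y) = t * F x y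
  split : ∀ x y (s t : ℝ), F x (s • y) + F (x + s • y) (t • y) = F x ((s + t) • y)

lemma triFun_of_pos (h0 : ∀ x (t : ℝ), F x (t • x) = 0) (hs : ∀ x y, F x y = F y x)
    (hn : ∀ x y, F (-x) (-y) = -F x y) (ht : ∀ (t : ℝ) x y, 0 < t → F (t • x) (t • y) = t * F x y)
    (hr : ∀ x y, F x y = F y (-(x + y)))
    (hc : ∀ x y (s t : ℝ), 0 < s → 0 < t →
      F x (s • y) + F (x + s • y) (t • y) = F x ((s + t) • y)) : TriFun F := by
  have hx0 : ∀ x, F x 0 = 0 := fun x => by simpa using h0 x 0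
  have refl : ∀ x y, F (x + y) (-y) = -F x y := fun x y => by
    rw [hr x y, hs y, ← hn, neg_neg]
  refine ⟨h0, hs, fun t x y => ?_, fun x y s t => ?_⟩
  · rcases lt_trichotomy t 0 with h | rfl | h
    · have := ht (-t) x y (by linarith)
      rw [neg_smul, neg_smul, hn] at this
      linarith
    · simp [hx0]
    · exact ht t x y h
  · let G : ℝ → ℝ → ℝ := fun a b => F (x + a • y) ((b - a) • y)
    have Gr : ∀ a b, G b a = -G a b := fun a b => by
      have e1 : x + b • y = x + a • y + (b - a) • y := by module
      have e2 : (a - b) • y = -((b - a) • y) := by module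
      change F (x + b • y) ((a - b) • y) = _
      rw [e1, e2]
      exact refl _ _
    have Gs : ∀ a, G a a = 0 := fun a => by simp [G, hx0]
    have Gp : ∀ a b c, a < b → b < c → G a b + G b c = G a c := fun a b c h1 h2 => by
      have := hc (x + a • y) y (b - a) (c - b) (by linarith) (by linarith)
      convert this using 3 <;> module
    have Gt : ∀ a b c, G a b + G b c = G a c := by
      intro a b c
      have r1 := Gr a b
      have r2 := Gr b c
      have r3 := Gr a c
      rcases lt_trichotomy a b with h1 | rfl | h1
      · rcases lt_trichotomy b c with h2 | rfl | h2
        · exact Gp a b c h1 h2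
        · rw [Gs, add_zero]
        · rcases lt_trichotomy a c with h3 | rfl | h3
          · linarith [Gp a c b h3 h2]
          · rw [Gs]; linarith
          · linarith [Gp c a b h3 h1]
      · rw [Gs, zero_add]
      · rcases lt_trichotomy b c with h2 | rfl | h2
        · rcases lt_trichotomy a c with h3 | rfl | h3
          · linarith [Gp b a c h1 h3]
          · rw [Gs]; linarith
          · linarith [Gp b c a h2 h3]
        · rw [Gs, add_zero]
        · linarith [Gp c b a h2 h1]
    have := Gt 0 s (s + t)
    simpa [G] using this

namespace TriFun

lemma sub_cobound (h : TriFun F) {g : E → ℝ} (hg : ∀ (t : ℝ) x, g (t • x) = t * g x) :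
    TriFun fun x y => F x y - (g (x + y) - g x - g y) where
  self x t := by
    have : x + t • x = (1 + t) • x := by module
    rw [h.self, this, hg, hg]; ring
  symm x y := by rw [h.symm, add_comm x y]; ring
  smul t x y := by rw [h.smul, ← smul_add, hg, hg, hg]; ring
  split x y s t := by
    have := h.split x y s t
    have e : x + s • y + t • y = x + (s + t) • y := by module
    rw [e, hg, hg, hg]
    linarith

lemma comp (h : TriFun F) {E' : Type*} [AddCommGroup E'] [Module ℝ E'] (f : E' →ₗ[ℝ] E) :
    TriFun fun x y => F (f x) (f y) where
  self x t := by rw [map_smul, h.self]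
  symm x y := h.symm _ _
  smul t x y := by rw [map_smul, map_smul, h.smul]
  split x y s t := by simpa using h.split (f x) (f y) s t

lemma eq_zero_of_axes {F : ℝ × ℝ → ℝ × ℝ → ℝ} (h : TriFun F)
    (h0 : ∀ a b, F (a, 0) (0, b) = 0) (u v : ℝ × ℝ) : F u v = 0 := by
  have key : ∀ p q : ℝ × ℝ, (∀ s : ℝ, F p (s • q) = 0) → ∀ s t : ℝ, F (p + s • q) (t • q) = 0 :=
    fun p q hpq s t => by
      have := h.split p q s t
      rw [hpq, hpq, zero_add] at this
      exact this
  have h1 : ∀ (u : ℝ × ℝ) (t : ℝ), F u (t • ((1 : ℝ), (0 : ℝ))) = 0 := fun u t => by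
    have := key (0, u.2) (1, 0) (fun s => by rw [h.symm]; simpa using h0 s u.2) u.1 t
    simpa using this
  by_cases hv : v.2 = 0
  · have := h1 u v.1
    have e : v.1 • ((1 : ℝ), (0 : ℝ)) = v := by ext <;> simp [hv]
    rwa [e] at this
  · have := key (u.1 - u.2 / v.2 * v.1, 0) v (fun s => by
      rw [h.symm]
      simpa using h1 (s • v) (u.1 - u.2 / v.2 * v.1)) (u.2 / v.2) 1
    rw [one_smul] at this
    convert this using 2
    ext <;> simp [hv]

lemma planar (h : TriFun F) (b c : E) : ∃ g : ℝ × ℝ → ℝ, ∀ u v : ℝ × ℝ,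
    F (u.1 • b + u.2 • c) (v.1 • b + v.2 • c) = g (u + v) - g u - g v := by
  let f : ℝ × ℝ →ₗ[ℝ] E :=
    (LinearMap.toSpanSingleton ℝ E b).coprod (LinearMap.toSpanSingleton ℝ E c)
  have hf : ∀ u : ℝ × ℝ, f u = u.1 • b + u.2 • c := fun u => by simp [f]
  have h1 := h.comp f
  have hz : ∀ x, F x 0 = 0 := fun x => by simpa using h.self x 0
  let g : ℝ × ℝ → ℝ := fun u => F (u.1 • b) (u.2 • c)
  have hg : ∀ (t : ℝ) x, g (t • x) = t * g x := fun t x => by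
    simp only [g, ← h.smul, smul_smul, Prod.smul_fst, Prod.smul_snd, smul_eq_mul]
  refine ⟨g, fun u v => ?_⟩
  have := (h1.sub_cobound hg).eq_zero_of_axes (fun a d => by
    simp [hf, g, hz, h.symm 0]) u v
  simp only [hf] at this
  linarith

lemma cocycle (h : TriFun F) (hc : ∀ x y z, LinearIndependent ℝ ![x, y, z] →
    F x y + F (x + y) z = F y z + F x (y + z)) (x y z : E) :
    F x y + F (x + y) z = F y z + F x (y + z) := by
  by_cases hl : LinearIndependent ℝ ![x, y, z]
  · exact hc x y z hl
  obtain ⟨b, c, u, v, w, rfl, rfl, rfl⟩ : ∃ (b c : E) (u v w : ℝ × ℝ), x = u.1 • b + u.2 • c ∧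
      y = v.1 • b + v.2 • c ∧ z = w.1 • b + w.2 • c := by
    rw [Fintype.not_linearIndependent_iff] at hl
    obtain ⟨a, ha, i, hi⟩ := hl
    simp only [Fin.sum_univ_three, Matrix.cons_val_zero, Matrix.cons_val_one,
      Matrix.cons_val] at ha
    fin_cases i
    · refine ⟨y, z, (-(a 0)⁻¹ * a 1, -(a 0)⁻¹ * a 2), (1, 0), (0, 1), ?_, by simp, by simp⟩
      have hi : a 0 ≠ 0 := hi
      have : x = (a 0)⁻¹ • (a 0 • x) := by rw [smul_smul, inv_mul_cancel₀ hi, one_smul]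
      rw [this]
      linear_combination (norm := module) (a 0)⁻¹ • ha
    · refine ⟨x, z, (1, 0), (-(a 1)⁻¹ * a 0, -(a 1)⁻¹ * a 2), (0, 1), by simp, ?_, by simp⟩
      have hi : a 1 ≠ 0 := hi
      have : y = (a 1)⁻¹ • (a 1 • y) := by rw [smul_smul, inv_mul_cancel₀ hi, one_smul]
      rw [this]
      linear_combination (norm := module) (a 1)⁻¹ • ha
    · refine ⟨x, y, (1, 0), (0, 1), (-(a 2)⁻¹ * a 0, -(a 2)⁻¹ * a 1), by simp, by simp, ?_⟩
      have hi : a 2 ≠ 0 := hi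
      have : z = (a 2)⁻¹ • (a 2 • z) := by rw [smul_smul, inv_mul_cancel₀ hi, one_smul]
      rw [this]
      linear_combination (norm := module) (a 2)⁻¹ • ha
  obtain ⟨g, hg⟩ := h.planar b c
  have e : ∀ u v : ℝ × ℝ, (u.1 • b + u.2 • c) + (v.1 • b + v.2 • c) =
      (u + v).1 • b + (u + v).2 • c := fun u v => by
    simp only [Prod.fst_add, Prod.snd_add]; module
  rw [e, e, hg, hg, hg, hg, add_assoc u v w]
  ring

/-- Underlying type of the extension of `E` by `ℝ` defined by a cocycle. -/
def Tw (E : Type*) : Type _ := E × ℝ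

theorem exists_cobound (h : TriFun F) (hc : ∀ x y z, LinearIndependent ℝ ![x, y, z] →
    F x y + F (x + y) z = F y z + F x (y + z)) :
    ∃ g : E → ℝ, (∀ (t : ℝ) x, g (t • x) = t * g x) ∧ ∀ x y, g (x + y) = g x + g y + F x y := by
  have hco := h.cocycle hc
  have hx0 : ∀ x, F x 0 = 0 := fun x => by simpa using h.self x 0
  have h0x : ∀ x, F 0 x = 0 := fun x => by rw [h.symm, hx0]
  let z : Zero (Tw E) := ⟨((0 : E), (0 : ℝ))⟩
  let n : Neg (Tw E) := ⟨fun a => (-a.1, -a.2)⟩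
  let s : Add (Tw E) := ⟨fun a b => (a.1 + b.1, a.2 + b.2 + F a.1 b.1)⟩
  let i1 : AddCommGroup (Tw E) :=
    { z, n, s with
      nsmul := nsmulRec
      zsmul := zsmulRec
      add_assoc := fun a b c => Prod.ext (add_assoc _ _ _) (by
        change a.2 + b.2 + F a.1 b.1 + c.2 + F (a.1 + b.1) c.1 =
          a.2 + (b.2 + c.2 + F b.1 c.1) + F a.1 (b.1 + c.1)
        linarith [hco a.1 b.1 c.1])
      zero_add := fun a => Prod.ext (zero_add _) (by
        change 0 + a.2 + F 0 a.1 = a.2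
        rw [h0x]; ring)
      add_zero := fun a => Prod.ext (add_zero _) (by
        change a.2 + 0 + F a.1 0 = a.2
        rw [hx0]; ring)
      neg_add_cancel := fun a => Prod.ext (neg_add_cancel _) (by
        change -a.2 + a.2 + F (-a.1) a.1 = 0
        have := h.self a.1 (-1)
        rw [neg_one_smul] at this
        rw [h.symm, this]; ring)
      add_comm := fun a b => Prod.ext (add_comm _ _) (by
        change a.2 + b.2 + F a.1 b.1 = b.2 + a.2 + F b.1 a.1
        rw [h.symm]; ring) }
  let i2 : Module ℝ (Tw E) :=
    { smul := fun t a => (t • a.1, t * a.2)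
      one_smul := fun a => Prod.ext (one_smul ℝ _) (one_mul _)
      mul_smul := fun s t a => Prod.ext (mul_smul _ _ _) (mul_assoc _ _ _)
      smul_zero := fun t => Prod.ext (smul_zero _) (mul_zero _)
      zero_smul := fun a => Prod.ext (zero_smul _ _) (zero_mul _)
      smul_add := fun t a b => Prod.ext (smul_add _ _ _) (by
        change t * (a.2 + b.2 + F a.1 b.1) = t * a.2 + t * b.2 + F (t • a.1) (t • b.1)
        rw [h.smul]; ring)
      add_smul := fun s t a => Prod.ext (add_smul _ _ _) (by
        change (s + t) * a.2 = s * a.2 + t * a.2 + F (s • a.1) (t • a.1)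
        have : F (s • a.1) (t • a.1) = 0 := by
          rcases eq_or_ne s 0 with rfl | hs
          · rw [zero_smul, h0x]
          · have := h.self (s • a.1) (t / s)
            rwa [smul_smul, div_mul_cancel₀ _ hs] at this
        rw [this]; ring) }
  let π : Tw E →ₗ[ℝ] E :=
    { toFun := fun a => a.1
      map_add' := fun _ _ => rfl
      map_smul' := fun _ _ => rfl }
  obtain ⟨σ, hσ⟩ := π.exists_rightInverse_of_surjective
    (LinearMap.range_eq_top.mpr fun x => ⟨(x, 0), rfl⟩)
  have hσ1 : ∀ x, (σ x).1 = x := fun x => LinearMap.congr_fun hσ x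
  refine ⟨fun x => (σ x).2, fun t x => ?_, fun x y => ?_⟩
  · exact congrArg Prod.snd (map_smul σ t x)
  · have := congrArg Prod.snd (map_add σ x y)
    change _ = (σ x).2 + (σ y).2 + F (σ x).1 (σ y).1 at this
    rwa [hσ1, hσ1] at this

end TriFun

end Cobound

section TriDensity

variable {V : Type*} [NormedAddCommGroup V] [NormedSpace ℝ V] [FiniteDimensional ℝ V]

omit [FiniteDimensional ℝ V] in
lemma neg_one_smul_clm (q : V →L[ℝ] ℝ) : (-1 : ℝ) • q = -q := by ext; simp

lemma exists_sep_of_linearIndependent {j m : ℕ} (hd : finrank ℝ V = j + m)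
    {f : Fin j → V →L[ℝ] ℝ} (hf : LinearIndependent ℝ f) : ∃ r : Fin m → V →L[ℝ] ℝ, Sep f r := by
  let A : V →ₗ[ℝ] (Fin j → ℝ) := LinearMap.pi fun i => (f i).toLinearMap
  have hA : LinearMap.range A = ⊤ := by
    by_contra hne
    obtain ⟨φ, hφ, hle⟩ := Submodule.exists_le_ker_of_lt_top _ (lt_top_iff_ne_top.mpr hne)
    refine hφ (LinearMap.pi_ext' fun i => LinearMap.ext_ring ?_)
    have hz : ∑ i, φ (Pi.single i 1) • f i = 0 := by
      ext x
      have h1 : φ (A x) = 0 := hle ⟨x, rfl⟩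
      have h2 : ∀ i : Fin j, (fun l => if i = l then (1 : ℝ) else 0) = Pi.single i 1 := fun i => by
        funext l; simp [Pi.single_apply, eq_comm]
      rw [LinearMap.pi_apply_eq_sum_univ] at h1
      simp only [h2] at h1
      simpa [A, mul_comm] using h1
    simpa using Fintype.linearIndependent_iff.mp hf _ hz i
  have hK : finrank ℝ (LinearMap.ker A) = m := by
    have := A.finrank_range_add_finrank_ker
    rw [hA, finrank_top, finrank_fin_fun, hd] at this
    omega
  let b := finBasisOfFinrankEq ℝ (LinearMap.ker A) hK
  have hex := fun i => (b.coord i).exists_extend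
  choose r hr using hex
  refine ⟨fun i => LinearMap.toContinuousLinearMap (r i), fun x h1 h2 => ?_⟩
  have hx : x ∈ LinearMap.ker A := by
    rw [LinearMap.mem_ker]; funext i; exact h1 i
  have : (⟨x, hx⟩ : LinearMap.ker A) = 0 := by
    refine b.ext_elem fun i => ?_
    have h3 := LinearMap.congr_fun (hr i) ⟨x, hx⟩
    have h4 : r i x = 0 := h2 i
    simp only [LinearMap.comp_apply, Submodule.subtype_apply, h4] at h3
    simpa using h3.symm
  exact congrArg Subtype.val this

variable {k : ℕ}

lemma exists_frame (hk : finrank ℝ V = k + 2) {p q : V →L[ℝ] ℝ}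
    (h : LinearIndependent ℝ ![p, q]) : ∃ r : Fin k → V →L[ℝ] ℝ, Frame p q r := by
  obtain ⟨r, hr⟩ := exists_sep_of_linearIndependent (m := k) (by omega) h
  exact ⟨r, fun x h1 h2 h3 => hr x (by rw [Fin.forall_fin_two]; exact ⟨h1, h2⟩) h3⟩

omit [FiniteDimensional ℝ V] in
lemma frame_cons {p q z : V →L[ℝ] ℝ} {r : Fin k → V →L[ℝ] ℝ} :
    Frame p q (Fin.cons z r : Fin (k + 1) → V →L[ℝ] ℝ) ↔
      ∀ x, p x = 0 → q x = 0 → z x = 0 → (∀ i, r i x = 0) → x = 0 := by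
  simp only [Frame, Fin.forall_fin_succ, Fin.cons_zero, Fin.cons_succ, and_imp]

lemma exists_frame_cons (hk : finrank ℝ V = k + 1 + 2) {p q z : V →L[ℝ] ℝ}
    (h : LinearIndependent ℝ ![p, q, z]) :
    ∃ r : Fin k → V →L[ℝ] ℝ, Frame p q (Fin.cons z r : Fin (k + 1) → V →L[ℝ] ℝ) := by
  obtain ⟨r, hr⟩ := exists_sep_of_linearIndependent (m := k) (by omega) h
  refine ⟨r, frame_cons.mpr fun x h1 h2 h3 h4 => hr x (fun i => ?_) h4⟩
  fin_cases i <;> assumption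

variable [MeasurableSpace V] [BorelSpace V] (μ : Measure V) [μ.IsAddHaarMeasure]

omit [BorelSpace V] in
lemma Frame.measure_box_pos (hk : finrank ℝ V = k + 2) {p q : V →L[ℝ] ℝ}
    {r : Fin k → V →L[ℝ] ℝ} (h : Frame p q r) : 0 < (μ (Box p q r)).toReal :=
  ENNReal.toReal_pos (Measure.measure_pos_of_nonempty_interior μ (h.interior_Box hk)).ne'
    h.isCompact_Box.measure_lt_top.ne

lemma Frame.measure_box_eq (hk : finrank ℝ V = k + 2) {p q : V →L[ℝ] ℝ}
    {r : Fin k → V →L[ℝ] ℝ} (h : Frame p q r) :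
    (μ (Box p q r)).toReal = 2 * (μ (Tri p q r)).toReal := by
  have h1 := (simpleVal_measure μ).box_eq h hk
  obtain ⟨v, hv1, hv2, hv3⟩ := h.exists_eq hk 0 0 1
  have e : μ (Tri (-p) (-q) r) = μ (Tri p q r) := by
    rw [← Measure.measure_neg μ (Tri (-p) (-q) r), ← measure_preimage_add μ v (Tri p q r)]
    congr 1
    ext y
    simp only [Tri, Set.mem_neg, Set.mem_preimage, Set.mem_ofPred_eq, _root_.neg_apply, map_neg,
      neg_neg, map_add, hv1, hv2, hv3, zero_add, Pi.one_apply]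
    refine and_congr_right fun _ => and_congr_right fun _ => and_congr_right fun _ =>
      forall_congr' fun i => ?_
    constructor <;> rintro ⟨h1, h2⟩ <;> constructor <;> linarith
  rw [e] at h1
  linarith

variable (k) in
open Classical in
/-- The ratio of `Φ (Tri p q r)` to the volume of `Box p q r`; it does not depend on `r`. -/
def triDens (Φ : Set V → ℝ) (p q : V →L[ℝ] ℝ) : ℝ :=
  if h : ∃ r : Fin k → V →L[ℝ] ℝ, Frame p q r then
    Φ (Tri p q h.choose) / (μ (Box p q h.choose)).toReal else 0

omit [FiniteDimensional ℝ V] [BorelSpace V] [μ.IsAddHaarMeasure] in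
lemma triDens_of_not {Φ : Set V → ℝ} {p q : V →L[ℝ] ℝ}
    (h : ¬∃ r : Fin k → V →L[ℝ] ℝ, Frame p q r) : triDens k μ Φ p q = 0 := by
  rw [triDens, dif_neg h]

variable {Φ : Set V → ℝ} (hΦ : SimpleVal Φ) (hk : finrank ℝ V = k + 2)
include hΦ hk

lemma SimpleVal.tri_eq_triDens {p q : V →L[ℝ] ℝ} {r : Fin k → V →L[ℝ] ℝ} (h : Frame p q r) :
    Φ (Tri p q r) = triDens k μ Φ p q * (μ (Box p q r)).toReal := by
  have hex : ∃ r : Fin k → V →L[ℝ] ℝ, Frame p q r := ⟨r, h⟩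
  obtain ⟨t, ht, H⟩ := hex.choose_spec.cylRel_tri hk h
  have h1 := H Φ hΦ
  have h2 : (μ (Tri p q r)).toReal = _ := H _ (simpleVal_measure μ)
  have h3 := hex.choose_spec.measure_box_pos μ hk
  rw [triDens, dif_pos hex, h.measure_box_eq μ hk, h1, h2]
  rw [hex.choose_spec.measure_box_eq μ hk] at h3 ⊢
  have h4 : (μ (Tri p q hex.choose)).toReal ≠ 0 := by intro h0; rw [h0] at h3; simp at h3
  field_simp

omit hΦ hk in
lemma triDens_symm (hΦ : SimpleVal Φ) (hk : finrank ℝ V = k + 2) (p q : V →L[ℝ] ℝ) :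
    triDens k μ Φ p q = triDens k μ Φ q p := by
  by_cases hex : ∃ r : Fin k → V →L[ℝ] ℝ, Frame p q r
  · obtain ⟨r, h⟩ := hex
    have h1 := hΦ.tri_eq_triDens μ hk h
    have h2 := hΦ.tri_eq_triDens μ hk h.symm
    rw [Tri_symm, Box_symm q p, h1] at h2
    exact mul_right_cancel₀ (h.measure_box_pos μ hk).ne' h2
  · rw [triDens_of_not μ hex, triDens_of_not μ fun ⟨r, h⟩ => hex ⟨r, h.symm⟩]

omit hΦ [BorelSpace V] [μ.IsAddHaarMeasure] in
lemma triDens_self (p : V →L[ℝ] ℝ) (t : ℝ) : triDens k μ Φ p (t • p) = 0 := by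
  refine triDens_of_not μ fun ⟨r, h⟩ => ?_
  obtain ⟨x, h1, h2, -⟩ := h.exists_eq hk 0 1 0
  simp [h1] at h2

variable (hB : ∀ (p q : V →L[ℝ] ℝ) (r : Fin k → V →L[ℝ] ℝ), Frame p q r → Φ (Box p q r) = 0)
include hB

lemma triDens_neg (p q : V →L[ℝ] ℝ) : triDens k μ Φ (-p) (-q) = -triDens k μ Φ p q := by
  by_cases hex : ∃ r : Fin k → V →L[ℝ] ℝ, Frame p q r
  · obtain ⟨r, h⟩ := hex
    have h1 := hΦ.tri_eq_triDens μ hk h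
    have h2 := hΦ.tri_eq_triDens μ hk h.neg
    have h3 := hΦ.box_eq h hk
    have h4 : (μ (Box (-p) (-q) r)).toReal = (μ (Box p q r)).toReal := by
      have e1 := (simpleVal_measure μ).box_smul hk h (t := -1) (by norm_num)
      have e2 := (simpleVal_measure μ).box_smul hk (h.smul (t := -1) (by norm_num)).symm
        (t := -1) (by norm_num)
      simp only [neg_one_smul_clm, abs_neg, abs_one, inv_one, one_mul] at e1 e2
      rw [Box_symm, e2, Box_symm, e1]
    rw [hB _ _ _ h, h1, h2, h4, ← add_mul] at h3
    have := (mul_eq_zero.mp h3.symm).resolve_right (h.measure_box_pos μ hk).ne'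
    linarith
  · rw [triDens_of_not μ hex, triDens_of_not μ fun ⟨r, h⟩ => hex ⟨r, by simpa using h.neg⟩,
      neg_zero]

omit hB in
lemma triDens_rot (p q : V →L[ℝ] ℝ) : triDens k μ Φ p q = triDens k μ Φ q (-(p + q)) := by
  by_cases hex : ∃ r : Fin k → V →L[ℝ] ℝ, Frame p q r
  · obtain ⟨r, h⟩ := hex
    have h' : Frame q (-(p + q)) r := fun x h1 h2 h3 => h x (by simpa [h1] using h2) h1 h3
    have h1 := hΦ.tri_eq_triDens μ hk h
    have h2 := hΦ.tri_eq_triDens μ hk h'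
    obtain ⟨v, hv1, hv2, hv3⟩ := h.exists_eq hk (-1) 0 0
    have h3 : Φ (Tri q (-(p + q)) r) = Φ (Tri p q r) := by
      refine hΦ.trans' v (convex_Tri _ _ _) h.isCompact_Tri fun y => ?_
      simp only [Tri, Set.mem_ofPred_eq, _root_.neg_apply, _root_.add_apply, map_add, hv1, hv2,
        hv3, zero_add, Pi.zero_apply]
      constructor
      · rintro ⟨h1, h2, h3, h4⟩; exact ⟨by linarith, h1, by linarith, h4⟩
      · rintro ⟨h1, h2, h3, h4⟩; exact ⟨h2, by linarith, by linarith, h4⟩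
    have h4 : (μ (Box q (-(p + q)) r)).toReal = (μ (Box p q r)).toReal := by
      have e1 := (simpleVal_measure μ).box_shear hk h.symm 1
      have e2 := (simpleVal_measure μ).box_smul hk (h.symm.shear 1) (t := -1) (by norm_num)
      simp only [neg_one_smul_clm, one_smul, abs_neg, abs_one, inv_one, one_mul] at e1 e2
      rw [e2, e1, Box_symm]
    rw [h3, h4, h1] at h2
    exact mul_right_cancel₀ (h.measure_box_pos μ hk).ne' h2
  · rw [triDens_of_not μ hex, triDens_of_not μ fun ⟨r, h⟩ => hex ⟨r, fun x h1 h2 h3 =>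
      h x h2 (by simp [h1, h2]) h3⟩]

lemma triDens_smul (t : ℝ) (p q : V →L[ℝ] ℝ) (ht : 0 < t) :
    triDens k μ Φ (t • p) (t • q) = t * triDens k μ Φ p q := by
  by_cases hex : ∃ r : Fin k → V →L[ℝ] ℝ, Frame p q r
  · obtain ⟨r, h⟩ := hex
    have h' : Frame (t • p) (t • q) r := ((h.smul ht.ne').symm.smul ht.ne').symm
    have h1 := hΦ.tri_eq_triDens μ hk h
    have h2 := hΦ.tri_eq_triDens μ hk h'
    have h3 : Tri (t • p) (t • q) r = TriS p q r t⁻¹ := by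
      ext x
      simp only [Tri, TriS, Set.mem_ofPred_eq, _root_.smul_apply, smul_eq_mul, ← mul_add,
        mul_nonneg_iff_of_pos_left ht]
      rw [← one_div, le_div_iff₀ ht, mul_comm t (p x + q x)]
    have h4 : (μ (Box (t • p) (t • q) r)).toReal = t⁻¹ * (t⁻¹ * (μ (Box p q r)).toReal) := by
      have e1 := (simpleVal_measure μ).box_smul hk h ht.ne'
      have e2 := (simpleVal_measure μ).box_smul hk (h.smul ht.ne').symm ht.ne'
      rw [abs_of_pos ht] at e1 e2
      rw [Box_symm, e2, Box_symm, e1]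
    rw [h3, hΦ.triS_eq hk hB h (inv_nonneg.mpr ht.le), h1, h4] at h2
    have := (h.measure_box_pos μ hk).ne'
    field_simp at h2
    linarith
  · rw [triDens_of_not μ hex, triDens_of_not μ fun ⟨r, h⟩ => hex ⟨r, fun x h1 h2 h3 =>
      h x (by simp [h1]) (by simp [h2]) h3⟩, mul_zero]

lemma triDens_split (p q : V →L[ℝ] ℝ) (s t : ℝ) (hs : 0 < s) (ht : 0 < t) :
    triDens k μ Φ p (s • q) + triDens k μ Φ (p + s • q) (t • q) =
      triDens k μ Φ p ((s + t) • q) := by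
  have hst : 0 < s + t := by positivity
  by_cases hex : ∃ r : Fin k → V →L[ℝ] ℝ, Frame p q r
  · obtain ⟨r, h⟩ := hex
    have f1 : Frame p (s • q) r := h.smul hs.ne'
    have f2 : Frame p ((s + t) • q) r := h.smul hst.ne'
    have f3 : Frame (p + s • q) q r := (h.symm.shear s).symm
    have f4 : Frame (p + s • q) (t • q) r := f3.smul ht.ne'
    have J1 := (simpleVal_measure μ).box_smul hk h hs.ne'
    have J2 := (simpleVal_measure μ).box_smul hk h hst.ne'
    have J3 := (simpleVal_measure μ).box_shear hk h.symm s
    have J4 := (simpleVal_measure μ).box_smul hk f3 ht.ne'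
    rw [Box_symm, Box_symm q p] at J3
    rw [J3] at J4
    rw [abs_of_pos hs] at J1
    rw [abs_of_pos hst] at J2
    rw [abs_of_pos ht] at J4
    have E1 := hΦ.tri_eq_triDens μ hk f1
    have E2 := hΦ.tri_eq_triDens μ hk f2
    have E4 := hΦ.tri_eq_triDens μ hk f4
    rw [J1] at E1
    rw [J2] at E2
    rw [J4] at E4
    set a := s / (s + t) with ha
    have ha' : 1 - a = t / (s + t) := by rw [ha]; field_simp; ring
    have hsa : s = a * (s + t) := by rw [ha]; field_simp
    have ha0 : 0 < a := by positivity
    have ha1 : 0 < 1 - a := by rw [ha']; positivity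
    have hcut := hΦ.cut _ (p + s • q) a (convex_Tri p ((s + t) • q) r) f2.isCompact_Tri
      (by simpa using h.ne_zero hk 1 s (by simp))
    have C1 : Tri p ((s + t) • q) r ∩ {x | (p + s • q) x ≤ a} = TriS p (s • q) r a := by
      ext x
      simp only [Tri, TriS, Set.mem_inter_iff, Set.mem_ofPred_eq, _root_.add_apply,
        _root_.smul_apply, smul_eq_mul, mul_nonneg_iff_of_pos_left hs,
        mul_nonneg_iff_of_pos_left hst]
      constructor
      · rintro ⟨⟨h1, h2, h3, h4⟩, h5⟩; exact ⟨h1, h2, h5, h4⟩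
      · rintro ⟨h1, h2, h3, h4⟩
        refine ⟨⟨h1, h2, ?_, h4⟩, h3⟩
        have : (s + t) * q x ≤ 1 := by
          have : a * ((s + t) * q x) ≤ a * 1 := by
            rw [← mul_assoc, ← hsa]; linarith
          exact le_of_mul_le_mul_left this ha0
        have h6 : s * q x = a * ((s + t) * q x) := by rw [← mul_assoc, ← hsa]
        nlinarith
    have C2 : Φ (Tri p ((s + t) • q) r ∩ {x | a ≤ (p + s • q) x}) =
        Φ (TriS (p + s • q) (t • q) r (1 - a)) := by
      obtain ⟨v, hv1, hv2, hv3⟩ := h.exists_eq hk a 0 0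
      refine hΦ.trans' v (convex_TriS _ _ _ _) (f4.isCompact_TriS _) fun y => ?_
      simp only [Tri, TriS, Set.mem_inter_iff, Set.mem_ofPred_eq, _root_.add_apply,
        _root_.smul_apply, smul_eq_mul, mul_nonneg_iff_of_pos_left ht,
        mul_nonneg_iff_of_pos_left hst, map_add, hv1, hv2, hv3, zero_add, Pi.zero_apply]
      constructor
      · rintro ⟨⟨h1, h2, h3, h4⟩, h5⟩; exact ⟨by linarith, h2, by linarith, h4⟩
      · rintro ⟨h1, h2, h3, h4⟩
        refine ⟨⟨?_, h2, by linarith, h4⟩, by linarith⟩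
        have h6 : s * q y = a * ((s + t) * q y) := by rw [← mul_assoc, ← hsa]
        have h7 : t * q y = (1 - a) * ((s + t) * q y) := by linarith
        have h8 : (1 - a) * ((s + t) * q y) ≤ (1 - a) * 1 := by rw [← h7]; linarith
        have h9 := le_of_mul_le_mul_left h8 ha1
        nlinarith
    rw [C1, C2, hΦ.triS_eq hk hB f1 ha0.le, hΦ.triS_eq hk hB f4 ha1.le, E1, E2, E4, ha', ha]
      at hcut
    have := (h.measure_box_pos μ hk).ne'
    field_simp at hcut
    linarith
  · have : ∀ (p' : V →L[ℝ] ℝ) (a b : ℝ), b ≠ 0 → triDens k μ Φ (p + a • q) (b • q) = 0 :=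
      fun p' a b hb => triDens_of_not μ fun ⟨r, h⟩ => hex ⟨r, fun x h1 h2 h3 =>
        h x (by simp [h1, h2]) (by simp [h2]) h3⟩
    have h0 := this p 0
    rw [zero_smul, add_zero] at h0
    rw [h0 _ hs.ne', h0 _ hst.ne', this p s t ht.ne', add_zero]

lemma triFun_triDens : TriFun (triDens k μ Φ) :=
  triFun_of_pos (triDens_self μ hk) (triDens_symm μ hΦ hk) (triDens_neg μ hΦ hk hB)
    (triDens_smul μ hΦ hk hB) (triDens_rot μ hΦ hk) (triDens_split μ hΦ hk hB)

end TriDensity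

section TetrahedralCocycle

variable {V : Type*} [NormedAddCommGroup V] [NormedSpace ℝ V] {k : ℕ}

/-- The product of the `s`-fold dilate of a standard tetrahedron with a cube. -/
def Tetra (a b c : V →L[ℝ] ℝ) (r : Fin k → V →L[ℝ] ℝ) (s : ℝ) : Set V :=
  {x | 0 ≤ a x ∧ 0 ≤ b x ∧ 0 ≤ c x ∧ a x + b x + c x ≤ s ∧ ∀ i, 0 ≤ r i x ∧ r i x ≤ 1}

lemma Tetra_rev (a b c : V →L[ℝ] ℝ) (r : Fin k → V →L[ℝ] ℝ) (s : ℝ) :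
    Tetra c b a r s = Tetra a b c r s := by
  ext x
  simp only [Tetra, Set.mem_ofPred_eq]
  constructor <;> rintro ⟨h1, h2, h3, h4, h5⟩ <;> exact ⟨h3, h2, h1, by linarith, h5⟩

lemma convex_Tetra (a b c : V →L[ℝ] ℝ) (r : Fin k → V →L[ℝ] ℝ) (s : ℝ) :
    Convex ℝ (Tetra a b c r s) := by
  have : Tetra a b c r s = {x | 0 ≤ a x} ∩ ({x | 0 ≤ b x} ∩ ({x | 0 ≤ c x} ∩
      ({x | (a + b + c) x ≤ s} ∩ {x | ∀ i, 0 ≤ r i x ∧ r i x ≤ 1}))) := rfl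
  rw [this]
  exact (convex_ge _ _).inter ((convex_ge _ _).inter ((convex_ge _ _).inter
    ((convex_le _ _).inter (convex_cube r))))

lemma isClosed_Tetra (a b c : V →L[ℝ] ℝ) (r : Fin k → V →L[ℝ] ℝ) (s : ℝ) :
    IsClosed (Tetra a b c r s) := by
  have : Tetra a b c r s = {x | 0 ≤ a x} ∩ ({x | 0 ≤ b x} ∩ ({x | 0 ≤ c x} ∩
      ({x | (a + b + c) x ≤ s} ∩ {x | ∀ i, 0 ≤ r i x ∧ r i x ≤ 1}))) := rfl
  rw [this]
  exact (isClosed_ge' _ _).inter ((isClosed_ge' _ _).inter ((isClosed_ge' _ _).inter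
    ((isClosed_le' _ _).inter (isClosed_cube r))))

lemma mem_Tri_cons {p q z : V →L[ℝ] ℝ} {r : Fin k → V →L[ℝ] ℝ} {x : V} :
    x ∈ Tri p q (Fin.cons z r : Fin (k + 1) → V →L[ℝ] ℝ) ↔
      0 ≤ p x ∧ 0 ≤ q x ∧ p x + q x ≤ 1 ∧ (0 ≤ z x ∧ z x ≤ 1) ∧ ∀ i, 0 ≤ r i x ∧ r i x ≤ 1 := by
  simp only [Tri, Set.mem_ofPred_eq, Fin.forall_fin_succ, Fin.cons_zero, Fin.cons_succ]

lemma Box_cons_swap (p q z : V →L[ℝ] ℝ) (r : Fin k → V →L[ℝ] ℝ) :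
    Box p q (Fin.cons z r : Fin (k + 1) → V →L[ℝ] ℝ) = Box p z (Fin.cons q r) := by
  ext x
  simp only [Box, Set.mem_ofPred_eq, Fin.forall_fin_succ, Fin.cons_zero, Fin.cons_succ]
  tauto

variable [FiniteDimensional ℝ V]

lemma isCompact_Tetra {a b c : V →L[ℝ] ℝ} {r : Fin k → V →L[ℝ] ℝ}
    (h : Frame a b (Fin.cons c r : Fin (k + 1) → V →L[ℝ] ℝ)) (s : ℝ) :
    IsCompact (Tetra a b c r s) := by
  refine h.isCompact_bounded (isClosed_Tetra _ _ _ _ _) (|s| + 1) fun x ⟨h1, h2, h3, h4, h5⟩ => ?_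
  have h6 := le_abs_self s
  have h7 := abs_nonneg s
  simp only [Fin.forall_fin_succ, Fin.cons_zero, Fin.cons_succ, abs_of_nonneg h1, abs_of_nonneg h2,
    abs_of_nonneg h3]
  refine ⟨by linarith, by linarith, by linarith, fun i => ?_⟩
  rw [abs_of_nonneg (h5 i).1]
  linarith [(h5 i).2]

variable [MeasurableSpace V] [BorelSpace V] (μ : Measure V) [μ.IsAddHaarMeasure]
  {Φ : Set V → ℝ} (hΦ : SimpleVal Φ)
include hΦ

lemma SimpleVal.tetra_eq (hk : finrank ℝ V = k + 1 + 2) {a b c : V →L[ℝ] ℝ}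
    {r : Fin k → V →L[ℝ] ℝ} (h : Frame a b (Fin.cons c r : Fin (k + 1) → V →L[ℝ] ℝ)) :
    Φ (Tetra a b c r 2) = 2 * Φ (Tetra a b c r 1) +
      (triDens (k + 1) μ Φ c b + triDens (k + 1) μ Φ a (b + c)) *
        (μ (Box a b (Fin.cons c r : Fin (k + 1) → V →L[ℝ] ℝ))).toReal := by
  have hf := frame_cons.mp h
  have f1 : Frame c b (Fin.cons (a + b + c) r : Fin (k + 1) → V →L[ℝ] ℝ) :=
    frame_cons.mpr fun x h1 h2 h3 h4 => hf x (by simpa [h1, h2] using h3) h2 h1 h4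
  have f2 : Frame a (b + c) (Fin.cons c r : Fin (k + 1) → V →L[ℝ] ℝ) :=
    frame_cons.mpr fun x h1 h2 h3 h4 => hf x h1 (by simpa [h3] using h2) h3 h4
  have f3 : Frame b (a + c) (Fin.cons c r : Fin (k + 1) → V →L[ℝ] ℝ) :=
    frame_cons.mpr fun x h1 h2 h3 h4 => hf x (by simpa [h3] using h2) h1 h3 h4
  have f4 : Frame c a (Fin.cons b r : Fin (k + 1) → V →L[ℝ] ℝ) :=
    frame_cons.mpr fun x h1 h2 h3 h4 => hf x h2 h3 h1 h4
  have f5 : Frame c b (Fin.cons a r : Fin (k + 1) → V →L[ℝ] ℝ) :=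
    frame_cons.mpr fun x h1 h2 h3 h4 => hf x h3 h2 h1 h4
  have J1 : (μ (Box c b (Fin.cons (a + b + c) r : Fin (k + 1) → V →L[ℝ] ℝ))).toReal =
      (μ (Box a b (Fin.cons c r : Fin (k + 1) → V →L[ℝ] ℝ))).toReal := by
    have e1 := (simpleVal_measure μ).box_shear hk f3 1
    have e2 := (simpleVal_measure μ).box_shear hk f4 1
    rw [one_smul] at e1 e2
    rw [Box_symm c b, Box_cons_swap, show a + b + c = a + c + b by abel, e1,
      Box_cons_swap b (a + c), Box_symm b c, Box_cons_swap c b, e2, Box_cons_swap c a,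
      Box_symm c b, Box_cons_swap b c, Box_symm b a]
  have J2 : (μ (Box a (b + c) (Fin.cons c r : Fin (k + 1) → V →L[ℝ] ℝ))).toReal =
      (μ (Box a b (Fin.cons c r : Fin (k + 1) → V →L[ℝ] ℝ))).toReal := by
    have e2 := (simpleVal_measure μ).box_shear hk f5 1
    rw [one_smul] at e2
    rw [Box_cons_swap, Box_symm a c, Box_cons_swap, e2, Box_cons_swap, Box_symm c a, Box_cons_swap]
  obtain ⟨v1, a1, b1, c1⟩ := h.exists_eq hk 1 0 0
  obtain ⟨v2, a2, b2, c2⟩ := h.exists_eq hk 0 1 0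
  obtain ⟨v3, a3, b3, c3⟩ := h.exists_eq hk 0 0 (Fin.cons 1 0)
  simp only [Fin.forall_fin_succ, Fin.cons_zero, Fin.cons_succ, Pi.zero_apply] at c1 c2 c3
  have hS2 := isCompact_Tetra h 2
  have cS2 := convex_Tetra a b c r 2
  have n1 : a + b + c ≠ 0 := fun h0 => by
    have := DFunLike.congr_fun h0 v1; simp [a1, b1, c1.1] at this
  have n2 : b + c ≠ 0 := fun h0 => by
    have := DFunLike.congr_fun h0 v2; simp [b2, c2.1] at this
  have n3 : c ≠ 0 := fun h0 => by
    have := DFunLike.congr_fun h0 v3; simp [c3.1] at this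
  have k1 := hΦ.cut _ (a + b + c) 1 cS2 hS2 n1
  have cP1 := cS2.inter (convex_ge (a + b + c) 1)
  have hP1 := hS2.inter_right (isClosed_ge' (a + b + c) 1)
  have k2 := hΦ.cut _ (b + c) 1 cP1 hP1 n2
  have k3 := hΦ.cut _ c 1 (cP1.inter (convex_ge (b + c) 1))
    (hP1.inter_right (isClosed_ge' (b + c) 1)) n3
  have t0 : Tetra a b c r 2 ∩ {x | (a + b + c) x ≤ 1} = Tetra a b c r 1 := by
    ext x
    simp only [Tetra, Set.mem_inter_iff, Set.mem_ofPred_eq, _root_.add_apply]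
    constructor
    · rintro ⟨⟨h1, h2, h3, h4, h5⟩, h6⟩; exact ⟨h1, h2, h3, h6, h5⟩
    · rintro ⟨h1, h2, h3, h4, h5⟩; exact ⟨⟨h1, h2, h3, by linarith, h5⟩, h4⟩
  have t1 : Φ (Tetra a b c r 2 ∩ {x | 1 ≤ (a + b + c) x} ∩ {x | (b + c) x ≤ 1}) =
      Φ (Tri c b (Fin.cons (a + b + c) r : Fin (k + 1) → V →L[ℝ] ℝ)) := by
    refine hΦ.trans' v1 (convex_Tri _ _ _) f1.isCompact_Tri fun y => ?_
    simp only [mem_Tri_cons, Tetra, Set.mem_inter_iff, Set.mem_ofPred_eq, _root_.add_apply,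
      map_add, a1, b1, c1.1, c1.2, zero_add]
    constructor
    · rintro ⟨⟨⟨h1, h2, h3, h4, h5⟩, h6⟩, h7⟩
      exact ⟨h3, h2, by linarith, ⟨by linarith, by linarith⟩, h5⟩
    · rintro ⟨h1, h2, h3, ⟨h4, h5⟩, h6⟩
      exact ⟨⟨⟨by linarith, h2, h1, by linarith, h6⟩, by linarith⟩, by linarith⟩
  have t2 : Φ (Tetra a b c r 2 ∩ {x | 1 ≤ (a + b + c) x} ∩ {x | 1 ≤ (b + c) x} ∩ {x | c x ≤ 1}) =
      Φ (Tri a (b + c) (Fin.cons c r : Fin (k + 1) → V →L[ℝ] ℝ)) := by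
    refine hΦ.trans' v2 (convex_Tri _ _ _) f2.isCompact_Tri fun y => ?_
    simp only [mem_Tri_cons, Tetra, Set.mem_inter_iff, Set.mem_ofPred_eq, _root_.add_apply,
      map_add, a2, b2, c2.1, c2.2, zero_add]
    constructor
    · rintro ⟨⟨⟨⟨h1, h2, h3, h4, h5⟩, h6⟩, h7⟩, h8⟩
      exact ⟨h1, by linarith, by linarith, ⟨by linarith, by linarith⟩, h5⟩
    · rintro ⟨h1, h2, h3, ⟨h4, h5⟩, h6⟩
      exact ⟨⟨⟨⟨h1, by linarith, h4, by linarith, h6⟩, by linarith⟩, by linarith⟩, h5⟩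
  have t3 : Φ (Tetra a b c r 2 ∩ {x | 1 ≤ (a + b + c) x} ∩ {x | 1 ≤ (b + c) x} ∩ {x | 1 ≤ c x}) =
      Φ (Tetra a b c r 1) := by
    refine hΦ.trans' v3 (convex_Tetra _ _ _ _ _) (isCompact_Tetra h 1) fun y => ?_
    simp only [Tetra, Set.mem_inter_iff, Set.mem_ofPred_eq, _root_.add_apply,
      map_add, a3, b3, c3.1, c3.2, zero_add]
    constructor
    · rintro ⟨⟨⟨⟨h1, h2, h3, h4, h5⟩, h6⟩, h7⟩, h8⟩
      exact ⟨h1, h2, by linarith, by linarith, h5⟩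
    · rintro ⟨h1, h2, h3, h4, h5⟩
      exact ⟨⟨⟨⟨h1, h2, by linarith, by linarith, h5⟩, by linarith⟩, by linarith⟩, by linarith⟩
  rw [t0, k2, t1, k3, t2, t3, hΦ.tri_eq_triDens μ hk f1, hΦ.tri_eq_triDens μ hk f2, J1, J2] at k1
  linarith

lemma triDens_cocycle (hk : finrank ℝ V = k + 2) {a b c : V →L[ℝ] ℝ}
    (h : LinearIndependent ℝ ![a, b, c]) :
    triDens k μ Φ a b + triDens k μ Φ (a + b) c = triDens k μ Φ b c + triDens k μ Φ a (b + c) := by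
  cases k with
  | zero =>
    have h1 := h.fintype_card_le_finrank
    rw [← (LinearMap.toContinuousLinearMap : (V →ₗ[ℝ] ℝ) ≃ₗ[ℝ] (V →L[ℝ] ℝ)).finrank_eq,
      Subspace.dual_finrank_eq, hk] at h1
    simp at h1
  | succ m =>
    obtain ⟨r, hr⟩ := exists_frame_cons hk h
    have hf := frame_cons.mp hr
    have hr' : Frame c b (Fin.cons a r : Fin (m + 1) → V →L[ℝ] ℝ) :=
      frame_cons.mpr fun x h1 h2 h3 h4 => hf x h3 h2 h1 h4
    have e1 := hΦ.tetra_eq μ hk hr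
    have e2 := hΦ.tetra_eq μ hk hr'
    rw [Tetra_rev a, Tetra_rev a, Box_cons_swap, Box_symm c a, Box_cons_swap a c, e1] at e2
    have e3 := mul_right_cancel₀ (hr.measure_box_pos μ hk).ne' (add_left_cancel e2)
    rw [triDens_symm μ hΦ hk (a + b) c, triDens_symm μ hΦ hk b c, e3, add_comm b a]

end TetrahedralCocycle

section CoboundContinuity

variable {E : Type*} [NormedAddCommGroup E] [NormedSpace ℝ E] [FiniteDimensional ℝ E]
  {F : E → E → ℝ} {g : E → ℝ} (hh : ∀ (t : ℝ) x, g (t • x) = t * g x)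
  (hg : ∀ x y, g (x + y) = g x + g y + F x y)
  (hF : ∀ x y, LinearIndependent ℝ ![x, y] →
    ContinuousAt (fun z : E × E => F z.1 z.2) (x, y))
include hh hg hF

lemma continuousAt_of_cobound_of_coords {d : ℕ} (b : Basis (Fin d) ℝ E) {y : E}
    (hy : ∀ i, b.repr y i ≠ 0) : ContinuousAt g y := by
  have h0 : g 0 = 0 := by simpa using hh 0 0
  have hc : ∀ i, Continuous fun x => b.repr x i := fun i =>
    (b.coord i).continuous_of_finiteDimensional
  have key : ∀ s : Finset (Fin d), ContinuousAt (fun x => g (∑ i ∈ s, b.repr x i • b i)) y := by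
    intro s
    induction s using Finset.induction_on with
    | empty => simpa using continuousAt_const
    | insert i s his ih =>
      rcases s.eq_empty_or_nonempty with rfl | ⟨j, hj⟩
      · simp only [Finset.sum_insert his, Finset.sum_empty, add_zero, hh]
        exact ((hc i).mul continuous_const).continuousAt
      · have hli : LinearIndependent ℝ ![∑ j ∈ s, b.repr y j • b j, b.repr y i • b i] := by
          rw [LinearIndependent.pair_iff]
          intro t u htu
          have e1 := congrArg (fun z => b.repr z i) htu
          have e2 := congrArg (fun z => b.repr z j) htu
          have hij : i ≠ j := fun h => his (h ▸ hj)
          simp [Finsupp.single_apply, his, hj, hij.symm, hy] at e1 e2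
          exact ⟨e2, e1⟩
        have hsum : ContinuousAt (fun x => ∑ j ∈ s, b.repr x j • b j) y :=
          (continuous_finsetSum s fun j _ => (hc j).smul continuous_const).continuousAt
        have hi : ContinuousAt (fun x => b.repr x i • b i) y :=
          ((hc i).smul continuous_const).continuousAt
        have e : (fun x => g (∑ j ∈ insert i s, b.repr x j • b j)) = fun x =>
            g (∑ j ∈ s, b.repr x j • b j) + b.repr x i * g (b i) +
              F (∑ j ∈ s, b.repr x j • b j) (b.repr x i • b i) := by
          funext x
          rw [Finset.sum_insert his, add_comm, hg, hh]
        rw [e]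
        exact (ih.add ((hc i).continuousAt.mul continuousAt_const)).add
          (ContinuousAt.comp' (f := fun x => (∑ j ∈ s, b.repr x j • b j, b.repr x i • b i))
            (hF _ _ hli) (hsum.prodMk hi))
  simpa [b.sum_repr] using key Finset.univ

lemma continuous_of_cobound : Continuous g := by
  have h0 : g 0 = 0 := by simpa using hh 0 0
  let b := finBasis ℝ E
  have hne : ∀ x, x ≠ 0 → ContinuousAt g x := by
    intro x hx
    let w : E := ∑ i, (if b.repr x i = 0 then (-1 : ℝ) else 0) • b i
    have hw : ∀ i, b.repr w i = if b.repr x i = 0 then (-1 : ℝ) else 0 := fun i =>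
      congrFun (b.repr_sum_self _) i
    have hxw : ∀ i, b.repr (x - w) i ≠ 0 := fun i => by
      rw [map_sub, Finsupp.sub_apply, hw]
      split_ifs with h
      · simp [h]
      · simpa using h
    have hcx := continuousAt_of_cobound_of_coords hh hg hF b hxw
    by_cases hall : ∀ i, b.repr x i ≠ 0
    · exact continuousAt_of_cobound_of_coords hh hg hF b hall
    push Not at hall
    obtain ⟨i, hi⟩ := hall
    obtain ⟨j, hj⟩ : ∃ j, b.repr x j ≠ 0 := by
      by_contra hcon
      push Not at hcon
      exact hx (b.ext_elem fun j => by simpa using hcon j)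
    have hli : LinearIndependent ℝ ![x - w, w] := by
      rw [LinearIndependent.pair_iff]
      intro t u htu
      have e1 := congrArg (fun z => b.repr z i) htu
      have e2 := congrArg (fun z => b.repr z j) htu
      simp only [map_add, map_sub, map_smul, Finsupp.add_apply, Finsupp.smul_apply,
        Finsupp.sub_apply, hw, hi, hj, if_true, if_false, smul_eq_mul, map_zero,
        Finsupp.zero_apply] at e1 e2
      have ht : t = 0 := by simpa [hj] using e2
      rw [ht] at e1
      exact ⟨ht, by linarith⟩
    have e : g = fun z => g (z - w) + g w + F (z - w) w := by
      funext z
      rw [← hg, sub_add_cancel]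
    rw [e]
    have hs : ContinuousAt (fun z => z - w) x := (continuous_id.sub continuous_const).continuousAt
    refine ((ContinuousAt.comp' (f := fun z => z - w) (x := x) hcx hs).add
      continuousAt_const).add ?_
    exact ContinuousAt.comp' (f := fun z => (z - w, w)) (hF _ _ hli) (hs.prodMk continuousAt_const)
  obtain ⟨M, hM⟩ := (isCompact_sphere (0 : E) 1).exists_bound_of_continuousOn (f := g)
    fun x hx => (hne x (by rintro rfl; simp at hx)).continuousWithinAt
  have hbd : ∀ x, ‖g x‖ ≤ M * ‖x‖ := by
    intro x
    by_cases hx : x = 0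
    · simp [hx, h0]
    · have hn : 0 < ‖x‖ := norm_pos_iff.mpr hx
      have h1 := hM (‖x‖⁻¹ • x) (by simp [norm_smul, hn.ne'])
      rw [hh, norm_mul, norm_inv, norm_norm, inv_mul_le_iff₀ hn] at h1
      linarith
  refine continuous_iff_continuousAt.mpr fun x => ?_
  by_cases hx : x = 0
  · subst hx
    rw [ContinuousAt, h0]
    refine squeeze_zero_norm hbd ?_
    have : Continuous fun x : E => M * ‖x‖ := by fun_prop
    simpa using this.tendsto 0
  · exact hne x hx

end CoboundContinuity

section TriDensityPotential

variable {V : Type*} [NormedAddCommGroup V] [NormedSpace ℝ V] [FiniteDimensional ℝ V] {k : ℕ}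
  {Φ : Set V → ℝ} (hΦ : SimpleVal Φ) (hk : finrank ℝ V = k + 2)

include hk in
lemma Frame.eventually {p q : V →L[ℝ] ℝ} {r : Fin k → V →L[ℝ] ℝ} (h : Frame p q r) {ε : ℝ}
    (hε : 0 < ε) : ∀ᶠ z : (V →L[ℝ] ℝ) × (V →L[ℝ] ℝ) in nhds (p, q),
      Frame z.1 z.2 r ∧ Tri z.1 z.2 r ⊆ Metric.cthickening ε (Tri p q r) ∧
        Tri p q r ⊆ Metric.cthickening ε (Tri z.1 z.2 r) := by
  obtain ⟨v, v1, v2, v3⟩ := h.exists_eq hk 1 0 0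
  obtain ⟨w, w1, w2, w3⟩ := h.exists_eq hk 0 1 0
  obtain ⟨R, hR⟩ := (h.isCompact_Tri).isBounded.exists_norm_le
  have hc : Continuous fun z : (V →L[ℝ] ℝ) × (V →L[ℝ] ℝ) => ‖z.1 - p‖ * ‖v‖ + ‖z.2 - q‖ * ‖w‖ := by
    fun_prop
  have hlim := hc.tendsto (p, q)
  simp only [sub_self, norm_zero, zero_mul, add_zero] at hlim
  have hδ : 0 < min (1 / 2) (ε / (2 * (|R| + 1))) := by positivity
  filter_upwards [hlim.eventually (gt_mem_nhds hδ)] with ⟨p', q'⟩ hpq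
  simp only at hpq ⊢
  set η := ‖p' - p‖ * ‖v‖ + ‖q' - q‖ * ‖w‖ with hη
  have hη1 : η < 1 / 2 := hpq.trans_le (min_le_left _ _)
  have hη2 : η * (2 * (|R| + 1)) ≤ ε :=
    (le_div_iff₀ (by positivity)).mp (hpq.trans_le (min_le_right _ _)).le
  let A : V → V := fun x => x + (((p' - p) x) • v + ((q' - q) x) • w)
  have hA : ∀ x, ‖A x - x‖ ≤ η * ‖x‖ := by
    intro x
    simp only [A, add_sub_cancel_left]
    refine (norm_add_le _ _).trans ?_
    rw [norm_smul, norm_smul, hη, add_mul]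
    have i1 := mul_le_mul_of_nonneg_right ((p' - p).le_opNorm x) (norm_nonneg v)
    have i2 := mul_le_mul_of_nonneg_right ((q' - q).le_opNorm x) (norm_nonneg w)
    linarith
  have hA' : ∀ x, ‖x‖ ≤ 2 * ‖A x‖ := by
    intro x
    have i2 := hA x
    have i3 : ‖x‖ - ‖A x‖ ≤ ‖A x - x‖ := by
      rw [norm_sub_rev]; exact norm_sub_norm_le x (A x)
    nlinarith [norm_nonneg x]
  have hp : ∀ x, p (A x) = p' x := fun x => by simp [A, v1, w1]
  have hq : ∀ x, q (A x) = q' x := fun x => by simp [A, v2, w2]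
  have hr : ∀ x i, r i (A x) = r i x := fun x i => by simp [A, v3, w3]
  have hT : ∀ x, A x ∈ Tri p q r ↔ x ∈ Tri p' q' r := fun x => by
    simp only [Tri, Set.mem_ofPred_eq, hp, hq, hr]
  have hd : ∀ x, A x ∈ Tri p q r → ‖A x - x‖ ≤ ε := by
    intro x hx
    have i1 := (hR _ hx).trans (le_abs_self R)
    have i2 := hA' x
    have i3 : 0 ≤ η := by positivity
    refine (hA x).trans (le_trans ?_ hη2)
    gcongr
    linarith
  have hfr : Frame p' q' r := by
    intro x h1 h2 h3
    have h4 : A x = 0 := h _ (by rw [hp, h1]) (by rw [hq, h2]) fun i => by rw [hr, h3]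
    have := hA' x
    rw [h4, norm_zero, mul_zero] at this
    exact norm_le_zero_iff.mp this
  refine ⟨hfr, fun x hx => ?_, fun y hy => ?_⟩
  · exact Metric.mem_cthickening_of_dist_le x (A x) ε _ ((hT x).mpr hx)
      (by rw [dist_comm, dist_eq_norm]; exact hd x ((hT x).mpr hx))
  · obtain ⟨x, x1, x2, x3⟩ := hfr.exists_eq hk (p y) (q y) fun i => r i y
    have hxy : A x = y := by
      refine sub_eq_zero.mp (h _ ?_ ?_ fun i => ?_)
      · rw [map_sub, hp, x1, sub_self]
      · rw [map_sub, hq, x2, sub_self]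
      · rw [map_sub, hr, x3, sub_self]
    rw [← hxy] at hy ⊢
    exact Metric.mem_cthickening_of_dist_le _ x ε _ ((hT x).mp hy)
      (by rw [dist_eq_norm]; exact hd x hy)

include hΦ hk in
lemma SimpleVal.continuousAt_tri {p q : V →L[ℝ] ℝ} {r : Fin k → V →L[ℝ] ℝ} (h : Frame p q r) :
    ContinuousAt (fun z : (V →L[ℝ] ℝ) × (V →L[ℝ] ℝ) => Φ (Tri z.1 z.2 r)) (p, q) := by
  rw [Metric.continuousAt_iff']
  intro ε hε
  obtain ⟨δ, hδ, H⟩ := hΦ.cont _ (convex_Tri p q r) h.isCompact_Tri (h.interior_Tri hk) ε hε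
  filter_upwards [h.eventually hk hδ] with z ⟨hz, h1, h2⟩
  exact H _ (convex_Tri _ _ _) hz.isCompact_Tri h1 h2

variable [MeasurableSpace V] [BorelSpace V] (μ : Measure V) [μ.IsAddHaarMeasure]

include hΦ hk in
lemma SimpleVal.continuousAt_triDens {p q : V →L[ℝ] ℝ} (h : LinearIndependent ℝ ![p, q]) :
    ContinuousAt (fun z : (V →L[ℝ] ℝ) × (V →L[ℝ] ℝ) => triDens k μ Φ z.1 z.2) (p, q) := by
  obtain ⟨r, hr⟩ := exists_frame hk h
  have e : (fun z : (V →L[ℝ] ℝ) × (V →L[ℝ] ℝ) => Φ (Tri z.1 z.2 r) /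
      (2 * (μ (Tri z.1 z.2 r)).toReal)) =ᶠ[nhds (p, q)] fun z => triDens k μ Φ z.1 z.2 := by
    filter_upwards [hr.eventually hk one_pos] with z ⟨hz, _⟩
    rw [← hz.measure_box_eq μ hk, hΦ.tri_eq_triDens μ hk hz,
      mul_div_cancel_right₀ _ (hz.measure_box_pos μ hk).ne']
  refine ContinuousAt.congr ?_ e
  have hne := (hr.measure_box_pos μ hk).ne'
  rw [hr.measure_box_eq μ hk] at hne
  exact (hΦ.continuousAt_tri hk hr).div
    (continuousAt_const.mul ((simpleVal_measure μ).continuousAt_tri hk hr)) hne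

include hΦ hk in
lemma SimpleVal.exists_box_const : ∃ c : ℝ, ∀ (p q : V →L[ℝ] ℝ) (r : Fin k → V →L[ℝ] ℝ),
    Frame p q r → Φ (Box p q r) = c * (μ (Box p q r)).toReal := by
  by_cases hex : ∃ (p q : V →L[ℝ] ℝ) (r : Fin k → V →L[ℝ] ℝ), Frame p q r
  · obtain ⟨p, q, r, h⟩ := hex
    refine ⟨Φ (Box p q r) / (μ (Box p q r)).toReal, fun p' q' r' h' => ?_⟩
    obtain ⟨t, ht, H⟩ := h.cylRel_box hk h'
    have h2 : (μ (Box p' q' r')).toReal = _ := H _ (simpleVal_measure μ)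
    have := (h.measure_box_pos μ hk).ne'
    rw [H Φ hΦ, h2]
    field_simp
  · exact ⟨0, fun p q r h => (hex ⟨p, q, r, h⟩).elim⟩

include hΦ hk in
/-- Up to a multiple of the volume, the values of a simple valuation on triangle prisms are
given by the coboundary of a continuous odd 1-homogeneous function. -/
lemma SimpleVal.exists_potential : ∃ (c : ℝ) (g : (V →L[ℝ] ℝ) → ℝ), Continuous g ∧
    (∀ (t : ℝ) ξ, g (t • ξ) = t * g ξ) ∧
    ∀ (p q : V →L[ℝ] ℝ) (r : Fin k → V →L[ℝ] ℝ), Frame p q r →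
      Φ (Tri p q r) = c * (μ (Tri p q r)).toReal +
        (g (p + q) - g p - g q) * (μ (Box p q r)).toReal := by
  obtain ⟨c, hc⟩ := hΦ.exists_box_const hk μ
  have hΨ := hΦ.lincomb (simpleVal_measure μ) 1 (-c)
  set Ψ : Set V → ℝ := fun S => 1 * Φ S + -c * (μ S).toReal with hΨd
  have hB : ∀ (p q : V →L[ℝ] ℝ) (r : Fin k → V →L[ℝ] ℝ), Frame p q r → Ψ (Box p q r) = 0 :=
    fun p q r h => by simp [hΨd, hc p q r h]
  obtain ⟨g, hg1, hg2⟩ := (triFun_triDens μ hΨ hk hB).exists_cobound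
    fun x y z h => triDens_cocycle μ hΨ hk h
  refine ⟨c, g, continuous_of_cobound hg1 hg2 fun x y h => hΨ.continuousAt_triDens hk μ h, hg1,
    fun p q r h => ?_⟩
  have := hΨ.tri_eq_triDens μ hk h
  rw [hg2]
  simp only [hΨd] at this
  rw [show g p + g q + triDens k μ Ψ p q - g p - g q = triDens k μ Ψ p q by ring, ← this]
  ring

end TriDensityPotential

section IsGauge

variable {V : Type*} [NormedAddCommGroup V] [NormedSpace ℝ V]

/-- Gauge functions of convex bodies having the origin as an interior point. -/
structure IsGauge (p : V → ℝ) : Prop where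
  add_le : ∀ x y, p (x + y) ≤ p x + p y
  smul : ∀ t : ℝ, 0 ≤ t → ∀ x, p (t • x) = t * p x
  upper : ∃ C : ℝ, 0 < C ∧ ∀ x, p x ≤ C * ‖x‖
  lower : ∃ m : ℝ, 0 < m ∧ ∀ x, m * ‖x‖ ≤ p x

lemma isGauge_norm : IsGauge fun x : V => ‖x‖ where
  add_le := norm_add_le
  smul t ht x := by rw [norm_smul, Real.norm_of_nonneg ht]
  upper := ⟨1, one_pos, fun x => by simp⟩
  lower := ⟨1, one_pos, fun x => by simp⟩

/-- Positively homogeneous functions are determined by their unit sublevel sets. -/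
lemma homogeneous_le {p q : V → ℝ} (hp : ∀ t : ℝ, 0 ≤ t → ∀ x, p (t • x) = t * p x)
    (hq : ∀ t : ℝ, 0 ≤ t → ∀ x, q (t • x) = t * q x) (hq' : ∀ x, x ≠ 0 → 0 < q x)
    (h : ∀ x, q x ≤ 1 → p x ≤ 1) (x : V) : p x ≤ q x := by
  by_cases hx : x = 0
  · have h1 := hp 0 le_rfl 0
    have h2 := hq 0 le_rfl 0
    simp only [smul_zero, zero_mul] at h1 h2
    rw [hx, h1, h2]
  · have h0 := hq' x hx
    have := h ((q x)⁻¹ • x) (by rw [hq _ (inv_nonneg.mpr h0.le), inv_mul_cancel₀ h0.ne'])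
    rw [hp _ (inv_nonneg.mpr h0.le), inv_mul_le_iff₀ h0, mul_one] at this
    exact this

namespace IsGauge

variable {p q : V → ℝ}

lemma zero_eq (hp : IsGauge p) : p 0 = 0 := by simpa using hp.smul 0 le_rfl 0

lemma nonneg (hp : IsGauge p) (x : V) : 0 ≤ p x := by
  obtain ⟨m, hm, h⟩ := hp.lower
  exact (by positivity : 0 ≤ m * ‖x‖).trans (h x)

lemma pos (hp : IsGauge p) {x : V} (hx : x ≠ 0) : 0 < p x := by
  obtain ⟨m, hm, h⟩ := hp.lower
  exact (by positivity : 0 < m * ‖x‖).trans_le (h x)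

lemma max (hp : IsGauge p) (hq : IsGauge q) : IsGauge fun x => Max.max (p x) (q x) where
  add_le x y := max_le ((hp.add_le x y).trans (add_le_add (le_max_left _ _) (le_max_left _ _)))
    ((hq.add_le x y).trans (add_le_add (le_max_right _ _) (le_max_right _ _)))
  smul t ht x := by rw [hp.smul t ht, hq.smul t ht, mul_max_of_nonneg _ _ ht]
  upper := by
    obtain ⟨C, hC, h⟩ := hp.upper
    obtain ⟨D, hD, h'⟩ := hq.upper
    refine ⟨C + D, by positivity, fun x => max_le ((h x).trans ?_) ((h' x).trans ?_)⟩ <;>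
    · gcongr; linarith
  lower := by
    obtain ⟨m, hm, h⟩ := hp.lower
    exact ⟨m, hm, fun x => (h x).trans (le_max_left _ _)⟩

lemma exists_lipschitz (hp : IsGauge p) : ∃ C, LipschitzWith C p := by
  obtain ⟨C, hC, h⟩ := hp.upper
  refine ⟨C.toNNReal, LipschitzWith.of_le_add_mul _ fun x y => ?_⟩
  have h1 := hp.add_le y (x - y)
  rw [add_sub_cancel] at h1
  have h2 := h (x - y)
  rw [dist_eq_norm, Real.coe_toNNReal C hC.le]
  linarith

lemma continuous (hp : IsGauge p) : Continuous p := by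
  obtain ⟨C, hC⟩ := hp.exists_lipschitz
  exact hC.continuous

lemma isClosed_le (hp : IsGauge p) (s : ℝ) : IsClosed {x | p x ≤ s} :=
  _root_.isClosed_le hp.continuous continuous_const

lemma convex_le (hp : IsGauge p) (s : ℝ) : Convex ℝ {x | p x ≤ s} := by
  intro x hx y hy a b ha hb hab
  have := hp.add_le (a • x) (b • y)
  rw [hp.smul a ha, hp.smul b hb] at this
  simp only [Set.mem_ofPred_eq] at hx hy ⊢
  calc p (a • x + b • y) ≤ a * p x + b * p y := this
    _ ≤ a * s + b * s := by gcongr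
    _ = s := by rw [← add_mul, hab, one_mul]

lemma mem_nhds (hp : IsGauge p) {s : ℝ} (hs : 0 < s) : {x | p x ≤ s} ∈ nhds (0 : V) := by
  have := hp.continuous.tendsto 0
  rw [hp.zero_eq] at this
  filter_upwards [this.eventually (gt_mem_nhds hs)] with x hx using le_of_lt hx

lemma isCompact_le [FiniteDimensional ℝ V] (hp : IsGauge p) (s : ℝ) : IsCompact {x | p x ≤ s} := by
  obtain ⟨m, hm, h⟩ := hp.lower
  refine Metric.isCompact_of_isClosed_isBounded (hp.isClosed_le s) ?_
  refine (Metric.isBounded_closedBall (x := (0 : V)) (r := s / m)).subset fun x hx => ?_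
  rw [mem_closedBall_zero_iff, le_div_iff₀ hm, mul_comm]
  exact (h x).trans hx

lemma fderiv_le (hp : IsGauge p) {x : V} (hx : DifferentiableAt ℝ p x) (y : V) :
    fderiv ℝ p x y ≤ p y := by
  have h1 : HasDerivAt (fun t : ℝ => p (x + t • y)) (fderiv ℝ p x y) 0 := by
    have h2 : HasDerivAt (fun t : ℝ => x + t • y) y 0 := by
      simpa using ((hasDerivAt_id (0 : ℝ)).smul_const y).const_add x
    have h3 : HasFDerivAt p (fderiv ℝ p x) (x + (0 : ℝ) • y) := by simpa using hx.hasFDerivAt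
    exact h3.comp_hasDerivAt 0 h2
  have h4 := (hasDerivWithinAt_iff_tendsto_slope' (by simp)).mp
    (h1.hasDerivWithinAt (s := Set.Ioi 0))
  refine le_of_tendsto h4 ?_
  filter_upwards [self_mem_nhdsWithin] with t ht
  have ht' : (0 : ℝ) < t := ht
  rw [slope_def_field, zero_smul, add_zero, sub_zero, div_le_iff₀ ht', mul_comm, ← hp.smul t ht'.le]
  linarith [hp.add_le x (t • y)]

lemma fderiv_self (hp : IsGauge p) {x : V} (hx : DifferentiableAt ℝ p x) :
    fderiv ℝ p x x = p x := by
  refine le_antisymm (hp.fderiv_le hx x) ?_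
  have h1 : HasDerivAt (fun t : ℝ => p (t • x)) (fderiv ℝ p x x) 1 := by
    have h2 : HasDerivAt (fun t : ℝ => t • x) x 1 := by
      simpa using (hasDerivAt_id (1 : ℝ)).smul_const x
    have h3 : HasFDerivAt p (fderiv ℝ p x) ((1 : ℝ) • x) := by simpa using hx.hasFDerivAt
    exact h3.comp_hasDerivAt 1 h2
  have h2 : HasDerivAt (fun t : ℝ => p (t • x)) (p x) 1 := by
    have h3 : HasDerivAt (fun t : ℝ => t * p x) (p x) 1 := by
      simpa using (hasDerivAt_id (1 : ℝ)).mul_const (p x)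
    refine h3.congr_of_eventuallyEq ?_
    filter_upwards [lt_mem_nhds (zero_lt_one (α := ℝ))] with t ht
    exact hp.smul t (le_of_lt ht) x
  exact (h2.unique h1).le

/-- Approximate supporting functionals at a differentiability point are close to the gradient. -/
lemma exists_close {x : V} (hx : DifferentiableAt ℝ p x) {ε : ℝ} (hε : 0 < ε) :
    ∃ η : ℝ, 0 < η ∧ ∀ ξ : V →L[ℝ] ℝ, (∀ y, ξ y ≤ p y) → p x - η ≤ ξ x →
      ‖ξ - fderiv ℝ p x‖ ≤ ε := by
  have h1 := hx.hasFDerivAt.isLittleO.def (half_pos hε)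
  obtain ⟨s, hs, h2⟩ := Metric.eventually_nhds_iff.mp h1
  refine ⟨ε / 2 * (s / 2), by positivity, fun ξ h3 h4 => ?_⟩
  have key : ∀ y, (ξ - fderiv ℝ p x) y ≤ ε * ‖y‖ := by
    intro y
    by_cases hy : y = 0
    · simp [hy]
    have hy' : 0 < ‖y‖ := norm_pos_iff.mpr hy
    set t := s / 2 / ‖y‖ with ht
    have ht0 : 0 < t := by positivity
    have hty : t * ‖y‖ = s / 2 := by rw [ht]; field_simp
    have h5 := h2 (y := x + t • y) (by
      rw [dist_eq_norm, add_sub_cancel_left, norm_smul, Real.norm_of_nonneg ht0.le, hty]; linarith)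
    rw [add_sub_cancel_left, norm_smul, Real.norm_of_nonneg ht0.le, hty, map_smul, smul_eq_mul,
      Real.norm_eq_abs] at h5
    have h6 := (abs_le.mp h5).2
    have h7 := h3 (x + t • y)
    rw [map_add, map_smul, smul_eq_mul] at h7
    rw [_root_.sub_apply]
    have h8 : t * (ξ y - fderiv ℝ p x y) ≤ t * (ε * ‖y‖) := by
      have : t * (ε * ‖y‖) = ε * (s / 2) := by rw [← hty]; ring
      linarith
    exact le_of_mul_le_mul_left h8 ht0
  refine ContinuousLinearMap.opNorm_le_bound _ hε.le fun y => ?_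
  rw [Real.norm_eq_abs, abs_le']
  refine ⟨key y, ?_⟩
  have := key (-y)
  rw [map_neg, norm_neg] at this
  exact this

end IsGauge

lemma isGauge_gauge [FiniteDimensional ℝ V] {K : Set V} (hK : Convex ℝ K) (hK' : IsCompact K)
    (h0 : K ∈ nhds 0) : IsGauge (gauge K) where
  add_le := gauge_add_le hK (absorbent_nhds_zero h0)
  smul t ht x := by rw [gauge_smul_of_nonneg ht, smul_eq_mul]
  upper := by
    obtain ⟨r, hr, h⟩ := Metric.mem_nhds_iff.mp h0
    refine ⟨r⁻¹, by positivity, fun x => ?_⟩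
    have := mul_gauge_le_norm h (x := x)
    rw [inv_mul_eq_div, le_div_iff₀ hr, mul_comm]
    exact this
  lower := by
    obtain ⟨R, hR⟩ := hK'.isBounded.exists_norm_le
    refine ⟨(|R| + 1)⁻¹, by positivity, fun x => ?_⟩
    have := le_gauge_of_subset_closedBall (absorbent_nhds_zero h0) (r := |R| + 1) (by positivity)
      (fun y hy => by
        rw [mem_closedBall_zero_iff]; linarith [hR y hy, le_abs_self R]) (x := x)
    rwa [inv_mul_eq_div]

lemma gauge_le_one_iff {K : Set V} (hK : Convex ℝ K) (hK' : IsCompact K)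
    (h0 : K ∈ nhds 0) {x : V} : gauge K x ≤ 1 ↔ x ∈ K := by
  rw [gauge_le_one_iff_mem_closure hK h0, hK'.isClosed.closure_eq]

end IsGauge

section Layercake

variable {V : Type*} [NormedAddCommGroup V] [NormedSpace ℝ V] [FiniteDimensional ℝ V]
  [MeasurableSpace V] [BorelSpace V] (μ : Measure V) [μ.IsAddHaarMeasure]

/-- The ratio of `∫ (1 - p)₊ ^ 2` to the volume of `{p ≤ 1}`. -/
def layerConst (n : ℕ) : ℝ :=
  ∫ t in Set.Ioi (0 : ℝ), if √t ≤ 1 then (1 - √t) ^ n else 0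

variable {p : V → ℝ}

omit [MeasurableSpace V] [BorelSpace V] in
lemma IsGauge.hasCompactSupport (hp : IsGauge p) :
    HasCompactSupport fun x => (Max.max 0 (1 - p x)) ^ 2 :=
  HasCompactSupport.intro (hp.isCompact_le 1) fun x hx => by
    have : ¬p x ≤ 1 := hx
    rw [max_eq_left (by linarith)]
    norm_num

omit [FiniteDimensional ℝ V] [MeasurableSpace V] [BorelSpace V] in
lemma IsGauge.continuous_sq (hp : IsGauge p) : Continuous fun x => (Max.max 0 (1 - p x)) ^ 2 := by
  have := hp.continuous
  fun_prop

lemma IsGauge.integrable_sq (hp : IsGauge p) : Integrable (fun x => (Max.max 0 (1 - p x)) ^ 2) μ :=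
  hp.continuous_sq.integrable_of_hasCompactSupport hp.hasCompactSupport

lemma IsGauge.integral_sq (hp : IsGauge p) :
    ∫ x, (Max.max 0 (1 - p x)) ^ 2 ∂μ = layerConst (finrank ℝ V) * (μ {x | p x ≤ 1}).toReal := by
  rw [(hp.integrable_sq μ).integral_eq_integral_meas_le
    (Filter.Eventually.of_forall fun x => sq_nonneg _), layerConst, ← integral_mul_const]
  refine setIntegral_congr_fun measurableSet_Ioi fun t ht => ?_
  have ht' : (0 : ℝ) < t := ht
  have hiff : ∀ x, t ≤ (Max.max 0 (1 - p x)) ^ 2 ↔ p x ≤ 1 - √t := fun x => by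
    rw [← Real.sqrt_le_left (le_max_left _ _), le_max_iff]
    have := Real.sqrt_pos.mpr ht'
    constructor
    · rintro (h | h) <;> linarith
    · intro h; right; linarith
  simp only [hiff]
  split_ifs with h
  · rw [← abs_of_nonneg (pow_nonneg (sub_nonneg.mpr h) (finrank ℝ V)), measureReal_def,
      ← ENNReal.toReal_ofReal (abs_nonneg _), ← ENNReal.toReal_mul, ← Measure.addHaar_smul]
    congr 2
    ext x
    rcases (sub_nonneg.mpr h).eq_or_lt with h1 | h1
    · rw [← h1]
      constructor
      · intro hx
        have hx0 : x = 0 := by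
          by_contra hne
          exact absurd (hp.pos hne) (not_lt.mpr hx)
        exact ⟨0, by simp [hp.zero_eq], by simp [hx0]⟩
      · rintro ⟨y, -, rfl⟩
        simp [hp.zero_eq]
    · rw [Set.mem_smul_set_iff_inv_smul_mem₀ h1.ne']
      simp only [Set.mem_ofPred_eq]
      rw [hp.smul _ (inv_nonneg.mpr h1.le), inv_mul_le_iff₀ h1, mul_one]
  · have : {x | p x ≤ 1 - √t} = ∅ := by
      ext x
      simp only [Set.mem_ofPred_eq, Set.mem_empty_iff_false, iff_false]
      linarith [hp.nonneg x]
    rw [this]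
    simp

include μ in
lemma layerConst_ne_zero : layerConst (finrank ℝ V) ≠ 0 := by
  intro h0
  have h1 := (isGauge_norm (V := V)).integral_sq μ
  rw [h0, zero_mul] at h1
  have h2 := (isGauge_norm (V := V)).continuous_sq.integral_pos_of_hasCompactSupport_nonneg_nonzero
    (μ := μ) (isGauge_norm (V := V)).hasCompactSupport (fun x => sq_nonneg _) (x := 0) (by simp)
  exact h2.ne' h1

end Layercake

section Support

variable {V : Type*} [NormedAddCommGroup V] [NormedSpace ℝ V]

/-- The Wulff shape of `h_S + t g`. -/
def wul (g : (V →L[ℝ] ℝ) → ℝ) (S : Set V) (t : ℝ) : Set V :=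
  {x | ∀ ξ : V →L[ℝ] ℝ, ξ x ≤ sSup (ξ '' S) + t * g ξ}

lemma isClosed_wul (g : (V →L[ℝ] ℝ) → ℝ) (S : Set V) (t : ℝ) : IsClosed (wul g S t) := by
  rw [wul, Set.ofPred_forall]
  exact isClosed_iInter fun ξ => isClosed_le ξ.continuous continuous_const

lemma convex_wul (g : (V →L[ℝ] ℝ) → ℝ) (S : Set V) (t : ℝ) : Convex ℝ (wul g S t) := by
  rw [wul, Set.ofPred_forall]
  exact convex_iInter fun ξ => convex_halfSpace_le ξ.isLinear _

variable {p : V → ℝ}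

/-- Sublinear functions are attained by dominated functionals. -/
lemma IsGauge.exists_dual [FiniteDimensional ℝ V] (hp : IsGauge p) (x : V) :
    ∃ ξ : V →L[ℝ] ℝ, ξ x = p x ∧ ∀ y, ξ y ≤ p y := by
  by_cases hx : x = 0
  · exact ⟨0, by simp [hx, hp.zero_eq], fun y => by simpa using hp.nonneg y⟩
  obtain ⟨f, h1, h2⟩ := exists_extension_of_le_sublinear
    (LinearPMap.mkSpanSingleton (K := ℝ) x (p x) hx) p (fun c hc y => hp.smul c hc.le y)
    hp.add_le (by
      rintro ⟨y, hy⟩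
      obtain ⟨c, rfl⟩ := Submodule.mem_span_singleton.mp hy
      rw [LinearPMap.mkSpanSingleton'_apply, RingHom.id_apply, smul_eq_mul]
      rcases le_total 0 c with hc | hc
      · exact (hp.smul c hc x).ge
      · exact (mul_nonpos_of_nonpos_of_nonneg hc (hp.nonneg x)).trans (hp.nonneg _))
  refine ⟨LinearMap.toContinuousLinearMap f, ?_, h2⟩
  have := h1 ⟨x, Submodule.mem_span_singleton_self x⟩
  exact this.trans (LinearPMap.mkSpanSingleton'_apply_self _ _ _ _)

variable [FiniteDimensional ℝ V]

lemma IsGauge.le_supp_mul (hp : IsGauge p) (ξ : V →L[ℝ] ℝ) (y : V) :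
    ξ y ≤ sSup (ξ '' {x | p x ≤ 1}) * p y := by
  by_cases hy : y = 0
  · simp [hy, hp.zero_eq]
  have h0 := hp.pos hy
  have h1 := le_csSup ((hp.isCompact_le 1).image ξ.continuous).bddAbove
    (Set.mem_image_of_mem ξ (show (p y)⁻¹ • y ∈ {x | p x ≤ 1} by
      rw [Set.mem_ofPred_eq, hp.smul _ (inv_nonneg.mpr h0.le), inv_mul_cancel₀ h0.ne']))
  rwa [map_smul, smul_eq_mul, inv_mul_le_iff₀ h0, mul_comm] at h1

omit [FiniteDimensional ℝ V] in
lemma IsGauge.supp_le (hp : IsGauge p) {ξ : V →L[ℝ] ℝ} {c : ℝ} (hc : 0 ≤ c)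
    (h : ∀ y, ξ y ≤ c * p y) : sSup (ξ '' {x | p x ≤ 1}) ≤ c := by
  refine csSup_le ⟨ξ 0, 0, by simp [hp.zero_eq], rfl⟩ ?_
  rintro _ ⟨y, hy, rfl⟩
  exact (h y).trans (mul_le_of_le_one_right hc hy)

lemma IsGauge.supp_nonneg (hp : IsGauge p) (ξ : V →L[ℝ] ℝ) :
    0 ≤ sSup (ξ '' {x | p x ≤ 1}) :=
  le_csSup ((hp.isCompact_le 1).image ξ.continuous).bddAbove
    ⟨0, by simp [hp.zero_eq], map_zero ξ⟩

/-- Homogeneous continuous functions are bounded by a multiple of the norm. -/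
lemma exists_bound_norm {g : (V →L[ℝ] ℝ) → ℝ} (hg : Continuous g)
    (hgh : ∀ (ξ : V →L[ℝ] ℝ) (t : ℝ), 0 < t → g (t • ξ) = t * g ξ) :
    ∃ M : ℝ, 0 < M ∧ ∀ ξ, |g ξ| ≤ M * ‖ξ‖ := by
  have hg0 : g 0 = 0 := by
    have := hgh 0 2 two_pos
    rw [smul_zero] at this
    linarith
  obtain ⟨M, hM⟩ := (isCompact_sphere (0 : V →L[ℝ] ℝ) 1).exists_bound_of_continuousOn
    hg.continuousOn
  refine ⟨|M| + 1, by positivity, fun ξ => ?_⟩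
  by_cases hξ : ξ = 0
  · simp [hξ, hg0]
  have h0 : 0 < ‖ξ‖ := norm_pos_iff.mpr hξ
  have h1 := hM (‖ξ‖⁻¹ • ξ) (by
    rw [mem_sphere_zero_iff_norm, norm_smul, norm_inv, norm_norm, inv_mul_cancel₀ h0.ne'])
  rw [hgh _ _ (inv_pos.mpr h0), Real.norm_eq_abs, abs_mul, abs_of_pos (inv_pos.mpr h0),
    inv_mul_le_iff₀ h0, mul_comm] at h1
  exact h1.trans (by gcongr; linarith [le_abs_self M])

lemma IsGauge.exists_bound_supp (hp : IsGauge p) {g : (V →L[ℝ] ℝ) → ℝ} (hg : Continuous g)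
    (hgh : ∀ (ξ : V →L[ℝ] ℝ) (t : ℝ), 0 < t → g (t • ξ) = t * g ξ) :
    ∃ b : ℝ, 0 < b ∧ ∀ ξ, |g ξ| ≤ b * sSup (ξ '' {x | p x ≤ 1}) := by
  obtain ⟨M, hM, h⟩ := exists_bound_norm hg hgh
  obtain ⟨C, hC, hC'⟩ := hp.upper
  refine ⟨M * C, by positivity, fun ξ => (h ξ).trans ?_⟩
  rw [mul_assoc]
  gcongr
  refine ContinuousLinearMap.opNorm_le_bound _ (mul_nonneg hC.le (hp.supp_nonneg ξ)) fun y => ?_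
  have key : ∀ y, ξ y ≤ C * sSup (ξ '' {x | p x ≤ 1}) * ‖y‖ := fun y =>
    calc ξ y ≤ sSup (ξ '' {x | p x ≤ 1}) * p y := hp.le_supp_mul ξ y
      _ ≤ sSup (ξ '' {x | p x ≤ 1}) * (C * ‖y‖) :=
        mul_le_mul_of_nonneg_left (hC' y) (hp.supp_nonneg ξ)
      _ = _ := by ring
  rw [Real.norm_eq_abs, abs_le']
  refine ⟨key y, ?_⟩
  have := key (-y)
  rwa [map_neg, norm_neg] at this

section Perturb

variable (hp : IsGauge p) {g : (V →L[ℝ] ℝ) → ℝ} {b t : ℝ}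
  (hb : ∀ ξ, |g ξ| ≤ b * sSup (ξ '' {x | p x ≤ 1})) (ht : 0 ≤ t) (hbt : b * t < 1) (hb0 : 0 < b)

include hp hb ht

lemma IsGauge.mem_wul {x : V} (hx : p x ≤ 1 - b * t) : x ∈ wul g {x | p x ≤ 1} t := by
  intro ξ
  have h1 := hp.le_supp_mul ξ x
  have h2 := mul_le_mul_of_nonneg_left hx (hp.supp_nonneg ξ)
  have h3 := mul_le_mul_of_nonneg_left (neg_le_of_abs_le (hb ξ)) ht
  linarith

include hb0 in
lemma IsGauge.le_of_mem_wul {x : V} (hx : x ∈ wul g {x | p x ≤ 1} t) : p x ≤ 1 + b * t := by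
  obtain ⟨ξ, h1, h2⟩ := hp.exists_dual x
  have h3 := hp.supp_le (c := 1) zero_le_one (ξ := ξ) (by simpa using h2)
  have h4 := hx ξ
  have h5 := mul_le_mul_of_nonneg_left (le_of_abs_le (hb ξ)) ht
  have h6 := mul_le_mul_of_nonneg_left h3 (by positivity : 0 ≤ t * b)
  linarith

include hb0 in
lemma IsGauge.wul_isCompact : IsCompact (wul g {x | p x ≤ 1} t) :=
  (hp.isCompact_le (1 + b * t)).of_isClosed_subset (isClosed_wul _ _ _)
    fun _ => hp.le_of_mem_wul hb ht hb0

include hbt in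
lemma IsGauge.wul_mem_nhds : wul g {x | p x ≤ 1} t ∈ nhds 0 :=
  Filter.mem_of_superset (hp.mem_nhds (sub_pos.mpr hbt)) fun _ => hp.mem_wul hb ht

include hb0 hbt

lemma IsGauge.gauge_wul : IsGauge (gauge (wul g {x | p x ≤ 1} t)) :=
  isGauge_gauge (convex_wul _ _ _) (hp.wul_isCompact hb ht hb0) (hp.wul_mem_nhds hb ht hbt)

lemma IsGauge.gauge_wul_le_one {x : V} :
    gauge (wul g {x | p x ≤ 1} t) x ≤ 1 ↔ x ∈ wul g {x | p x ≤ 1} t :=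
  gauge_le_one_iff (convex_wul _ _ _) (hp.wul_isCompact hb ht hb0)
    (hp.wul_mem_nhds hb ht hbt)

lemma IsGauge.gauge_wul_le (x : V) : (1 - b * t) * gauge (wul g {x | p x ≤ 1} t) x ≤ p x := by
  have h0 := sub_pos.mpr hbt
  have hq := hp.gauge_wul hb ht hbt hb0
  rw [← le_inv_mul_iff₀ h0]
  refine homogeneous_le hq.smul (q := fun x => (1 - b * t)⁻¹ * p x)
    (fun s hs x => by rw [hp.smul s hs]; ring)
    (fun x hx => mul_pos (inv_pos.mpr h0) (hp.pos hx)) (fun x hx => ?_) x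
  rw [hp.gauge_wul_le_one hb ht hbt hb0]
  rw [inv_mul_le_iff₀ h0, mul_one] at hx
  exact hp.mem_wul hb ht hx

lemma IsGauge.le_gauge_wul (x : V) : p x ≤ (1 + b * t) * gauge (wul g {x | p x ≤ 1} t) x := by
  have h0 : 0 < 1 + b * t := by positivity
  have hq := hp.gauge_wul hb ht hbt hb0
  rw [← inv_mul_le_iff₀ h0]
  refine homogeneous_le (p := fun x => (1 + b * t)⁻¹ * p x)
    (fun s hs x => by rw [hp.smul s hs]; ring) hq.smul
    (fun x => hq.pos) (fun x hx => ?_) x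
  rw [hp.gauge_wul_le_one hb ht hbt hb0] at hx
  rw [inv_mul_le_iff₀ h0, mul_one]
  exact hp.le_of_mem_wul hb ht hb0 hx

/-- A functional dominated by `p` bounds the perturbed gauge from below. -/
lemma IsGauge.le_mul_gauge_wul {ξ : V →L[ℝ] ℝ} (hξ : ∀ y, ξ y ≤ p y) (x : V) :
    ξ x ≤ (1 + t * g ξ) * gauge (wul g {x | p x ≤ 1} t) x := by
  have hq := hp.gauge_wul hb ht hbt hb0
  by_cases hx : x = 0
  · simp [hx]
  have h0 := hq.pos hx
  have h1 := (hp.gauge_wul_le_one hb ht hbt hb0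
    (x := (gauge (wul g {x | p x ≤ 1} t) x)⁻¹ • x)).mp
      (by rw [hq.smul _ (inv_nonneg.mpr h0.le), inv_mul_cancel₀ h0.ne']) ξ
  rw [map_smul, smul_eq_mul] at h1
  have h2 := hp.supp_le (c := 1) zero_le_one (ξ := ξ) (by simpa using hξ)
  have h3 : (gauge (wul g {x | p x ≤ 1} t) x)⁻¹ * ξ x ≤ 1 + t * g ξ := by linarith
  rwa [inv_mul_le_iff₀ h0, mul_comm] at h3

/-- An upper bound for the perturbed gauge. -/
lemma IsGauge.mul_gauge_wul_le
    (hgh : ∀ (ξ : V →L[ℝ] ℝ) (t : ℝ), 0 < t → g (t • ξ) = t * g ξ) {x : V} {a : ℝ} (ha : 0 < a)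
    (h : ∀ ξ : V →L[ℝ] ℝ, (∀ y, ξ y ≤ p y) → a * ξ x ≤ (1 + t * g ξ) * p x) :
    a * gauge (wul g {x | p x ≤ 1} t) x ≤ p x := by
  have hq := hp.gauge_wul hb ht hbt hb0
  by_cases hx : x = 0
  · simp [hx, hp.zero_eq]
  have h0 := hp.pos hx
  have key : (a * (p x)⁻¹) • x ∈ wul g {x | p x ≤ 1} t := by
    intro ξ
    rcases (hp.supp_nonneg ξ).eq_or_lt with h1 | h1
    · have h2 : ξ x ≤ 0 := by simpa [← h1] using hp.le_supp_mul ξ x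
      have h3 : g ξ = 0 := by simpa [← h1] using hb ξ
      rw [← h1, h3, map_smul, smul_eq_mul, mul_zero, add_zero]
      exact mul_nonpos_of_nonneg_of_nonpos (by positivity) h2
    · set s := sSup (ξ '' {x | p x ≤ 1})
      have h2 := h (s⁻¹ • ξ) fun y => by
        rw [_root_.smul_apply, smul_eq_mul, inv_mul_le_iff₀ h1]
        exact hp.le_supp_mul ξ y
      rw [_root_.smul_apply, smul_eq_mul, hgh _ _ (inv_pos.mpr h1)] at h2
      rw [map_smul, smul_eq_mul]
      have h3 : a * (p x)⁻¹ * ξ x = (s * (p x)⁻¹) * (a * (s⁻¹ * ξ x)) := by field_simp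
      have h4 : s + t * g ξ = (s * (p x)⁻¹) * ((1 + t * (s⁻¹ * g ξ)) * p x) := by field_simp
      rw [h3, h4]
      gcongr
  have h1 := (hp.gauge_wul_le_one hb ht hbt hb0).mpr key
  rw [hq.smul _ (by positivity), mul_right_comm, ← div_eq_mul_inv, div_le_one h0] at h1
  exact h1

end Perturb

end Support

section Squeeze

/-- Computing a right derivative by squeezing. -/
lemma hasDerivWithinAt_of_squeeze {f l : ℝ → ℝ} {d : ℝ} (hl : HasDerivAt l d 0)
    (hl0 : l 0 = f 0) (hlf : ∀ᶠ t in nhdsWithin (0 : ℝ) (Set.Ioi 0), l t ≤ f t)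
    (hu : ∀ a : ℝ, d < a → ∃ (u : ℝ → ℝ) (d' : ℝ), d' < a ∧ HasDerivAt u d' 0 ∧ u 0 = f 0 ∧
      ∀ᶠ t in nhdsWithin (0 : ℝ) (Set.Ioi 0), f t ≤ u t) :
    HasDerivWithinAt f d (Set.Ioi 0) 0 := by
  have slope_tendsto : ∀ {u : ℝ → ℝ} {d' : ℝ}, HasDerivAt u d' 0 →
      Filter.Tendsto (slope u 0) (nhdsWithin (0 : ℝ) (Set.Ioi 0)) (nhds d') := fun h =>
    (hasDerivWithinAt_iff_tendsto_slope' (by simp)).mp h.hasDerivWithinAt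
  rw [hasDerivWithinAt_iff_tendsto_slope' (by simp), tendsto_order]
  constructor
  · intro a ha
    filter_upwards [(slope_tendsto hl).eventually (lt_mem_nhds ha), hlf, self_mem_nhdsWithin]
      with t h1 h2 h3
    have h3' : (0 : ℝ) < t := h3
    refine h1.trans_le ?_
    rw [slope_def_field, slope_def_field, hl0]
    gcongr
  · intro a ha
    obtain ⟨u, d', h0, h1, h2, h3⟩ := hu a ha
    filter_upwards [(slope_tendsto h1).eventually (gt_mem_nhds h0), h3, self_mem_nhdsWithin]
      with t h1 h4 h5
    have h5' : (0 : ℝ) < t := h5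
    refine lt_of_le_of_lt ?_ h1
    rw [slope_def_field, slope_def_field, h2]
    gcongr

lemma hasDerivAt_max_sq (s : ℝ) :
    HasDerivAt (fun s : ℝ => (max 0 (1 - s)) ^ 2) (-(2 * max 0 (1 - s))) s := by
  rw [hasDerivAt_iff_isLittleO]
  have h1 : (fun y : ℝ => (max 0 (1 - y)) ^ 2 - (max 0 (1 - s)) ^ 2
      - (y - s) • (-(2 * max 0 (1 - s)))) =O[nhds s] fun y => (y - s) ^ 2 := by
    refine Asymptotics.IsBigO.of_bound 1 (Filter.Eventually.of_forall fun y => ?_)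
    rw [one_mul, Real.norm_of_nonneg (sq_nonneg _), Real.norm_eq_abs, abs_le, smul_eq_mul]
    rcases max_cases 0 (1 - y) with ⟨h, h'⟩ | ⟨h, h'⟩ <;>
    rcases max_cases 0 (1 - s) with ⟨k, k'⟩ | ⟨k, k'⟩ <;> rw [h, k] <;>
    constructor <;> nlinarith
  have h2 := Asymptotics.isLittleO_pow_sub_sub s one_lt_two
  simp only [Real.norm_eq_abs, sq_abs] at h2
  exact h1.trans_isLittleO h2

lemma abs_max_sq_sub_le {a b : ℝ} (ha : 0 ≤ a) (hb : 0 ≤ b) :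
    |(max 0 (1 - a)) ^ 2 - (max 0 (1 - b)) ^ 2| ≤ 2 * |a - b| := by
  have h1 : |max 0 (1 - a) - max 0 (1 - b)| ≤ |a - b| := by
    refine (abs_max_sub_max_le_max _ _ _ _).trans ?_
    rw [sub_zero, abs_zero, max_eq_right (abs_nonneg _), abs_sub_comm]
    ring_nf
    rfl
  have h2 : |max 0 (1 - a) + max 0 (1 - b)| ≤ 2 := by
    rw [abs_of_nonneg (by positivity)]
    have := max_le zero_le_one (by linarith : 1 - a ≤ 1)
    have := max_le zero_le_one (by linarith : 1 - b ≤ 1)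
    linarith
  rw [sq_sub_sq, abs_mul]
  gcongr

end Squeeze

section Variation

variable {V : Type*} [NormedAddCommGroup V] [NormedSpace ℝ V] [FiniteDimensional ℝ V]
  {p : V → ℝ} {g : (V →L[ℝ] ℝ) → ℝ}

/-- The radial derivative of the gauge of a Wulff shape. -/
lemma IsGauge.hasDerivWithinAt_gauge_wul (hp : IsGauge p) (hg : Continuous g)
    (hgh : ∀ (ξ : V →L[ℝ] ℝ) (t : ℝ), 0 < t → g (t • ξ) = t * g ξ) {b : ℝ} (hb0 : 0 < b)
    (hb : ∀ ξ, |g ξ| ≤ b * sSup (ξ '' {x | p x ≤ 1})) {x : V} (hx : DifferentiableAt ℝ p x) :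
    HasDerivWithinAt (fun t => gauge (wul g {x | p x ≤ 1} t) x) (-(p x * g (fderiv ℝ p x)))
      (Set.Ioi 0) 0 := by
  have hsmall : ∀ᶠ t in nhdsWithin (0 : ℝ) (Set.Ioi 0), 0 < t ∧ b * t < 1 := by
    filter_upwards [self_mem_nhdsWithin, mem_nhdsWithin_of_mem_nhds
      (gt_mem_nhds (inv_pos.mpr hb0))] with t h1 h2
    refine ⟨h1, ?_⟩
    have := mul_lt_mul_of_pos_left h2 hb0
    rwa [mul_inv_cancel₀ hb0.ne'] at this
  have hzero : gauge (wul g {x | p x ≤ 1} 0) x = p x := by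
    have h1 := hp.gauge_wul_le hb le_rfl (by simp) hb0 x
    have h2 := hp.le_gauge_wul hb le_rfl (by simp) hb0 x
    simp only [mul_zero, sub_zero, add_zero, one_mul] at h1 h2
    exact le_antisymm h1 h2
  have hder : ∀ c : ℝ, HasDerivAt (fun t : ℝ => p x / (1 + t * c)) (-(p x * c)) 0 := by
    intro c
    have h1 : HasDerivAt (fun t : ℝ => 1 + t * c) c 0 := by
      simpa using ((hasDerivAt_id (0 : ℝ)).mul_const c).const_add 1
    have h2 := (hasDerivAt_const (0 : ℝ) (p x)).div h1 (by simp)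
    refine HasDerivAt.congr_deriv h2 ?_
    simp
  have hpos : ∀ c : ℝ, ∀ᶠ t in nhdsWithin (0 : ℝ) (Set.Ioi 0), 0 < 1 + t * c := by
    intro c
    have : Continuous fun t : ℝ => 1 + t * c := by fun_prop
    exact mem_nhdsWithin_of_mem_nhds (this.continuousAt.eventually (lt_mem_nhds (by simp)))
  set ξ := fderiv ℝ p x with hξ
  refine hasDerivWithinAt_of_squeeze (hder (g ξ)) (by simp [hzero]) ?_ fun a ha => ?_
  · filter_upwards [hsmall, hpos (g ξ)] with t h1 h2
    have h3 := hp.le_mul_gauge_wul hb h1.1.le h1.2 hb0 (hp.fderiv_le hx) x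
    rw [hp.fderiv_self hx] at h3
    rwa [div_le_iff₀ h2, mul_comm]
  · by_cases hx0 : x = 0
    · refine ⟨fun _ => 0, 0, ?_, hasDerivAt_const _ _, by simp [hx0], by simp [hx0]⟩
      simpa [hx0, hp.zero_eq] using ha
    have h0 := hp.pos hx0
    obtain ⟨ε, hε, h1⟩ : ∃ ε : ℝ, 0 < ε ∧ -(p x * (g ξ - ε)) < a := by
      refine ⟨(a + p x * g ξ) / (2 * p x), by apply div_pos <;> linarith, ?_⟩
      have : p x * ((a + p x * g ξ) / (2 * p x)) = (a + p x * g ξ) / 2 := by field_simp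
      rw [mul_sub, this]
      linarith
    refine ⟨fun t => p x / (1 + t * (g ξ - ε)), _, h1, hder _, by simp [hzero], ?_⟩
    obtain ⟨δ, hδ, h2⟩ := Metric.continuousAt_iff.mp (hg.continuousAt (x := ξ)) ε hε
    obtain ⟨η, hη, h3⟩ := IsGauge.exists_close hx (half_pos hδ)
    have h4 : ∀ᶠ t in nhdsWithin (0 : ℝ) (Set.Ioi 0),
        (1 + t * (g ξ - ε)) * (p x - η) < (1 - b * t) * p x := by
      have k1 : Continuous fun t : ℝ => (1 + t * (g ξ - ε)) * (p x - η) := by fun_prop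
      have k2 : Continuous fun t : ℝ => (1 - b * t) * p x := by fun_prop
      exact mem_nhdsWithin_of_mem_nhds
        (k1.continuousAt.eventually_lt k2.continuousAt (by simpa using hη))
    filter_upwards [hsmall, hpos (g ξ - ε), h4] with t h5 h6 h7
    rw [le_div_iff₀ h6, mul_comm]
    refine hp.mul_gauge_wul_le hb h5.1.le h5.2 hb0 hgh h6 fun ζ hζ => ?_
    rcases le_total (p x - η) (ζ x) with h8 | h8
    · have h9 := h2 (x := ζ) (by rw [dist_eq_norm]; linarith [h3 ζ hζ h8])
      rw [Real.dist_eq] at h9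
      have h10 := (abs_lt.mp h9).1
      have h11 : 1 + t * (g ξ - ε) ≤ 1 + t * g ζ := by
        have := mul_le_mul_of_nonneg_left (by linarith : g ξ - ε ≤ g ζ) h5.1.le
        linarith
      exact (mul_le_mul_of_nonneg_left (hζ x) h6.le).trans
        (mul_le_mul_of_nonneg_right h11 h0.le)
    · have h9 := mul_le_mul_of_nonneg_left h8 h6.le
      refine h9.trans (h7.le.trans (mul_le_mul_of_nonneg_right ?_ h0.le))
      have h10 := neg_le_of_abs_le (hb ζ)
      have h11 := hp.supp_le (c := 1) zero_le_one (ξ := ζ) (by simpa using hζ)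
      have h12 := mul_le_mul_of_nonneg_left h11 hb0.le
      have h13 := mul_le_mul_of_nonneg_left (by linarith : -b ≤ g ζ) h5.1.le
      linarith

variable [MeasurableSpace V] [BorelSpace V] (μ : Measure V) [μ.IsAddHaarMeasure]

/-- The density of the first variation of the volume. -/
def varDens (g : (V →L[ℝ] ℝ) → ℝ) (p : V → ℝ) (x : V) : ℝ :=
  2 * max 0 (1 - p x) * p x * g (fderiv ℝ p x)

/-- The first variation of the volume of a convex body under perturbation by `g`. -/
theorem IsGauge.hasDerivWithinAt_wul (hp : IsGauge p) (hg : Continuous g)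
    (hgh : ∀ (ξ : V →L[ℝ] ℝ) (t : ℝ), 0 < t → g (t • ξ) = t * g ξ) :
    HasDerivWithinAt (fun t => (μ (wul g {x | p x ≤ 1} t)).toReal)
      ((layerConst (finrank ℝ V))⁻¹ * ∫ x, varDens g p x ∂μ) (Set.Ici 0) 0 := by
  obtain ⟨b, hb0, hb⟩ := hp.exists_bound_supp hg hgh
  rw [← hasDerivWithinAt_Ioi_iff_Ici]
  have hsmall : ∀ᶠ t in nhdsWithin (0 : ℝ) (Set.Ioi 0), 0 < t ∧ b * t < 1 / 2 := by
    filter_upwards [self_mem_nhdsWithin, mem_nhdsWithin_of_mem_nhds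
      (gt_mem_nhds (by positivity : 0 < b⁻¹ * (1 / 2)))] with t h1 h2
    refine ⟨h1, ?_⟩
    rwa [← lt_inv_mul_iff₀ hb0]
  have hzero : gauge (wul g {x | p x ≤ 1} 0) = p := by
    funext x
    have h1 := hp.gauge_wul_le hb le_rfl (by simp) hb0 x
    have h2 := hp.le_gauge_wul hb le_rfl (by simp) hb0 x
    simp only [mul_zero, sub_zero, add_zero, one_mul] at h1 h2
    exact le_antisymm h1 h2
  set P : ℝ → V → ℝ := fun t => gauge (wul g {x | p x ≤ 1} t) with hP
  have hPg : ∀ t, 0 ≤ t → b * t < 1 / 2 → IsGauge (P t) := fun t h1 h2 =>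
    hp.gauge_wul hb h1 (by linarith) hb0
  set F : ℝ → V → ℝ := fun t x => (Max.max 0 (1 - P t x)) ^ 2 with hF
  have hvol : ∀ t, 0 ≤ t → b * t < 1 / 2 → (μ (wul g {x | p x ≤ 1} t)).toReal
      = (layerConst (finrank ℝ V))⁻¹ * ∫ x, F t x ∂μ := by
    intro t h1 h2
    rw [hF, (hPg t h1 h2).integral_sq μ, inv_mul_cancel_left₀ (layerConst_ne_zero μ)]
    congr 2
    ext x
    exact (hp.gauge_wul_le_one hb h1 (by linarith) hb0).symm
  suffices h : HasDerivWithinAt (fun t => ∫ x, F t x ∂μ) (∫ x, varDens g p x ∂μ) (Set.Ioi 0) 0 by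
    refine (h.const_mul _).congr_of_eventuallyEq ?_ (hvol 0 le_rfl (by simp))
    filter_upwards [hsmall] with t ht using hvol t ht.1.le ht.2
  rw [hasDerivWithinAt_iff_tendsto_slope' (by simp)]
  have hF0 : F 0 = fun x => (Max.max 0 (1 - p x)) ^ 2 := by
    funext x
    simp only [hF, hP, hzero]
  have hslope : ∀ᶠ t in nhdsWithin (0 : ℝ) (Set.Ioi 0),
      ∫ x, slope (fun t => F t x) 0 t ∂μ = slope (fun t => ∫ x, F t x ∂μ) 0 t := by
    filter_upwards [hsmall] with t ht
    simp only [slope_def_field, integral_div]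
    rw [integral_sub ((hPg t ht.1.le ht.2).integrable_sq μ)
      ((hPg 0 le_rfl (by simp)).integrable_sq μ)]
  refine Filter.Tendsto.congr' hslope ?_
  refine tendsto_integral_filter_of_dominated_convergence
    (Set.indicator {x | p x ≤ 3 / 2} fun _ => 6 * b) ?_ ?_ ?_ ?_
  · filter_upwards [hsmall] with t ht
    have h1 := (hPg t ht.1.le ht.2).continuous_sq
    have h2 := (hPg 0 le_rfl (by simp)).continuous_sq
    simp only [slope_def_field]
    exact ((h1.sub h2).div_const _).aestronglyMeasurable
  · filter_upwards [hsmall] with t ht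
    refine Filter.Eventually.of_forall fun x => ?_
    have h1 := hp.gauge_wul_le hb ht.1.le (by linarith) hb0 x
    have h2 := hp.le_gauge_wul hb ht.1.le (by linarith) hb0 x
    have h3 := (hPg t ht.1.le ht.2).nonneg x
    have h4 := hp.nonneg x
    change (1 - b * t) * P t x ≤ p x at h1
    change p x ≤ (1 + b * t) * P t x at h2
    have hbt : 0 < b * t := mul_pos hb0 ht.1
    rw [slope_def_field, hF0, sub_zero, Real.norm_eq_abs, abs_div, abs_of_pos ht.1,
      div_le_iff₀ ht.1]
    by_cases hx : p x ≤ 3 / 2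
    · rw [Set.indicator_of_mem (s := {x | p x ≤ 3 / 2}) hx]
      refine (abs_max_sq_sub_le h3 h4).trans ?_
      have h5 : P t x ≤ 3 := by nlinarith
      have h6 : |P t x - p x| ≤ b * t * 3 := by
        rw [abs_le]
        constructor <;> nlinarith
      linarith
    · rw [Set.indicator_of_notMem (s := {x | p x ≤ 3 / 2}) hx]
      have h5 : 1 ≤ P t x := by
        by_contra! h
        nlinarith
      have h6 : 1 ≤ p x := by linarith
      simp only [hF]
      rw [max_eq_left (by linarith), max_eq_left (by linarith)]
      simp
  · exact (integrable_indicator_iff (hp.isClosed_le _).measurableSet).mpr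
      (integrableOn_const (hp.isCompact_le _).measure_lt_top.ne)
  · obtain ⟨C, hC⟩ := hp.exists_lipschitz
    filter_upwards [hC.ae_differentiableAt (μ := μ)] with x hx
    have h1 := hp.hasDerivWithinAt_gauge_wul hg hgh hb0 hb hx
    have h2 := (hasDerivAt_max_sq (P 0 x)).comp_hasDerivWithinAt (0 : ℝ) h1
    have h3 : HasDerivWithinAt (fun t => F t x) (varDens g p x) (Set.Ioi 0) 0 := by
      refine HasDerivWithinAt.congr_deriv h2 ?_
      have h4 : P 0 x = p x := congrFun hzero x
      rw [h4, varDens]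
      ring
    exact (hasDerivWithinAt_iff_tendsto_slope' (by simp)).mp h3

end Variation

section FirstVariation

variable {V : Type*} [NormedAddCommGroup V] [NormedSpace ℝ V]

lemma fderiv_eq_of_le {f h : V → ℝ} {x : V} (hf : DifferentiableAt ℝ f x)
    (hh : DifferentiableAt ℝ h x) (hle : ∀ y, f y ≤ h y) (he : f x = h x) :
    fderiv ℝ f x = fderiv ℝ h x := by
  have h1 : IsLocalMin (fun y => h y - f y) x :=
    Filter.Eventually.of_forall fun y => by
      simp only [he, sub_self]
      linarith [hle y]
  have h2 := h1.fderiv_eq_zero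
  rw [fderiv_fun_sub hh hf] at h2
  exact (sub_eq_zero.mp h2).symm

variable [FiniteDimensional ℝ V]

/-- A convex set without interior points lies in a hyperplane. -/
lemma exists_const_of_interior [Nontrivial V] {S : Set V} (hS : Convex ℝ S)
    (h : interior S = ∅) : ∃ u : V →L[ℝ] ℝ, u ≠ 0 ∧ ∃ c, ∀ x ∈ S, u x = c := by
  rcases S.eq_empty_or_nonempty with rfl | ⟨x₀, hx₀⟩
  · obtain ⟨x, hx⟩ := exists_ne (0 : V)
    obtain ⟨u, hu⟩ := SeparatingDual.exists_ne_zero (R := ℝ) hx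
    exact ⟨u, fun h0 => hu (by simp [h0]), 0, by simp⟩
  have h1 : vectorSpan ℝ S < ⊤ := by
    rw [lt_top_iff_ne_top]
    intro h2
    rw [← AffineSubspace.affineSpan_eq_top_iff_vectorSpan_eq_top_of_nonempty ℝ V V ⟨x₀, hx₀⟩,
      ← hS.interior_nonempty_iff_affineSpan_eq_top, h] at h2
    exact Set.not_nonempty_empty h2
  obtain ⟨f, hf, h2⟩ := Submodule.exists_le_ker_of_lt_top _ h1
  refine ⟨LinearMap.toContinuousLinearMap f, by simpa using hf, f x₀, fun x hx => ?_⟩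
  have h3 := h2 (vsub_mem_vectorSpan ℝ hx hx₀)
  rw [LinearMap.mem_ker, vsub_eq_sub, map_sub, sub_eq_zero] at h3
  exact h3

lemma exists_isGauge {K : Set V} (hK : Convex ℝ K) (hK' : IsCompact K) {x : V}
    (hx : x ∈ interior K) : ∃ p : V → ℝ, IsGauge p ∧ K = (fun y => x + y) '' {y | p y ≤ 1} := by
  have h1 : Convex ℝ ((fun y => -x + y) '' K) := hK.translate _
  have h2 : IsCompact ((fun y => -x + y) '' K) := hK'.image (by fun_prop)
  have h3 : (fun y => -x + y) '' K ∈ nhds 0 := by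
    rw [Set.image_add_left, neg_neg]
    refine (continuous_const.add continuous_id).continuousAt.preimage_mem_nhds ?_
    simpa using mem_interior_iff_mem_nhds.mp hx
  refine ⟨_, isGauge_gauge h1 h2 h3, ?_⟩
  have h4 : {y | gauge ((fun y => -x + y) '' K) y ≤ 1} = (fun y => -x + y) '' K :=
    Set.ext fun y => gauge_le_one_iff h1 h2 h3
  rw [h4, Set.image_image]
  simp

omit [FiniteDimensional ℝ V] in
lemma wul_translate (g : (V →L[ℝ] ℝ) → ℝ) {S : Set V} (hS : IsCompact S) (hne : S.Nonempty) (x : V)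
    (t : ℝ) : wul g ((fun y => x + y) '' S) t = (fun y => x + y) '' wul g S t := by
  have h : ∀ ξ : V →L[ℝ] ℝ, sSup (ξ '' ((fun y => x + y) '' S)) = ξ x + sSup (ξ '' S) := by
    intro ξ
    have h1 := (OrderIso.addLeft (ξ x)).map_csSup' (hne.image ξ)
      (hS.image ξ.continuous).bddAbove
    simp only [OrderIso.addLeft_apply] at h1
    rw [h1, Set.image_image, Set.image_image]
    simp
  ext y
  rw [Set.image_add_left (t := wul g S t), Set.mem_preimage]
  refine forall_congr' fun ξ => ?_
  rw [h, map_add, map_neg]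
  constructor <;> intro h <;> linarith

variable [MeasurableSpace V] [BorelSpace V] (μ : Measure V) [μ.IsAddHaarMeasure]

/-- The first variation of the volume in direction `g`. -/
def wd (g : (V →L[ℝ] ℝ) → ℝ) (S : Set V) : ℝ :=
  derivWithin (fun t => (μ (wul g S t)).toReal) (Set.Ici 0) 0

omit [FiniteDimensional ℝ V] in
lemma wd_translate (g : (V →L[ℝ] ℝ) → ℝ) {S : Set V} (hS : IsCompact S) (x : V) :
    wd μ g ((fun y => x + y) '' S) = wd μ g S := by
  rcases S.eq_empty_or_nonempty with rfl | hne
  · simp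
  have h : ∀ t, μ (wul g ((fun y => x + y) '' S) t) = μ (wul g S t) := fun t => by
    rw [wul_translate g hS hne, Set.image_add_left, measure_preimage_add]
  simp only [wd, h]

omit [FiniteDimensional ℝ V] in
lemma wd_add_eval (g : (V →L[ℝ] ℝ) → ℝ) (S : Set V) (e : V) :
    wd μ (fun ξ => g ξ + ξ e) S = wd μ g S := by
  have h : ∀ t, wul (fun ξ => g ξ + ξ e) S t = (fun y => t • e + y) '' wul g S t := by
    intro t
    ext y
    rw [Set.image_add_left, Set.mem_preimage]
    refine forall_congr' fun ξ => ?_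
    rw [map_add, map_neg, map_smul, smul_eq_mul]
    constructor <;> intro h <;> linarith
  simp only [wd, h, Set.image_add_left, measure_preimage_add]

lemma wd_null [Nontrivial V] {g : (V →L[ℝ] ℝ) → ℝ} (hgo : ∀ ξ, g (-ξ) = -g ξ) {S : Set V}
    (hS : Convex ℝ S) (h : interior S = ∅) : wd μ g S = 0 := by
  obtain ⟨u, hu, c, hc⟩ := exists_const_of_interior hS h
  suffices ∀ t, μ (wul g S t) = 0 by simp [wd, this]
  intro t
  obtain ⟨c', h1, h2⟩ : ∃ c', sSup (u '' S) = c' ∧ sSup ((-u) '' S) = -c' := by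
    rcases S.eq_empty_or_nonempty with rfl | hne
    · exact ⟨0, by simp, by simp⟩
    · refine ⟨c, ?_, ?_⟩
      · rw [(Set.image_congr hc).trans (hne.image_const c), csSup_singleton]
      · rw [(Set.image_congr fun x hx => (by rw [_root_.neg_apply, hc x hx] : (-u) x = -c)).trans
          (hne.image_const (-c)), csSup_singleton]
  refine measure_mono_null (fun x hx => ?_) (measure_hyperplane μ hu (c' + t * g u))
  have h3 := hx u
  have h4 := hx (-u)
  rw [h1] at h3
  rw [h2, hgo, _root_.neg_apply] at h4
  exact le_antisymm h3 (by linarith)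

variable {p q : V → ℝ} {g : (V →L[ℝ] ℝ) → ℝ} (hg : Continuous g)
  (hgh : ∀ (ξ : V →L[ℝ] ℝ) (t : ℝ), 0 < t → g (t • ξ) = t * g ξ)

include hg hgh in
lemma IsGauge.wd_eq (hp : IsGauge p) :
    wd μ g {x | p x ≤ 1} = (layerConst (finrank ℝ V))⁻¹ * ∫ x, varDens g p x ∂μ :=
  (hp.hasDerivWithinAt_wul μ hg hgh).derivWithin (uniqueDiffOn_Ici _ _ Set.self_mem_Ici)

omit [FiniteDimensional ℝ V] [MeasurableSpace V] [BorelSpace V] in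
lemma IsGauge.abs_varDens_le (hp : IsGauge p) {x : V} {B : ℝ} (hB : |g (fderiv ℝ p x)| ≤ B) :
    |varDens g p x| ≤ {x | p x ≤ 1}.indicator (fun _ => 2 * B) x := by
  have h0 := hp.nonneg x
  rw [varDens, abs_mul]
  by_cases hx : p x ≤ 1
  · rw [Set.indicator_of_mem (s := {x | p x ≤ 1}) hx, max_eq_right (by linarith),
      abs_of_nonneg (mul_nonneg (by linarith) h0)]
    refine mul_le_mul ?_ hB (abs_nonneg _) zero_le_two
    nlinarith
  · rw [Set.indicator_of_notMem (s := {x | p x ≤ 1}) hx, max_eq_left (by linarith)]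
    simp

omit [FiniteDimensional ℝ V] [μ.IsAddHaarMeasure] in
include hg in
lemma IsGauge.aestronglyMeasurable_varDens (hp : IsGauge p) :
    AEStronglyMeasurable (varDens g p) μ := by
  have h1 : Measurable fun x => g (fderiv ℝ p x) := hg.measurable.comp (measurable_fderiv ℝ p)
  have h2 := hp.continuous.measurable
  exact (((measurable_const.mul (measurable_const.max (measurable_const.sub h2))).mul h2).mul
    h1).aestronglyMeasurable

lemma IsGauge.integrable_indicator (hp : IsGauge p) (s B : ℝ) :
    Integrable ({x | p x ≤ s}.indicator fun _ => B) μ :=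
  (integrable_indicator_iff (hp.isClosed_le _).measurableSet).mpr
    (integrableOn_const (hp.isCompact_le _).measure_lt_top.ne)

omit [FiniteDimensional ℝ V] [MeasurableSpace V] [BorelSpace V] in
lemma IsGauge.abs_le_of_dual (hp : IsGauge p) {b s : ℝ} (hb0 : 0 < b) (hs : 0 ≤ s)
    (hb : ∀ ξ, |g ξ| ≤ b * sSup (ξ '' {x | p x ≤ 1})) {ξ : V →L[ℝ] ℝ} (h : ∀ y, ξ y ≤ s * p y) :
    |g ξ| ≤ b * s :=
  (hb ξ).trans (mul_le_mul_of_nonneg_left (hp.supp_le hs h) hb0.le)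

include hg hgh in
lemma IsGauge.integrable_varDens (hp : IsGauge p) : Integrable (varDens g p) μ := by
  obtain ⟨b, hb0, hb⟩ := hp.exists_bound_supp hg hgh
  obtain ⟨C, hC⟩ := hp.exists_lipschitz
  refine (hp.integrable_indicator μ 1 (2 * (b * 1))).mono' (hp.aestronglyMeasurable_varDens μ hg) ?_
  filter_upwards [hC.ae_differentiableAt (μ := μ)] with x hx
  exact hp.abs_varDens_le (hp.abs_le_of_dual hb0 zero_le_one hb
    fun y => by simpa using hp.fderiv_le hx y)

include hg hgh in
lemma wd_val {K L : Set V} (hK : Convex ℝ K) (hK' : IsCompact K) (hL : Convex ℝ L)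
    (hL' : IsCompact L) (hU : Convex ℝ (K ∪ L)) (hI : (interior (K ∩ L)).Nonempty) :
    wd μ g (K ∪ L) + wd μ g (K ∩ L) = wd μ g K + wd μ g L := by
  obtain ⟨x₀, hx₀⟩ := hI
  have hxK := interior_mono Set.inter_subset_left hx₀
  have hxL := interior_mono Set.inter_subset_right hx₀
  obtain ⟨p, hp, rfl⟩ := exists_isGauge hK hK' hxK
  obtain ⟨q, hq, rfl⟩ := exists_isGauge hL hL' hxL
  obtain ⟨r, hr, hUr⟩ := exists_isGauge hU (hK'.union hL')
    (interior_mono Set.subset_union_left hxK)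
  have hinj : Function.Injective fun y => x₀ + y := add_right_injective x₀
  have hm := hp.max hq
  have hmm : (fun y => x₀ + y) '' {y | p y ≤ 1} ∩ (fun y => x₀ + y) '' {y | q y ≤ 1}
      = (fun y => x₀ + y) '' {y | Max.max (p y) (q y) ≤ 1} := by
    rw [← Set.image_inter hinj]
    congr 1
    ext y
    simp
  have hrm : ∀ y, r y ≤ 1 ↔ min (p y) (q y) ≤ 1 := by
    rw [← Set.image_union, Set.image_eq_image hinj] at hUr
    intro y
    have := Set.ext_iff.mp hUr y
    simp only [Set.mem_union, Set.mem_ofPred_eq] at this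
    rw [← this, min_le_iff]
  have hmin : ∀ t : ℝ, 0 ≤ t → ∀ x, min (p (t • x)) (q (t • x)) = t * min (p x) (q x) :=
    fun t ht x => by rw [hp.smul t ht, hq.smul t ht, mul_min_of_nonneg _ _ ht]
  have hr_eq : ∀ y, r y = min (p y) (q y) := fun y => le_antisymm
    (homogeneous_le hr.smul hmin (fun x hx => lt_min (hp.pos hx) (hq.pos hx))
      (fun x => (hrm x).mpr) y)
    (homogeneous_le hmin hr.smul (fun x => hr.pos) (fun x => (hrm x).mp) y)
  rw [hUr, hmm, wd_translate μ g (hr.isCompact_le 1), wd_translate μ g (hm.isCompact_le 1),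
    wd_translate μ g (hp.isCompact_le 1), wd_translate μ g (hq.isCompact_le 1),
    hr.wd_eq μ hg hgh, hm.wd_eq μ hg hgh, hp.wd_eq μ hg hgh, hq.wd_eq μ hg hgh, ← mul_add,
    ← mul_add, ← integral_add (hr.integrable_varDens μ hg hgh) (hm.integrable_varDens μ hg hgh),
    ← integral_add (hp.integrable_varDens μ hg hgh) (hq.integrable_varDens μ hg hgh)]
  congr 1
  refine integral_congr_ae ?_
  obtain ⟨_, c1⟩ := hp.exists_lipschitz
  obtain ⟨_, c2⟩ := hq.exists_lipschitz
  obtain ⟨_, c3⟩ := hr.exists_lipschitz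
  obtain ⟨_, c4⟩ := hm.exists_lipschitz
  filter_upwards [c1.ae_differentiableAt (μ := μ), c2.ae_differentiableAt (μ := μ),
    c3.ae_differentiableAt (μ := μ), c4.ae_differentiableAt (μ := μ)] with x d1 d2 d3 d4
  have hrp : ∀ y, r y ≤ p y := fun y => (hr_eq y).trans_le (min_le_left _ _)
  have hrq : ∀ y, r y ≤ q y := fun y => (hr_eq y).trans_le (min_le_right _ _)
  simp only [varDens]
  rcases le_total (p x) (q x) with h | h
  · have e1 : r x = p x := (hr_eq x).trans (min_eq_left h)
    have e2 : q x = Max.max (p x) (q x) := (max_eq_right h).symm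
    rw [fderiv_eq_of_le d3 d1 hrp e1, e1, ← fderiv_eq_of_le d2 d4 (fun y => le_max_right _ _) e2,
      ← e2]
  · have e1 : r x = q x := (hr_eq x).trans (min_eq_right h)
    have e2 : p x = Max.max (p x) (q x) := (max_eq_left h).symm
    rw [fderiv_eq_of_le d3 d2 hrq e1, e1, ← fderiv_eq_of_le d1 d4 (fun y => le_max_left _ _) e2,
      ← e2, add_comm]

end FirstVariation

section VariationSimple

variable {V : Type*} [NormedAddCommGroup V] [NormedSpace ℝ V] [FiniteDimensional ℝ V]
  [MeasurableSpace V] [BorelSpace V] (μ : Measure V) [μ.IsAddHaarMeasure]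
  {g : (V →L[ℝ] ℝ) → ℝ} (hg : Continuous g)
  (hgh : ∀ (ξ : V →L[ℝ] ℝ) (t : ℝ), 0 < t → g (t • ξ) = t * g ξ)

include hg hgh

lemma IsGauge.tendsto_integral_varDens {p : V → ℝ} (hp : IsGauge p) {q : ℕ → V → ℝ}
    (hq : ∀ n, IsGauge (q n)) {ρ : ℕ → ℝ} (hρ0 : ∀ n, 0 < ρ n) (hρ1 : ∀ n, ρ n ≤ 1 / 2)
    (hρ : Filter.Tendsto ρ Filter.atTop (nhds 0)) (h1 : ∀ n x, (1 - ρ n) * q n x ≤ p x)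
    (h2 : ∀ n x, p x ≤ (1 + ρ n) * q n x) :
    Filter.Tendsto (fun n => ∫ x, varDens g (q n) x ∂μ) Filter.atTop
      (nhds (∫ x, varDens g p x ∂μ)) := by
  obtain ⟨b, hb0, hb⟩ := hp.exists_bound_supp hg hgh
  obtain ⟨_, c1⟩ := hp.exists_lipschitz
  have hqd : ∀ᵐ x ∂μ, ∀ n, DifferentiableAt ℝ (q n) x := by
    rw [ae_all_iff]
    intro n
    obtain ⟨_, c2⟩ := (hq n).exists_lipschitz
    exact c2.ae_differentiableAt
  refine tendsto_integral_of_dominated_convergence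
    ({x | p x ≤ 2}.indicator fun _ => 2 * (b * 2))
    (fun n => (hq n).aestronglyMeasurable_varDens μ hg) (hp.integrable_indicator μ _ _) ?_ ?_
  · intro n
    filter_upwards [hqd] with x hx
    refine ((hq n).abs_varDens_le (hp.abs_le_of_dual hb0 zero_le_two hb fun y => ?_)).trans ?_
    · have h3 := (hq n).fderiv_le (hx n) y
      have h4 := h1 n y
      have h5 := hρ1 n
      have h6 := (hq n).nonneg y
      nlinarith
    · refine Set.indicator_le_indicator_of_subset (fun y hy => ?_) (fun _ => by positivity) x
      have h3 : q n y ≤ 1 := hy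
      have h4 := h2 n y
      have h5 := hρ1 n
      have h6 := hρ0 n
      have h7 := (hq n).nonneg y
      change p y ≤ 2
      nlinarith
  · filter_upwards [hqd, c1.ae_differentiableAt (μ := μ)] with x hx hpx
    have hm : Filter.Tendsto (fun n => 1 - ρ n) Filter.atTop (nhds 1) := by
      simpa using hρ.const_sub 1
    have hpl : Filter.Tendsto (fun n => 1 + ρ n) Filter.atTop (nhds 1) := by
      simpa using hρ.const_add 1
    have hqx : Filter.Tendsto (fun n => q n x) Filter.atTop (nhds (p x)) := by
      refine tendsto_of_tendsto_of_tendsto_of_le_of_le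
        (g := fun n => p x / (1 + ρ n)) (h := fun n => p x / (1 - ρ n)) ?_ ?_ ?_ ?_
      · have := (tendsto_const_nhds (x := p x)).div hpl one_ne_zero
        rwa [div_one] at this
      · have := (tendsto_const_nhds (x := p x)).div hm one_ne_zero
        rwa [div_one] at this
      · intro n
        have := hρ0 n
        simp only
        rw [div_le_iff₀ (by linarith), mul_comm]
        exact h2 n x
      · intro n
        have := hρ1 n
        simp only
        rw [le_div_iff₀ (by linarith), mul_comm]
        exact h1 n x
    have hd : Filter.Tendsto (fun n => (1 - ρ n) • fderiv ℝ (q n) x) Filter.atTop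
        (nhds (fderiv ℝ p x)) := by
      rw [Metric.tendsto_atTop]
      intro ε hε
      obtain ⟨η, hη, h3⟩ := IsGauge.exists_close hpx (half_pos hε)
      have h4 : Filter.Tendsto (fun n => (1 - ρ n) * q n x) Filter.atTop (nhds (p x)) := by
        simpa using hm.mul hqx
      obtain ⟨N, hN⟩ := Filter.eventually_atTop.mp
        (h4.eventually (lt_mem_nhds (sub_lt_self (p x) hη)))
      refine ⟨N, fun n hn => ?_⟩
      rw [dist_eq_norm]
      refine lt_of_le_of_lt (h3 _ (fun y => ?_) ?_) (half_lt_self hε)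
      · have := hρ1 n
        rw [_root_.smul_apply, smul_eq_mul]
        exact (mul_le_mul_of_nonneg_left ((hq n).fderiv_le (hx n) y) (by linarith)).trans (h1 n y)
      · rw [_root_.smul_apply, smul_eq_mul, (hq n).fderiv_self (hx n)]
        exact (hN n hn).le
    have hd' : Filter.Tendsto (fun n => fderiv ℝ (q n) x) Filter.atTop
        (nhds (fderiv ℝ p x)) := by
      have := (hm.inv₀ one_ne_zero).smul hd
      rw [inv_one, one_smul] at this
      refine this.congr fun n => ?_
      have := hρ1 n
      rw [smul_smul, inv_mul_cancel₀ (by linarith), one_smul]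
    have h3 := (hg.tendsto _).comp hd'
    exact ((((tendsto_const_nhds (x := (0 : ℝ))).max (hqx.const_sub 1)).const_mul 2).mul hqx).mul h3

lemma wd_cont (K : Set V) (hK : Convex ℝ K) (hK' : IsCompact K) (h0 : (0 : V) ∈ interior K)
    (ε : ℝ) (hε : 0 < ε) : ∃ ρ : ℝ, 0 < ρ ∧ ρ < 1 ∧
      ∀ L : Set V, Convex ℝ L → IsCompact L → (1 - ρ) • K ⊆ L → L ⊆ (1 + ρ) • K →
        |wd μ g L - wd μ g K| < ε := by
  by_contra! hcon
  set ρ : ℕ → ℝ := fun n => 1 / ((n : ℝ) + 2) with hρd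
  have hρ0 : ∀ n, 0 < ρ n := fun n => by positivity
  have hρ1 : ∀ n, ρ n ≤ 1 / 2 := fun n => by
    refine one_div_le_one_div_of_le two_pos ?_
    linarith [(Nat.cast_nonneg n : (0 : ℝ) ≤ n)]
  have hρ : Filter.Tendsto ρ Filter.atTop (nhds 0) :=
    tendsto_const_nhds.div_atTop
      (Filter.tendsto_atTop_add_const_right _ _ tendsto_natCast_atTop_atTop)
  choose L hL hL' hKL hLK hbad using fun n => hcon (ρ n) (hρ0 n) (by linarith [hρ1 n])
  have hK0 := mem_interior_iff_mem_nhds.mp h0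
  have hL0 : ∀ n, L n ∈ nhds 0 := fun n => Filter.mem_of_superset
    ((set_smul_mem_nhds_zero_iff (by linarith [hρ1 n])).mpr hK0) (hKL n)
  have hp := isGauge_gauge hK hK' hK0
  have hq := fun n => isGauge_gauge (hL n) (hL' n) (hL0 n)
  have hpK : {x | gauge K x ≤ 1} = K := Set.ext fun x => gauge_le_one_iff hK hK' hK0
  have hqL : ∀ n, {x | gauge (L n) x ≤ 1} = L n := fun n =>
    Set.ext fun x => gauge_le_one_iff (hL n) (hL' n) (hL0 n)
  have hlim := hp.tendsto_integral_varDens μ hg hgh hq hρ0 hρ1 hρ (fun n x => ?_) fun n x => ?_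
  · have h3 : Filter.Tendsto (fun n => wd μ g (L n)) Filter.atTop (nhds (wd μ g K)) := by
      rw [← hpK, hp.wd_eq μ hg hgh]
      refine (hlim.const_mul (layerConst (finrank ℝ V))⁻¹).congr fun n => ?_
      rw [← (hq n).wd_eq μ hg hgh, hqL]
    obtain ⟨N, hN⟩ := Metric.tendsto_atTop.mp h3 ε hε
    exact absurd (hN N le_rfl) (not_lt.mpr (hbad N))
  · have h0 : 0 < 1 - ρ n := by linarith [hρ1 n]
    have h1 := gauge_mono (absorbent_nhds_zero ((set_smul_mem_nhds_zero_iff h0.ne').mpr hK0))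
      (hKL n) x
    rw [gauge_smul_left_of_nonneg h0.le] at h1
    simp only [Pi.smul_apply, smul_eq_mul] at h1
    rwa [le_inv_mul_iff₀ h0] at h1
  · have h0 : 0 < 1 + ρ n := by linarith [hρ0 n]
    have h1 := gauge_mono (absorbent_nhds_zero (hL0 n)) (hLK n) x
    rw [gauge_smul_left_of_nonneg h0.le] at h1
    simp only [Pi.smul_apply, smul_eq_mul] at h1
    rwa [inv_mul_le_iff₀ h0] at h1

/-- Variations supported on a thin slab are small. -/
lemma IsGauge.tendsto_wd_slab {p : V → ℝ} (hp : IsGauge p) {u : V →L[ℝ] ℝ} (hu : u ≠ 0)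
    (hgu : g u = 0) (hgu' : g (-u) = 0) {ε : ℕ → ℝ} (hε0 : ∀ n, 0 < ε n)
    (hε : Filter.Tendsto ε Filter.atTop (nhds 0)) :
    Filter.Tendsto (fun n => wd μ g {x | p x ≤ 1 ∧ |u x| ≤ ε n}) Filter.atTop (nhds 0) := by
  have hq : ∀ n, IsGauge fun x => Max.max (p x) ((ε n)⁻¹ * |u x|) := fun n => by
    have h0 := inv_pos.mpr (hε0 n)
    refine ⟨fun x y => max_le ((hp.add_le x y).trans
      (add_le_add (le_max_left _ _) (le_max_left _ _))) ?_, fun t ht x => ?_, ?_, ?_⟩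
    · refine le_trans ?_ (add_le_add (le_max_right _ _) (le_max_right _ _))
      rw [← mul_add, map_add]
      exact mul_le_mul_of_nonneg_left (abs_add_le _ _) h0.le
    · rw [hp.smul t ht, map_smul, smul_eq_mul, abs_mul, abs_of_nonneg ht,
        mul_max_of_nonneg _ _ ht]
      ring_nf
    · obtain ⟨C, hC, h⟩ := hp.upper
      refine ⟨C + (ε n)⁻¹ * ‖u‖, by positivity, fun x => max_le ((h x).trans ?_) ?_⟩
      · gcongr
        exact le_add_of_nonneg_right (by positivity)
      · have := mul_le_mul_of_nonneg_left (u.le_opNorm x) h0.le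
        rw [Real.norm_eq_abs, ← mul_assoc] at this
        refine this.trans ?_
        gcongr
        exact le_add_of_nonneg_left hC.le
    · obtain ⟨m, hm, h⟩ := hp.lower
      exact ⟨m, hm, fun x => (h x).trans (le_max_left _ _)⟩
  have hset : ∀ n, {x | p x ≤ 1 ∧ |u x| ≤ ε n} = {x | Max.max (p x) ((ε n)⁻¹ * |u x|) ≤ 1} :=
    fun n => by
      ext x
      rw [Set.mem_ofPred_eq, Set.mem_ofPred_eq, max_le_iff, inv_mul_le_iff₀ (hε0 n), mul_one]
  simp only [hset]
  have hwd := fun n => (hq n).wd_eq μ hg hgh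
  simp only [hwd]
  rw [← mul_zero (layerConst (finrank ℝ V))⁻¹]
  refine Filter.Tendsto.const_mul _ ?_
  rw [← integral_zero V ℝ (μ := μ)]
  obtain ⟨_, c1⟩ := hp.exists_lipschitz
  have hqd : ∀ᵐ x ∂μ, ∀ n, DifferentiableAt ℝ (fun x => Max.max (p x) ((ε n)⁻¹ * |u x|)) x := by
    rw [ae_all_iff]
    intro n
    obtain ⟨_, c2⟩ := (hq n).exists_lipschitz
    exact c2.ae_differentiableAt
  have hu0 : ∀ᵐ x ∂μ, u x ≠ 0 := by
    simpa [ae_iff] using measure_hyperplane μ hu 0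
  have hcase : ∀ x, u x ≠ 0 → (∀ n, DifferentiableAt ℝ
      (fun x => Max.max (p x) ((ε n)⁻¹ * |u x|)) x) → DifferentiableAt ℝ p x → ∀ n,
      varDens g (fun x => Max.max (p x) ((ε n)⁻¹ * |u x|)) x
        = if (ε n)⁻¹ * |u x| ≤ p x then varDens g p x else 0 := by
    intro x hux hd hpd n
    have h0 := inv_pos.mpr (hε0 n)
    split_ifs with h
    · have h1 := fderiv_eq_of_le hpd (hd n) (fun y => le_max_left _ _) (max_eq_left h).symm
      simp only [varDens]
      rw [← h1, max_eq_left h]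
    · push Not at h
      have key : ∀ v : V →L[ℝ] ℝ, g v = 0 → (∀ y, v y ≤ |u y|) → v x = |u x| →
          varDens g (fun x => Max.max (p x) ((ε n)⁻¹ * |u x|)) x = 0 := by
        intro v hv h1 h2
        have h3 := fderiv_eq_of_le ((ε n)⁻¹ • v).differentiableAt (hd n) (fun y => by
          rw [_root_.smul_apply, smul_eq_mul]
          exact (mul_le_mul_of_nonneg_left (h1 y) h0.le).trans (le_max_right _ _)) (by
          rw [_root_.smul_apply, smul_eq_mul, h2, max_eq_right h.le])
        rw [ContinuousLinearMap.fderiv] at h3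
        rw [varDens, ← h3, hgh _ _ h0, hv, mul_zero, mul_zero]
      rcases le_total 0 (u x) with hs | hs
      · exact key u hgu (fun y => le_abs_self _) (abs_of_nonneg hs).symm
      · exact key (-u) hgu' (fun y => neg_le_abs _) (abs_of_nonpos hs).symm
  refine tendsto_integral_of_dominated_convergence (fun x => |varDens g p x|)
    (fun n => (hq n).aestronglyMeasurable_varDens μ hg)
    (hp.integrable_varDens μ hg hgh).abs (fun n => ?_) ?_
  · filter_upwards [hqd, hu0, c1.ae_differentiableAt (μ := μ)] with x h1 h2 h3
    rw [hcase x h2 h1 h3 n]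
    split_ifs
    · rfl
    · simp
  · filter_upwards [hqd, hu0, c1.ae_differentiableAt (μ := μ)] with x h1 h2 h3
    refine tendsto_const_nhds.congr' ?_
    have h4 : Filter.Tendsto (fun n => ε n * p x) Filter.atTop (nhds 0) := by
      simpa using hε.mul_const (p x)
    filter_upwards [h4.eventually (gt_mem_nhds (abs_pos.mpr h2))] with n hn
    rw [hcase x h2 h1 h3 n, if_neg]
    rw [inv_mul_le_iff₀ (hε0 n)]
    exact not_le.mpr hn

end VariationSimple

section VariationCut

variable {V : Type*} [NormedAddCommGroup V] [NormedSpace ℝ V]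

lemma exists_interior_lt {S : Set V} {x : V} (hx : x ∈ interior S) {u : V →L[ℝ] ℝ} (hu : u ≠ 0) :
    ∃ y ∈ interior S, u x < u y := by
  by_contra! h
  refine hu ?_
  have hm : IsLocalMax u x := Filter.mem_of_superset (isOpen_interior.mem_nhds hx) h
  simpa using hm.fderiv_eq_zero

lemma tendsto_cut {Φ : Set V → ℝ}
    (hc : ∀ K : Set V, Convex ℝ K → IsCompact K → (interior K).Nonempty → ∀ ε > 0, ∃ δ > 0,
      ∀ L : Set V, Convex ℝ L → IsCompact L → L ⊆ Metric.cthickening δ K →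
        K ⊆ Metric.cthickening δ L → |Φ L - Φ K| < ε)
    {K : Set V} (hK : Convex ℝ K) (hK' : IsCompact K) {u : V →L[ℝ] ℝ} (hu : u ≠ 0) {x : V}
    (hx : x ∈ interior K) (hux : u x = 0) {ε : ℕ → ℝ} (hε0 : ∀ n, 0 < ε n)
    (hε : Filter.Tendsto ε Filter.atTop (nhds 0)) :
    Filter.Tendsto (fun n => Φ (K ∩ {x | -ε n ≤ u x})) Filter.atTop
      (nhds (Φ (K ∩ {x | 0 ≤ u x}))) := by
  obtain ⟨y, hy, huy⟩ := exists_interior_lt hx hu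
  rw [hux] at huy
  have hint : y ∈ interior (K ∩ {x | 0 ≤ u x}) := by
    rw [interior_inter]
    refine ⟨hy, mem_interior.mpr ⟨{x | 0 < u x}, fun z (hz : 0 < u z) => hz.le,
      isOpen_lt continuous_const u.continuous, huy⟩⟩
  rw [Metric.tendsto_atTop]
  intro e he
  obtain ⟨δ, hδ, h⟩ := hc _ (hK.inter (convex_ge u 0)) (hK'.inter_right (isClosed_ge' u 0))
    ⟨y, hint⟩ e he
  obtain ⟨C, hC⟩ := Metric.isBounded_iff.mp hK'.isBounded
  have hlim : Filter.Tendsto (fun n => ε n * C) Filter.atTop (nhds 0) := by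
    simpa using hε.mul_const C
  obtain ⟨N, hN⟩ := Filter.eventually_atTop.mp
    (hlim.eventually (gt_mem_nhds (mul_pos hδ huy)))
  refine ⟨N, fun n hn => ?_⟩
  have hn0 := hε0 n
  refine h _ (hK.inter (convex_ge u _)) (hK'.inter_right (isClosed_ge' u _)) ?_ ?_
  · rintro z ⟨hz, huz⟩
    have huz' : -ε n ≤ u z := huz
    have hs : 0 < ε n + u y := by linarith
    have hC0 : 0 ≤ C := dist_nonneg.trans (hC hz hz)
    refine Metric.mem_cthickening_of_dist_le z
      ((u y / (ε n + u y)) • z + (ε n / (ε n + u y)) • y) δ _ ⟨hK hz (interior_subset hy)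
        (by positivity) (by positivity) (by field_simp; ring), ?_⟩ ?_
    · change 0 ≤ u _
      rw [map_add, map_smul, map_smul, smul_eq_mul, smul_eq_mul]
      have : u y / (ε n + u y) * u z + ε n / (ε n + u y) * u y
        = u y * (u z + ε n) / (ε n + u y) := by field_simp
      rw [this]
      exact div_nonneg (mul_nonneg huy.le (by linarith)) hs.le
    · have h1 : z - ((u y / (ε n + u y)) • z + (ε n / (ε n + u y)) • y)
          = (ε n / (ε n + u y)) • (z - y) := by
        have h2 : u y / (ε n + u y) = 1 - ε n / (ε n + u y) := by field_simp; ring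
        rw [h2]
        module
      rw [dist_eq_norm, h1, norm_smul, Real.norm_of_nonneg (by positivity), ← dist_eq_norm,
        div_mul_eq_mul_div, div_le_iff₀ hs]
      have h3 := mul_le_mul_of_nonneg_left (hC hz (interior_subset hy)) hn0.le
      have h4 := hN n hn
      nlinarith
  · refine subset_trans ?_ (Metric.self_subset_cthickening _)
    rintro z ⟨hz, huz⟩
    have huz' : 0 ≤ u z := huz
    exact ⟨hz, show -ε n ≤ u z by linarith⟩

variable [FiniteDimensional ℝ V] [MeasurableSpace V] [BorelSpace V] (μ : Measure V)
  [μ.IsAddHaarMeasure] {g : (V →L[ℝ] ℝ) → ℝ} (hg : Continuous g)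
  (hgh : ∀ (ξ : V →L[ℝ] ℝ) (t : ℝ), 0 < t → g (t • ξ) = t * g ξ)

include hg hgh

lemma IsGauge.wd_cut {p : V → ℝ} (hp : IsGauge p) {u : V →L[ℝ] ℝ} (hu : u ≠ 0)
    (hgu : g u = 0) (hgu' : g (-u) = 0) :
    wd μ g {x | p x ≤ 1}
      = wd μ g ({x | p x ≤ 1} ∩ {x | u x ≤ 0}) + wd μ g ({x | p x ≤ 1} ∩ {x | 0 ≤ u x}) := by
  have hc := cont_of_sandwich (fun S x _ hS => wd_translate μ g hS x) (wd_cont μ hg hgh)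
  have hε : Filter.Tendsto (fun n : ℕ => 1 / ((n : ℝ) + 1)) Filter.atTop (nhds 0) :=
    tendsto_one_div_add_atTop_nhds_zero_nat
  have hε0 : ∀ n : ℕ, 0 < 1 / ((n : ℝ) + 1) := fun n => by positivity
  have hK := hp.convex_le 1
  have hK' := hp.isCompact_le 1
  have h0 : (0 : V) ∈ interior {x | p x ≤ 1} :=
    mem_interior_iff_mem_nhds.mpr (hp.mem_nhds one_pos)
  have h1 := tendsto_cut hc hK hK' hu h0 (map_zero u) hε0 hε
  have h2 := tendsto_cut hc hK hK' (neg_ne_zero.mpr hu) h0 (by simp) hε0 hε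
  have h3 := hp.tendsto_wd_slab μ hg hgh hu hgu hgu' hε0 hε
  simp only [_root_.neg_apply, neg_le_neg_iff, Left.nonneg_neg_iff] at h2
  have h4 := h3.const_add (wd μ g {x | p x ≤ 1})
  rw [add_zero] at h4
  refine tendsto_nhds_unique (h4.congr fun n => ?_) (h2.add h1)
  have hn := hε0 n
  have hU : {x | p x ≤ 1} ∩ {x | u x ≤ 1 / ((n : ℝ) + 1)} ∪
      {x | p x ≤ 1} ∩ {x | -(1 / ((n : ℝ) + 1)) ≤ u x} = {x | p x ≤ 1} := by
    rw [← Set.inter_union_distrib_left, Set.inter_eq_left]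
    intro x _
    rcases le_total (u x) 0 with h | h
    · exact Or.inl (h.trans hn.le)
    · exact Or.inr ((neg_nonpos.mpr hn.le).trans h)
  have hI : {x | p x ≤ 1} ∩ {x | u x ≤ 1 / ((n : ℝ) + 1)} ∩
      ({x | p x ≤ 1} ∩ {x | -(1 / ((n : ℝ) + 1)) ≤ u x})
      = {x | p x ≤ 1 ∧ |u x| ≤ 1 / ((n : ℝ) + 1)} := by
    ext x
    simp only [Set.mem_inter_iff, Set.mem_ofPred_eq, abs_le]
    tauto
  have h5 := wd_val μ hg hgh (hK.inter (_root_.KlainSchneider.convex_le u _))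
    (hK'.inter_right (_root_.KlainSchneider.isClosed_le' u _))
    (hK.inter (_root_.KlainSchneider.convex_ge u _)) (hK'.inter_right (isClosed_ge' u _))
    (by rwa [hU])
    ⟨0, by
      rw [hI, mem_interior_iff_mem_nhds]
      refine Filter.inter_mem (hp.mem_nhds one_pos) ?_
      refine (u.continuous.abs.tendsto 0).eventually (ge_mem_nhds ?_)
      simpa using hn⟩
  rwa [hU, hI] at h5

variable [Nontrivial V] (hgo : ∀ ξ, g (-ξ) = -g ξ)

include hgo

lemma wd_cut (S : Set V) (u : V →L[ℝ] ℝ) (c : ℝ) (hS : Convex ℝ S) (hS' : IsCompact S)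
    (hu : u ≠ 0) :
    wd μ g S = wd μ g (S ∩ {x | u x ≤ c}) + wd μ g (S ∩ {x | c ≤ u x}) := by
  have hn1 := fun h => wd_null μ hgo (hS.inter (convex_le u c)) h
  have hn2 := fun h => wd_null μ hgo (hS.inter (convex_ge u c)) h
  rcases (interior S).eq_empty_or_nonempty with he | hne
  · rw [wd_null μ hgo hS he, hn1, hn2, add_zero]
    · exact Set.subset_eq_empty (interior_mono Set.inter_subset_left) he
    · exact Set.subset_eq_empty (interior_mono Set.inter_subset_left) he
  have hcl : ∀ T : Set V, IsClosed T → interior S ⊆ T → S ∩ T = S := fun T hT h => by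
    rw [Set.inter_eq_left]
    refine subset_closure.trans ?_
    rw [← hS.closure_interior_eq_closure_of_nonempty_interior hne]
    exact hT.closure_subset_iff.mpr h
  by_cases h1 : ∃ x ∈ interior S, u x < c
  swap
  · push Not at h1
    have h := hcl _ (isClosed_ge' u c) h1
    rw [h, hn1, zero_add]
    refine interior_eq_empty_of_const hu (c := c) fun x hx => le_antisymm hx.2 ?_
    have := hx.1
    rw [← h] at this
    exact this.2
  by_cases h2 : ∃ x ∈ interior S, c < u x
  swap
  · push Not at h2
    have h := hcl _ (isClosed_le' u c) h2
    rw [h, hn2, add_zero]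
    refine interior_eq_empty_of_const hu (c := c) fun x hx => le_antisymm ?_ hx.2
    have := hx.1
    rw [← h] at this
    exact this.2
  obtain ⟨x1, hx1, hc1⟩ := h1
  obtain ⟨x2, hx2, hc2⟩ := h2
  obtain ⟨x, hx, hux⟩ := hS.interior.isPreconnected.intermediate_value hx1 hx2
    u.continuous.continuousOn ⟨hc1.le, hc2.le⟩
  obtain ⟨p, hp, hSp⟩ := exists_isGauge hS hS' hx
  obtain ⟨v, hv⟩ := DFunLike.ne_iff.mp hu
  rw [_root_.zero_apply] at hv
  set e : V := -((g u / u v) • v) with he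
  have hue : u e = -g u := by
    rw [he, map_neg, map_smul, smul_eq_mul, div_mul_cancel₀ _ hv]
  have e1 : S ∩ {x | u x ≤ c} = (fun y => x + y) '' ({y | p y ≤ 1} ∩ {y | u y ≤ 0}) := by
    rw [Set.image_inter (add_right_injective x), ← hSp, Set.image_add_left]
    ext y
    simp [hux, add_comm]
  have e2 : S ∩ {x | c ≤ u x} = (fun y => x + y) '' ({y | p y ≤ 1} ∩ {y | 0 ≤ u y}) := by
    rw [Set.image_inter (add_right_injective x), ← hSp, Set.image_add_left]
    ext y
    simp [hux, add_comm]
  have hK' := hp.isCompact_le 1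
  rw [e1, e2, hSp, wd_translate μ g hK', wd_translate μ g (hK'.inter_right (isClosed_le' u 0)),
    wd_translate μ g (hK'.inter_right (isClosed_ge' u 0)), ← wd_add_eval μ g _ e,
    ← wd_add_eval μ g ({y | p y ≤ 1} ∩ {y | u y ≤ 0}) e,
    ← wd_add_eval μ g ({y | p y ≤ 1} ∩ {y | 0 ≤ u y}) e]
  refine hp.wd_cut μ (by fun_prop) (fun ξ t ht => ?_) hu ?_ ?_
  · rw [hgh ξ t ht, _root_.smul_apply, smul_eq_mul, mul_add]
  · rw [hue, add_neg_cancel]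
  · rw [hgo, _root_.neg_apply, hue, add_neg_cancel]

/-- The first variation of the volume in an odd direction is a simple valuation. -/
lemma simpleVal_wd : SimpleVal (wd μ g) where
  null _ hS _ h := wd_null μ hgo hS h
  trans _ x _ hS' := wd_translate μ g hS' x
  cut := wd_cut μ hg hgh hgo
  val _ _ hK hK' hL hL' hU hI := wd_val μ hg hgh hK hK' hL hL' hU hI
  cont := cont_of_sandwich (fun _ x _ hS => wd_translate μ g hS x) (wd_cont μ hg hgh)

end VariationCut

section Polytope

variable {V : Type*} [NormedAddCommGroup V] [NormedSpace ℝ V] [FiniteDimensional ℝ V]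
  [MeasurableSpace V] [BorelSpace V] (μ : Measure V) [μ.IsAddHaarMeasure]

/-- The first variation of the volume of a polytope is a combination of the values at the
facet normals. -/
lemma exists_weights {ι : Type*} [Fintype ι] [Nonempty ι] {f : ι → V →L[ℝ] ℝ}
    (hK' : IsCompact {x | ∀ i, f i x ≤ 1}) : ∃ w : ι → ℝ, ∀ g : (V →L[ℝ] ℝ) → ℝ,
      Continuous g → (∀ (ξ : V →L[ℝ] ℝ) (t : ℝ), 0 < t → g (t • ξ) = t * g ξ) →
        wd μ g {x | ∀ i, f i x ≤ 1} = ∑ i, w i * g (f i) := by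
  classical
  have hK : Convex ℝ {x | ∀ i, f i x ≤ 1} := by
    rw [Set.ofPred_forall]
    exact convex_iInter fun i => convex_le (f i) 1
  have h0 : {x | ∀ i, f i x ≤ 1} ∈ nhds (0 : V) := by
    rw [Set.ofPred_forall, Filter.iInter_mem]
    refine fun i => ((f i).continuous.tendsto 0).eventually (ge_mem_nhds ?_)
    simp
  set p := gauge {x | ∀ i, f i x ≤ 1} with hpd
  have hp : IsGauge p := isGauge_gauge hK hK' h0
  have hpK : {x | p x ≤ 1} = {x | ∀ i, f i x ≤ 1} :=
    Set.ext fun x => gauge_le_one_iff hK hK' h0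
  have hle : ∀ i x, f i x ≤ p x := fun i => homogeneous_le (fun t _ x => by simp) hp.smul
    (fun x => hp.pos) fun x hx => (hpK ▸ hx : x ∈ {x | ∀ i, f i x ≤ 1}) i
  have heq : ∀ x, ∃ i, f i x = p x := by
    intro x
    obtain ⟨i, hi⟩ := Finite.exists_max fun i => f i x
    refine ⟨i, le_antisymm (hle i x) (le_of_not_gt fun hlt => ?_)⟩
    have hpx : 0 < p x := hp.pos fun hx => by simp [hx, hp.zero_eq] at hlt
    obtain ⟨s, hs1, hs2⟩ := exists_between (max_lt hlt hpx)
    have hs0 : 0 < s := (le_max_right _ _).trans_lt hs1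
    have hm : s⁻¹ • x ∈ {x | p x ≤ 1} := by
      rw [hpK]
      intro j
      rw [map_smul, smul_eq_mul, inv_mul_le_iff₀ hs0, mul_one]
      exact (hi j).trans ((le_max_left _ 0).trans hs1.le)
    have hm' : p (s⁻¹ • x) ≤ 1 := hm
    rw [hp.smul _ (inv_pos.mpr hs0).le, inv_mul_le_iff₀ hs0, mul_one] at hm'
    exact absurd hs2 (not_lt.mpr hm')
  set D : V → ℝ := fun x => 2 * max 0 (1 - p x) * p x with hD
  have hDi : Integrable D μ := by
    have hpc := hp.continuous
    refine Continuous.integrable_of_hasCompactSupport (by fun_prop)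
      (HasCompactSupport.of_support_subset_isCompact (hp.isCompact_le 1) fun x hx => ?_)
    by_contra h
    have h' : 1 < p x := not_le.mp h
    exact hx (by simp [hD, max_eq_left (sub_nonpos.mpr h'.le)])
  set A : ι → Set V := fun i => {x | fderiv ℝ p x = f i ∧ Function.invFun f (f i) = i} with hA
  have hAm : ∀ i, MeasurableSet (A i) := fun i =>
    (measurable_fderiv ℝ p (measurableSet_singleton (f i))).inter (MeasurableSet.const _)
  refine ⟨fun i => (layerConst (finrank ℝ V))⁻¹ * ∫ x, (A i).indicator D x ∂μ, fun g hg hgh => ?_⟩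
  rw [← hpK, hp.wd_eq μ hg hgh]
  simp only [mul_assoc]
  rw [← Finset.mul_sum]
  congr 1
  simp only [← integral_mul_const]
  rw [← integral_finsetSum _ fun i _ => (hDi.indicator (hAm i)).mul_const _]
  refine integral_congr_ae ?_
  obtain ⟨_, c1⟩ := hp.exists_lipschitz
  filter_upwards [c1.ae_differentiableAt (μ := μ)] with x hx
  obtain ⟨i, hi⟩ := heq x
  have hfi := fderiv_eq_of_le (f i).differentiableAt hx (hle i) hi
  rw [ContinuousLinearMap.fderiv] at hfi
  have hinv : f (Function.invFun f (f i)) = f i := Function.invFun_eq ⟨i, rfl⟩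
  rw [Finset.sum_eq_single (Function.invFun f (f i))]
  · rw [Set.indicator_of_mem (show x ∈ A _ from ⟨by rw [hinv, hfi], by rw [hinv]⟩), hinv, varDens,
      hfi]
  · intro j _ hj
    rw [Set.indicator_of_notMem, zero_mul]
    rintro ⟨h1, h2⟩
    rw [hfi, h1] at hj
    exact hj h2.symm
  · simp

end Polytope

section TriValue

variable {V : Type*} [NormedAddCommGroup V] [NormedSpace ℝ V] [FiniteDimensional ℝ V]
  [MeasurableSpace V] [BorelSpace V] (μ : Measure V) [μ.IsAddHaarMeasure] {k : ℕ}
  (hk : finrank ℝ V = k + 2) {p q : V →L[ℝ] ℝ} {r : Fin k → V →L[ℝ] ℝ} (h : Frame p q r)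

include hk h

lemma Frame.measure_triS {s : ℝ} (hs : 0 < s) :
    (μ (TriS p q r s)).toReal = s ^ 2 * (μ (Tri p q r)).toReal := by
  have hd : finrank ℝ V = finrank ℝ (ℝ × ℝ × (Fin k → ℝ)) := by
    simp [hk]
    omega
  set e : V ≃ₗ[ℝ] ℝ × ℝ × (Fin k → ℝ) :=
    (frameMap p q r).toLinearMap.linearEquivOfInjective h.frameMap_injective hd with he
  set F : (ℝ × ℝ × (Fin k → ℝ)) →ₗ[ℝ] (ℝ × ℝ × (Fin k → ℝ)) :=
    (s • LinearMap.id).prodMap ((s • LinearMap.id).prodMap LinearMap.id) with hF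
  set A : V →ₗ[ℝ] V := e.symm.toLinearMap ∘ₗ F ∘ₗ e.toLinearMap with hA
  have hdet : LinearMap.det A = s ^ 2 := by
    rw [hA, ← LinearEquiv.symm_symm e]
    have := LinearMap.det_conj F e.symm
    simp only [LinearEquiv.symm_symm] at this ⊢
    rw [this, hF, LinearMap.det_prodMap, LinearMap.det_prodMap]
    simp [sq]
  have hAx : ∀ x, p (A x) = s * p x ∧ q (A x) = s * q x ∧ ∀ i, r i (A x) = r i x := by
    intro x
    have h1 : e (A x) = F (e x) := by simp [hA]
    have h2 : ∀ y, e y = (p y, q y, fun i => r i y) := fun y => rfl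
    rw [h2, h2] at h1
    simp only [hF, LinearMap.prodMap_apply, LinearMap.smul_apply, LinearMap.id_apply,
      Prod.mk.injEq, smul_eq_mul] at h1
    exact ⟨h1.1, h1.2.1, fun i => congrFun h1.2.2 i⟩
  have hpre : A ⁻¹' (TriS p q r s) = Tri p q r := by
    ext x
    obtain ⟨h1, h2, h3⟩ := hAx x
    simp only [Set.mem_preimage, TriS, Tri, Set.mem_ofPred_eq, h1, h2, h3,
      mul_nonneg_iff_of_pos_left hs, ← mul_add, mul_le_iff_le_one_right hs]
  have hm := Measure.addHaar_preimage_linearMap μ (f := A) (by rw [hdet]; positivity)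
    (TriS p q r s)
  rw [hpre, hdet, abs_of_nonneg (by positivity)] at hm
  rw [hm, ENNReal.toReal_mul, ENNReal.toReal_ofReal (by positivity), ← mul_assoc,
    mul_inv_cancel₀ (by positivity), one_mul]

omit [MeasurableSpace V] [BorelSpace V] in
lemma Frame.wul_tri {v w : V} (hv : p v = 1 ∧ q v = 0 ∧ ∀ i, r i v = 0)
    (hw : p w = 0 ∧ q w = 1 ∧ ∀ i, r i w = 0) {t : ℝ} (ht : 0 ≤ t) :
    wul (fun ξ : V →L[ℝ] ℝ => max 0 (max (ξ v) (ξ w))) (Tri p q r) t = TriS p q r (1 + t) := by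
  obtain ⟨z, hz1, hz2, hz3⟩ := h.exists_eq hk 0 0 fun _ => 0
  have hne : (Tri p q r).Nonempty := ⟨z, by simp [Tri, hz1, hz2, hz3]⟩
  ext x
  constructor
  · intro hx
    have hsup : ∀ (ξ : V →L[ℝ] ℝ) (b : ℝ), (∀ x ∈ Tri p q r, ξ x ≤ b) →
        ξ x ≤ b + t * max 0 (max (ξ v) (ξ w)) := fun ξ b hb => (hx ξ).trans <| by
      have := csSup_le (hne.image ξ) (by rintro _ ⟨x, hx, rfl⟩; exact hb x hx)
      linarith
    refine ⟨?_, ?_, ?_, fun i => ⟨?_, ?_⟩⟩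
    · have h1 := hsup (-p) 0 fun y hy => by simpa using hy.1
      simpa [hv, hw] using h1
    · have h1 := hsup (-q) 0 fun y hy => by simpa using hy.2.1
      simpa [hv, hw] using h1
    · have h1 := hsup (p + q) 1 fun y hy => by simpa using hy.2.2.1
      simpa [hv, hw] using h1
    · have h1 := hsup (-r i) 0 fun y hy => by simpa using (hy.2.2.2 i).1
      simpa [hv, hw] using h1
    · have h1 := hsup (r i) 1 fun y hy => by simpa using (hy.2.2.2 i).2
      simpa [hv, hw] using h1
  · rintro ⟨h1, h2, h3, h4⟩ ξ
    have ht1 : 0 < 1 + t := by linarith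
    set y : V := x - (t * (p x / (1 + t))) • v - (t * (q x / (1 + t))) • w with hy
    have hp1 : p y = p x / (1 + t) := by
      simp only [hy, map_sub, map_smul, smul_eq_mul, hv, hw]
      field_simp
      ring
    have hq1 : q y = q x / (1 + t) := by
      simp only [hy, map_sub, map_smul, smul_eq_mul, hv, hw]
      field_simp
      ring
    have hyT : y ∈ Tri p q r := by
      refine ⟨by rw [hp1]; positivity, by rw [hq1]; positivity, ?_, fun i => ?_⟩
      · rw [hp1, hq1, ← add_div, div_le_one ht1]
        exact h3
      · have : r i y = r i x := by simp [hy, hv, hw]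
        rw [this]
        exact h4 i
    have h5 : ξ y ≤ sSup (ξ '' Tri p q r) :=
      le_csSup (h.isCompact_Tri.image ξ.continuous).bddAbove ⟨y, hyT, rfl⟩
    have h6 : ξ x = ξ y + t * (p y * ξ v + q y * ξ w) := by
      rw [hp1, hq1, hy]
      simp only [map_sub, map_smul, smul_eq_mul]
      ring
    have h7 : p y * ξ v + q y * ξ w ≤ max 0 (max (ξ v) (ξ w)) := by
      set M := max 0 (max (ξ v) (ξ w)) with hM
      have m0 : 0 ≤ M := le_max_left _ _
      have m1 : ξ v ≤ M := (le_max_left _ _).trans (le_max_right _ _)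
      have m2 : ξ w ≤ M := (le_max_right _ _).trans (le_max_right _ _)
      have := hyT.1
      have := hyT.2.1
      have := hyT.2.2.1
      nlinarith
    rw [h6]
    exact add_le_add h5 (mul_le_mul_of_nonneg_left h7 ht)

lemma Frame.wd_tri_test {v w : V} (hv : p v = 1 ∧ q v = 0 ∧ ∀ i, r i v = 0)
    (hw : p w = 0 ∧ q w = 1 ∧ ∀ i, r i w = 0) :
    wd μ (fun ξ : V →L[ℝ] ℝ => max 0 (max (ξ v) (ξ w))) (Tri p q r)
      = (μ (Box p q r)).toReal := by
  have h1 : ∀ t ∈ Set.Ici (0 : ℝ),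
      (μ (wul (fun ξ : V →L[ℝ] ℝ => max 0 (max (ξ v) (ξ w))) (Tri p q r) t)).toReal
        = (1 + t) ^ 2 * (μ (Tri p q r)).toReal := fun t ht => by
    have ht' : 0 ≤ t := ht
    rw [h.wul_tri hk hv hw ht, h.measure_triS μ hk (by linarith)]
  rw [wd, derivWithin_congr h1 (h1 0 Set.self_mem_Ici), h.measure_box_eq μ hk]
  have h2 : HasDerivAt (fun t : ℝ => (1 + t) ^ 2 * (μ (Tri p q r)).toReal)
      (2 * (μ (Tri p q r)).toReal) 0 := by
    have := (((hasDerivAt_id (0 : ℝ)).const_add 1).pow 2).mul_const (μ (Tri p q r)).toReal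
    simpa using this
  exact h2.hasDerivWithinAt.derivWithin (uniqueDiffOn_Ici 0 0 Set.self_mem_Ici)

/-- The first variation of the volume of a triangular prism. -/
lemma Frame.wd_tri {g : (V →L[ℝ] ℝ) → ℝ} (hg : Continuous g)
    (hgh : ∀ (ξ : V →L[ℝ] ℝ) (t : ℝ), 0 < t → g (t • ξ) = t * g ξ)
    (hgo : ∀ ξ, g (-ξ) = -g ξ) :
    wd μ g (Tri p q r) = (g (p + q) - g p - g q) * (μ (Box p q r)).toReal := by
  obtain ⟨z, hz1, hz2, hz3⟩ := h.exists_eq hk (1 / 3) (1 / 3) fun _ => 1 / 2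
  set f : Fin 3 ⊕ Fin k ⊕ Fin k → V →L[ℝ] ℝ :=
    Sum.elim ![(3 : ℝ) • -p, (3 : ℝ) • -q, (3 : ℝ) • (p + q)]
      (Sum.elim (fun i => (2 : ℝ) • -r i) fun i => (2 : ℝ) • r i) with hf
  have hset : {x | ∀ i, f i x ≤ 1} = (fun y => z + y) ⁻¹' Tri p q r := by
    ext x
    simp only [hf, Set.mem_ofPred_eq, Sum.forall, Sum.elim_inl, Sum.elim_inr, Fin.forall_fin_succ,
      Set.mem_preimage, Tri, map_add, hz1, hz2, hz3, Matrix.cons_val_zero, Matrix.cons_val_succ,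
      _root_.smul_apply, _root_.neg_apply, _root_.add_apply, smul_eq_mul, IsEmpty.forall_iff,
      and_true, forall_and]
    constructor
    · rintro ⟨⟨h1, h2, h3⟩, h4, h5⟩
      exact ⟨by linarith, by linarith, by linarith, fun i => by linarith [h4 i],
        fun i => by linarith [h5 i]⟩
    · rintro ⟨h1, h2, h3, h4, h5⟩
      exact ⟨⟨by linarith, by linarith, by linarith⟩, fun i => by linarith [h4 i],
        fun i => by linarith [h5 i]⟩
  have hcomp : IsCompact {x | ∀ i, f i x ≤ 1} := by
    rw [hset]
    exact (Homeomorph.addLeft z).isCompact_preimage.mpr h.isCompact_Tri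
  have hT : Tri p q r = (fun y => z + y) '' {x | ∀ i, f i x ≤ 1} := by
    rw [hset, Set.image_preimage_eq _ (add_left_surjective z)]
  obtain ⟨W, hW⟩ := exists_weights μ hcomp
  have key : ∀ g : (V →L[ℝ] ℝ) → ℝ, Continuous g →
      (∀ (ξ : V →L[ℝ] ℝ) (t : ℝ), 0 < t → g (t • ξ) = t * g ξ) →
      wd μ g (Tri p q r) = 3 * W (.inl 0) * g (-p) + 3 * W (.inl 1) * g (-q)
        + 3 * W (.inl 2) * g (p + q) + (∑ i, 2 * W (.inr (.inl i)) * g (-r i)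
          + ∑ i, 2 * W (.inr (.inr i)) * g (r i)) := by
    intro g hg hgh
    rw [hT, wd_translate μ g hcomp, hW g hg hgh]
    have f0 : f (.inl 0) = (3 : ℝ) • -p := rfl
    have f1 : f (.inl 1) = (3 : ℝ) • -q := rfl
    have f2 : f (.inl 2) = (3 : ℝ) • (p + q) := rfl
    have f3 : ∀ i, f (.inr (.inl i)) = (2 : ℝ) • -r i := fun i => rfl
    have f4 : ∀ i, f (.inr (.inr i)) = (2 : ℝ) • r i := fun i => rfl
    simp only [Fintype.sum_sum_type, Fin.sum_univ_three, f0, f1, f2, f3, f4,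
      hgh _ _ (three_pos : (0 : ℝ) < 3), hgh _ _ (two_pos : (0 : ℝ) < 2)]
    congr 2
    · ring
    · ring
    · exact Finset.sum_congr rfl fun i _ => by ring
    · exact Finset.sum_congr rfl fun i _ => by ring
  have hlin : ∀ e : V, wd μ (fun ξ : V →L[ℝ] ℝ => ξ e) (Tri p q r) = 0 := by
    intro e
    have h1 := wd_add_eval μ (fun _ => (0 : ℝ)) (Tri p q r) e
    simp only [zero_add] at h1
    rw [h1]
    simp [wd, wul]
  have hlin' := fun e : V => (key (fun ξ => ξ e) (by fun_prop) fun ξ t _ => by simp).symm.trans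
    (hlin e)
  simp only [_root_.neg_apply, _root_.add_apply, mul_neg, Finset.sum_neg_distrib] at hlin'
  obtain ⟨v, hv1, hv2, hv3⟩ := h.exists_eq hk 1 0 fun _ => 0
  obtain ⟨w, hw1, hw2, hw3⟩ := h.exists_eq hk 0 1 fun _ => 0
  have e1 := hlin' v
  have e2 := hlin' w
  simp only [hv1, hv2, hv3, neg_zero, mul_zero, Finset.sum_const_zero] at e1
  simp only [hw1, hw2, hw3, neg_zero, mul_zero, Finset.sum_const_zero] at e2
  have e3 : ∀ i, W (.inr (.inl i)) = W (.inr (.inr i)) := by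
    intro i
    obtain ⟨x, hx1, hx2, hx3⟩ := h.exists_eq hk 0 0 (Pi.single i 1)
    have e := hlin' x
    simp only [hx1, hx2, hx3, neg_zero, mul_zero, Pi.single_apply, mul_ite,
      Finset.sum_ite_eq', Finset.mem_univ, if_true] at e
    linarith
  have e4 := (key (fun ξ => max 0 (max (ξ v) (ξ w))) (by fun_prop) fun ξ t ht => by
    simp only [_root_.smul_apply, smul_eq_mul]
    rw [mul_max_of_nonneg _ _ ht.le, mul_max_of_nonneg _ _ ht.le, mul_zero]).symm.trans
    (h.wd_tri_test μ hk ⟨hv1, hv2, hv3⟩ ⟨hw1, hw2, hw3⟩)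
  simp only [_root_.neg_apply, _root_.add_apply, hv1, hv2, hv3, hw1, hw2, hw3] at e4
  norm_num at e4
  have e5 : (∑ i, 2 * W (.inr (.inl i)) * g (-r i) + ∑ i, 2 * W (.inr (.inr i)) * g (r i)) = 0 := by
    rw [← Finset.sum_add_distrib]
    refine Finset.sum_eq_zero fun i _ => ?_
    rw [hgo, e3]
    ring
  rw [key g hg hgh, e5, hgo, hgo, ← e4]
  linear_combination g p * e1 + g q * e2

end TriValue

section OfBody

variable {V : Type*} [NormedAddCommGroup V] [NormedSpace ℝ V]

open Classical in
/-- A functional on convex bodies, extended by zero to a functional on sets. -/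
def ofBody (φ : ConvexBody V → ℝ) (S : Set V) : ℝ :=
  if h : Convex ℝ S ∧ IsCompact S ∧ S.Nonempty then φ ⟨S, h.1, h.2.1, h.2.2⟩ else 0

variable {φ : ConvexBody V → ℝ}

lemma ofBody_eq {S : Set V} (h : Convex ℝ S) (h' : IsCompact S) (hne : S.Nonempty) :
    ofBody φ S = φ ⟨S, h, h', hne⟩ := dif_pos ⟨h, h', hne⟩

lemma ofBody_coe (K : ConvexBody V) : ofBody φ (K : Set V) = φ K :=
  ofBody_eq K.convex K.isCompact K.nonempty

lemma ofBody_empty : ofBody φ (∅ : Set V) = 0 := dif_neg fun h => Set.not_nonempty_empty h.2.2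

lemma bodyDim_lt [FiniteDimensional ℝ V] {K : ConvexBody V} {u : V →L[ℝ] ℝ} (hu : u ≠ 0) {c : ℝ}
    (h : ∀ x ∈ K, u x = c) : bodyDim K < finrank ℝ V := by
  refine Submodule.finrank_lt fun htop => hu ?_
  have hle : vectorSpan ℝ (K : Set V) ≤ LinearMap.ker u.toLinearMap := by
    refine Submodule.span_le.mpr ?_
    rintro _ ⟨x, hx, y, hy, rfl⟩
    simp [h x hx, h y hy]
  rw [htop] at hle
  ext x
  exact hle (Submodule.mem_top (x := x))

lemma ofBody_null [FiniteDimensional ℝ V]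
    (hsimple : ∀ K : ConvexBody V, bodyDim K < finrank ℝ V → φ K = 0) {S : Set V}
    (hS : Convex ℝ S) (hS' : IsCompact S) {u : V →L[ℝ] ℝ} (hu : u ≠ 0) {c : ℝ}
    (h : ∀ x ∈ S, u x = c) : ofBody φ S = 0 := by
  rcases S.eq_empty_or_nonempty with rfl | hne
  · exact ofBody_empty
  · rw [ofBody_eq hS hS' hne]
    exact hsimple _ (bodyDim_lt hu h)

lemma ofBody_val (hφv : IsValuation φ) {K L : Set V} (hK : Convex ℝ K) (hK' : IsCompact K)
    (hL : Convex ℝ L) (hL' : IsCompact L) (hU : Convex ℝ (K ∪ L)) (hI : (K ∩ L).Nonempty) :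
    ofBody φ (K ∪ L) + ofBody φ (K ∩ L) = ofBody φ K + ofBody φ L := by
  rw [ofBody_eq hK hK' (hI.mono Set.inter_subset_left),
    ofBody_eq hL hL' (hI.mono Set.inter_subset_right),
    ofBody_eq hU (hK'.union hL') ((hI.mono Set.inter_subset_left).mono Set.subset_union_left),
    ofBody_eq (hK.inter hL) (hK'.inter hL') hI]
  exact hφv ⟨K, hK, hK', _⟩ ⟨L, hL, hL', _⟩ hU hI

lemma ofBody_cont (hφc : Continuous φ) (K : Set V) (hK : Convex ℝ K) (hK' : IsCompact K)
    (hi : (interior K).Nonempty) (ε : ℝ) (hε : 0 < ε) : ∃ δ > 0,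
    ∀ L : Set V, Convex ℝ L → IsCompact L → L ⊆ Metric.cthickening δ K →
      K ⊆ Metric.cthickening δ L → |ofBody φ L - ofBody φ K| < ε := by
  have hne : K.Nonempty := hi.mono interior_subset
  obtain ⟨δ, hδ, h⟩ := Metric.continuous_iff.mp hφc ⟨K, hK, hK', hne⟩ ε hε
  refine ⟨δ / 2, half_pos hδ, fun L hL hL' h1 h2 => ?_⟩
  have hLne : L.Nonempty := by
    rw [Set.nonempty_iff_ne_empty]
    rintro rfl
    rw [Metric.cthickening_empty] at h2
    exact Set.not_nonempty_empty (hne.mono h2)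
  rw [ofBody_eq hK hK' hne, ofBody_eq hL hL' hLne]
  refine h _ (lt_of_le_of_lt ?_ (half_lt_self hδ))
  refine Metric.hausdorffDist_le_of_mem_dist (half_pos hδ).le (fun x hx => ?_) fun x hx => ?_
  · have := h1 hx
    rw [hK'.cthickening_eq_biUnion_closedBall (half_pos hδ).le] at this
    simpa using this
  · have := h2 hx
    rw [hL'.cthickening_eq_biUnion_closedBall (half_pos hδ).le] at this
    simpa using this

lemma simpleVal_ofBody [FiniteDimensional ℝ V] [Nontrivial V] (hφc : Continuous φ)
    (hφt : IsTranslationInvariant φ) (hφv : IsValuation φ)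
    (hsimple : ∀ K : ConvexBody V, bodyDim K < finrank ℝ V → φ K = 0) :
    SimpleVal (ofBody φ) where
  null S hS hS' h := by
    obtain ⟨u, hu, c, hc⟩ := exists_const_of_interior hS h
    exact ofBody_null hsimple hS hS' hu hc
  trans S x hS hS' := by
    rcases S.eq_empty_or_nonempty with rfl | hne
    · simp
    · rw [ofBody_eq hS hS' hne, ← hφt ⟨S, hS, hS', hne⟩ x,
      ← ofBody_coe (φ := φ) (ConvexBody.translate _ x)]
      rfl
  cut S u c hS hS' hu := by
    have hU : S ∩ {x | u x ≤ c} ∪ S ∩ {x | c ≤ u x} = S := by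
      rw [← Set.inter_union_distrib_left, Set.inter_eq_left]
      exact fun x _ => le_total (u x) c
    rcases (S ∩ {x | u x ≤ c}).eq_empty_or_nonempty with h1 | ⟨x, hx⟩
    · rw [h1, Set.empty_union] at hU
      rw [h1, hU, ofBody_empty, zero_add]
    rcases (S ∩ {x | c ≤ u x}).eq_empty_or_nonempty with h1 | ⟨y, hy⟩
    · rw [h1, Set.union_empty] at hU
      rw [h1, hU, ofBody_empty, add_zero]
    obtain ⟨z, hz, huz⟩ := hS.isPreconnected.intermediate_value hx.1 hy.1
      u.continuous.continuousOn ⟨hx.2, hy.2⟩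
    have h := ofBody_val hφv (hS.inter (convex_le u c)) (hS'.inter_right (isClosed_le' u c))
      (hS.inter (convex_ge u c)) (hS'.inter_right (isClosed_ge' u c)) (by rwa [hU])
      ⟨z, ⟨hz, huz.le⟩, hz, huz.ge⟩
    rw [hU, ofBody_null hsimple ((hS.inter (convex_le u c)).inter (hS.inter (convex_ge u c)))
      ((hS'.inter_right (isClosed_le' u c)).inter (hS'.inter_right (isClosed_ge' u c))) hu
      (c := c) fun x hx => le_antisymm hx.1.2 hx.2.2, add_zero] at h
    exact h
  val K L hK hK' hL hL' hU hI := ofBody_val hφv hK hK' hL hL' hU (hI.mono interior_subset)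
  cont := ofBody_cont hφc

end OfBody

section Representation

variable {V : Type*} [NormedAddCommGroup V] [NormedSpace ℝ V] [FiniteDimensional ℝ V]

lemma exists_eval {d : (V →L[ℝ] ℝ) → ℝ}
    (hd : ∀ (ξ : V →L[ℝ] ℝ) (t : ℝ), 0 < t → d (t • ξ) = t * d ξ)
    (hd' : ∀ ξ, d (-ξ) = -d ξ)
    (ha : ∀ p q : V →L[ℝ] ℝ, LinearIndependent ℝ ![p, q] → d (p + q) = d p + d q) :
    ∃ x : V, ∀ ξ : V →L[ℝ] ℝ, d ξ = ξ x := by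
  have h0 : d 0 = 0 := by
    have := hd' 0
    rw [neg_zero] at this
    linarith
  have hs : ∀ (t : ℝ) ξ, d (t • ξ) = t * d ξ := fun t ξ => by
    rcases lt_trichotomy t 0 with ht | rfl | ht
    · have := hd ξ (-t) (neg_pos.mpr ht)
      rw [show -t • ξ = -(t • ξ) from neg_smul t ξ, hd'] at this
      linarith
    · rw [zero_smul, h0, zero_mul]
    · exact hd ξ t ht
  have hadd : ∀ p q, d (p + q) = d p + d q := fun p q => by
    by_cases hl : LinearIndependent ℝ ![p, q]
    · exact ha p q hl
    rcases eq_or_ne p 0 with rfl | hp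
    · simp [h0]
    rw [LinearIndependent.pair_iff' hp] at hl
    push Not at hl
    obtain ⟨a, rfl⟩ := hl
    rw [show p + a • p = (1 + a) • p by rw [add_smul, one_smul], hs, hs]
    ring
  let D : (V →L[ℝ] ℝ) →ₗ[ℝ] ℝ := ⟨⟨d, hadd⟩, fun t ξ => by simp [hs]⟩
  refine ⟨(Module.evalEquiv ℝ V).symm (D.comp LinearMap.toContinuousLinearMap.toLinearMap),
    fun ξ => ?_⟩
  exact (Module.apply_evalEquiv_symm_apply (R := ℝ) (M := V) (ξ : V →ₗ[ℝ] ℝ)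
    (D.comp LinearMap.toContinuousLinearMap.toLinearMap)).symm

variable [MeasurableSpace V] [BorelSpace V] (μ : Measure V) [μ.IsAddHaarMeasure]

omit [FiniteDimensional ℝ V] [BorelSpace V] [μ.IsAddHaarMeasure] in
lemma mixedVolFn_eq_wd (K : ConvexBody V) (g : (V →L[ℝ] ℝ) → ℝ) :
    mixedVolFn μ K g = (finrank ℝ V : ℝ)⁻¹ * wd μ g K := rfl

omit [FiniteDimensional ℝ V] [BorelSpace V] [μ.IsAddHaarMeasure] in
lemma mixedVolFn_zero (K : ConvexBody V) : mixedVolFn μ K (fun _ => 0) = 0 := by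
  simp [mixedVolFn]

/-- A convex body representing the triangle prism of a frame. -/
def triBody {k : ℕ} {p q : V →L[ℝ] ℝ} {r : Fin k → V →L[ℝ] ℝ} (hk : finrank ℝ V = k + 2)
    (h : Frame p q r) : ConvexBody V :=
  ⟨Tri p q r, convex_Tri p q r, h.isCompact_Tri, (h.interior_Tri hk).mono interior_subset⟩

lemma Frame.rep_triBody {k : ℕ} {p q : V →L[ℝ] ℝ} {r : Fin k → V →L[ℝ] ℝ}
    (hk : finrank ℝ V = k + 2) (h : Frame p q r) {g : (V →L[ℝ] ℝ) → ℝ} (hg : Continuous g)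
    (hgh : ∀ (ξ : V →L[ℝ] ℝ) (t : ℝ), 0 < t → g (t • ξ) = t * g ξ)
    (hgo : ∀ ξ, g (-ξ) = -g ξ) (c : ℝ) :
    c * (μ (triBody hk h : Set V)).toReal + mixedVolFn μ (triBody hk h) g
      = (c / 2 + ((k : ℝ) + 2)⁻¹ * (g (p + q) - g p - g q)) * (μ (Box p q r)).toReal := by
  have h1 := h.measure_box_eq μ hk
  have h2 := h.wd_tri μ hk hg hgh hgo
  have h3 : ((triBody hk h : ConvexBody V) : Set V) = Tri p q r := rfl
  rw [mixedVolFn_eq_wd, h3, h2, hk, h1]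
  push_cast
  ring

lemma rep_unique {φ : ConvexBody V → ℝ} {c c' : ℝ} {g g' : (V →L[ℝ] ℝ) → ℝ}
    (hg : Continuous g) (hgh : ∀ (ξ : V →L[ℝ] ℝ) (t : ℝ), 0 < t → g (t • ξ) = t * g ξ)
    (hgo : ∀ ξ, g (-ξ) = -g ξ)
    (hr : ∀ K : ConvexBody V, φ K = c * (μ (K : Set V)).toReal + mixedVolFn μ K g)
    (hg' : Continuous g') (hgh' : ∀ (ξ : V →L[ℝ] ℝ) (t : ℝ), 0 < t → g' (t • ξ) = t * g' ξ)
    (hgo' : ∀ ξ, g' (-ξ) = -g' ξ)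
    (hr' : ∀ K : ConvexBody V, φ K = c' * (μ (K : Set V)).toReal + mixedVolFn μ K g') :
    ∃ x : V, ∀ ξ : V →L[ℝ] ℝ, g' ξ = g ξ + ξ x := by
  suffices h : ∀ p q : V →L[ℝ] ℝ, LinearIndependent ℝ ![p, q] →
      g' (p + q) - g (p + q) = g' p - g p + (g' q - g q) by
    obtain ⟨x, hx⟩ := exists_eval (d := fun ξ => g' ξ - g ξ)
      (fun ξ t ht => by simp only [hgh ξ t ht, hgh' ξ t ht]; ring)
      (fun ξ => by simp only [hgo, hgo']; ring) h
    exact ⟨x, fun ξ => by linarith [hx ξ]⟩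
  intro p q hl
  have hn : 2 ≤ finrank ℝ V := by
    have h1 := hl.fintype_card_le_finrank
    have h2 : finrank ℝ (V →L[ℝ] ℝ) = finrank ℝ V := by
      rw [← (LinearMap.toContinuousLinearMap (𝕜 := ℝ) (E := V) (F' := ℝ)).finrank_eq]
      exact Subspace.dual_finrank_eq
    simpa [h2] using h1
  obtain ⟨k, hk⟩ := Nat.exists_eq_add_of_le' hn
  have key : ∀ s : ℝ, 0 < s → c / 2 + ((k : ℝ) + 2)⁻¹ * (s * (g (p + q) - g p - g q))
      = c' / 2 + ((k : ℝ) + 2)⁻¹ * (s * (g' (p + q) - g' p - g' q)) := fun s hs => by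
    obtain ⟨r, h⟩ := exists_frame hk hl
    have hf : Frame (s • p) (s • q) r := fun x h1 h2 h3 => by
      simp only [_root_.smul_apply, smul_eq_mul, mul_eq_zero, hs.ne', false_or] at h1 h2
      exact h x h1 h2 h3
    have e := (hr (triBody hk hf)).symm.trans (hr' (triBody hk hf))
    rw [hf.rep_triBody μ hk hg hgh hgo, hf.rep_triBody μ hk hg' hgh' hgo', ← smul_add, hgh _ _ hs,
      hgh _ _ hs, hgh _ _ hs, hgh' _ _ hs, hgh' _ _ hs, hgh' _ _ hs] at e
    have := mul_right_cancel₀ (hf.measure_box_pos μ hk).ne' e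
    linear_combination this
  have k1 := key 1 one_pos
  have k2 := key 2 two_pos
  have h3 : ((k : ℝ) + 2)⁻¹ * ((g' (p + q) - g' p - g' q) - (g (p + q) - g p - g q)) = 0 := by
    linear_combination k1 - k2
  have h4 := (mul_eq_zero.mp h3).resolve_left (by positivity)
  linarith

variable {φ : ConvexBody V → ℝ} (hφc : Continuous φ) (hφt : IsTranslationInvariant φ)
  (hφv : IsValuation φ) (hsimple : ∀ K : ConvexBody V, bodyDim K < finrank ℝ V → φ K = 0)
include hφc hφt hφv hsimple

lemma exists_rep_of_two_le {k : ℕ} (hk : finrank ℝ V = k + 2) :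
    ∃ (c : ℝ) (g : (V →L[ℝ] ℝ) → ℝ), Continuous g ∧
      (∀ (ξ : V →L[ℝ] ℝ) (t : ℝ), 0 < t → g (t • ξ) = t * g ξ) ∧ (∀ ξ, g (-ξ) = -g ξ) ∧
      ∀ K : ConvexBody V, φ K = c * (μ (K : Set V)).toReal + mixedVolFn μ K g := by
  have : Nontrivial V := Module.nontrivial_of_finrank_pos (R := ℝ) (by omega)
  have hΦ := simpleVal_ofBody hφc hφt hφv hsimple
  obtain ⟨c, g, hg, hgh, hT⟩ := hΦ.exists_potential hk μ
  have hgo : ∀ ξ, g (-ξ) = -g ξ := fun ξ => by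
    rw [← neg_one_smul ℝ ξ, hgh, neg_one_mul]
  have hG : Continuous fun ξ => ((k : ℝ) + 2) * g ξ := hg.const_mul _
  have hGh : ∀ (ξ : V →L[ℝ] ℝ) (t : ℝ), 0 < t →
      ((k : ℝ) + 2) * g (t • ξ) = t * (((k : ℝ) + 2) * g ξ) := fun ξ t _ => by rw [hgh]; ring
  have hGo : ∀ ξ, ((k : ℝ) + 2) * g (-ξ) = -(((k : ℝ) + 2) * g ξ) := fun ξ => by rw [hgo]; ring
  have hk0 : (k : ℝ) + 2 ≠ 0 := by positivity
  refine ⟨c, _, hG, hGh, hGo, fun K => ?_⟩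
  have hΨ := (hΦ.lincomb (simpleVal_measure μ) 1 (-c)).lincomb (simpleVal_wd μ hG hGh hGo) 1
    (-((k : ℝ) + 2)⁻¹)
  have h0 := hΨ.eq_zero_of_tri hk (fun p q r h => ?_) K.convex K.isCompact
  · rw [mixedVolFn_eq_wd, hk]
    simp only [ofBody_coe] at h0
    push_cast
    linarith
  · simp only [hT p q r h, h.wd_tri μ hk hG hGh hGo]
    field_simp
    ring

lemma exists_rep_of_one (h1 : finrank ℝ V = 1) :
    ∃ c : ℝ, ∀ K : ConvexBody V, φ K = c * (μ (K : Set V)).toReal := by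
  have : Nontrivial V := Module.nontrivial_of_finrank_pos (R := ℝ) (by omega)
  have hΦ := simpleVal_ofBody hφc hφt hφv hsimple
  obtain ⟨v, hv⟩ := exists_ne (0 : V)
  obtain ⟨z, hz⟩ := SeparatingDual.exists_eq_one (R := ℝ) hv
  have hzx : ∀ x, x = z x • v := fun x => by
    obtain ⟨a, rfl⟩ := exists_smul_eq_of_finrank_eq_one h1 hv x
    simp [hz]
  have hcomp : ∀ a b, IsCompact (Set.univ ∩ {x | a ≤ z x ∧ z x ≤ b}) := fun a b => by
    have : Set.univ ∩ {x | a ≤ z x ∧ z x ≤ b} = (fun t : ℝ => t • v) '' Set.Icc a b := by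
      ext x
      simp only [Set.univ_inter, Set.mem_ofPred_eq, Set.mem_image, Set.mem_Icc]
      constructor
      · exact fun h => ⟨z x, h, (hzx x).symm⟩
      · rintro ⟨t, ht, rfl⟩
        simpa [hz] using ht
    rw [this]
    exact isCompact_Icc.image (by fun_prop)
  have hint : (interior (Set.univ ∩ {x | 0 ≤ z x ∧ z x ≤ 1})).Nonempty := by
    refine ⟨(2⁻¹ : ℝ) • v, mem_interior.mpr ⟨{x | 0 < z x} ∩ {x | z x < 1}, fun x hx =>
      ⟨trivial, le_of_lt hx.1, le_of_lt hx.2⟩, (isOpen_lt continuous_const z.continuous).inter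
      (isOpen_lt z.continuous continuous_const), ?_, ?_⟩⟩ <;>
    · simp only [Set.mem_ofPred_eq, map_smul, hz, smul_eq_mul]
      norm_num
  have hscale : ∀ {Ψ : Set V → ℝ}, SimpleVal Ψ → ∀ t : ℝ, 0 ≤ t →
      Ψ (Set.univ ∩ {x | 0 ≤ z x ∧ z x ≤ t}) = t * Ψ (Set.univ ∩ {x | 0 ≤ z x ∧ z x ≤ 1}) :=
    fun hΨ t ht => hΨ.slab_scale convex_univ hz (fun _ _ _ => trivial) hcomp hint ht
  have hpos : (μ (Set.univ ∩ {x | 0 ≤ z x ∧ z x ≤ 1})).toReal ≠ 0 :=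
    (ENNReal.toReal_pos (Measure.measure_pos_of_nonempty_interior μ hint).ne'
      (hcomp 0 1).measure_lt_top.ne).ne'
  refine ⟨ofBody φ (Set.univ ∩ {x | 0 ≤ z x ∧ z x ≤ 1}) /
    (μ (Set.univ ∩ {x | 0 ≤ z x ∧ z x ≤ 1})).toReal, fun K => ?_⟩
  obtain ⟨x, hx, hmin⟩ := K.isCompact.exists_isMinOn K.nonempty z.continuous.continuousOn
  obtain ⟨y, hy, hmax⟩ := K.isCompact.exists_isMaxOn K.nonempty z.continuous.continuousOn
  have hK : ∀ w, x + w ∈ (K : Set V) ↔ w ∈ Set.univ ∩ {w | 0 ≤ z w ∧ z w ≤ z y - z x} := fun w => by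
    simp only [Set.univ_inter, Set.mem_ofPred_eq]
    constructor
    · intro h
      have h1 : z x ≤ z (x + w) := hmin h
      have h2 : z (x + w) ≤ z y := hmax h
      rw [map_add] at h1 h2
      constructor <;> linarith
    · intro h
      obtain ⟨w', hw', he⟩ := K.convex.isPreconnected.intermediate_value hx hy
        z.continuous.continuousOn (show z (x + w) ∈ Set.Icc (z x) (z y) by
          rw [map_add]; constructor <;> linarith [h.1, h.2])
      rwa [hzx (x + w), ← he, ← hzx w']
  have hle : 0 ≤ z y - z x := sub_nonneg.mpr (hmin hy)
  have e : ∀ {Ψ : Set V → ℝ}, SimpleVal Ψ →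
      Ψ K = (z y - z x) * Ψ (Set.univ ∩ {x | 0 ≤ z x ∧ z x ≤ 1}) := fun hΨ => by
    rw [hΨ.trans' x (convex_slab convex_univ z _ _) (hcomp _ _) hK, hscale hΨ _ hle]
  have e1 := e hΦ
  have e2 := e (simpleVal_measure μ)
  rw [← ofBody_coe (φ := φ), e1, e2]
  field_simp

omit [BorelSpace V] hφc hφt hφv hsimple in
lemma exists_rep_of_zero (h0 : finrank ℝ V = 0) :
    ∃ c : ℝ, ∀ K : ConvexBody V, φ K = c * (μ (K : Set V)).toReal := by
  have : Subsingleton V := finrank_zero_iff.mp h0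
  have huniv : ∀ K : ConvexBody V, (K : Set V) = Set.univ := fun K =>
    Subsingleton.eq_univ_of_nonempty K.nonempty
  have hK : ∀ K : ConvexBody V, K = 0 := fun K => SetLike.coe_injective <| by
    rw [huniv, huniv]
  have hpos : (μ ((0 : ConvexBody V) : Set V)).toReal ≠ 0 := by
    refine (ENNReal.toReal_pos ?_ (0 : ConvexBody V).isCompact.measure_lt_top.ne).ne'
    rw [huniv]
    exact (isOpen_univ.measure_pos μ Set.univ_nonempty).ne'
  refine ⟨φ 0 / (μ ((0 : ConvexBody V) : Set V)).toReal, fun K => ?_⟩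
  rw [hK K]
  field_simp

lemma exists_rep :
    ∃ (c : ℝ) (g : (V →L[ℝ] ℝ) → ℝ), Continuous g ∧
      (∀ (ξ : V →L[ℝ] ℝ) (t : ℝ), 0 < t → g (t • ξ) = t * g ξ) ∧ (∀ ξ, g (-ξ) = -g ξ) ∧
      ∀ K : ConvexBody V, φ K = c * (μ (K : Set V)).toReal + mixedVolFn μ K g := by
  rcases Nat.lt_or_ge (finrank ℝ V) 2 with h | h
  · obtain ⟨c, hc⟩ : ∃ c : ℝ, ∀ K : ConvexBody V, φ K = c * (μ (K : Set V)).toReal := by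
      rcases Nat.le_one_iff_eq_zero_or_eq_one.mp (Nat.le_of_lt_succ h) with h | h
      · exact exists_rep_of_zero μ h
      · exact exists_rep_of_one μ hφc hφt hφv hsimple h
    exact ⟨c, fun _ => 0, continuous_const, by simp, by simp, fun K => by
      rw [mixedVolFn_zero, add_zero, hc]⟩
  · obtain ⟨k, hk⟩ := Nat.exists_eq_add_of_le' h
    exact exists_rep_of_two_le μ hφc hφt hφv hsimple hk

end Representation

end KlainSchneider

/-- Klain–Schneider. Let `V` be an `n`-dimensional real vector space
(with a fixed Lebesgue measure `μ`) and let `φ : 𝒦(V) → ℝ` be a continuous, translation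
invariant, simple valuation. Then `φ(K) = c · vol(K) + V(K, …, K, g)` for all
`K ∈ 𝒦(V)`, where `c ∈ ℝ` is a constant and `g : V* → ℝ` is an odd, positively
1-homogeneous, continuous function, unique up to the addition of a linear function. -/
theorem klain_schneider_simple
    {V : Type*} [NormedAddCommGroup V] [NormedSpace ℝ V] [FiniteDimensional ℝ V]
    [MeasurableSpace V] [BorelSpace V] (μ : Measure V) [μ.IsAddHaarMeasure]
    (n : ℕ) (hn : Module.finrank ℝ V = n)
    (φ : ConvexBody V → ℝ) (hφc : Continuous φ)
    (hφt : IsTranslationInvariant φ) (hφv : IsValuation φ)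
    (hsimple : ∀ K : ConvexBody V, bodyDim K < n → φ K = 0) :
    ∃ (c : ℝ) (g : (V →L[ℝ] ℝ) → ℝ), Continuous g ∧
      (∀ (ξ : V →L[ℝ] ℝ) (t : ℝ), 0 < t → g (t • ξ) = t * g ξ) ∧
      (∀ ξ : V →L[ℝ] ℝ, g (-ξ) = -g ξ) ∧
      (∀ K : ConvexBody V, φ K = c * (μ (K : Set V)).toReal + mixedVolFn μ K g) ∧
      (∀ (c' : ℝ) (g' : (V →L[ℝ] ℝ) → ℝ),
        (Continuous g' ∧ (∀ (ξ : V →L[ℝ] ℝ) (t : ℝ), 0 < t → g' (t • ξ) = t * g' ξ) ∧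
          (∀ ξ : V →L[ℝ] ℝ, g' (-ξ) = -g' ξ) ∧
          ∀ K : ConvexBody V, φ K = c' * (μ (K : Set V)).toReal + mixedVolFn μ K g') →
        ∃ x : V, ∀ ξ : V →L[ℝ] ℝ, g' ξ = g ξ + ξ x) := by
  subst hn
  obtain ⟨c, g, hg, hgh, hgo, hr⟩ := KlainSchneider.exists_rep μ hφc hφt hφv hsimple
  exact ⟨c, g, hg, hgh, hgo, hr, fun c' g' ⟨hg', hgh', hgo', hr'⟩ =>
    KlainSchneider.rep_unique μ hg hgh hgo hr hg' hgh' hgo' hr'⟩
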